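/- Let X be a smooth Fano complete intersection in complex projective space ℙ^n of s ≥ 2 hypersurfaces of degrees d_1, …, d_s with d := d_1 + ⋯ + d_s. If d − s ≤ 5, then the Fano variety of lines F(X) has dimension exactly 2n − d − s − 2. -/

import Mathlib

/-!
Formalization of: Let X be a smooth Fano complete intersection in ℙ^n (over ℂ) of s ≥ 2
hypersurfaces of degrees d_1, …, d_s with d := Σ d_i.  If d − s ≤ 5, then the Fano variety
of lines F(X) has dimension exactly 2n − d − s − 2.
-/

noncomputable section

/-- The Zariski topology on complex projective `n`-space `ℙ(ℂ^{n+1})`: it is generated by the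
complements of the zero loci of homogeneous polynomials. -/
instance projZariski (n : ℕ) : TopologicalSpace (Projectivization ℂ (Fin (n + 1) → ℂ)) :=
  TopologicalSpace.generateFrom
    {U | ∃ (k : ℕ) (f : MvPolynomial (Fin (n + 1)) ℂ), f.IsHomogeneous k ∧
      U = {x | MvPolynomial.eval x.rep f ≠ 0}}

/-- The Grassmannian `G(1,n)` of projective lines in `ℙ^n`, i.e. the set of 2-dimensional
linear subspaces of `ℂ^{n+1}`. -/
def ProjLine (n : ℕ) : Type :=
  {W : Submodule ℂ (Fin (n + 1) → ℂ) // Module.finrank ℂ W = 2}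

/-- The Zariski topology on the Grassmannian of lines: it is generated by the complements of
the loci of lines `ℙ(W)` on which a fixed polynomial in two vector arguments vanishes
identically on `W × W` (e.g. polynomials in the Plücker coordinates). -/
instance grassZariski (n : ℕ) : TopologicalSpace (ProjLine n) :=
  TopologicalSpace.generateFrom
    {U | ∃ F : MvPolynomial (Fin (n + 1) ⊕ Fin (n + 1)) ℂ,
      U = {W : ProjLine n | ¬ ∀ u ∈ W.1, ∀ v ∈ W.1, MvPolynomial.eval (Sum.elim u v) F = 0}}

/-- The projective line `ℙ(W) ⊆ ℙ^n` associated to a linear subspace `W ⊆ ℂ^{n+1}`,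
as a set of points of `ℙ^n`. -/
def lineSet {n : ℕ} (W : Submodule ℂ (Fin (n + 1) → ℂ)) :
    Set (Projectivization ℂ (Fin (n + 1) → ℂ)) :=
  {x | x.rep ∈ W}

/-- The Fano variety of lines of `X ⊆ ℙ^n`: the subset of the Grassmannian of lines
consisting of the lines contained in `X`. -/
def fanoLines {n : ℕ} (X : Set (Projectivization ℂ (Fin (n + 1) → ℂ))) : Set (ProjLine n) :=
  {W | lineSet W.1 ⊆ X}

/-- `X ⊆ ℙ^n` is a smooth complete intersection of the `s` hypersurfaces of degrees
`d 0, …, d (s-1)` cut out by the homogeneous polynomials `f 0, …, f (s-1)`:  each `f i` is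
homogeneous of degree `d i ≥ 2`, `X` is the common zero locus of the `f i`, `X` has
codimension `s` (i.e. dimension `n - s`), and the Jacobian matrix `(∂f_i/∂x_j)` has rank `s`
at every point of (the affine cone over) `X`. -/
structure IsSmoothCI (n s : ℕ) (d : Fin s → ℕ) (f : Fin s → MvPolynomial (Fin (n + 1)) ℂ)
    (X : Set (Projectivization ℂ (Fin (n + 1) → ℂ))) : Prop where
  two_le_deg : ∀ i, 2 ≤ d i
  homog : ∀ i, (f i).IsHomogeneous (d i)
  locus : X = {x | ∀ i, MvPolynomial.eval x.rep (f i) = 0}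
  codim : topologicalKrullDim ↥X = ((n - s : ℕ) : WithBot ℕ∞)
  smooth : ∀ v : Fin (n + 1) → ℂ, v ≠ 0 → (∀ i, MvPolynomial.eval v (f i) = 0) →
    (Matrix.of fun i j => MvPolynomial.eval v (MvPolynomial.pderiv j (f i))).rank = s

namespace FL

open Matrix Polynomial

section KeyLemma

variable {A : Type*} [CommRing A]

/-- A multilinear map that vanishes as soon as one argument lies in `K` only depends on the
arguments modulo `K`. -/
theorem mlin_congr {ι M N : Type*} [Finite ι] [AddCommGroup M] [Module A M]
    [AddCommGroup N] [Module A N] (f : MultilinearMap A (fun _ : ι => M) N) (K : Set M)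
    (hK : ∀ v : ι → M, ∀ i, v i ∈ K → f v = 0) (v w : ι → M) (h : ∀ i, v i - w i ∈ K) :
    f v = f w := by
  classical
  have := Fintype.ofFinite ι
  have key : ∀ S : Finset ι, f (S.piecewise v w) = f w := by
    intro S
    induction S using Finset.induction_on with
    | empty => simp
    | insert a S ha ih =>
      rw [Finset.piecewise_insert]
      have e1 : Function.update (S.piecewise v w) a (v a)
          = Function.update (S.piecewise v w) a ((v a - w a) + w a) := by simp
      rw [e1, MultilinearMap.map_update_add, hK _ a (by simpa using h a), zero_add]
      have : Function.update (S.piecewise v w) a (w a) = S.piecewise v w := by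
        rw [Function.update_eq_self_iff]; simp [ha]
      rw [this, ih]
  have := key Finset.univ
  simpa using this

/-- Factor lemma, first form. -/
theorem factor_aux {V : Type*} [AddCommGroup V] [Module A V] {s : ℕ}
    (L : V →ₗ[A] (Fin s → A)) (Φ : V [⋀^Fin s]→ₗ[A] A)
    (hΦ : ∀ v : Fin s → V, ∀ i, L (v i) = 0 → Φ v = 0)
    (ξ : A) (ρ : Fin s → V) (hρ : ∀ l, L (ρ l) = ξ • Pi.single l 1) (ν : Fin s → V) :
    ξ ^ s * Φ ν = Φ ρ * Matrix.det (Matrix.of fun i => L (ν i)) := by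
  classical
  let R : (Fin s → A) →ₗ[A] V := (Pi.basisFun A (Fin s)).constr A ρ
  have hR : ∀ l, R (Pi.single l 1) = ρ l := by
    intro l
    have := (Pi.basisFun A (Fin s)).constr_basis A ρ l
    simp only [Pi.basisFun_apply] at this
    exact this
  have hLR : ∀ c, L (R c) = ξ • c := by
    intro c
    have : (L ∘ₗ R) = ξ • LinearMap.id := by
      apply (Pi.basisFun A (Fin s)).ext
      intro l
      simp [hR, hρ]
    exact congrArg (fun g => g c) this
  have h1 : ξ ^ s * Φ ν = Φ (fun i => ξ • ν i) := by
    have := Φ.toMultilinearMap.map_smul_univ (fun _ => ξ) ν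
    simp at this
    exact this.symm
  have h2 : Φ (fun i => ξ • ν i) = Φ (fun i => R (L (ν i))) := by
    apply mlin_congr Φ.toMultilinearMap {v | L v = 0}
    · intro v i hi; exact hΦ v i hi
    · intro i
      simp [hLR]
  have h3 := AlternatingMap.eq_smul_basis_det (Pi.basisFun A (Fin s)) (Φ.compLinearMap R)
  have h4 := congrArg (fun g => g (fun i => L (ν i))) h3
  simp only [AlternatingMap.compLinearMap_apply, AlternatingMap.smul_apply, smul_eq_mul,
    Pi.basisFun_det_apply] at h4
  rw [h1, h2]
  have h5 : (fun i => R (Pi.basisFun A (Fin s) i)) = ρ := by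
    funext i; simp [hR]
  rw [h5] at h4
  exact h4

variable [IsDomain A]

/-- Factor lemma: an alternating `s`-form killed by `ker L` is a multiple of the determinant. -/
theorem factor_lemma {V : Type*} [AddCommGroup V] [Module A V] {s : ℕ}
    (L : V →ₗ[A] (Fin s → A)) (Φ : V [⋀^Fin s]→ₗ[A] A)
    (hΦ : ∀ v : Fin s → V, ∀ i, L (v i) = 0 → Φ v = 0)
    (ξ₁ ξ₂ : A) (ρ₁ ρ₂ : Fin s → V) (h1 : ∀ l, L (ρ₁ l) = ξ₁ • Pi.single l 1)
    (h2 : ∀ l, L (ρ₂ l) = ξ₂ • Pi.single l 1) (hξ : ξ₁ ≠ 0)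
    (hreg : ∀ z w, ξ₂ ^ s * z = ξ₁ ^ s * w → ∃ z', z = ξ₁ ^ s * z') :
    ∃ μ : A, ∀ ν, Φ ν = μ * Matrix.det (Matrix.of fun i => L (ν i)) := by
  have e1 := factor_aux L Φ hΦ ξ₁ ρ₁ h1
  have e2 := factor_aux L Φ hΦ ξ₂ ρ₂ h2
  have hd : Matrix.det (Matrix.of fun i => L (ρ₁ i)) = ξ₁ ^ s := by
    have : (Matrix.of fun i => L (ρ₁ i)) = ξ₁ • (1 : Matrix (Fin s) (Fin s) A) := by
      ext i j
      simp [h1, Matrix.one_apply, Pi.single_apply, eq_comm]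
    rw [this, Matrix.det_smul]; simp
  have hξs : ξ₁ ^ s ≠ 0 := pow_ne_zero _ hξ
  obtain ⟨μ, hμ⟩ := hreg (Φ ρ₁) (Φ ρ₂) (by
    have := e2 ρ₁; rw [hd] at this; rw [this]; ring)
  refine ⟨μ, fun ν => ?_⟩
  apply mul_left_cancel₀ hξs
  rw [e1 ν, hμ]; ring

/-- Extension lemma (depth three). -/
theorem ext_lemma {V : Type*} [AddCommGroup V] [Module A V] {s : ℕ}
    (L : V →ₗ[A] (Fin s → A)) (ψ : LinearMap.ker L →ₗ[A] A)
    (ξ : Fin 3 → A) (ρ : Fin 3 → Fin s → V)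
    (hρ : ∀ i l, L (ρ i l) = ξ i • Pi.single l 1) (hξ : ξ 0 ≠ 0)
    (hreg2 : ∀ z w, ξ 1 * z = ξ 0 * w → ∃ z', z = ξ 0 * z')
    (hreg3 : ∀ z a b, ξ 2 * z = ξ 0 * a + ξ 1 * b → ∃ a' b', z = ξ 0 * a' + ξ 1 * b') :
    ∃ lam : V →ₗ[A] A, ∀ κ : LinearMap.ker L, lam κ = ψ κ := by
  classical
  have hsum : ∀ c : Fin s → A, (∑ l, c l • (Pi.single l (1:A) : Fin s → A)) = c := by
    intro c
    ext j; simp [Finset.sum_apply, Pi.single_apply]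
  have hcop : ∀ i v, ξ i • v - ∑ l, L v l • ρ i l ∈ LinearMap.ker L := by
    intro i v
    rw [LinearMap.mem_ker]
    simp only [map_sub, map_smul, map_sum, hρ]
    simp_rw [smul_comm _ (ξ i), ← Finset.smul_sum]
    rw [hsum, sub_self]
  let κm : Fin 3 → V →ₗ[A] LinearMap.ker L := fun i =>
    LinearMap.codRestrict (LinearMap.ker L)
      (ξ i • LinearMap.id - ∑ l, ((LinearMap.proj l ∘ₗ L).smulRight (ρ i l)))
      (fun v => by simpa using hcop i v)
  have hκm : ∀ i v, (κm i v : V) = ξ i • v - ∑ l, L v l • ρ i l := by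
    intro i v; simp [κm]
  have hbr : ∀ i j l, ξ i • ρ j l - ξ j • ρ i l ∈ LinearMap.ker L := by
    intro i j l
    rw [LinearMap.mem_ker]
    simp only [map_sub, map_smul, hρ]
    rw [smul_comm, sub_self]
  let c : Fin 3 → Fin 3 → Fin s → A := fun i j l => ψ ⟨_, hbr i j l⟩
  let lm : Fin 3 → V →ₗ[A] A := fun i => ψ ∘ₗ κm i
  have hrel : ∀ i j v, ξ j * lm i v - ξ i * lm j v = ∑ l, L v l * c i j l := by
    intro i j v
    have : ξ j • κm i v - ξ i • κm j v = ∑ l, L v l • (⟨_, hbr i j l⟩ : LinearMap.ker L) := by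
      apply Subtype.ext
      push_cast
      rw [hκm, hκm]
      simp only [smul_sub, Finset.smul_sum, Finset.sum_sub_distrib]
      rw [smul_comm (ξ j) (ξ i) v]
      simp_rw [smul_comm (ξ _) (L v _)]
      abel
    have := congrArg ψ this
    simp only [map_sub, map_smul, map_sum, smul_eq_mul] at this
    exact this
  have hcoc : ∀ l, ξ 2 * c 0 1 l = ξ 0 * (- c 1 2 l) + ξ 1 * (- c 2 0 l) := by
    intro l
    have : ξ 2 • (⟨_, hbr 0 1 l⟩ : LinearMap.ker L)
        = ξ 0 • (- ⟨_, hbr 1 2 l⟩) + ξ 1 • (- (⟨_, hbr 2 0 l⟩ : LinearMap.ker L)) := by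
      apply Subtype.ext
      push_cast
      module
    have := congrArg ψ this
    simp only [map_add, map_neg, map_smul, smul_eq_mul] at this
    exact this
  choose a b hab using fun l => hreg3 _ _ _ (hcoc l)
  let l0 : V →ₗ[A] A := lm 0 - ∑ l, b l • (LinearMap.proj l ∘ₗ L)
  let l1 : V →ₗ[A] A := lm 1 + ∑ l, a l • (LinearMap.proj l ∘ₗ L)
  have hl : ∀ v, ξ 1 * l0 v = ξ 0 * l1 v := by
    intro v
    have h := hrel 0 1 v
    simp only [hab] at h
    have e : ∑ l, L v l * (ξ 0 * a l + ξ 1 * b l)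
        = ξ 0 * ∑ l, a l * L v l + ξ 1 * ∑ l, b l * L v l := by
      rw [Finset.mul_sum, Finset.mul_sum, ← Finset.sum_add_distrib]
      apply Finset.sum_congr rfl; intros; ring
    rw [e] at h
    simp only [l0, l1, LinearMap.sub_apply, LinearMap.add_apply, LinearMap.sum_apply,
      LinearMap.smul_apply, LinearMap.comp_apply, LinearMap.proj_apply, smul_eq_mul]
    linear_combination h
  choose q hq using fun v => hreg2 _ _ (hl v)
  refine ⟨⟨⟨q, ?_⟩, ?_⟩, ?_⟩
  · intro v w
    apply mul_left_cancel₀ hξ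
    rw [← hq, mul_add, ← hq, ← hq, map_add]
  · intro r v
    apply mul_left_cancel₀ hξ
    simp only [RingHom.id_apply, smul_eq_mul]
    rw [← hq, map_smul, hq, smul_eq_mul]; ring
  · rintro ⟨v, hv⟩
    apply mul_left_cancel₀ hξ
    change ξ 0 * q v = _
    rw [← hq]
    have hv0 : L v = 0 := hv
    have : κm 0 v = ξ 0 • (⟨v, hv⟩ : LinearMap.ker L) := by
      apply Subtype.ext
      rw [hκm]; simp [hv0]
    simp only [l0, LinearMap.sub_apply, LinearMap.sum_apply, LinearMap.smul_apply,
      LinearMap.comp_apply, hv0]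
    simp only [lm, LinearMap.comp_apply, this, map_smul, smul_eq_mul]
    simp

/-- The key lemma: weights force an alternating form to vanish. -/
theorem key_lemma {σ : Type*} [Fintype σ] [DecidableEq σ] {s : ℕ}
    (J : Matrix (Fin s) σ A) (Θ : (σ → A) [⋀^Fin (s + 1)]→ₗ[A] A)
    (hΘ : ∀ κ : σ → A, J *ᵥ κ = 0 → ∀ v : Fin s → σ → A, ∀ i, J *ᵥ (v i) = 0 →
      Θ (Matrix.vecCons κ v) = 0)
    (ξ : Fin 3 → A) (ρ : Fin 3 → Fin s → σ → A)
    (hρ : ∀ i l, J *ᵥ (ρ i l) = ξ i • Pi.single l 1) (hξ : ξ 0 ≠ 0)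
    (hreg2s : ∀ z w, ξ 1 ^ s * z = ξ 0 ^ s * w → ∃ z', z = ξ 0 ^ s * z')
    (hreg2 : ∀ z w, ξ 1 * z = ξ 0 * w → ∃ z', z = ξ 0 * z')
    (hreg3 : ∀ z a b, ξ 2 * z = ξ 0 * a + ξ 1 * b → ∃ a' b', z = ξ 0 * a' + ξ 1 * b')
    (γ : A →+* A[X]) (w : Fin s → ℕ) (W : ℕ)
    (hJ : ∀ i j, γ (J i j) = X ^ w i * C (J i j))
    (hΘγ : ∀ idx : Fin (s + 1) → σ, γ (Θ fun r => Pi.single (idx r) 1)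
      = X ^ W * C (Θ fun r => Pi.single (idx r) 1))
    (hW : W < ∑ i, w i) : Θ = 0 := by
  classical
  let L : (σ → A) →ₗ[A] (Fin s → A) := J.mulVecLin
  have hL : ∀ v, L v = J *ᵥ v := fun v => rfl
  have hfac : ∀ κ : LinearMap.ker L, ∃ μ : A, ∀ ν : Fin s → σ → A,
      Θ (Matrix.vecCons κ.1 ν) = μ * Matrix.det (Matrix.of fun i => L (ν i)) := by
    intro κ
    obtain ⟨μ, hμ⟩ := factor_lemma L (Θ.curryLeft κ.1) (fun v i hi => hΘ κ.1 κ.2 v i hi)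
      (ξ 0) (ξ 1) (ρ 0) (ρ 1) (hρ 0) (hρ 1) hξ hreg2s
    exact ⟨μ, fun ν => hμ ν⟩
  choose ψ hψ using hfac
  have hd : Matrix.det (Matrix.of fun i => L (ρ 0 i)) ≠ 0 := by
    have : (Matrix.of fun i => L (ρ 0 i)) = ξ 0 • (1 : Matrix (Fin s) (Fin s) A) := by
      ext i j
      simp [hL, hρ, Matrix.one_apply, Pi.single_apply, eq_comm]
    rw [this, Matrix.det_smul]; simp [hξ]
  let ψl : LinearMap.ker L →ₗ[A] A :=
    { toFun := ψ
      map_add' := fun a b => by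
        apply mul_right_cancel₀ hd
        rw [add_mul, ← hψ, ← hψ, ← hψ]
        exact Θ.map_vecCons_add _ _ _
      map_smul' := fun r a => by
        apply mul_right_cancel₀ hd
        simp only [RingHom.id_apply, smul_eq_mul]
        rw [mul_assoc, ← hψ, ← hψ]
        exact Θ.map_vecCons_smul _ _ _ }
  obtain ⟨lam, hlam⟩ := ext_lemma L ψl ξ ρ hρ hξ hreg2 hreg3
  -- minors
  let D : (Fin s → σ) → A := fun I => Matrix.det (Matrix.of fun i l => J l (I i))
  have hLs : ∀ j, L (Pi.single j 1) = fun l => J l j := by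
    intro j; funext l; simp [hL]
  have hDL : ∀ I, D I = Matrix.det (Matrix.of fun i => L (Pi.single (I i) 1)) := by
    intro I; simp only [D, hLs]
  have hDγ : ∀ I, γ (D I) = X ^ (∑ i, w i) * C (D I) := by
    intro I
    have e : (Matrix.of fun i l => J l (I i)).map γ
        = ((Matrix.of fun i l => J l (I i)).map C) * Matrix.diagonal (fun l => (X : A[X]) ^ w l) := by
      ext1 i l
      rw [Matrix.mul_diagonal]
      simp only [Matrix.map_apply, Matrix.of_apply, hJ]
      ring
    simp only [D]
    rw [RingHom.map_det, RingHom.mapMatrix_apply, e, Matrix.det_mul, Matrix.det_diagonal,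
      Finset.prod_pow_eq_pow_sum, RingHom.map_det, RingHom.mapMatrix_apply, mul_comm]
  obtain ⟨I, hI⟩ : ∃ I, D I ≠ 0 := by
    by_contra hcon
    push Not at hcon
    apply hd
    have : (Matrix.detRowAlternating (n := Fin s) (R := A)).compLinearMap L = 0 := by
      apply Module.Basis.ext_alternating (Pi.basisFun A σ)
      intro v hv
      have := hcon v
      rw [hDL] at this
      simp only [AlternatingMap.compLinearMap_apply, Pi.basisFun_apply, AlternatingMap.zero_apply]
      exact this
    exact congrArg (fun g => g (ρ 0)) this
  let MI : Matrix (Fin s) (Fin s) A := Matrix.of fun i l => J l (I i)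
  let R : (Fin s → A) →ₗ[A] (σ → A) :=
    ∑ i, (LinearMap.proj i ∘ₗ Matrix.cramer MIᵀ).smulRight (Pi.single (I i) (1:A) : σ → A)
  have hR : ∀ c, R c = ∑ i, Matrix.det (MI.updateRow i c) • (Pi.single (I i) (1:A) : σ → A) := by
    intro c
    simp only [R, LinearMap.sum_apply, LinearMap.smulRight_apply, LinearMap.comp_apply,
      LinearMap.proj_apply, Matrix.cramer_transpose_apply]
  let κ : (σ → A) →ₗ[A] (σ → A) := D I • LinearMap.id - R ∘ₗ L
  have hκ : ∀ v, κ v = D I • v - R (L v) := fun v => rfl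
  have hLκ : ∀ v, L (κ v) = 0 := by
    intro v
    rw [hκ, map_sub, map_smul]
    have h1 := Matrix.mulVec_cramer MIᵀ (L v)
    have h2 : L (R (L v)) = MIᵀ *ᵥ (Matrix.cramer MIᵀ (L v)) := by
      rw [hR, map_sum]
      funext l
      simp only [map_smul, hLs, Finset.sum_apply, Pi.smul_apply, smul_eq_mul, Matrix.mulVec,
        dotProduct, Matrix.cramer_transpose_apply, MI, Matrix.transpose_apply, Matrix.of_apply]
      apply Finset.sum_congr rfl; intros; ring
    rw [h2, h1, Matrix.det_transpose, sub_self]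
  have hκγ : ∀ j r, γ (κ (Pi.single j 1) r) = X ^ (∑ i, w i) * C (κ (Pi.single j 1) r) := by
    intro j r
    have hu : ∀ i, Matrix.det (MI.updateRow i (L (Pi.single j 1))) = D (Function.update I i j) := by
      intro i
      simp only [D]
      congr 1
      ext a b
      by_cases hai : a = i
      · subst hai; simp [hLs]
      · simp [MI, hai]
    have hs : ∀ (a b : σ), γ ((Pi.single a (1:A) : σ → A) b) = C ((Pi.single a (1:A) : σ → A) b) := by
      intro a b
      by_cases hab : b = a
      · subst hab; simp
      · simp [hab]
    rw [hκ, hR]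
    simp only [hu, Pi.sub_apply, Pi.smul_apply, smul_eq_mul, Finset.sum_apply, map_sub, map_sum,
      map_mul, hDγ, hs, mul_sub, Finset.mul_sum, mul_assoc]
  have hψ0 : ∀ j, ψ ⟨κ (Pi.single j 1), hLκ _⟩ = 0 := by
    intro j
    set q := ψ ⟨κ (Pi.single j 1), hLκ _⟩ with hq
    have h1 := hψ ⟨κ (Pi.single j 1), hLκ _⟩ (fun i => Pi.single (I i) 1)
    rw [← hDL, ← hq] at h1
    -- expand in the first argument
    have h2 : Θ (Matrix.vecCons (κ (Pi.single j 1)) (fun i => Pi.single (I i) 1))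
        = ∑ r, κ (Pi.single j 1) r * Θ (fun t => Pi.single ((Matrix.vecCons r I : Fin (s+1) → σ) t) 1) := by
      have e1 : κ (Pi.single j 1) = ∑ r, κ (Pi.single j 1) r • (Pi.single r (1:A) : σ → A) := by
        ext r; simp [Finset.sum_apply, Pi.single_apply]
      let E : (σ → A) →ₗ[A] A :=
        { toFun := fun v => Θ (Matrix.vecCons v (fun i => Pi.single (I i) 1))
          map_add' := fun x y => Θ.map_vecCons_add _ _ _
          map_smul' := fun x y => Θ.map_vecCons_smul _ _ _ }
      change E (κ (Pi.single j 1)) = _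
      conv_lhs => rw [e1]
      simp only [map_sum, map_smul, smul_eq_mul]
      apply Finset.sum_congr rfl
      intro r _
      congr 1
      simp only [E, LinearMap.coe_mk, AddHom.coe_mk]
      congr 1
      funext t
      refine Fin.cases ?_ (fun t => ?_) t <;> simp
    rw [h2] at h1
    have h3 := congrArg γ h1
    simp only [map_sum, map_mul, hκγ, hΘγ, hDγ] at h3
    have h4 : (X : A[X]) ^ (∑ i, w i) * C (D I) * γ q
        = X ^ (∑ i, w i) * C (D I) * (X ^ W * C q) := by
      have h5 : C (∑ r, κ (Pi.single j 1) r * Θ (fun t => Pi.single ((Matrix.vecCons r I : Fin (s+1) → σ) t) 1)) = C (q * D I) := by rw [h1]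
      simp only [map_sum, map_mul] at h5
      calc (X : A[X]) ^ (∑ i, w i) * C (D I) * γ q = γ q * (X ^ (∑ i, w i) * C (D I)) := by ring
        _ = X ^ (∑ i, w i) * X ^ W * (∑ r, C (κ (Pi.single j 1) r) * C (Θ (fun t => Pi.single ((Matrix.vecCons r I : Fin (s+1) → σ) t) 1))) := by
            rw [← h3, Finset.mul_sum]
            apply Finset.sum_congr rfl; intros; ring
        _ = _ := by rw [h5]; ring
    have h6 : γ q = X ^ W * C q :=
      mul_left_cancel₀ (mul_ne_zero (pow_ne_zero _ X_ne_zero) (by simpa using hI)) h4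
    have h7 : q = ∑ r, κ (Pi.single j 1) r * lam (Pi.single r 1) := by
      have e := hlam ⟨κ (Pi.single j 1), hLκ _⟩
      have e1 : κ (Pi.single j 1) = ∑ r, κ (Pi.single j 1) r • (Pi.single r (1:A) : σ → A) := by
        ext r; simp [Finset.sum_apply, Pi.single_apply]
      have e3 : q = lam (κ (Pi.single j 1)) := e.symm
      rw [e3]
      conv_lhs => rw [e1]
      simp only [map_sum, map_smul, smul_eq_mul]
    have h8 : γ q = X ^ (∑ i, w i) * ∑ r, C (κ (Pi.single j 1) r) * γ (lam (Pi.single r 1)) := by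
      rw [h7, map_sum, Finset.mul_sum]
      apply Finset.sum_congr rfl
      intro r _
      rw [map_mul, hκγ, mul_assoc]
    have h9 := h6.symm.trans h8
    have h10 := congrArg (fun p => p.coeff W) h9
    rw [coeff_X_pow_mul', coeff_X_pow_mul'] at h10
    simp only [le_refl, if_true, Nat.sub_self, coeff_C_zero, not_le.mpr hW, if_false] at h10
    exact h10
  have hzero : ∀ v, Θ.curryLeft (κ v) = 0 := by
    have : Θ.curryLeft ∘ₗ κ = 0 := by
      apply (Pi.basisFun A σ).ext
      intro j
      ext ν
      simp only [Pi.basisFun_apply, LinearMap.comp_apply, LinearMap.zero_apply,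
        AlternatingMap.zero_apply]
      have := hψ ⟨κ (Pi.single j 1), hLκ _⟩ ν
      rw [hψ0, zero_mul] at this
      exact this
    intro v
    exact congrArg (fun g => g v) this
  have hvan : ∀ v : Fin (s+1) → σ → A, ∀ i, v i ∈ Set.range κ → Θ v = 0 := by
    rintro v i ⟨u, hu⟩
    have h1 : Θ (v ∘ Equiv.swap 0 i) = 0 := by
      have : v ∘ Equiv.swap 0 i = Matrix.vecCons (κ u) (Matrix.vecTail (v ∘ Equiv.swap 0 i)) := by
        conv_lhs => rw [← Matrix.cons_head_tail (v ∘ Equiv.swap 0 i)]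
        congr 1
        simp [Matrix.vecHead, hu]
      rw [this]
      exact congrArg (fun g => g (Matrix.vecTail (v ∘ Equiv.swap 0 i))) (hzero u)
    rw [AlternatingMap.map_perm] at h1
    rcases Int.units_eq_one_or (Equiv.Perm.sign (Equiv.swap 0 i)) with h | h <;>
      simpa [h] using h1
  ext v
  have h1 : D I ^ (s+1) * Θ v = Θ (fun i => D I • v i) := by
    have := Θ.toMultilinearMap.map_smul_univ (fun _ => D I) v
    simp at this
    exact this.symm
  have h2 : Θ (fun i => D I • v i) = Θ (fun i => R (L (v i))) := by
    apply mlin_congr Θ.toMultilinearMap (Set.range κ)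
    · exact hvan
    · intro i; exact ⟨v i, hκ _⟩
  have h3 : Θ (fun i => R (L (v i))) = 0 := by
    have := AlternatingMap.map_linearDependent (Θ.compLinearMap R) (fun i => L (v i)) (by
      intro hli
      have := hli.fintype_card_le_finrank
      simp at this)
    exact this
  rw [h2, h3] at h1
  simpa using (mul_eq_zero.mp h1).resolve_left (pow_ne_zero _ hI)

end KeyLemma
end FL

namespace FL

open Matrix

section Basics

/-- The Jacobian matrix of `f` at a point `p` with values in an algebra. -/
noncomputable def Jac {K A σ : Type*} [Field K] [CommRing A] [Algebra K A] {s : ℕ}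
    (f : Fin s → MvPolynomial σ K) (p : σ → A) : Matrix (Fin s) σ A :=
  Matrix.of fun i j => MvPolynomial.aeval p (MvPolynomial.pderiv j (f i))

/-- Smoothness of the projective complete intersection over `F`. -/
def Smooth {K : Type*} (F : Type*) {σ : Type*} [Field K] [Field F] [Algebra K F] {s : ℕ}
    (f : Fin s → MvPolynomial σ K) : Prop :=
  ∀ v : σ → F, v ≠ 0 → (∀ i, MvPolynomial.aeval v (f i) = 0) →
    LinearIndependent F (fun i => Jac f v i)

theorem deriv_aeval {K A σ : Type*} [Field K] [CommRing A] [Algebra K A] [Fintype σ]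
    (D : Derivation K A A) (p : σ → A) (f : MvPolynomial σ K) :
    D (MvPolynomial.aeval p f) =
      ∑ j, MvPolynomial.aeval p (MvPolynomial.pderiv j f) * D (p j) := by
  classical
  induction f using MvPolynomial.induction_on with
  | C a => simp
  | add f g hf hg =>
    simp only [map_add, hf, hg, add_mul, Finset.sum_add_distrib]
  | mul_X f i hf =>
    simp only [map_mul, MvPolynomial.aeval_X, Derivation.leibniz, hf, smul_eq_mul,
      MvPolynomial.pderiv_X, map_add]
    simp only [add_mul, Finset.sum_add_distrib, Finset.mul_sum]
    congr 1
    · rw [Finset.sum_eq_single i]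
      · simp
      · intro j _ hj; simp [hj.symm]
      · simp
    · apply Finset.sum_congr rfl; intros; ring

theorem jac_mulVec_deriv {K A σ : Type*} [Field K] [CommRing A] [Algebra K A] [Fintype σ] {s : ℕ}
    (f : Fin s → MvPolynomial σ K) (D : Derivation K A A) (p : σ → A) :
    Jac f p *ᵥ (fun j => D (p j)) = fun i => D (MvPolynomial.aeval p (f i)) := by
  funext i
  rw [deriv_aeval]
  rfl

theorem jac_map {K A B σ : Type*} [Field K] [CommRing A] [Algebra K A] [CommRing B] [Algebra K B]
    {s : ℕ} (f : Fin s → MvPolynomial σ K) (φ : A →ₐ[K] B) (p : σ → A) :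
    (Jac f p).map φ = Jac f (fun j => φ (p j)) := by
  ext i j
  simp only [Jac, Matrix.map_apply, Matrix.of_apply]
  rw [← AlgHom.comp_apply, MvPolynomial.comp_aeval]

/-- Euler: a homogeneous form satisfies `f(c p) = c^d f(p)`. -/
theorem aeval_smul_homog {K A σ : Type*} [CommRing K] [CommRing A] [Algebra K A]
    {f : MvPolynomial σ K} {d : ℕ} (hf : f.IsHomogeneous d) (c : A) (p : σ → A) :
    MvPolynomial.aeval (fun j => c * p j) f = c ^ d * MvPolynomial.aeval p f := by
  rw [MvPolynomial.aeval_def, MvPolynomial.aeval_def, MvPolynomial.eval₂_eq,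
    MvPolynomial.eval₂_eq, Finset.mul_sum]
  apply Finset.sum_congr rfl
  intro m hm
  have hd : ∑ i ∈ m.support, m i = d := by
    have := hf (MvPolynomial.mem_support_iff.mp hm)
    rw [← this, Finsupp.weight_apply, Finsupp.sum]; simp
  simp only [mul_pow, Finset.prod_mul_distrib]
  rw [Finset.prod_pow_eq_pow_sum, hd]
  ring

/-- Coefficientwise application of a derivation. -/
noncomputable def mapCoeffFun {K F τ : Type*} [Field K] [CommRing F] [Algebra K F]
    (D : Derivation K F F) (p : MvPolynomial τ F) : MvPolynomial τ F :=
  ∑ m ∈ p.support, MvPolynomial.monomial m (D (p.coeff m))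

theorem coeff_mapCoeffFun {K F τ : Type*} [Field K] [CommRing F] [Algebra K F]
    (D : Derivation K F F) (p : MvPolynomial τ F) (n : τ →₀ ℕ) :
    (mapCoeffFun D p).coeff n = D (p.coeff n) := by
  classical
  simp only [mapCoeffFun, MvPolynomial.coeff_sum, MvPolynomial.coeff_monomial]
  rw [Finset.sum_ite_eq']
  split_ifs with h
  · rfl
  · rw [MvPolynomial.notMem_support_iff.mp h, map_zero]

/-- Coefficientwise extension of a derivation to a polynomial ring. -/
noncomputable def mapCoeff {K F : Type*} (τ : Type*) [Field K] [CommRing F] [Algebra K F]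
    (D : Derivation K F F) : Derivation K (MvPolynomial τ F) (MvPolynomial τ F) :=
  Derivation.mk'
    { toFun := mapCoeffFun D
      map_add' := by
        intro p q; ext n; simp only [MvPolynomial.coeff_add, coeff_mapCoeffFun, map_add]
      map_smul' := by
        intro c p; ext n
        simp only [MvPolynomial.coeff_smul, coeff_mapCoeffFun, RingHom.id_apply]
        exact D.map_smul _ _ }
    (by
      classical
      intro p q
      ext n
      simp only [LinearMap.coe_mk, AddHom.coe_mk, smul_eq_mul, MvPolynomial.coeff_add]
      rw [mul_comm q, coeff_mapCoeffFun, MvPolynomial.coeff_mul, MvPolynomial.coeff_mul,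
        MvPolynomial.coeff_mul]
      simp only [coeff_mapCoeffFun, map_sum, Derivation.leibniz, smul_eq_mul]
      rw [← Finset.sum_add_distrib]
      apply Finset.sum_congr rfl; intros; ring)

theorem coeff_mapCoeff {K F τ : Type*} [Field K] [CommRing F] [Algebra K F]
    (D : Derivation K F F) (p : MvPolynomial τ F) (n : τ →₀ ℕ) :
    (mapCoeff τ D p).coeff n = D (p.coeff n) := coeff_mapCoeffFun D p n

theorem mapCoeff_C {K F τ : Type*} [Field K] [CommRing F] [Algebra K F]
    (D : Derivation K F F) (c : F) :
    mapCoeff τ D (MvPolynomial.C c) = MvPolynomial.C (D c) := by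
  classical
  ext n
  rw [coeff_mapCoeff, MvPolynomial.coeff_C, MvPolynomial.coeff_C]
  split_ifs <;> simp

theorem mapCoeff_X {K F τ : Type*} [Field K] [CommRing F] [Algebra K F]
    (D : Derivation K F F) (i : τ) :
    mapCoeff τ D (MvPolynomial.X i) = 0 := by
  classical
  ext n
  rw [coeff_mapCoeff, MvPolynomial.coeff_X]
  split_ifs <;> simp

end Basics

section Det


/-- The alternating form `ν ↦ det [c, ν]`. -/
noncomputable def detForm {A σ : Type*} [CommRing A] [Fintype σ] [DecidableEq σ] {ι : Type*} {t : ℕ} (e : σ ≃ ι ⊕ Fin t) (c : ι → σ → A) :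
    (σ → A) [⋀^Fin t]→ₗ[A] A where
  toFun ν := Matrix.det (Matrix.of fun i => Sum.elim c ν (e i))
  map_update_add' := by
    classical
    intro inst ν i x y
    have : inst = instDecidableEqFin t := Subsingleton.elim _ _
    subst this
    have key : ∀ z, (Matrix.of fun j => Sum.elim c (Function.update ν i z) (e j))
        = (Matrix.of fun j => Sum.elim c ν (e j)).updateRow (e.symm (Sum.inr i)) z := by
      intro z
      ext j k
      simp only [Matrix.of_apply, Sum.elim_update_right, Matrix.updateRow_apply]
      by_cases h : j = e.symm (Sum.inr i)
      · subst h; simp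
      · have h' : e j ≠ Sum.inr i := fun h2 => h (by rw [← h2]; simp)
        rw [Function.update_of_ne h']; simp [h]
    simp only [key]
    exact Matrix.det_updateRow_add _ _ _ _
  map_update_smul' := by
    classical
    intro inst ν i r x
    have : inst = instDecidableEqFin t := Subsingleton.elim _ _
    subst this
    have key : ∀ z, (Matrix.of fun j => Sum.elim c (Function.update ν i z) (e j))
        = (Matrix.of fun j => Sum.elim c ν (e j)).updateRow (e.symm (Sum.inr i)) z := by
      intro z
      ext j k
      simp only [Matrix.of_apply, Sum.elim_update_right, Matrix.updateRow_apply]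
      by_cases h : j = e.symm (Sum.inr i)
      · subst h; simp
      · have h' : e j ≠ Sum.inr i := fun h2 => h (by rw [← h2]; simp)
        rw [Function.update_of_ne h']; simp [h]
    simp only [key]
    exact Matrix.det_updateRow_smul _ _ _ _
  map_eq_zero_of_eq' := by
    intro ν i j hij hne
    apply Matrix.det_zero_of_row_eq (i := e.symm (Sum.inr i)) (j := e.symm (Sum.inr j))
    · simpa using hne
    · funext k; simp [hij]

theorem detForm_apply {A σ : Type*} [CommRing A] [Fintype σ] [DecidableEq σ] {ι : Type*} {t : ℕ} (e : σ ≃ ι ⊕ Fin t) (c : ι → σ → A) (ν : Fin t → σ → A) :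
    detForm e c ν = Matrix.det (Matrix.of fun i => Sum.elim c ν (e i)) := rfl

theorem detForm_eq_zero_of_dep {A σ : Type*} [CommRing A] [Fintype σ] [DecidableEq σ] [IsDomain A] {ι : Type*} {t : ℕ} (e : σ ≃ ι ⊕ Fin t)
    (c : ι → σ → A) (ν : Fin t → σ → A)
    (h : ¬ LinearIndependent A (Sum.elim c ν)) : detForm e c ν = 0 := by
  have := AlternatingMap.map_linearDependent (Matrix.detRowAlternating (n := σ) (R := A))
    (fun i => Sum.elim c ν (e i)) (by
      intro h2
      apply h
      have := h2.comp e.symm e.symm.injective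
      have e2 : (fun i => Sum.elim c ν (e i)) ∘ e.symm = Sum.elim c ν := by funext i; simp
      rwa [e2] at this)
  exact this

/-- Too many vectors in the kernel of a full rank matrix are dependent. -/
theorem ker_dep {A σ : Type*} [CommRing A] [Fintype σ] [IsDomain A] {s : ℕ} (J : Matrix (Fin s) σ A) (ξ : A) (hξ : ξ ≠ 0)
    (ρ : Fin s → σ → A) (hρ : ∀ l, J *ᵥ (ρ l) = ξ • Pi.single l 1)
    {ι : Type*} [Fintype ι] (v : ι → σ → A) (hv : ∀ i, J *ᵥ v i = 0)
    (hcard : Fintype.card σ < Fintype.card ι + s) : ¬ LinearIndependent A v := by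
  classical
  intro hli
  have hall : LinearIndependent A (Sum.elim v ρ) := by
    apply LinearIndependent.sum_type hli
    · rw [Fintype.linearIndependent_iff]
      intro g hg l
      have h1 := congrArg (fun u => (J *ᵥ u) l) hg
      simp only [Matrix.mulVec_sum, Matrix.mulVec_smul, hρ, Matrix.mulVec_zero] at h1
      simp only [Finset.sum_apply, Pi.smul_apply, Pi.single_apply, smul_eq_mul, Pi.zero_apply] at h1
      simpa [hξ] using h1
    · rw [Submodule.disjoint_def]
      intro x hx hx'
      obtain ⟨g, rfl⟩ := (Submodule.mem_span_range_iff_exists_fun A).mp hx'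
      have hJ : J *ᵥ (∑ i, g i • ρ i) = 0 := by
        have : Submodule.span A (Set.range v) ≤ LinearMap.ker J.mulVecLin := by
          rw [Submodule.span_le]; rintro _ ⟨i, rfl⟩; exact hv i
        exact this hx
      have : ∀ l, g l = 0 := by
        intro l
        have h1 := congrArg (fun u => u l) hJ
        simp only [Matrix.mulVec_sum, Matrix.mulVec_smul, hρ] at h1
        simp only [Finset.sum_apply, Pi.smul_apply, Pi.single_apply, smul_eq_mul, Pi.zero_apply] at h1
        simpa [hξ] using h1
      simp [this]
  have := hall.fintype_card_le_finrank
  simp at this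
  omega

end Det

section NSS

theorem nss {F A : Type*} [Field F] [IsAlgClosed F] [CommRing A] [Algebra F A]
    [Algebra.FiniteType F A] (I : Ideal A) (x : A)
    (h : ∀ φ : A →ₐ[F] F, (∀ y ∈ I, φ y = 0) → φ x = 0) : x ∈ I.radical := by
  have : IsJacobsonRing A := isJacobsonRing_of_finiteType (A := F)
  rw [Ideal.radical_eq_jacobson, Ideal.jacobson, Ideal.mem_sInf]
  rintro M ⟨hIM, hM⟩
  let _ : Field (A ⧸ M) := Ideal.Quotient.field M
  have hfin : Module.Finite F (A ⧸ M) := finite_of_finite_type_of_isJacobsonRing F (A ⧸ M)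
  have hbij : Function.Bijective (algebraMap F (A ⧸ M)) :=
    IsAlgClosed.algebraMap_bijective_of_isIntegral
  let ε : F ≃ₐ[F] (A ⧸ M) := AlgEquiv.ofBijective (Algebra.ofId F (A ⧸ M)) hbij
  let φ : A →ₐ[F] F := (ε.symm : (A ⧸ M) →ₐ[F] F).comp (Ideal.Quotient.mkₐ F M)
  have hφ : ∀ y, φ y = 0 ↔ y ∈ M := by
    intro y
    simp only [φ, AlgHom.comp_apply]
    rw [← Ideal.Quotient.eq_zero_iff_mem]
    simp
  rw [← hφ]
  exact h φ (fun y hy => (hφ y).mpr (hIM hy))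

/-- Rows independent over a field implies surjectivity. -/
theorem mulVec_surj {F σ : Type*} [Field F] [Fintype σ] {s : ℕ} (J : Matrix (Fin s) σ F)
    (h : LinearIndependent F (fun i => J i)) : Function.Surjective (fun v => J *ᵥ v) := by
  have h1 : J.rank = s := by simpa using LinearIndependent.rank_matrix h
  have h2 : LinearMap.range J.mulVecLin = ⊤ := by
    apply Submodule.eq_top_of_finrank_eq
    rw [← Matrix.rank, h1]; simp
  intro v
  obtain ⟨w, hw⟩ := LinearMap.range_eq_top.mp h2 v
  exact ⟨w, hw⟩

/-- Generic right inverses up to a power. -/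
theorem rho_exists {F A σ : Type*} [Field F] [IsAlgClosed F] [CommRing A] [Algebra F A]
    [Algebra.FiniteType F A] [Fintype σ] {s : ℕ} (J : Matrix (Fin s) σ A)
    (x : A) (h : ∀ φ : A →ₐ[F] F, φ x ≠ 0 → LinearIndependent F (fun i => (J.map φ) i)) :
    ∃ M : ℕ, ∃ ρ : Fin s → σ → A, ∀ l, J *ᵥ (ρ l) = x ^ M • Pi.single l 1 := by
  classical
  let D : (Fin s → σ) → A := fun I => Matrix.det (Matrix.of fun l i => J l (I i))
  have hx : x ∈ (Ideal.span (Set.range D)).radical := by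
    apply nss (F := F)
    intro φ hφ
    by_contra hne
    have hsurj := mulVec_surj _ (h φ hne)
    choose R hR using hsurj
    have : (Matrix.detRowAlternating (n := Fin s) (R := F)).compLinearMap
        (J.map φ).mulVecLin = 0 := by
      apply Module.Basis.ext_alternating (Pi.basisFun F σ)
      intro v hv
      simp only [AlternatingMap.compLinearMap_apply, Pi.basisFun_apply, AlternatingMap.zero_apply]
      have h1 := hφ (D v) (Ideal.subset_span ⟨v, rfl⟩)
      simp only [D] at h1
      rw [← AlgHom.coe_toRingHom, RingHom.map_det, ← Matrix.det_transpose] at h1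
      convert h1 using 1
      change Matrix.det _ = _
      congr 1
      ext i l
      simp
    have h2 := congrArg (fun g => g (fun i => R (Pi.single i 1))) this
    simp only [AlternatingMap.compLinearMap_apply, Matrix.mulVecLin_apply, hR,
      AlternatingMap.zero_apply] at h2
    have h3 : Matrix.det (1 : Matrix (Fin s) (Fin s) F) = 0 := by
      rw [← h2]
      change _ = Matrix.det _
      congr 1
      ext i l
      simp [Matrix.one_apply, Pi.single_apply, eq_comm]
    simp at h3
  obtain ⟨M, hM⟩ := hx
  obtain ⟨r, hr⟩ := (Ideal.mem_span_range_iff_exists_fun).mp hM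
  refine ⟨M, fun l => ∑ I, r I • ∑ i, Matrix.cramer (Matrix.of fun l i => J l (I i))
    (Pi.single l 1) i • (Pi.single (I i) (1:A) : σ → A), fun l => ?_⟩
  have key : ∀ I : Fin s → σ, J *ᵥ (∑ i, Matrix.cramer (Matrix.of fun l i => J l (I i))
    (Pi.single l 1) i • (Pi.single (I i) (1:A) : σ → A)) = D I • Pi.single l 1 := by
    intro I
    rw [← Matrix.mulVec_cramer, Matrix.mulVec_sum]
    funext k
    simp only [Finset.sum_apply, Matrix.mulVec_smul, Pi.smul_apply, smul_eq_mul,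
      Matrix.mulVec_single_one, Matrix.mulVec, dotProduct, Matrix.of_apply]
    apply Finset.sum_congr rfl
    intro i _
    simp [Matrix.col_apply, mul_comm]
  rw [Matrix.mulVec_sum]
  simp only [Matrix.mulVec_smul, key, smul_smul]
  rw [← Finset.sum_smul, hr]

end NSS
end FL

namespace FL

open Matrix

theorem G_lemma {K F A σ : Type*} [Field K] [Field F] [IsAlgClosed F] [Algebra K F]
    [CommRing A] [IsDomain A] [Algebra F A] [Algebra K A] [IsScalarTower K F A]
    [Algebra.FiniteType F A] [Fintype σ] [DecidableEq σ] {s : ℕ}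
    (f : Fin s → MvPolynomial σ K) (d : Fin s → ℕ) (hf : ∀ i, (f i).IsHomogeneous (d i))
    (hsm : Smooth F f) (P : σ → A) (hP : ∀ i, MvPolynomial.aeval P (f i) = 0)
    (ξ : Fin 3 → A) (hPξ : ∀ φ : A →ₐ[F] F, ∀ i, φ (ξ i) ≠ 0 → (fun j => φ (P j)) ≠ 0)
    (hξ : ∀ i, ξ i ≠ 0)
    (hreg2 : ∀ M N z w, ξ 1 ^ M * z = ξ 0 ^ N * w → ∃ z', z = ξ 0 ^ N * z')
    (hreg3 : ∀ L M N z a b, ξ 2 ^ L * z = ξ 0 ^ M * a + ξ 1 ^ N * b →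
      ∃ a' b', z = ξ 0 ^ M * a' + ξ 1 ^ N * b')
    {ι : Type*} [Fintype ι] (e : σ ≃ ι ⊕ Fin (s + 1)) (Δ : ι → Derivation K A A)
    (Θ : (σ → A) [⋀^Fin (s + 1)]→ₗ[A] A) (r : A) (hr : r ≠ 0)
    (hΘ : r • Θ = detForm e (fun i j => Δ i (P j)))
    (γ : A →ₐ[K] Polynomial A) (β : ℕ) (hγ : ∀ j, γ (P j) = Polynomial.X ^ β * Polynomial.C (P j))
    (W : ℕ) (hΘγ : ∀ idx : Fin (s + 1) → σ, γ (Θ fun r => Pi.single (idx r) 1)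
      = Polynomial.X ^ W * Polynomial.C (Θ fun r => Pi.single (idx r) 1))
    (hW : W < ∑ i, β * (d i - 1)) : Θ = 0 := by
  classical
  have h1 : ∀ i : Fin 3, ∃ M : ℕ, ∃ ρ : Fin s → σ → A,
      ∀ l, Jac f P *ᵥ (ρ l) = ξ i ^ M • Pi.single l 1 := by
    intro i
    apply rho_exists (F := F)
    intro φ hφ
    have h2 := hsm (fun j => φ (P j)) (hPξ φ i hφ) (by
      intro l
      have := congrArg φ (hP l)
      rw [map_zero] at this
      rw [← this]
      have h3 := MvPolynomial.comp_aeval_apply (f := P) (φ.restrictScalars K) (f l)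
      exact h3.symm)
    have h4 := jac_map f (φ.restrictScalars K) P
    have h5 : (Jac f P).map φ = Jac f (fun j => φ (P j)) := h4
    rw [h5]; exact h2
  choose M ρ hρ using h1
  have hker : ∀ i, Jac f P *ᵥ (fun j => Δ i (P j)) = 0 := by
    intro i
    rw [jac_mulVec_deriv]
    funext l
    simp [hP]
  apply key_lemma (Jac f P) Θ ?_ (fun i => ξ i ^ M i) ρ hρ (pow_ne_zero _ (hξ 0))
    ?_ ?_ ?_ γ.toRingHom (fun i => β * (d i - 1)) W ?_ hΘγ hW
  · intro κ hκ v i hi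
    have h2 : r • Θ (Matrix.vecCons κ v) = 0 := by
      rw [← AlternatingMap.smul_apply, hΘ]
      apply detForm_eq_zero_of_dep
      intro hli
      let inc : ι ⊕ Fin 2 → ι ⊕ Fin (s + 1) := Sum.map id ![0, i.succ]
      have hinc : Function.Injective inc := by
        apply Function.Injective.sumMap Function.injective_id
        intro a b hab
        fin_cases a <;> fin_cases b <;> simp_all [Fin.ext_iff]
      refine ker_dep (Jac f P) (ξ 0 ^ M 0) (pow_ne_zero _ (hξ 0)) (ρ 0) (hρ 0) _ ?_ ?_
        (hli.comp inc hinc)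
      · rintro (a | b)
        · exact hker a
        · fin_cases b
          · simpa [inc] using hκ
          · simpa [inc] using hi
      · have := Fintype.card_congr e
        simp at this ⊢
        omega
    exact (smul_eq_zero.mp h2).resolve_left hr
  · intro z w h
    simp only [← pow_mul] at h ⊢
    exact hreg2 _ _ z w h
  · intro z w h
    exact hreg2 _ _ z w h
  · intro z a b h
    exact hreg3 _ _ _ z a b h
  · intro i j
    have h2 : (MvPolynomial.pderiv j (f i)).IsHomogeneous (d i - 1) := (hf i).pderiv
    change γ (MvPolynomial.aeval P (MvPolynomial.pderiv j (f i))) =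
      _ * Polynomial.C (MvPolynomial.aeval P (MvPolynomial.pderiv j (f i)))
    rw [MvPolynomial.comp_aeval_apply]
    simp only [hγ]
    rw [aeval_smul_homog h2, ← pow_mul]
    congr 1
    exact (MvPolynomial.comp_aeval_apply (f := P) (Polynomial.CAlgHom (R := K) (A := A)) _).symm

end FL

namespace FL

open Matrix

theorem mem_span_pows {τ R : Type*} [CommRing R] {κ : Type*} (v : κ → τ) (N : κ → ℕ)
    (z : MvPolynomial τ R) :
    z ∈ Ideal.span (Set.range fun k => (MvPolynomial.X (v k) : MvPolynomial τ R) ^ N k) ↔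
      ∀ m ∈ z.support, ∃ k, N k ≤ m (v k) := by
  classical
  have : (Set.range fun k => (MvPolynomial.X (v k) : MvPolynomial τ R) ^ N k) =
      (fun m => MvPolynomial.monomial m (1 : R)) '' (Set.range fun k => Finsupp.single (v k) (N k)) := by
    rw [← Set.range_comp]
    congr 1
    funext k
    simp [MvPolynomial.X_pow_eq_monomial]
  rw [this, MvPolynomial.mem_ideal_span_monomial_image]
  simp [Finsupp.single_le_iff]

theorem span_pows_reg {τ R : Type*} [CommRing R] {κ : Type*} (v : κ → τ) (N : κ → ℕ)
    (j : τ) (hj : ∀ k, v k ≠ j) (L : ℕ) (z : MvPolynomial τ R)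
    (h : (MvPolynomial.X j : MvPolynomial τ R) ^ L * z ∈
      Ideal.span (Set.range fun k => (MvPolynomial.X (v k) : MvPolynomial τ R) ^ N k)) :
    z ∈ Ideal.span (Set.range fun k => (MvPolynomial.X (v k) : MvPolynomial τ R) ^ N k) := by
  classical
  rw [mem_span_pows] at h ⊢
  intro m hm
  obtain ⟨k, hk⟩ := h (m + Finsupp.single j L) (by
    rw [MvPolynomial.mem_support_iff, MvPolynomial.X_pow_eq_monomial, add_comm,
      MvPolynomial.coeff_monomial_mul, one_mul]
    exact MvPolynomial.mem_support_iff.mp hm)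
  refine ⟨k, ?_⟩
  simpa [Finsupp.single_apply, (hj k).symm] using hk

theorem mv_reg2 {τ R : Type*} [CommRing R] (i j : τ) (hij : i ≠ j) (M N : ℕ)
    (z w : MvPolynomial τ R) (h : MvPolynomial.X j ^ M * z = MvPolynomial.X i ^ N * w) :
    ∃ z', z = MvPolynomial.X i ^ N * z' := by
  have := span_pows_reg (fun _ : Unit => i) (fun _ => N) j (fun _ => hij) M z (by
    rw [h]
    exact Ideal.mul_mem_right _ _ (Ideal.subset_span ⟨(), rfl⟩))
  rw [Set.range_const, Ideal.mem_span_singleton] at this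
  exact this

theorem mv_reg3 {τ R : Type*} [CommRing R] (i j k : τ) (hik : i ≠ k) (hjk : j ≠ k) (L M N : ℕ)
    (z a b : MvPolynomial τ R)
    (h : MvPolynomial.X k ^ L * z = MvPolynomial.X i ^ M * a + MvPolynomial.X j ^ N * b) :
    ∃ a' b', z = MvPolynomial.X i ^ M * a' + MvPolynomial.X j ^ N * b' := by
  have := span_pows_reg (fun t : Bool => if t then i else j) (fun t => if t then M else N) k
    (by rintro (_ | _) <;> simpa) L z (by
    rw [h]
    apply Ideal.add_mem
    · exact Ideal.mul_mem_right _ _ (Ideal.subset_span ⟨true, by simp⟩)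
    · exact Ideal.mul_mem_right _ _ (Ideal.subset_span ⟨false, by simp⟩))
  rw [Ideal.mem_span_range_iff_exists_fun] at this
  obtain ⟨c, hc⟩ := this
  refine ⟨c true, c false, ?_⟩
  rw [← hc]
  simp [mul_comm]

end FL

namespace FL

open Matrix

/-- LI is an open condition along lines. -/
theorem li_open {F V ι : Type*} [Field F] [Infinite F] [AddCommGroup V] [Module F V] [Fintype ι]
    (v u : ι → V) (hv : LinearIndependent F v) :
    ∃ w : F, w ≠ 0 ∧ LinearIndependent F (fun i => w • v i + u i) := by
  classical
  obtain ⟨g, hg⟩ := LinearMap.exists_leftInverse_of_injective (Fintype.linearCombination F v)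
    (by
      rw [LinearMap.ker_eq_bot']
      intro x hx
      funext i
      exact Fintype.linearIndependent_iff.mp hv x (by simpa [Fintype.linearCombination_apply] using hx) i)
  have hgv : ∀ i, g (v i) = Pi.single i 1 := by
    intro i
    have := congrArg (fun h => h (Pi.single i 1)) hg
    simpa [Fintype.linearCombination_apply_single] using this
  let N : Matrix ι ι F := Matrix.of fun i j => -(g (u i) j)
  obtain ⟨w, hw⟩ : ∃ w : F, Polynomial.eval w (N.charpoly * Polynomial.X) ≠ 0 := by
    by_contra hcon
    push Not at hcon
    have : N.charpoly * Polynomial.X = 0 := Polynomial.funext (fun r => by simpa using hcon r)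
    rw [mul_eq_zero] at this
    rcases this with h | h
    · exact (N.charpoly_monic.ne_zero) h
    · exact Polynomial.X_ne_zero h
  rw [Polynomial.eval_mul, Polynomial.eval_X, Matrix.eval_charpoly] at hw
  refine ⟨w, right_ne_zero_of_mul hw, ?_⟩
  apply LinearIndependent.of_comp g
  have h1 : (g ∘ fun i => w • v i + u i) = (Matrix.scalar ι w - N).row := by
    funext i j
    simp [hgv, N, Matrix.row, Matrix.diagonal_apply, Pi.single_apply, eq_comm]
  rw [h1, Matrix.linearIndependent_rows_iff_isUnit, Matrix.isUnit_iff_isUnit_det, isUnit_iff_ne_zero]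
  exact left_ne_zero_of_mul hw

theorem detForm_ne_zero_field {F σ : Type*} [Field F] [Fintype σ] [DecidableEq σ]
    {ι : Type*} [Fintype ι] {t : ℕ}
    (e : σ ≃ ι ⊕ Fin t) (c : ι → σ → F) (hc : LinearIndependent F c) :
    ∃ ν : Fin t → σ → F, detForm e c ν ≠ 0 := by
  classical
  let b := Module.Basis.sumExtend hc
  have hfin : Finite (ι ⊕ ↑(Module.Basis.sumExtendIndex hc)) := Module.Finite.finite_basis b
  have : Fintype ↑(Module.Basis.sumExtendIndex hc) :=
    @Fintype.ofFinite _ (Finite.of_injective (Sum.inr : _ → ι ⊕ ↑(Module.Basis.sumExtendIndex hc)) Sum.inr_injective)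
  have hcard : Fintype.card ↑(Module.Basis.sumExtendIndex hc) = t := by
    have h1 := Module.finrank_eq_card_basis b
    have h2 := Fintype.card_congr e
    rw [Fintype.card_sum] at h1 h2
    rw [Fintype.card_fin] at h2
    rw [Module.finrank_fintype_fun_eq_card] at h1
    omega
  let ε : Fin t ≃ ↑(Module.Basis.sumExtendIndex hc) := (Fintype.equivFinOfCardEq hcard).symm
  refine ⟨fun r => b (Sum.inr (ε r)), ?_⟩
  rw [detForm_apply]
  rw [← isUnit_iff_ne_zero, ← Matrix.isUnit_iff_isUnit_det, ← Matrix.linearIndependent_rows_iff_isUnit]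
  have h3 := b.linearIndependent.comp (fun i => Sum.map id ε (e i)) (by
    intro i j hij
    apply e.injective
    exact (Function.Injective.sumMap Function.injective_id ε.injective) hij)
  have h4 : (Matrix.of fun i => Sum.elim c (fun r => b (Sum.inr (ε r))) (e i)).row =
      (⇑b ∘ fun i => Sum.map id (⇑ε) (e i)) := by
    funext i
    change Sum.elim c (fun r => b (Sum.inr (ε r))) (e i) = b (Sum.map id (⇑ε) (e i))
    rcases e i with a | a
    · simp only [b, Module.Basis.sumExtend, Module.Basis.reindex_apply, Sum.map_inl, id,
        Module.Basis.coe_extend, Sum.elim_inl]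
      rfl
    · simp
  rw [h4]; exact h3

theorem detForm_ne_zero {A F σ : Type*} [CommRing A] [Field F] [Fintype σ] [DecidableEq σ]
    {ι : Type*} [Fintype ι] {t : ℕ} (φ : A →+* F) (lift : F → A) (hlift : ∀ x, φ (lift x) = x)
    (e : σ ≃ ι ⊕ Fin t) (c : ι → σ → A) (hc : LinearIndependent F (fun i j => φ (c i j))) :
    detForm e c ≠ 0 := by
  intro h0
  obtain ⟨ν, hν⟩ := detForm_ne_zero_field e _ hc
  apply hν
  have h1 : φ (detForm e c (fun r j => lift (ν r j))) = 0 := by rw [h0]; simp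
  rw [← h1, detForm_apply, detForm_apply, RingHom.map_det]
  congr 1
  ext i j
  simp only [Matrix.of_apply, RingHom.mapMatrix_apply, Matrix.map_apply]
  rcases e i with a | a <;> simp [hlift]

theorem det_weight {A n : Type*} [CommRing A] [Fintype n] [DecidableEq n] (γ : A →+* Polynomial A)
    (M : Matrix n n A) (W : n → ℕ)
    (h : ∀ i j, γ (M i j) = Polynomial.X ^ W i * Polynomial.C (M i j)) :
    γ M.det = Polynomial.X ^ (∑ i, W i) * Polynomial.C M.det := by
  rw [RingHom.map_det, RingHom.map_det, ← Finset.prod_pow_eq_pow_sum, ← Matrix.det_mul_column]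
  congr 1
  ext1 i j
  simp [h]

theorem detForm_weight {A σ ι : Type*} [CommRing A] [Fintype σ] [DecidableEq σ] [Fintype ι] {t : ℕ}
    (γ : A →+* Polynomial A) (e : σ ≃ ι ⊕ Fin t) (c : ι → σ → A) (W : ι → ℕ)
    (h : ∀ i j, γ (c i j) = Polynomial.X ^ W i * Polynomial.C (c i j)) (idx : Fin t → σ) :
    γ (detForm e c fun r => Pi.single (idx r) 1) =
      Polynomial.X ^ (∑ i, W i) * Polynomial.C (detForm e c fun r => Pi.single (idx r) 1) := by
  classical
  rw [detForm_apply]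
  have h1 := det_weight γ (Matrix.of fun i => Sum.elim c (fun r => Pi.single (idx r) (1:A)) (e i))
    (fun i => Sum.elim W 0 (e i)) (by
      intro i j
      simp only [Matrix.of_apply]
      rcases e i with a | a
      · simp [h]
      · simp only [Sum.elim_inr, Pi.zero_apply, pow_zero, one_mul]
        rw [Pi.single_apply]; split_ifs <;> simp)
  rw [h1]
  congr 2
  rw [Equiv.sum_comp e (Sum.elim W 0)]
  simp

/-- The grading coaction on a polynomial ring. -/
noncomputable def coact (K : Type*) {F τ : Type*} [Field K] [Field F] [Algebra K F] (wt : τ → ℕ) :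
    MvPolynomial τ F →ₐ[K] Polynomial (MvPolynomial τ F) :=
  (MvPolynomial.aeval (R := F) (fun r => (Polynomial.X ^ wt r * Polynomial.C (MvPolynomial.X r) :
    Polynomial (MvPolynomial τ F)))).restrictScalars K

theorem coact_wh (K : Type*) {F τ : Type*} [Field K] [Field F] [Algebra K F] (wt : τ → ℕ)
    (q : MvPolynomial τ F) (n : ℕ) (hq : MvPolynomial.IsWeightedHomogeneous wt q n) :
    coact K wt q = Polynomial.X ^ n * Polynomial.C q := by
  change MvPolynomial.aeval (R := F) _ q = _
  rw [MvPolynomial.aeval_def, MvPolynomial.eval₂_eq]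
  conv_rhs => rw [q.as_sum, map_sum, Finset.mul_sum]
  apply Finset.sum_congr rfl
  intro m hm
  have hd : ∑ i ∈ m.support, m i * wt i = n := by
    have := hq (MvPolynomial.mem_support_iff.mp hm)
    rw [← this, Finsupp.weight_apply, Finsupp.sum]; simp
  have h2 : MvPolynomial.monomial m (q.coeff m) =
    MvPolynomial.C (q.coeff m) * ∏ i ∈ m.support, MvPolynomial.X i ^ m i :=
    MvPolynomial.monomial_eq
  rw [h2, ← hd, ← Finset.prod_pow_eq_pow_sum, map_mul, map_prod]
  simp only [mul_pow, Finset.prod_mul_distrib, ← pow_mul, map_pow]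
  have h3 : algebraMap F (Polynomial (MvPolynomial τ F)) (q.coeff m) =
    Polynomial.C (MvPolynomial.C (q.coeff m)) := rfl
  rw [h3]
  simp only [mul_comm (wt _) (m _)]
  ring

theorem mapCoeff_wh {K F τ : Type*} [Field K] [Field F] [Algebra K F] (wt : τ → ℕ)
    (D : Derivation K F F) (q : MvPolynomial τ F) (n : ℕ)
    (hq : MvPolynomial.IsWeightedHomogeneous wt q n) :
    MvPolynomial.IsWeightedHomogeneous wt (mapCoeff τ D q) n := by
  intro m hm
  apply hq
  intro h0
  apply hm
  rw [coeff_mapCoeff, h0, map_zero]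

end FL

namespace FL

open Matrix

/-- Homogenisation of a univariate polynomial in the variables `X 1, X 2`. -/
noncomputable def hom3 {F : Type*} [Field F] (β : ℕ) (p : Polynomial F) :
    MvPolynomial (Fin 3) F :=
  ∑ i ∈ Finset.range (β + 1), MvPolynomial.C (p.coeff i) * (MvPolynomial.X 1 ^ (β - i) *
    MvPolynomial.X 2 ^ i)

section hom3
variable {F : Type*} [Field F] (β : ℕ) (p : Polynomial F)

theorem hom3_eval (hp : p.natDegree ≤ β) (v : Fin 3 → F) (hv : v 1 ≠ 0) :
    MvPolynomial.eval v (hom3 β p) = v 1 ^ β * p.eval (v 2 / v 1) := by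
  rw [Polynomial.eval_eq_sum_range' (Nat.lt_succ_of_le hp), hom3, map_sum, Finset.mul_sum]
  apply Finset.sum_congr rfl
  intro i hi
  have hi' : i ≤ β := by simpa [Nat.lt_succ_iff] using hi
  simp only [map_mul, MvPolynomial.eval_C, map_pow, MvPolynomial.eval_X, div_pow]
  have : v 1 ^ β = v 1 ^ (β - i) * v 1 ^ i := by rw [← pow_add]; congr 1; omega
  rw [this]
  field_simp

theorem hom3_eval_zero (v : Fin 3 → F) (hv : v 1 = 0) :
    MvPolynomial.eval v (hom3 β p) = p.coeff β * v 2 ^ β := by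
  rw [hom3, map_sum, Finset.sum_eq_single β]
  · simp
  · intro i hi hne
    have hi' : i ≤ β := by simpa [Nat.lt_succ_iff] using hi
    have : β - i ≠ 0 := by omega
    simp [hv, this]
  · simp

theorem hom3_wh :
    MvPolynomial.IsWeightedHomogeneous (![β, 1, 1] : Fin 3 → ℕ) (hom3 β p) β := by
  apply MvPolynomial.IsWeightedHomogeneous.sum
  intro i hi
  have hi' : i ≤ β := by simpa [Nat.lt_succ_iff] using hi
  have h1 := (MvPolynomial.isWeightedHomogeneous_X F (![β, 1, 1] : Fin 3 → ℕ) 1).pow (β - i)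
  have h2 := (MvPolynomial.isWeightedHomogeneous_X F (![β, 1, 1] : Fin 3 → ℕ) 2).pow i
  have h3 := (MvPolynomial.isWeightedHomogeneous_C (![β, 1, 1] : Fin 3 → ℕ) (p.coeff i)).mul
    (h1.mul h2)
  convert h3 using 1
  simp
  omega

theorem hom3_pderiv_zero : MvPolynomial.pderiv 0 (hom3 β p) = 0 := by
  rw [hom3, map_sum]
  apply Finset.sum_eq_zero
  intro i _
  simp [Derivation.leibniz, Derivation.leibniz_pow, MvPolynomial.pderiv_X]

theorem hom3_pderiv_two (hp : p.natDegree ≤ β) (w t : F) :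
    MvPolynomial.eval ![w, 1, t] (MvPolynomial.pderiv 2 (hom3 β p)) =
      (Polynomial.derivative p).eval t := by
  rw [Polynomial.derivative_eval, Polynomial.sum_over_range' _ _ (β + 1) (Nat.lt_succ_of_le hp),
    hom3, map_sum, map_sum]
  · apply Finset.sum_congr rfl
    intro i _
    simp [Derivation.leibniz, Derivation.leibniz_pow, MvPolynomial.pderiv_X]
    ring
  · simp

theorem hom3_pderiv_one (hp : p.natDegree ≤ β) (w t : F) :
    MvPolynomial.eval ![w, 1, t] (MvPolynomial.pderiv 1 (hom3 β p)) =
      β * p.eval t - t * (Polynomial.derivative p).eval t := by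
  rw [Polynomial.derivative_eval, Polynomial.sum_over_range' _ _ (β + 1) (Nat.lt_succ_of_le hp),
    Polynomial.eval_eq_sum_range' (Nat.lt_succ_of_le hp), hom3, map_sum, map_sum, Finset.mul_sum,
    Finset.mul_sum, ← Finset.sum_sub_distrib]
  · apply Finset.sum_congr rfl
    intro i hi
    have hi' : i ≤ β := by simpa [Nat.lt_succ_iff] using hi
    simp [Derivation.leibniz, Derivation.leibniz_pow, MvPolynomial.pderiv_X, Nat.cast_sub hi']
    rcases Nat.eq_zero_or_pos i with rfl | h
    · simp; ring
    · obtain ⟨j, rfl⟩ := Nat.exists_eq_add_of_lt h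
      simp [pow_succ]; ring
  · simp

end hom3

theorem prop_of_wronskian {F : Type*} [Field F] [CharZero F] (p q : Polynomial F) (hp : p ≠ 0)
    (h : p * Polynomial.derivative q = Polynomial.derivative p * q) :
    ∃ c : F, q = Polynomial.C c * p := by
  have key : ∀ q : Polynomial F, q ≠ 0 →
      p * Polynomial.derivative q = Polynomial.derivative p * q → q.natDegree = p.natDegree := by
    intro q hq h
    have hXd : ∀ r : Polynomial F, (Polynomial.X * Polynomial.derivative r).natDegree ≤ r.natDegree ∧
        (Polynomial.X * Polynomial.derivative r).coeff r.natDegree = r.natDegree * r.leadingCoeff := by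
      intro r
      rcases Nat.eq_zero_or_pos r.natDegree with h0 | h0
      · rw [Polynomial.derivative_of_natDegree_zero h0]; simp [h0]
      · obtain ⟨j, hj⟩ := Nat.exists_eq_add_of_lt h0
        refine ⟨?_, ?_⟩
        · refine (Polynomial.natDegree_mul_le).trans ?_
          have := Polynomial.natDegree_derivative_le r
          rw [Polynomial.natDegree_X]; omega
        · rw [Polynomial.leadingCoeff, hj]
          simp [Polynomial.coeff_X_mul, Polynomial.coeff_derivative]
          ring
    have h1 : p * (Polynomial.X * Polynomial.derivative q) =
        (Polynomial.X * Polynomial.derivative p) * q := by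
      rw [mul_left_comm, h, mul_assoc]
    have h2 := congrArg (fun r => r.coeff (p.natDegree + q.natDegree)) h1
    rw [Polynomial.coeff_mul_add_eq_of_natDegree_le le_rfl (hXd q).1,
      Polynomial.coeff_mul_add_eq_of_natDegree_le (hXd p).1 le_rfl, (hXd q).2, (hXd p).2] at h2
    have hp' : p.leadingCoeff ≠ 0 := by simpa
    have hq' : q.leadingCoeff ≠ 0 := by simpa
    change p.leadingCoeff * _ = _ * q.leadingCoeff at h2
    have h3 : ((q.natDegree : F) - p.natDegree) * (p.leadingCoeff * q.leadingCoeff) = 0 := by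
      linear_combination h2
    have h4 := (mul_eq_zero.mp h3).resolve_right (mul_ne_zero hp' hq')
    exact_mod_cast sub_eq_zero.mp h4
  by_cases hq : q = 0
  · exact ⟨0, by simp [hq]⟩
  refine ⟨q.leadingCoeff / p.leadingCoeff, ?_⟩
  by_contra hne
  have hd := key q hq h
  set c := q.leadingCoeff / p.leadingCoeff with hc
  have hr : q - Polynomial.C c * p ≠ 0 := sub_ne_zero.mpr hne
  have h1 := key (q - Polynomial.C c * p) hr (by
    simp only [Polynomial.derivative_sub, Polynomial.derivative_mul, Polynomial.derivative_C]
    linear_combination h)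
  have hc0 : c ≠ 0 := div_ne_zero (by simpa) (by simpa)
  have hlt : (q - Polynomial.C c * p).degree < q.degree := by
    apply Polynomial.degree_sub_lt_left _ hq
    · rw [Polynomial.leadingCoeff_mul, Polynomial.leadingCoeff_C, hc, div_mul_cancel₀]; simpa
    · rw [Polynomial.degree_C_mul hc0, Polynomial.degree_eq_natDegree hq,
        Polynomial.degree_eq_natDegree hp, hd]
  have := Polynomial.natDegree_lt_natDegree hr hlt
  omega

end FL

namespace FL

open Matrix MvPolynomial

theorem coact_X (K : Type*) {F τ : Type*} [Field K] [Field F] [Algebra K F] (wt : τ → ℕ) (r : τ) :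
    coact K wt (X r : MvPolynomial τ F) =
      Polynomial.X ^ wt r * Polynomial.C (X r) := by
  change aeval (R := F) _ (X r) = _
  simp

theorem coact_C (K : Type*) {F τ : Type*} [Field K] [Field F] [Algebra K F] (wt : τ → ℕ) (r : F) :
    coact K wt (C r : MvPolynomial τ F) = Polynomial.C (C r) := by
  change aeval (R := F) _ (C r) = _
  simp

theorem hom3_mapCoeff_eval {K F : Type*} [Field K] [Field F] [Algebra K F] (D : Derivation K F F)
    (β : ℕ) (p : Polynomial F) (c w t : F) :
    eval ![w, 1, t] (mapCoeff (Fin 3) D (hom3 β p * C c)) =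
      ∑ i ∈ Finset.range (β + 1), D (p.coeff i * c) * t ^ i := by
  rw [hom3, Finset.sum_mul, map_sum, map_sum]
  apply Finset.sum_congr rfl
  intro i _
  simp only [Derivation.leibniz, Derivation.leibniz_pow, mapCoeff_C, mapCoeff_X]
  simp
  ring

/-- restriction of scalars for a derivation on polynomials -/
noncomputable def pd (K : Type*) {F τ : Type*} [Field K] [Field F] [Algebra K F] (r : τ) :
    Derivation K (MvPolynomial τ F) (MvPolynomial τ F) :=
  (pderiv (R := F) r).restrictScalars K

theorem li_cons_apply {F V : Type*} [Field F] [AddCommGroup V] [Module F V] {k : ℕ} {x : V}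
    {e : Fin k → V} (h : LinearIndependent F (Fin.cons x e : Fin (k + 1) → V)) (w : F) (c : Fin k → F)
    (h0 : w • x + ∑ a, c a • e a = 0) : w = 0 ∧ ∀ a, c a = 0 := by
  have := Fintype.linearIndependent_iff.mp h (Fin.cons w c) (by
    simpa [Fin.sum_univ_succ] using h0)
  exact ⟨this 0, fun a => this a.succ⟩

theorem R_core {K F σ : Type*} [Field K] [Field F] [IsAlgClosed F] [CharZero F] [Algebra K F]
    [Fintype σ] {s m k : ℕ}
    (f : Fin s → MvPolynomial σ K) (d : Fin s → ℕ) (hf : ∀ i, (f i).IsHomogeneous (d i))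
    (hsm : Smooth F f) (hcard : Fintype.card σ = m + s + 1) (hm : ∑ i, (d i - 1) = m)
    (hk : k + 1 = m) (D : Fin k → Derivation K F F) (x : σ → F)
    (hli : LinearIndependent F (Fin.cons x (fun a j => D a (x j)) : Fin (k + 1) → σ → F))
    (p : Fin k → Polynomial F) (β : ℕ) (hβ : ∀ a, (p a).natDegree ≤ β) (hβ1 : 1 ≤ β)
    (hinf : ∃ a, (p a).coeff β ≠ 0) (hroot : ∀ t, ∃ a, (p a).eval t ≠ 0)
    (j1 j2 : Fin k) (hW : p j1 * Polynomial.derivative (p j2) ≠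
      Polynomial.derivative (p j1) * p j2)
    (S : Finset F) (hvan : ∀ t ∉ S, ∀ (w : F) i, aeval
      (fun j => w * x j + ∑ a, (p a).eval t * D a (x j)) (f i) = 0) : False := by
  classical
  set wt : Fin 3 → ℕ := ![β, 1, 1] with hwt
  have hj12 : j1 ≠ j2 := by
    rintro rfl; apply hW; ring
  let P : σ → MvPolynomial (Fin 3) F := fun j => X 0 * C (x j) +
    ∑ a, hom3 β (p a) * C (D a (x j))
  have hPe : ∀ (v : Fin 3 → F) j, eval v (P j) =
      v 0 * x j + ∑ a, eval v (hom3 β (p a)) * D a (x j) := by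
    intro v j; simp [P]
  have hPz : ∀ v : Fin 3 → F, (∀ j, eval v (P j) = 0) → v = 0 := by
    intro v hv
    obtain ⟨h0, h1⟩ := li_cons_apply hli (v 0) (fun a => eval v (hom3 β (p a)))
      (by funext j; have := hv j; rw [hPe] at this; simpa using this)
    have hv1 : v 1 = 0 := by
      by_contra hne
      obtain ⟨a, ha⟩ := hroot (v 2 / v 1)
      have := h1 a
      rw [hom3_eval _ _ (hβ a) v hne] at this
      exact (mul_ne_zero (pow_ne_zero _ hne) ha) this
    have hv2 : v 2 = 0 := by
      by_contra hne
      obtain ⟨a, ha⟩ := hinf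
      have := h1 a
      rw [hom3_eval_zero _ _ v hv1] at this
      exact (mul_ne_zero ha (pow_ne_zero _ hne)) this
    funext r
    fin_cases r
    · exact h0
    · exact hv1
    · exact hv2
  have hP : ∀ i, aeval P (f i) = 0 := by
    intro i
    let Q : MvPolynomial (Fin 3) F := X 1 *
      ∏ t ∈ S, (X 2 - C t * X 1)
    have hQ : Q ≠ 0 := by
      refine mul_ne_zero (X_ne_zero _) ?_
      rw [Finset.prod_ne_zero_iff]
      intro t _ h0
      have := congrArg (eval ![0, 0, 1]) h0
      simp at this
    have h1 : Q * aeval P (f i) = 0 := by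
      apply MvPolynomial.funext
      intro v
      rw [map_mul, map_zero]
      have h2 : eval v (aeval P (f i)) =
          aeval (fun j => eval v (P j)) (f i) := by
        have := comp_aeval_apply (f := P)
          ((aeval v : MvPolynomial (Fin 3) F →ₐ[F] F).restrictScalars K) (f i)
        exact this
      by_cases hv1 : v 1 = 0
      · simp [Q, hv1]
      by_cases hvS : v 2 / v 1 ∈ S
      · have : eval v Q = 0 := by
          simp only [Q, map_mul, map_prod]
          rw [Finset.prod_eq_zero hvS]
          · simp
          · simp [hv1]
        rw [this, zero_mul]
      · have h3 := hvan _ hvS (v 0 / v 1 ^ β) i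
        have h4 : (fun j => eval v (P j)) = fun j => v 1 ^ β *
            (v 0 / v 1 ^ β * x j + ∑ a, (p a).eval (v 2 / v 1) * D a (x j)) := by
          funext j
          rw [hPe, mul_add, Finset.mul_sum]
          congr 1
          · field_simp
          · apply Finset.sum_congr rfl
            intro a _
            rw [hom3_eval _ _ (hβ a) v hv1, mul_assoc]
        rw [h2, h4, aeval_smul_homog (hf i), h3]
        simp
    exact (mul_eq_zero.mp h1).resolve_left hQ
  let ι := Fin 3 ⊕ {j : Fin k // j ≠ j1 ∧ j ≠ j2}
  have hcι : Fintype.card {j : Fin k // j ≠ j1 ∧ j ≠ j2} + 2 = k := by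
    have h1 := Finset.card_compl ({j1, j2} : Finset (Fin k))
    rw [Finset.card_pair hj12, Fintype.card_fin] at h1
    have h2 : Fintype.card {j : Fin k // j ≠ j1 ∧ j ≠ j2} = ({j1, j2} : Finset (Fin k))ᶜ.card := by
      rw [Fintype.card_subtype]
      congr 1
      ext j; simp
    have h3 : 2 ≤ k := by
      have := Finset.card_le_univ ({j1, j2} : Finset (Fin k))
      rw [Finset.card_pair hj12, Fintype.card_fin] at this
      exact this
    omega
  have hcard' : Fintype.card σ = Fintype.card (ι ⊕ Fin (s + 1)) := by
    simp only [ι, Fintype.card_sum, Fintype.card_fin]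
    omega
  let eqv : σ ≃ ι ⊕ Fin (s + 1) := Fintype.equivOfCardEq hcard'
  let Δ : ι → Derivation K (MvPolynomial (Fin 3) F) (MvPolynomial (Fin 3) F) :=
    Sum.elim (fun r => pd K r) (fun j => mapCoeff (Fin 3) (D j.1))
  let wts : ι → ℕ := Sum.elim ![0, β - 1, β - 1] (fun _ => β)
  have hPwh : ∀ j, IsWeightedHomogeneous wt (P j) β := by
    intro j
    apply IsWeightedHomogeneous.add
    · have := (isWeightedHomogeneous_X F wt 0).mul
        (isWeightedHomogeneous_C wt (x j))
      simpa [hwt] using this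
    · apply IsWeightedHomogeneous.sum
      intro a _
      have := (hom3_wh β (p a)).mul (isWeightedHomogeneous_C wt (D a (x j)))
      simpa using this
  have hcwh : ∀ i j, IsWeightedHomogeneous wt (Δ i (P j)) (wts i) := by
    rintro (r | r) j
    · change IsWeightedHomogeneous wt (pderiv r (P j)) _
      apply (hPwh j).pderiv
      fin_cases r <;> simp [wts, wt] <;> omega
    · exact mapCoeff_wh wt _ _ _ (hPwh j)
  have hzero := G_lemma (F := F) f d hf hsm P hP X (by
      intro φ i hφ h0
      apply hφ
      have h1 : ∀ q, φ q = eval (fun r => φ (X r)) q := by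
        intro q
        have : φ = aeval (fun r => φ (X r)) := by ext; simp
        rw [this]; simp [aeval_eq_eval]
      have h2 := hPz (fun r => φ (X r)) (by
        intro j
        rw [← h1]
        exact congrFun h0 j)
      exact congrFun h2 i)
    (fun i => X_ne_zero i)
    (fun M N z w h => mv_reg2 0 1 (by decide) M N z w h)
    (fun L M N z a b h => mv_reg3 0 1 2 (by decide) (by decide) L M N z a b h)
    eqv Δ (detForm eqv (fun i j => Δ i (P j))) 1 one_ne_zero (one_smul _ _)
    (coact K wt) β (fun j => coact_wh K wt _ _ (hPwh j)) (∑ i, wts i)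
    (fun idx => detForm_weight (coact K wt).toRingHom eqv _ wts
      (fun i j => coact_wh K wt _ _ (hcwh i j)) idx)
    (by
      rw [← Finset.mul_sum, hm]
      simp only [ι, wts, Fintype.sum_sum_type, Sum.elim_inl, Sum.elim_inr, Fin.sum_univ_three,
        Finset.sum_const, Finset.card_univ, smul_eq_mul]
      obtain ⟨q, hq⟩ : ∃ q, q = Fintype.card {j : Fin k // j ≠ j1 ∧ j ≠ j2} := ⟨_, rfl⟩
      rw [← hq] at hcι ⊢
      subst hk
      subst hcι
      simp
      have : β * (q + 2 + 1) = q * β + 3 * β := by ring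
      rw [this]
      omega)
  -- nonvanishing
  obtain ⟨t0, ht0⟩ : ∃ t, (p j1 * Polynomial.derivative (p j2) -
      Polynomial.derivative (p j1) * p j2).eval t ≠ 0 := by
    by_contra hcon
    push Not at hcon
    apply hW
    rw [← sub_eq_zero]
    exact Polynomial.funext (fun r => by simpa using hcon r)
  let Ya : Fin k → F := fun a => β * (p a).eval t0 - t0 * (Polynomial.derivative (p a)).eval t0
  let Yb : Fin k → F := fun a => (Polynomial.derivative (p a)).eval t0
  have hmin : Ya j1 * Yb j2 - Yb j1 * Ya j2 ≠ 0 := by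
    have : Ya j1 * Yb j2 - Yb j1 * Ya j2 = β * (p j1 * Polynomial.derivative (p j2) -
      Polynomial.derivative (p j1) * p j2).eval t0 := by
      simp [Ya, Yb]; ring
    rw [this]
    exact mul_ne_zero (by exact_mod_cast (by omega)) ht0
  let e : Fin k → σ → F := fun a j => D a (x j)
  let v : ι → σ → F := Sum.elim ![x, ∑ a, Ya a • e a, ∑ a, Yb a • e a] (fun j => e j.1)
  let u : ι → σ → F := Sum.elim 0 (fun j => ∑ a, fun l =>
    ∑ i ∈ Finset.range (β + 1), D j.1 ((p a).coeff i * D a (x l)) * t0 ^ i)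
  have hv : LinearIndependent F v := by
    rw [Fintype.linearIndependent_iff]
    intro g hg
    simp only [ι, v, Fintype.sum_sum_type, Sum.elim_inl, Sum.elim_inr, Fin.sum_univ_three] at hg
    simp only [Matrix.cons_val_zero, Matrix.cons_val_one, Matrix.cons_val] at hg
    let g' : Fin k → F := fun a => if h : a ≠ j1 ∧ a ≠ j2 then g (Sum.inr ⟨a, h⟩) else 0
    have hsum : ∑ j : {j : Fin k // j ≠ j1 ∧ j ≠ j2}, g (Sum.inr j) • e j.1 = ∑ a, g' a • e a := by
      have h1 : ∑ j : {j : Fin k // j ≠ j1 ∧ j ≠ j2}, g (Sum.inr j) • e j.1 =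
          ∑ j : {j : Fin k // j ≠ j1 ∧ j ≠ j2}, g' j.1 • e j.1 := by
        apply Finset.sum_congr rfl
        rintro ⟨j, hj⟩ _
        simp [g', hj]
      rw [h1, ← Finset.sum_subtype (Finset.univ.filter (fun j => j ≠ j1 ∧ j ≠ j2)) (by simp)
        (fun a => g' a • e a)]
      apply Finset.sum_subset (Finset.subset_univ _)
      intro a _ ha
      have : ¬ (a ≠ j1 ∧ a ≠ j2) := by simpa using ha
      simp only [g', dif_neg this, zero_smul]
    rw [hsum] at hg
    have hg2 : g (Sum.inl 0) • x + ∑ a, (g (Sum.inl 1) * Ya a + g (Sum.inl 2) * Yb a + g' a) • e a = 0 := by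
      rw [← hg]
      simp only [add_smul, Finset.sum_add_distrib, mul_smul, Finset.smul_sum]
      abel
    obtain ⟨h0, h1⟩ := li_cons_apply hli _ _ hg2
    have ha := h1 j1
    have hb := h1 j2
    simp only [g', ne_eq, not_true_eq_false, false_and, and_false, dite_false, add_zero] at ha hb
    have hg1 : g (Sum.inl 1) = 0 := by
      apply (mul_eq_zero.mp (_ : g (Sum.inl 1) * (Ya j1 * Yb j2 - Yb j1 * Ya j2) = 0)).resolve_right hmin
      linear_combination Yb j2 * ha - Yb j1 * hb
    have hg3 : g (Sum.inl 2) = 0 := by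
      apply (mul_eq_zero.mp (_ : g (Sum.inl 2) * (Ya j1 * Yb j2 - Yb j1 * Ya j2) = 0)).resolve_right hmin
      linear_combination Ya j1 * hb - Ya j2 * ha
    rintro (r | ⟨j, hj⟩)
    · fin_cases r
      · exact h0
      · exact hg1
      · exact hg3
    · have := h1 j
      simpa [g', hj, hg1, hg3] using this
  obtain ⟨w0, hw0, hLI⟩ := li_open v u hv
  apply detForm_ne_zero (eval ![w0, 1, t0]) C (by simp) eqv
    (fun i j => Δ i (P j)) _ hzero
  have hLI2 := hLI.units_smul (Sum.elim (fun _ => (Units.mk0 w0 hw0)⁻¹) (fun _ => 1))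
  suffices heq : (fun i j => eval ![w0, 1, t0] (Δ i (P j))) =
      ((Sum.elim (fun _ => (Units.mk0 w0 hw0)⁻¹) (fun _ => 1) : ι → Fˣ) • fun i => w0 • v i + u i) by
    rw [heq]; exact hLI2
  funext i j
  rcases i with r | r
  · have hpd : pderiv r (P j) = pderiv r (X 0) *
        C (x j) + ∑ a, pderiv r (hom3 β (p a)) * C (D a (x j)) := by
      simp [P, Derivation.leibniz, mul_comm]
    change eval _ (pderiv r (P j)) = _
    rw [hpd]
    simp only [Pi.smul_apply', Sum.elim_inl, u, v, Pi.zero_apply, add_zero, Units.smul_def,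
      Units.val_inv_eq_inv_val, Units.val_mk0, smul_smul, inv_mul_cancel₀ hw0, one_smul]
    fin_cases r
    · simp [hom3_pderiv_zero]
    · simp [pderiv_X, hom3_pderiv_one _ _ (hβ _), Ya, e]
    · simp [pderiv_X, hom3_pderiv_two _ _ (hβ _), Yb, e]
  · have hpd : mapCoeff (Fin 3) (D r.1) (P j) = X 0 * C (D r.1 (x j)) +
        ∑ a, mapCoeff (Fin 3) (D r.1) (hom3 β (p a) * C (D a (x j))) := by
      simp only [P, map_add, map_sum]
      congr 1
      rw [Derivation.leibniz, mapCoeff_C, mapCoeff_X]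
      simp
    change eval _ (mapCoeff (Fin 3) (D r.1) (P j)) = _
    rw [hpd]
    simp only [map_add, map_sum, hom3_mapCoeff_eval]
    simp [u, v, e]

end FL

namespace FL

open Matrix

theorem R_lemma {K F σ : Type*} [Field K] [Field F] [IsAlgClosed F] [CharZero F] [Algebra K F]
    [Fintype σ] {s m k : ℕ}
    (f : Fin s → MvPolynomial σ K) (d : Fin s → ℕ) (hf : ∀ i, (f i).IsHomogeneous (d i))
    (hsm : Smooth F f) (hcard : Fintype.card σ = m + s + 1) (hm : ∑ i, (d i - 1) = m)
    (hk : k + 1 = m) (D : Fin k → Derivation K F F) (x : σ → F)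
    (hli : LinearIndependent F (Fin.cons x (fun a j => D a (x j)) : Fin (k + 1) → σ → F)) :
    ∀ (N : ℕ) (p : Fin k → Polynomial F) (_ : ∑ a, (p a).natDegree = N)
    (_ : ¬ ∃ (g : Polynomial F) (c : Fin k → F), ∀ a, p a = Polynomial.C (c a) * g)
    (S : Finset F) (_ : ∀ t ∉ S, ∀ (w : F) i, MvPolynomial.aeval
      (fun j => w * x j + ∑ a, (p a).eval t * D a (x j)) (f i) = 0), False := by
  classical
  intro N
  induction N using Nat.strong_induction_on with
  | _ N ih =>
  intro p hN hnp S hvan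
  by_cases hroot : ∀ t, ∃ a, (p a).eval t ≠ 0
  · -- no common roots
    have hW : ∃ j1 j2, p j1 * Polynomial.derivative (p j2) ≠
        Polynomial.derivative (p j1) * p j2 := by
      by_contra hcon
      push Not at hcon
      apply hnp
      by_cases h0 : ∀ a, p a = 0
      · exact ⟨0, fun _ => 0, fun a => by simp [h0]⟩
      · push Not at h0
        obtain ⟨a0, ha0⟩ := h0
        choose c hc using fun a => prop_of_wronskian (p a0) (p a) ha0 (hcon a0 a)
        exact ⟨p a0, c, hc⟩
    obtain ⟨j1, j2, hW⟩ := hW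
    obtain ⟨a0, _, ha0⟩ := Finset.exists_max_image Finset.univ (fun a => (p a).natDegree) ⟨j1, Finset.mem_univ _⟩
    have hβ : ∀ a, (p a).natDegree ≤ (p a0).natDegree := fun a => ha0 a (Finset.mem_univ _)
    have hβ1 : 1 ≤ (p a0).natDegree := by
      by_contra hcon
      apply hnp
      refine ⟨1, fun a => (p a).coeff 0, fun a => ?_⟩
      rw [mul_one]
      exact Polynomial.eq_C_of_natDegree_eq_zero (by have := hβ a; omega)
    refine R_core f d hf hsm hcard hm hk D x hli p _ hβ hβ1 ⟨a0, ?_⟩ hroot j1 j2 hW S hvan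
    intro h0
    have : (p a0).leadingCoeff = 0 := h0
    rw [Polynomial.leadingCoeff_eq_zero] at this
    rw [this] at hβ1
    simp at hβ1
  · push Not at hroot
    obtain ⟨t0, ht0⟩ := hroot
    have hdvd : ∀ a, ∃ q, p a = (Polynomial.X - Polynomial.C t0) * q := by
      intro a
      obtain ⟨q, hq⟩ := Polynomial.dvd_iff_isRoot.mpr (ht0 a)
      exact ⟨q, hq⟩
    choose q hq using hdvd
    have hdeg : ∀ a, p a ≠ 0 → (p a).natDegree = (q a).natDegree + 1 := by
      intro a ha
      rw [hq a] at ha ⊢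
      rw [Polynomial.natDegree_mul (left_ne_zero_of_mul ha) (right_ne_zero_of_mul ha),
        Polynomial.natDegree_X_sub_C, add_comm]
    have hq0 : ∀ a, p a = 0 → q a = 0 := by
      intro a ha
      rw [hq a, mul_eq_zero] at ha
      exact ha.resolve_left (Polynomial.X_sub_C_ne_zero t0)
    have hlt : ∑ a, (q a).natDegree < N := by
      rw [← hN]
      obtain ⟨a0, ha0⟩ : ∃ a, p a ≠ 0 := by
        by_contra hcon
        push Not at hcon
        exact hnp ⟨0, fun _ => 0, fun a => by simp [hcon]⟩
      apply Finset.sum_lt_sum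
      · intro a _
        by_cases h : p a = 0
        · rw [hq0 a h, h]
        · rw [hdeg a h]; omega
      · exact ⟨a0, Finset.mem_univ _, by rw [hdeg a0 ha0]; omega⟩
    refine ih _ hlt q rfl ?_ (insert t0 S) ?_
    · rintro ⟨g, c, hgc⟩
      exact hnp ⟨(Polynomial.X - Polynomial.C t0) * g, c, fun a => by rw [hq a, hgc a]; ring⟩
    · intro t ht w i
      rw [Finset.mem_insert, not_or] at ht
      have h1 := hvan t ht.2 ((t - t0) * w) i
      have h2 : (fun j => (t - t0) * w * x j + ∑ a, (p a).eval t * D a (x j)) =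
          fun j => (t - t0) * (w * x j + ∑ a, (q a).eval t * D a (x j)) := by
        funext j
        rw [mul_add, Finset.mul_sum, mul_assoc]
        congr 1
        apply Finset.sum_congr rfl
        intro a _
        rw [hq a]; simp [mul_assoc]
      rw [h2, aeval_smul_homog (hf i)] at h1
      exact (mul_eq_zero.mp h1).resolve_left (pow_ne_zero _ (sub_ne_zero.mpr ht.1))

end FL

namespace FL

open Matrix

/-- Homogeneous forms with constant coefficients vanishing at a point which together with its
derivatives spans everything are zero. -/
theorem hom_span {C E σ : Type*} [Field C] [Field E] [CharZero E] [Algebra C E] [Fintype σ]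
    (𝔇 : Set (Derivation C E E)) (z : σ → E)
    (hspan : ∀ φ : σ → E, ∑ j, φ j * z j = 0 → (∀ D ∈ 𝔇, ∑ j, φ j * D (z j) = 0) → φ = 0) :
    ∀ (n : ℕ) (g : MvPolynomial σ C), g.IsHomogeneous n → MvPolynomial.aeval z g = 0 → g = 0 := by
  intro n
  have hC : CharZero C := by
    refine ⟨fun a b h => ?_⟩
    have := congrArg (algebraMap C E) h
    simpa using this
  induction n with
  | zero =>
    intro g hg h0
    have h1 := (MvPolynomial.totalDegree_zero_iff_isHomogeneous (p := g)).mpr hg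
    rw [MvPolynomial.totalDegree_eq_zero_iff_eq_C] at h1
    rw [h1] at h0 ⊢
    simp only [MvPolynomial.aeval_C] at h0
    rw [(map_eq_zero _).mp h0, map_zero]
  | succ n ih =>
    intro g hg h0
    have he := hg.sum_X_mul_pderiv
    have hp : ∀ j, MvPolynomial.pderiv j g = 0 := by
      intro j
      apply ih _ (by simpa using hg.pderiv (i := j))
      have := hspan (fun j => MvPolynomial.aeval z (MvPolynomial.pderiv j g)) (by
        have h2 := congrArg (MvPolynomial.aeval z) he
        simp only [map_sum, map_mul, MvPolynomial.aeval_X, map_nsmul, h0, smul_zero] at h2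
        rw [← h2]
        exact Finset.sum_congr rfl fun _ _ => mul_comm _ _) (by
        intro D _
        rw [← deriv_aeval, h0, map_zero])
      exact congrFun this j
    simp only [hp, mul_zero, Finset.sum_const_zero] at he
    rw [eq_comm, smul_eq_zero] at he
    exact he.resolve_left (by omega)

section Conic

variable {F Ω : Type*} [Field F] [IsAlgClosed F] [Field Ω] [Algebra F Ω]

/-- `y` is a multiple of a polynomial curve point. -/
def RatPt (F : Type*) {Ω ι : Type*} [Field F] [Field Ω] [Algebra F Ω] (n : ℕ) (y : ι → Ω) : Prop :=
  ∃ (τ c : Ω) (p : ι → Polynomial F), (∀ i, (p i).natDegree ≤ n) ∧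
    ∀ i, y i = c * Polynomial.aeval τ (p i)

open Polynomial in
theorem ratPt_two (y : Fin 3 → Ω) (μ ν : F) (a : Ω) (h0 : y 0 = a * algebraMap F Ω μ)
    (h1 : y 1 = a * algebraMap F Ω ν) : RatPt F 2 y := by
  by_cases ha : a = 0
  · refine ⟨0, y 2, ![0, 0, 1], ?_, ?_⟩
    · intro i; fin_cases i <;> simp
    · intro i; fin_cases i <;> simp [h0, h1, ha]
  · refine ⟨y 2 / a, a, ![C μ, C ν, X], ?_, ?_⟩
    · intro i; fin_cases i <;> simp
    · intro i; fin_cases i <;> simp [h0, h1]; field_simp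

theorem quad_root (A B D : F) (hA : A ≠ 0) : ∃ t : F, A * t ^ 2 + B * t + D = 0 := by
  have := IsAlgClosed.exists_root (Polynomial.C A * Polynomial.X ^ 2 + Polynomial.C B * Polynomial.X
    + Polynomial.C D) (by rw [Polynomial.degree_quadratic hA]; decide)
  obtain ⟨t, ht⟩ := this
  exact ⟨t, by simpa [Polynomial.IsRoot] using ht⟩

/-- binary quadratic equation over alg closed subfield -/
theorem quad_ratio (A B D : F) (h : ¬ (A = 0 ∧ B = 0 ∧ D = 0)) (y0 y1 : Ω)
    (he : algebraMap F Ω A * y0 ^ 2 + algebraMap F Ω B * y0 * y1 + algebraMap F Ω D * y1 ^ 2 = 0) :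
    ∃ (μ ν : F) (a : Ω), y0 = a * algebraMap F Ω μ ∧ y1 = a * algebraMap F Ω ν := by
  by_cases h1 : y1 = 0
  · exact ⟨1, 0, y0, by simp, by simp [h1]⟩
  by_cases hA : A = 0
  · subst hA
    by_cases hB : B = 0
    · subst hB
      simp only [map_zero, zero_mul, zero_add, mul_eq_zero, map_eq_zero] at he
      exfalso
      rcases he with he | he
      · exact h ⟨rfl, rfl, he⟩
      · exact h1 (pow_eq_zero_iff (by norm_num) |>.mp he)
    · refine ⟨-D, B, y1 / algebraMap F Ω B, ?_, ?_⟩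
      · have hB' : algebraMap F Ω B ≠ 0 := by simpa using hB
        have : y1 * (algebraMap F Ω B * y0 + algebraMap F Ω D * y1) = 0 := by
          rw [← he]; simp; ring
        have := (mul_eq_zero.mp this).resolve_left h1
        field_simp
        simp only [map_neg]
        linear_combination this
      · have hB' : algebraMap F Ω B ≠ 0 := by simpa using hB
        field_simp
  · obtain ⟨t, ht⟩ := quad_root A B D hA
    have ht' := congrArg (algebraMap F Ω) ht
    simp only [map_add, map_mul, map_pow, map_zero] at ht'
    have hA' : algebraMap F Ω A ≠ 0 := by simpa using hA
    have : (y0 - algebraMap F Ω t * y1) * (algebraMap F Ω A * y0 +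
        (algebraMap F Ω A * algebraMap F Ω t + algebraMap F Ω B) * y1) = 0 := by
      linear_combination he - y1 ^ 2 * ht'
    rcases mul_eq_zero.mp this with h2 | h2
    · exact ⟨t, 1, y1, by linear_combination h2, by simp⟩
    · refine ⟨-(A * t + B), A, y1 / algebraMap F Ω A, ?_, ?_⟩
      · field_simp; simp only [map_neg, map_add, map_mul]; linear_combination h2
      · field_simp

open Polynomial in
theorem conic0 (y : Fin 3 → Ω) (a b r0 r1 r2 : F)
    (h : ¬ (a = 0 ∧ b = 0 ∧ r0 = 0 ∧ r1 = 0 ∧ r2 = 0))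
    (he : y 2 * (algebraMap F Ω a * y 0 + algebraMap F Ω b * y 1) + algebraMap F Ω r0 * y 0 ^ 2 +
      algebraMap F Ω r1 * y 0 * y 1 + algebraMap F Ω r2 * y 1 ^ 2 = 0) : RatPt F 2 y := by
  by_cases hl : algebraMap F Ω a * y 0 + algebraMap F Ω b * y 1 = 0
  · by_cases hab : a = 0 ∧ b = 0
    · obtain ⟨μ, ν, c, h1, h2⟩ := quad_ratio r0 r1 r2 (by tauto) (y 0) (y 1) (by
        rw [hl] at he; linear_combination he)
      exact ratPt_two y μ ν c h1 h2
    · by_cases hb : b = 0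
      · have ha : a ≠ 0 := fun h => hab ⟨h, hb⟩
        refine ratPt_two y 0 1 (y 1) ?_ (by simp)
        rw [hb] at hl
        simpa [ha] using hl
      · have hb' : algebraMap F Ω b ≠ 0 := by simpa using hb
        refine ratPt_two y (-b) a (- y 0 / algebraMap F Ω b) ?_ ?_
        · simp; field_simp
        · field_simp; linear_combination hl
  · by_cases h0 : y 0 = 0
    · refine ratPt_two y 0 1 (y 1) (by simp [h0]) (by simp)
    · refine ⟨y 1 / y 0, y 0 ^ 2 / (algebraMap F Ω a * y 0 + algebraMap F Ω b * y 1),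
        ![C a + C b * X, C a * X + C b * X ^ 2, - (C r0 + C r1 * X + C r2 * X ^ 2)], ?_, ?_⟩
      · intro i
        fin_cases i
        · simp; compute_degree; norm_num
        · simp; compute_degree
        · simp only [Fin.reduceFinMk, Fin.isValue, cons_val]; compute_degree
      · obtain ⟨L, hL⟩ : ∃ L, L = algebraMap F Ω a * y 0 + algebraMap F Ω b * y 1 := ⟨_, rfl⟩
        rw [← hL] at he hl ⊢
        intro i
        fin_cases i
        · simp; field_simp; linear_combination hL
        · simp; field_simp; linear_combination y 1 * hL
        · simp; field_simp; linear_combination he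

theorem RatPt.lin {ι κ : Type*} [Fintype ι] {n : ℕ} {y : ι → Ω} (h : RatPt F n y)
    (B : κ → ι → F) : RatPt F n (fun a => ∑ i, algebraMap F Ω (B a i) * y i) := by
  obtain ⟨τ, c, p, hp, hy⟩ := h
  refine ⟨τ, c, fun a => ∑ i, Polynomial.C (B a i) * p i, ?_, ?_⟩
  · intro a
    apply Polynomial.natDegree_sum_le_of_forall_le
    intro i _
    exact (Polynomial.natDegree_C_mul_le _ _).trans (hp i)
  · intro a
    simp only [map_sum, map_mul, Polynomial.aeval_C, Finset.mul_sum, hy]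
    exact Finset.sum_congr rfl fun i _ => by ring

/-- Conic lemma. -/
theorem conic (y : Fin 3 → Ω) (A B D E G H : F)
    (h : ¬ (A = 0 ∧ B = 0 ∧ D = 0 ∧ E = 0 ∧ G = 0 ∧ H = 0))
    (he : algebraMap F Ω A * y 0 ^ 2 + algebraMap F Ω B * y 0 * y 1 + algebraMap F Ω D * y 1 ^ 2
      + algebraMap F Ω E * y 0 * y 2 + algebraMap F Ω G * y 1 * y 2 + algebraMap F Ω H * y 2 ^ 2 = 0) :
    RatPt F 2 y := by
  by_cases hA : A = 0
  · have := conic0 (F := F) ![y 1, y 2, y 0] B E D G H (by subst hA; tauto) (by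
      simp [hA] at he ⊢; linear_combination he)
    have := this.lin ![![0, 0, 1], ![1, 0, 0], ![0, 1, 0]]
    convert this using 1
    funext i
    fin_cases i <;> simp [Fin.sum_univ_three]
  · obtain ⟨t, ht⟩ := quad_root A B D hA
    have ht' := congrArg (algebraMap F Ω) ht
    simp only [map_add, map_mul, map_pow, map_zero] at ht'
    have := conic0 (F := F) ![y 0 - algebraMap F Ω t * y 1, y 2, y 1] (A * t + A * t + B) (E * t + G)
      A E H (by tauto) (by
      simp; linear_combination he - y 1 ^ 2 * ht')
    have := this.lin ![![1, 0, t], ![0, 0, 1], ![0, 1, 0]]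
    convert this using 1
    funext i
    fin_cases i <;> simp [Fin.sum_univ_three]

end Conic

end FL

namespace FL

open Matrix

section Descent

variable {K F : Type*} [Field K] [Field F] [Algebra K F]

/-- Field of constants of a set of derivations. -/
def constF (𝔇 : Set (Derivation K F F)) : IntermediateField K F where
  carrier := {c | ∀ D ∈ 𝔇, D c = 0}
  mul_mem' := by
    intro a b ha hb D hD
    simp [ha D hD, hb D hD]
  add_mem' := by
    intro a b ha hb D hD
    simp [ha D hD, hb D hD]
  algebraMap_mem' := by
    intro r D _
    simp
  inv_mem' := by
    intro a ha D hD
    simp [Derivation.leibniz_inv, ha D hD]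

theorem mem_constF {𝔇 : Set (Derivation K F F)} {c : F} : c ∈ constF 𝔇 ↔ ∀ D ∈ 𝔇, D c = 0 :=
  Iff.rfl

/-- A derivation as a derivation over the constants. -/
noncomputable def constDer (𝔇 : Set (Derivation K F F)) (D : Derivation K F F) (hD : D ∈ 𝔇) :
    Derivation (constF 𝔇) F F :=
  Derivation.mk'
    { toFun := D
      map_add' := map_add D
      map_smul' := by
        intro c a
        have : D (c : F) = 0 := c.2 D hD
        change D ((c : F) * a) = (c : F) * D a
        simp [this] }
    (by
      intro a b
      change D (a * b) = a * D b + b * D a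
      simp)

theorem constDer_apply (𝔇 : Set (Derivation K F F)) (D : Derivation K F F) (hD : D ∈ 𝔇) (a : F) :
    constDer 𝔇 D hD a = D a := rfl

theorem exists_coords {σ : Type*} [Fintype σ] (W : Submodule F (σ → F)) (r : ℕ)
    (hr : Module.finrank F W = r) : ∃ ι : Fin r → σ, ∃ w : Fin r → W,
    (∀ b c, (w b : σ → F) (ι c) = if b = c then 1 else 0) ∧
    ∀ u : W, u = ∑ b, (u : σ → F) (ι b) • w b := by
  classical
  let φ : σ → Module.Dual F W := fun j => (LinearMap.proj j).comp W.subtype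
  have htop : Submodule.span F (Set.range φ) = ⊤ := by
    by_contra hne
    have h1 := Submodule.exists_dual_map_eq_bot_of_lt_top (lt_top_iff_ne_top.mpr hne) inferInstance
    obtain ⟨g, hg, hg2⟩ := h1
    obtain ⟨u, hu⟩ := (Module.evalEquiv F W).surjective g
    apply hg
    have : u = 0 := by
      apply Subtype.ext
      funext j
      have h3 : g (φ j) ∈ Submodule.map g (Submodule.span F (Set.range φ)) :=
        Submodule.mem_map_of_mem (Submodule.subset_span ⟨j, rfl⟩)
      rw [hg2, Submodule.mem_bot, ← hu] at h3
      exact h3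
    rw [← hu, this, map_zero]
  obtain ⟨h, hmem, hsp, hli⟩ := Submodule.exists_fun_fin_finrank_span_eq F (Set.range φ)
  have hfr : Module.finrank F (Submodule.span F (Set.range φ)) = r := by
    rw [htop, finrank_top, Subspace.dual_finrank_eq, hr]
  obtain ⟨ι, hι⟩ : ∃ ι : Fin r → σ, ∀ i, h (Fin.cast hfr.symm i) = φ (ι i) := by
    choose ι hι using hmem
    exact ⟨fun i => ι (Fin.cast hfr.symm i), fun i => (hι _).symm⟩
  let L : W →ₗ[F] (Fin r → F) := LinearMap.pi fun i => φ (ι i)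
  have hinj : Function.Injective L := by
    rw [← LinearMap.ker_eq_bot, LinearMap.ker_eq_bot']
    intro u hu
    apply Subtype.ext
    funext j
    have h1 : ∀ ψ ∈ Submodule.span F (Set.range h), ψ u = 0 := by
      intro ψ hψ
      induction hψ using Submodule.span_induction with
      | mem ψ hψ =>
        obtain ⟨i, rfl⟩ := hψ
        have h2 := hι (Fin.cast hfr i)
        have h3 := congrFun hu (Fin.cast hfr i)
        simp only [Fin.cast_cast, Fin.cast_eq_self] at h2
        rw [h2]
        exact h3
      | zero => rfl
      | add a b _ _ ha hb => rw [LinearMap.add_apply, ha, hb, add_zero]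
      | smul c a _ ha => rw [LinearMap.smul_apply, ha, smul_zero]
    exact h1 (φ j) (by rw [hsp]; exact Submodule.subset_span ⟨j, rfl⟩)
  let e : W ≃ₗ[F] (Fin r → F) := LinearEquiv.ofInjectiveOfFinrankEq L hinj (by simp [hr])
  have he : ∀ u c, e u c = (u : σ → F) (ι c) := fun u c => rfl
  refine ⟨ι, fun b => e.symm (Pi.single b 1), ?_, ?_⟩
  · intro b c
    rw [← he, LinearEquiv.apply_symm_apply, Pi.single_apply]
    simp [eq_comm]
  · intro u
    apply e.injective
    funext c
    simp only [map_sum, map_smul, LinearEquiv.apply_symm_apply, Finset.sum_apply, Pi.smul_apply,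
      Pi.single_apply, smul_eq_mul]
    simp [he]

theorem descent {σ : Type*} [Fintype σ] (𝔇 : Set (Derivation K F F)) (W : Submodule F (σ → F))
    (r : ℕ) (hr : Module.finrank F W = r)
    (hst : ∀ D ∈ 𝔇, ∀ u ∈ W, (fun j => D (u j)) ∈ W) :
    ∃ ι : Fin r → σ, ∃ w : Fin r → σ → constF 𝔇,
    (∀ b c, w b (ι c) = if b = c then 1 else 0) ∧
    (∀ b, (fun j => (w b j : F)) ∈ W) ∧
    ∀ u ∈ W, ∀ j, u j = ∑ b, u (ι b) * (w b j : F) := by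
  obtain ⟨ι, w, h1, h2⟩ := exists_coords W r hr
  have hw : ∀ b j, (w b : σ → F) j ∈ constF 𝔇 := by
    intro b j D hD
    have h3 := h2 ⟨_, hst D hD _ (w b).2⟩
    have h4 := congrFun (congrArg Subtype.val h3) j
    simp only at h4
    rw [h4]
    have h5 : ∀ c, D ((w b : σ → F) (ι c)) = 0 := by
      intro c
      rw [h1]
      split_ifs <;> simp
    simp [h5]
  refine ⟨ι, fun b j => ⟨_, hw b j⟩, ?_, ?_, ?_⟩
  · intro b c
    apply Subtype.ext
    simp only [h1]
    split_ifs <;> rfl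
  · intro b
    exact (w b).2
  · intro u hu j
    have h4 := congrFun (congrArg Subtype.val (h2 ⟨u, hu⟩)) j
    simpa using h4

/-- Spanning by derivatives, in the form of `hom_span`, for the coordinates of `x`. -/
theorem descent_span {σ : Type*} [Fintype σ] (𝔇 : Set (Derivation K F F)) (W : Submodule F (σ → F))
    (x : σ → F) (hx : x ∈ W)
    (hst : ∀ D ∈ 𝔇, ∀ u ∈ W, (fun j => D (u j)) ∈ W)
    (hsp : W ≤ Submodule.span F ({x} ∪ {u | ∃ D ∈ 𝔇, u = fun j => D (x j)}))
    {r : ℕ} (ι : Fin r → σ) (w : Fin r → σ → constF 𝔇)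
    (h1 : ∀ b c, w b (ι c) = if b = c then 1 else 0)
    (h2 : ∀ b, (fun j => (w b j : F)) ∈ W) :
    ∀ φ : Fin r → F, ∑ b, φ b * x (ι b) = 0 →
      (∀ D ∈ {D' : Derivation (constF 𝔇) F F | ∃ D, ∃ hD : D ∈ 𝔇, D' = constDer 𝔇 D hD},
        ∑ b, φ b * D (x (ι b)) = 0) → φ = 0 := by
  intro φ h3 h4
  let L : (σ → F) →ₗ[F] F := ∑ b, φ b • LinearMap.proj (ι b)
  have hL : ∀ u, L u = ∑ b, φ b * u (ι b) := by
    intro u; simp [L]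
  have h5 : ∀ u ∈ Submodule.span F ({x} ∪ {u | ∃ D ∈ 𝔇, u = fun j => D (x j)}), L u = 0 := by
    intro u hu
    induction hu using Submodule.span_induction with
    | mem u hu =>
      rw [hL]
      rcases hu with rfl | ⟨D, hD, rfl⟩
      · exact h3
      · exact h4 (constDer 𝔇 D hD) ⟨D, hD, rfl⟩
    | zero => simp
    | add a b _ _ ha hb => rw [map_add, ha, hb, add_zero]
    | smul c a _ ha => rw [map_smul, ha, smul_zero]
  funext b
  have h6 := h5 _ (hsp (h2 b))
  rw [hL] at h6
  simp only [h1] at h6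
  simpa [apply_ite] using h6

/-- Restriction of a polynomial to the span of the `w b`. -/
noncomputable def restr {σ C : Type*} [Field C] [Algebra K C] {r : ℕ} (w : Fin r → σ → C)
    (g : MvPolynomial σ K) : MvPolynomial (Fin r) C :=
  MvPolynomial.aeval (fun j => ∑ b, MvPolynomial.C (w b j) * MvPolynomial.X b) g

theorem restr_homog {σ C : Type*} [Field C] [Algebra K C] {r : ℕ} (w : Fin r → σ → C)
    (g : MvPolynomial σ K) (n : ℕ) (hg : g.IsHomogeneous n) : (restr w g).IsHomogeneous n := by
  have := hg.aeval (fun j => ∑ b, MvPolynomial.C (w b j) * MvPolynomial.X b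
    : σ → MvPolynomial (Fin r) C) (n := 1) (by
      intro j
      apply MvPolynomial.IsHomogeneous.sum
      intro b _
      exact (MvPolynomial.isHomogeneous_C_mul_X _ _))
  simpa [restr] using this

theorem aeval_restr {σ C A : Type*} [Field C] [Algebra K C] [CommRing A] [Algebra K A] [Algebra C A]
    [IsScalarTower K C A] {r : ℕ} (w : Fin r → σ → C)
    (g : MvPolynomial σ K) (z : Fin r → A) :
    MvPolynomial.aeval z (restr w g) =
      MvPolynomial.aeval (fun j => ∑ b, z b * algebraMap C A (w b j)) g := by
  have h := MvPolynomial.comp_aeval_apply (R := K)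
    (f := fun j => ∑ b, MvPolynomial.C (w b j) * MvPolynomial.X b)
    ((MvPolynomial.aeval (R := C) z).restrictScalars K) g
  rw [restr]
  refine h.trans ?_
  congr 2
  funext j
  simp [mul_comm]

/-- Stab lemma. -/
theorem stab {σ : Type*} [Fintype σ] [CharZero F] (𝔇 : Set (Derivation K F F))
    (W : Submodule F (σ → F))
    (x : σ → F) (hx : x ∈ W)
    (hst : ∀ D ∈ 𝔇, ∀ u ∈ W, (fun j => D (u j)) ∈ W)
    (hsp : W ≤ Submodule.span F ({x} ∪ {u | ∃ D ∈ 𝔇, u = fun j => D (x j)}))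
    (g : MvPolynomial σ K) (n : ℕ) (hg : g.IsHomogeneous n) (h0 : MvPolynomial.aeval x g = 0) :
    ∀ u ∈ W, MvPolynomial.aeval u g = 0 := by
  obtain ⟨ι, w, h1, h2, h3⟩ := descent 𝔇 W _ rfl hst
  have h4 := hom_span _ (fun b => x (ι b)) (descent_span 𝔇 W x hx hst hsp ι w h1 h2) n
    (restr w g) (restr_homog w g n hg) (by
      rw [aeval_restr, ← h0]
      congr 2
      funext j
      exact (h3 x hx j).symm)
  intro u hu
  have h5 := aeval_restr w g (fun b => u (ι b))
  rw [h4, map_zero] at h5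
  rw [h5]
  congr 2
  funext j
  exact h3 u hu j

end Descent

end FL

namespace FL

open Matrix

/-- Evaluation of derivations at a vector. -/
noncomputable def evD {K F σ : Type*} [Field K] [Field F] [Algebra K F] (x : σ → F) :
    Derivation K F F →ₗ[F] (σ → F) where
  toFun D j := D (x j)
  map_add' _ _ := rfl
  map_smul' _ _ := rfl

theorem evD_apply {K F σ : Type*} [Field K] [Field F] [Algebra K F] (x : σ → F)
    (D : Derivation K F F) (j : σ) : evD x D j = D (x j) := rfl

theorem span_bracket {K F ι : Type*} [Field K] [Field F] [Algebra K F]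
    (D : ι → Derivation K F F)
    (hbr : ∀ a b, ⁅D a, D b⁆ ∈ Submodule.span F (Set.range D)) :
    ∀ d ∈ Submodule.span F (Set.range D), ∀ d' ∈ Submodule.span F (Set.range D),
      ⁅d, d'⁆ ∈ Submodule.span F (Set.range D) := by
  have sm : ∀ (c : F) (d d' : Derivation K F F), ⁅c • d, d'⁆ = c • ⁅d, d'⁆ - d' c • d := by
    intro c d d'
    ext a
    simp [Derivation.commutator_apply]
    ring
  have key : ∀ b, ∀ d ∈ Submodule.span F (Set.range D),
      ⁅d, D b⁆ ∈ Submodule.span F (Set.range D) := by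
    intro b d hd
    induction hd using Submodule.span_induction with
    | mem d hd => obtain ⟨a, rfl⟩ := hd; exact hbr a b
    | zero => simp
    | add d e _ _ hd he => rw [add_lie]; exact Submodule.add_mem _ hd he
    | smul c d hd0 hd =>
      rw [sm]
      exact Submodule.sub_mem _ (Submodule.smul_mem _ _ hd) (Submodule.smul_mem _ _ hd0)
  intro d hd d' hd'
  induction hd' using Submodule.span_induction with
  | mem d' hd' => obtain ⟨b, rfl⟩ := hd'; exact key b d hd
  | zero => simp
  | add d' e _ _ h1 h2 => rw [lie_add]; exact Submodule.add_mem _ h1 h2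
  | smul c d' hd0 h1 =>
    rw [← lie_skew, sm, neg_sub]
    refine Submodule.sub_mem _ (Submodule.smul_mem _ _ hd0) (Submodule.smul_mem _ _ ?_)
    rw [← lie_skew]
    exact Submodule.neg_mem _ h1

/-- The core situation. -/
structure Core {K F Ω σ : Type*} [Field K] [Field F] [Field Ω] [Algebra K F] [Algebra F Ω]
    [Algebra K Ω] [Fintype σ] {s k : ℕ} (m : ℕ) (f : Fin s → MvPolynomial σ K) (d : Fin s → ℕ)
    (D : Fin k → Derivation K F F) (x : σ → F) (δ : Derivation K Ω Ω) (Y : Fin k → Ω) : Prop where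
  hf : ∀ i, (f i).IsHomogeneous (d i)
  hsm : Smooth F f
  hcard : Fintype.card σ = m + s + 1
  hm : ∑ i, (d i - 1) = m
  li : LinearIndependent F (Fin.cons x (fun a j => D a (x j)) : Fin (k + 1) → σ → F)
  hbr : ∀ a b, ⁅D a, D b⁆ ∈ Submodule.span F (Set.range D)
  hδ : ∀ c : F, δ (algebraMap F Ω c) = ∑ a, Y a * algebraMap F Ω (D a c)
  hδδ : ∀ j, δ (δ (algebraMap F Ω (x j))) = 0
  hnp : ¬ ∃ (c : Ω) (v : Fin k → F), ∀ a, Y a = c * algebraMap F Ω (v a)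
  van : ∀ (w t : Ω) i, MvPolynomial.aeval
    (fun j => w * algebraMap F Ω (x j) + t * δ (algebraMap F Ω (x j))) (f i) = 0

namespace Core

variable {K F Ω σ : Type*} [Field K] [Field F] [Field Ω] [Algebra K F] [Algebra F Ω]
    [Algebra K Ω] [IsScalarTower K F Ω] [IsAlgClosed F] [CharZero F] [Fintype σ] {s k m : ℕ}
    {f : Fin s → MvPolynomial σ K} {d : Fin s → ℕ}
    {D : Fin k → Derivation K F F} {x : σ → F} {δ : Derivation K Ω Ω} {Y : Fin k → Ω}

theorem fx (h : Core m f d D x δ Y) (i : Fin s) : MvPolynomial.aeval x (f i) = 0 := by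
  have h1 := h.van 1 0 i
  simp only [one_mul, zero_mul, add_zero] at h1
  apply (algebraMap F Ω).injective
  rw [map_zero, ← h1]
  exact (MvPolynomial.aeval_algebraMap_apply (B := Ω) x (f i)).symm

/-- Change of frame. -/
theorem basis (h : Core m f d D x δ Y) (B B' : Matrix (Fin k) (Fin k) F) (hB : B' * B = 1) :
    Core m f d (fun a => ∑ b, B a b • D b) x δ
      (fun a => ∑ b, Y b * algebraMap F Ω (B' b a)) := by
  have hB2 : B * B' = 1 := mul_eq_one_comm.mp hB
  have hD' : ∀ b, D b = ∑ a, B' b a • ∑ e, B a e • D e := by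
    intro b
    simp only [Finset.smul_sum, smul_smul]
    rw [Finset.sum_comm]
    simp only [← Finset.sum_smul]
    have : ∀ e, ∑ a, B' b a * B a e = if b = e then 1 else 0 := by
      intro e
      have := congrFun (congrFun hB b) e
      rwa [Matrix.mul_apply, Matrix.one_apply] at this
    simp [this]
  have hspan : Submodule.span F (Set.range fun a => ∑ b, B a b • D b) =
      Submodule.span F (Set.range D) := by
    apply le_antisymm
    · rw [Submodule.span_le]
      rintro _ ⟨a, rfl⟩
      exact Submodule.sum_mem _ fun b _ =>
        Submodule.smul_mem _ _ (Submodule.subset_span ⟨b, rfl⟩)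
    · rw [Submodule.span_le]
      rintro _ ⟨b, rfl⟩
      rw [hD' b]
      exact Submodule.sum_mem _ fun a _ =>
        Submodule.smul_mem _ _ (Submodule.subset_span ⟨a, rfl⟩)
  refine { hf := h.hf, hsm := h.hsm, hcard := h.hcard, hm := h.hm, li := ?_, hbr := ?_, hδ := ?_, hδδ := h.hδδ, hnp := ?_, van := h.van }
  · have h1 := h.li
    rw [linearIndependent_finCons] at h1 ⊢
    have e1 : (fun a j => (∑ b, B a b • D b) (x j)) = fun a => ∑ b, B a b • evD x (D b) := by
      funext a
      have := map_sum (evD x) (fun b => B a b • D b) Finset.univ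
      simp only [map_smul] at this
      rw [← this]; rfl
    have e2 : (fun a j => D a (x j)) = fun a => evD x (D a) := rfl
    rw [e1]
    rw [e2] at h1
    refine ⟨?_, ?_⟩
    · rw [Fintype.linearIndependent_iff]
      intro g hg
      simp only [Finset.smul_sum, smul_smul] at hg
      rw [Finset.sum_comm] at hg
      simp only [← Finset.sum_smul] at hg
      have h2 := Fintype.linearIndependent_iff.mp h1.1 _ hg
      have h3 : g ᵥ* B = 0 := by
        funext i
        simpa [Matrix.vecMul, dotProduct] using h2 i
      have h4 : g = g ᵥ* (B * B') := by rw [hB2, Matrix.vecMul_one]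
      rw [← Matrix.vecMul_vecMul, h3, Matrix.zero_vecMul] at h4
      intro i; rw [h4]; rfl
    · intro hx
      apply h1.2
      refine Submodule.span_le.mpr ?_ hx
      rintro _ ⟨a, rfl⟩
      exact Submodule.sum_mem _ fun b _ =>
        Submodule.smul_mem _ _ (Submodule.subset_span ⟨b, rfl⟩)
  · intro a b
    rw [hspan]
    have hm : ∀ a, ∑ b, B a b • D b ∈ Submodule.span F (Set.range D) := fun a =>
      Submodule.sum_mem _ fun b _ => Submodule.smul_mem _ _ (Submodule.subset_span ⟨b, rfl⟩)
    exact span_bracket D h.hbr _ (hm a) _ (hm b)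
  · intro c
    rw [h.hδ]
    have : ∀ b, D b c = ∑ a, B' b a * (∑ e, B a e • D e) c := by
      intro b
      have := congrFun (congrArg (evD (fun _ : Unit => c)) (hD' b)) ()
      rw [map_sum, Finset.sum_apply] at this
      exact this
    simp only [this, map_sum, map_mul, Finset.mul_sum, Finset.sum_mul]
    rw [Finset.sum_comm]
    exact Finset.sum_congr rfl fun a _ => Finset.sum_congr rfl fun b _ => by ring
  · rintro ⟨c, v, hv⟩
    apply h.hnp
    refine ⟨c, fun b => ∑ a, v a * B a b, ?_⟩
    intro b
    have h1 : Y b = ∑ a, (∑ e, Y e * algebraMap F Ω (B' e a)) * algebraMap F Ω (B a b) := by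
      simp only [Finset.sum_mul]
      rw [Finset.sum_comm]
      have : ∀ e, ∑ a, Y e * algebraMap F Ω (B' e a) * algebraMap F Ω (B a b) =
          Y e * algebraMap F Ω (if e = b then 1 else 0) := by
        intro e
        have := congrFun (congrFun hB e) b
        rw [Matrix.mul_apply, Matrix.one_apply] at this
        rw [← this, map_sum, Finset.mul_sum]
        exact Finset.sum_congr rfl fun a _ => by rw [map_mul]; ring
      simp only [this]
      simp [apply_ite]
    rw [h1]
    simp only [hv, map_sum, map_mul, Finset.mul_sum]
    exact Finset.sum_congr rfl fun a _ => by ring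

theorem R_gen (h : Core m f d D x δ Y) (hk : k + 1 = m) {n : ℕ} (hr : RatPt F n Y) : False := by
  obtain ⟨τ, c, p, -, hp⟩ := hr
  have hc : c ≠ 0 := by
    rintro rfl
    exact h.hnp ⟨0, 0, fun a => by simp [hp]⟩
  have hτ : Transcendental F τ := by
    intro halg
    obtain ⟨t, rfl⟩ := minpoly.mem_range_of_degree_eq_one F τ
      (IsAlgClosed.degree_eq_one_of_irreducible F (minpoly.irreducible halg.isIntegral))
    refine h.hnp ⟨c, fun a => (p a).eval t, fun a => ?_⟩
    rw [hp, Polynomial.aeval_algebraMap_apply]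
    simp
  have hnp : ¬ ∃ (g : Polynomial F) (c : Fin k → F), ∀ a, p a = Polynomial.C (c a) * g := by
    rintro ⟨g, v, hv⟩
    exact h.hnp ⟨c * Polynomial.aeval τ g, v, fun a => by rw [hp, hv]; simp; ring⟩
  refine R_lemma f d h.hf h.hsm h.hcard h.hm hk D x h.li _ p rfl hnp ∅ ?_
  intro t _ w i
  let P : σ → Polynomial F := fun j => Polynomial.C (w * x j) +
    ∑ a, p a * Polynomial.C (D a (x j))
  have hP : MvPolynomial.aeval P (f i) = 0 := by
    rw [transcendental_iff_injective] at hτ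
    apply hτ
    rw [map_zero]
    have h1 := MvPolynomial.comp_aeval_apply (R := K) (f := P)
      ((Polynomial.aeval (R := F) τ).restrictScalars K) (f i)
    refine h1.trans ?_
    have h2 := h.van (algebraMap F Ω w) c⁻¹ i
    rw [← h2]
    congr 2
    funext j
    simp only [AlgHom.coe_restrictScalars', P, map_add, Polynomial.aeval_C, map_sum, map_mul, h.hδ, hp, Finset.mul_sum]
    congr 1
    apply Finset.sum_congr rfl
    intro a _
    field_simp
  have h1 := MvPolynomial.comp_aeval_apply (R := K) (f := P)
      ((Polynomial.aeval (R := F) t).restrictScalars K) (f i)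
  rw [hP, map_zero] at h1
  rw [h1]
  congr 2
  funext j
  simp [P, Polynomial.eval_finsetSum]

theorem no_plane (h : Core m f d D x δ Y) (hk : k + 1 = m) (p q : Fin k → F)
    (hpq : LinearIndependent F ![p, q])
    (hv : ∀ (w t : F) i, MvPolynomial.aeval
      (fun j => w * x j + ∑ a, (p a + t * q a) * D a (x j)) (f i) = 0) : False := by
  refine R_lemma f d h.hf h.hsm h.hcard h.hm hk D x h.li _
    (fun a => Polynomial.C (p a) + Polynomial.X * Polynomial.C (q a)) rfl ?_ ∅ ?_
  · rintro ⟨g, v, hgv⟩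
    rw [LinearIndependent.pair_iff] at hpq
    have h0 : ∀ a, p a = v a * g.coeff 0 := by
      intro a; have := congrArg (fun r => Polynomial.coeff r 0) (hgv a); simpa using this
    have h1 : ∀ a, q a = v a * g.coeff 1 := by
      intro a; have := congrArg (fun r => Polynomial.coeff r 1) (hgv a)
      simpa [Polynomial.coeff_C] using this
    have h2 := hpq (g.coeff 1) (-(g.coeff 0)) (by
      funext a; simp [h0, h1]; ring)
    have h3 := hpq 1 1 (by
      funext a; simp [h0, h1, h2.1, neg_eq_zero.mp h2.2])
    exact one_ne_zero h3.1
  · intro t _ w i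
    rw [← hv w t i]
    congr 2
    funext j
    simp [mul_comm t]

/-- The relation `II(Y, Y) = 0`. -/
theorem frame_dd (h : Core m f d D x δ Y) (ℓ : (σ → F) →ₗ[F] F) 
    (hℓ : ∀ a, δ (Y a) = 0 ∨ ℓ (evD x (D a)) = 0) :
    ∑ a, ∑ b, Y a * Y b * algebraMap F Ω (ℓ fun j => D b (D a (x j))) = 0 := by
  classical
  have h1 : ∀ u : σ → F, ℓ u = ∑ j, u j * ℓ (Pi.single j 1) := by
    intro u
    conv_lhs => rw [LinearMap.pi_apply_eq_sum_univ ℓ u]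
    refine Finset.sum_congr rfl fun j _ => ?_
    rw [smul_eq_mul]
    congr 2
    funext i; simp [Pi.single_apply, eq_comm]
  have h2 : ∑ j, δ (δ (algebraMap F Ω (x j))) * algebraMap F Ω (ℓ (Pi.single j 1)) = 0 := by
    simp [h.hδδ]
  simp only [h.hδ, map_sum, Derivation.leibniz, smul_eq_mul] at h2
  simp only [Finset.sum_mul, add_mul, Finset.sum_add_distrib, Finset.mul_sum] at h2
  rw [Finset.sum_comm] at h2
  have h2' : ∀ A B : Ω, A + B = 0 → ∀ B', B = B' → A + B' = 0 := by
    rintro A B h _ rfl; exact h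
  replace h2 := h2' _ _ h2 _ Finset.sum_comm
  have h3 : ∀ a, ∑ j, algebraMap F Ω (D a (x j)) * δ (Y a) * algebraMap F Ω (ℓ (Pi.single j 1)) = 0 := by
    intro a
    rcases hℓ a with h0 | h0
    · simp [h0]
    have := congrArg (algebraMap F Ω) h0
    rw [h1, map_sum, map_zero] at this
    have h4 := congrArg (fun z => δ (Y a) * z) this
    simp only [mul_zero, Finset.mul_sum] at h4
    rw [← h4]
    exact Finset.sum_congr rfl fun j _ => by rw [evD_apply, map_mul]; ring
  simp only [h3, Finset.sum_const_zero, add_zero] at h2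
  rw [← h2]
  refine Finset.sum_congr rfl fun a _ => ?_
  rw [Finset.sum_comm]
  refine Finset.sum_congr rfl fun b _ => ?_
  rw [h1, map_sum, Finset.mul_sum]
  exact Finset.sum_congr rfl fun j _ => by rw [map_mul]; ring

end Core

end FL

namespace FL

open Matrix

theorem sep {F V : Type*} [Field F] [AddCommGroup V] [Module F V] (W : Submodule F V) (v : V)
    (hv : v ∉ W) : ∃ ℓ : V →ₗ[F] F, (∀ u ∈ W, ℓ u = 0) ∧ ℓ v ≠ 0 := by
  obtain ⟨g, h1, h2⟩ := Submodule.exists_dual_map_eq_bot_of_notMem hv inferInstance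
  refine ⟨g, fun u hu => ?_, h1⟩
  have := Submodule.mem_map_of_mem (f := g) hu
  rwa [h2, Submodule.mem_bot] at this

theorem exists_col {F : Type*} [Field F] {k : ℕ} (l : Fin (k + 1) → F) (hl : l ≠ 0) :
    ∃ B' B : Matrix (Fin (k + 1)) (Fin (k + 1)) F, B' * B = 1 ∧ ∀ b, B' b (Fin.last k) = l b := by
  classical
  obtain ⟨i0, hi0⟩ := Function.ne_iff.mp hl
  let π := Equiv.swap i0 (Fin.last k)
  let B' : Matrix (Fin (k + 1)) (Fin (k + 1)) F :=
    Matrix.of fun b a => if a = Fin.last k then l b else if b = π a then 1 else 0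
  have hu : IsUnit B' := by
    rw [← Matrix.mulVec_injective_iff_isUnit]
    have : Function.Injective B'.mulVecLin := by
      rw [← LinearMap.ker_eq_bot, LinearMap.ker_eq_bot']
      intro v hv
      have h1 : ∀ b, ∑ a, B' b a * v a = 0 := fun b => congrFun hv b
      have hlast : v (Fin.last k) = 0 := by
        have := h1 i0
        rw [Finset.sum_eq_single (Fin.last k)] at this
        · simp only [B', Matrix.of_apply, if_true, mul_eq_zero] at this
          exact this.resolve_left hi0
        · intro a _ ha
          have : i0 ≠ π a := by
            intro h
            apply ha
            have := congrArg π h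
            simpa [π] using this.symm
          simp [B', ha, this]
        · simp
      funext a
      by_cases ha : a = Fin.last k
      · rw [ha, hlast]; rfl
      · have := h1 (π a)
        rw [Finset.sum_eq_single a] at this
        · simpa [B', ha] using this
        · intro a' _ ha'
          by_cases h : a' = Fin.last k
          · simp [h, hlast]
          · have : ¬ π a = π a' := fun h => ha' (π.injective h).symm
            simp [B', h, this]
        · simp
    exact this
  obtain ⟨u, hu⟩ := hu
  refine ⟨B', ↑u⁻¹, by rw [← hu]; simp, fun b => by simp [B']⟩

section dv

variable {K F σ : Type*} [Field K] [Field F] [Algebra K F]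

/-- Coordinatewise derivative. -/
def dv (D : Derivation K F F) (u : σ → F) : σ → F := fun j => D (u j)

theorem dv_add (D : Derivation K F F) (u v : σ → F) : dv D (u + v) = dv D u + dv D v := by
  funext j; simp [dv]

theorem dv_smul (D : Derivation K F F) (c : F) (u : σ → F) :
    dv D (c • u) = c • dv D u + D c • u := by
  funext j; simp [dv, mul_comm]

theorem dv_span (D : Derivation K F F) (S : Set (σ → F)) (W : Submodule F (σ → F))
    (hS : S ⊆ W) (hD : ∀ u ∈ S, dv D u ∈ W) : ∀ u ∈ Submodule.span F S, dv D u ∈ W := by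
  intro u hu
  induction hu using Submodule.span_induction with
  | mem u hu => exact hD u hu
  | zero =>
    have : dv D (0 : σ → F) = 0 := by funext j; simp [dv]
    rw [this]; exact Submodule.zero_mem _
  | add a b _ _ ha hb => rw [dv_add]; exact Submodule.add_mem _ ha hb
  | smul c a ha0 ha =>
    rw [dv_smul]
    exact Submodule.add_mem _ (Submodule.smul_mem _ _ ha)
      (Submodule.smul_mem _ _ (Submodule.span_le.mpr hS ha0))

end dv

namespace Core

variable {K F Ω σ : Type*} [Field K] [Field F] [Field Ω] [Algebra K F] [Algebra F Ω]
    [Algebra K Ω] [IsScalarTower K F Ω] [IsAlgClosed F] [CharZero F] [Fintype σ] {s k m : ℕ}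
    {f : Fin s → MvPolynomial σ K} {d : Fin s → ℕ}
    {D : Fin k → Derivation K F F} {x : σ → F} {δ : Derivation K Ω Ω} {Y : Fin k → Ω}

/-- The affine tangent space. -/
def tang (D : Fin k → Derivation K F F) (x : σ → F) : Submodule F (σ → F) :=
  Submodule.span F ({x} ∪ Set.range fun a => dv (D a) x)

theorem bracket (h : Core m f d D x δ Y) (a b : Fin k) : ∃ S : Fin k → F, ∀ u : σ → F,
    dv (D a) (dv (D b) u) - dv (D b) (dv (D a) u) = ∑ e, S e • dv (D e) u := by
  obtain ⟨S, hS⟩ := (Submodule.mem_span_range_iff_exists_fun F).mp (h.hbr a b)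
  refine ⟨S, fun u => ?_⟩
  have := congrArg (evD u) hS
  rw [map_sum] at this
  simp only [map_smul] at this
  refine Eq.trans ?_ this.symm
  funext j
  rw [evD_apply, Derivation.commutator_apply]
  rfl

theorem dd_symm (h : Core m f d D x δ Y) (ℓ : (σ → F) →ₗ[F] F) (hℓ : ∀ u ∈ tang D x, ℓ u = 0)
    (a b : Fin k) : ℓ (dv (D a) (dv (D b) x)) = ℓ (dv (D b) (dv (D a) x)) := by
  obtain ⟨S, hS⟩ := h.bracket a b
  have := congrArg ℓ (hS x)
  rw [map_sub, map_sum, Finset.sum_eq_zero, sub_eq_zero] at this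
  · exact this
  · intro e _
    rw [map_smul, hℓ _ (Submodule.subset_span (Or.inr ⟨e, rfl⟩)), smul_zero]

theorem stable_false (h : Core m f d D x δ Y) (hk : k + 1 = m) {r : ℕ} (hr : 2 ≤ r)
    (κ : Fin r → Fin k) (hκ : Function.Injective κ)
    (hst : ∀ a b, dv (D (κ b)) (dv (D (κ a)) x) ∈ tang (fun a => D (κ a)) x) : False := by
  classical
  have hmem : ∀ a, dv (D (κ a)) x ∈ tang (fun a => D (κ a)) x := fun a =>
    Submodule.subset_span (Or.inr ⟨a, rfl⟩)
  have hx : x ∈ tang (fun a => D (κ a)) x := Submodule.subset_span (Or.inl rfl)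
  have key : ∀ i, ∀ u ∈ tang (fun a => D (κ a)) x, MvPolynomial.aeval u (f i) = 0 := by
    intro i
    refine stab (Set.range fun a => D (κ a)) _ x hx ?_ ?_ (f i) (d i) (h.hf i) (h.fx i)
    · rintro _ ⟨b, rfl⟩ u hu
      refine dv_span _ _ _ Submodule.subset_span ?_ u hu
      rintro _ (rfl | ⟨a, rfl⟩)
      · exact hmem b
      · exact hst a b
    · apply Submodule.span_mono
      apply Set.union_subset_union_right
      rintro _ ⟨a, rfl⟩
      exact ⟨_, ⟨a, rfl⟩, rfl⟩
  have h01 : κ ⟨0, by omega⟩ ≠ κ ⟨1, by omega⟩ := fun h0 => by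
    have := hκ h0; simp at this
  refine h.no_plane hk (Pi.single (κ ⟨0, by omega⟩) 1) (Pi.single (κ ⟨1, by omega⟩) 1) ?_ ?_
  · rw [LinearIndependent.pair_iff]
    intro α β hab
    have e1 := congrFun hab (κ ⟨0, by omega⟩)
    have e2 := congrFun hab (κ ⟨1, by omega⟩)
    simp [Pi.single_apply, h01, h01.symm] at e1 e2
    exact ⟨e1, e2⟩
  · intro w t i
    have := key i (w • x + dv (D (κ ⟨0, by omega⟩)) x + t • dv (D (κ ⟨1, by omega⟩)) x)
      (Submodule.add_mem _ (Submodule.add_mem _ (Submodule.smul_mem _ _ hx) (hmem _))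
        (Submodule.smul_mem _ _ (hmem _)))
    rw [← this]
    congr 2
    funext j
    simp only [Pi.single_apply, dv, Pi.add_apply, Pi.smul_apply, smul_eq_mul, add_mul,
      Finset.sum_add_distrib, ite_mul, mul_ite, one_mul, zero_mul, mul_one, mul_zero,
      Finset.sum_ite_eq', Finset.mem_univ, if_true]
    ring

/-- Conic case. -/
theorem conic_false (h : Core m f d D x δ Y) (hk : k + 1 = m) (κ : Fin 3 → Fin k)
    (hκ : ∀ a, a ∉ Set.range κ → Y a = 0) (hκi : Function.Injective κ) (q : Fin 3 → Fin 3 → F)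
    (hq : ∑ a, ∑ b, Y (κ a) * Y (κ b) * algebraMap F Ω (q a b) = 0) (a0 b0 : Fin 3)
    (h0 : q a0 b0 + q b0 a0 ≠ 0) : False := by
  classical
  have h1 := conic (F := F) (fun a => Y (κ a)) (q 0 0) (q 0 1 + q 1 0) (q 1 1) (q 0 2 + q 2 0)
    (q 1 2 + q 2 1) (q 2 2) (by
      rintro ⟨h1, h2, h3, h4, h5, h6⟩
      apply h0
      fin_cases a0 <;> fin_cases b0 <;> simp [h1, h2, h3, h4, h5, h6, add_comm] <;>
      simp [h2, h4, h5, add_comm (q 1 0), add_comm (q 2 0), add_comm (q 2 1)]) (by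
      rw [← hq]
      simp [Fin.sum_univ_three]
      ring)
  have h2 := h1.lin (κ := Fin k) (fun b a => if κ a = b then 1 else 0)
  refine h.R_gen hk (n := 2) ?_
  convert h2 using 1
  funext b
  by_cases hb : b ∈ Set.range κ
  · obtain ⟨a, rfl⟩ := hb
    simp [hκi.eq_iff, apply_ite]
  · have : ∀ a, κ a ≠ b := fun a ha => hb ⟨a, ha⟩
    simp [hκ b hb, this]

theorem case3 {D : Fin 2 → Derivation K F F} {Y : Fin 2 → Ω} (h : Core 3 f d D x δ Y) : False := by
  refine h.R_gen rfl (n := 1) ?_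
  by_cases h0 : Y 0 = 0
  · refine ⟨0, Y 1, ![0, 1], ?_, ?_⟩
    · intro i; fin_cases i <;> simp
    · intro i; fin_cases i <;> simp [h0]
  · refine ⟨Y 1 / Y 0, Y 0, ![1, Polynomial.X], ?_, ?_⟩
    · intro i; fin_cases i <;> simp
    · intro i; fin_cases i <;> simp; field_simp

theorem case4 {D : Fin 3 → Derivation K F F} {Y : Fin 3 → Ω} (h : Core 4 f d D x δ Y) : False := by
  by_cases hst : ∀ a b, dv (D b) (dv (D a) x) ∈ tang D x
  · exact h.stable_false rfl (r := 3) (by norm_num) id Function.injective_id hst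
  · push Not at hst
    obtain ⟨a, b, hab⟩ := hst
    obtain ⟨ℓ, h1, h2⟩ := sep _ _ hab
    refine h.conic_false rfl id (by simp) Function.injective_id
      (fun a b => ℓ (dv (D b) (dv (D a) x))) ?_ a b ?_
    · exact h.frame_dd ℓ fun a => Or.inr (h1 _ (Submodule.subset_span (Or.inr ⟨a, rfl⟩)))
    · rw [h.dd_symm ℓ h1 a b, ← two_mul]
      exact mul_ne_zero two_ne_zero h2

end Core

end FL

namespace FL

open Matrix

namespace Core

variable {K F Ω σ : Type*} [Field K] [Field F] [Field Ω] [Algebra K F] [Algebra F Ω]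
    [Algebra K Ω] [IsScalarTower K F Ω] [IsAlgClosed F] [CharZero F] [Fintype σ] {s m : ℕ}
    {f : Fin s → MvPolynomial σ K} {d : Fin s → ℕ}
    {D : Fin 4 → Derivation K F F} {x : σ → F} {δ : Derivation K Ω Ω} {Y : Fin 4 → Ω}

theorem x_mem {k : ℕ} (D : Fin k → Derivation K F F) (x : σ → F) : x ∈ tang D x :=
  Submodule.subset_span (Or.inl rfl)

theorem e_mem {k : ℕ} (D : Fin k → Derivation K F F) (x : σ → F) (a : Fin k) :
    dv (D a) x ∈ tang D x :=
  Submodule.subset_span (Or.inr ⟨a, rfl⟩)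

theorem tang_dv {k : ℕ} {D : Fin k → Derivation K F F} {x : σ → F}
    (W : Submodule F (σ → F)) (D' : Derivation K F F) (hW : tang D x ≤ W)
    (h0 : dv D' x ∈ W)
    (h1 : ∀ a, dv D' (dv (D a) x) ∈ W) : ∀ u ∈ tang D x, dv D' u ∈ W := by
  apply dv_span _ _ _ (Submodule.subset_span.trans hW)
  rintro _ (rfl | ⟨a, rfl⟩)
  · exact h0
  · exact h1 a

theorem case5_lin0 (h : Core 5 f d D x δ Y) (hY : Y 3 = 0) : False := by
  classical
  have hnr : ∀ a : Fin 4, a ∉ Set.range (Fin.castSucc : Fin 3 → Fin 4) → Y a = 0 := by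
    intro a ha
    fin_cases a
    · exact absurd ⟨0, rfl⟩ ha
    · exact absurd ⟨1, rfl⟩ ha
    · exact absurd ⟨2, rfl⟩ ha
    · exact hY
  have hsum : ∀ q : Fin 4 → Fin 4 → F, ∑ a, ∑ b, Y a * Y b * algebraMap F Ω (q a b) = 0 →
      ∑ a : Fin 3, ∑ b : Fin 3, Y a.castSucc * Y b.castSucc *
        algebraMap F Ω (q a.castSucc b.castSucc) = 0 := by
    intro q hq
    rw [Fin.sum_univ_castSucc] at hq
    have h3 : Y (Fin.last 3) = 0 := hY
    simp only [Fin.sum_univ_castSucc (n := 3), h3] at hq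
    simpa using hq
  have hA : ∀ a b : Fin 3, dv (D b.castSucc) (dv (D a.castSucc) x) ∈ tang D x := by
    intro a b
    by_contra hab
    obtain ⟨ℓ, h1, h2⟩ := sep _ _ hab
    refine h.conic_false rfl Fin.castSucc hnr (Fin.castSucc_injective 3)
      (fun a b => ℓ (dv (D b.castSucc) (dv (D a.castSucc) x))) ?_ a b ?_
    · exact hsum (fun a b => ℓ (dv (D b) (dv (D a) x)))
        (h.frame_dd ℓ fun a => Or.inr (h1 _ (e_mem D x a)))
    · rw [h.dd_symm ℓ h1 a.castSucc b.castSucc, ← two_mul]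
      exact mul_ne_zero two_ne_zero h2
  -- the functional dual to `e 3`
  let D0 : Fin 3 → Derivation K F F := fun a => D a.castSucc
  have hT0 : tang D0 x ≤ tang D x := by
    apply Submodule.span_mono
    apply Set.union_subset_union_right
    rintro _ ⟨a, rfl⟩
    exact ⟨a.castSucc, rfl⟩
  have he3 : dv (D 3) x ∉ tang D0 x := by
    have h1 := h.li
    intro h2
    have h3 := h1.notMem_span_image (s := {Fin.last 4}ᶜ) (x := Fin.last 4) (by simp)
    apply h3
    refine Submodule.span_mono ?_ h2
    rintro _ (rfl | ⟨a, rfl⟩)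
    · exact ⟨0, by simp, rfl⟩
    · refine ⟨a.castSucc.succ, ?_, ?_⟩
      · simp [Fin.ext_iff]; omega
      · simp [D0]; rfl
  obtain ⟨ℓ', hℓ', hℓ3⟩ := sep _ _ he3
  obtain ⟨ℓ3, hl0, hl3⟩ : ∃ ℓ3 : (σ → F) →ₗ[F] F, (∀ u ∈ tang D0 x, ℓ3 u = 0) ∧
      ℓ3 (dv (D 3) x) = 1 :=
    ⟨(ℓ' (dv (D 3) x))⁻¹ • ℓ', fun u hu => by simp [hℓ' u hu], by simp [hℓ3]⟩
  have hdec : ∀ u ∈ tang D x, u - ℓ3 u • dv (D 3) x ∈ tang D0 x := by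
    intro u hu
    induction hu using Submodule.span_induction with
    | mem u hu =>
      rcases hu with rfl | ⟨a, rfl⟩
      · rw [hl0 _ (x_mem D0 u)]; simpa using x_mem D0 u
      · induction a using Fin.lastCases with
        | last =>
          change dv (D 3) x - ℓ3 (dv (D 3) x) • dv (D 3) x ∈ _
          rw [hl3]; simp
        | cast a =>
          have := e_mem D0 x a
          have h2 := hl0 _ this
          simp only [D0] at this h2
          rw [h2]; simpa using this
    | zero => simp
    | add a b _ _ ha hb =>
      have := Submodule.add_mem _ ha hb
      rw [map_add, add_smul]
      convert this using 1
      abel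
    | smul c a _ ha =>
      have := Submodule.smul_mem _ c ha
      rw [map_smul, smul_assoc, ← smul_sub]
      exact this
  let β : Fin 3 → Fin 3 → F := fun a b => ℓ3 (dv (D b.castSucc) (dv (D a.castSucc) x))
  have hβsym : ∀ a b, β a b + β b a = 0 := by
    intro a b
    by_contra hne
    refine h.conic_false rfl Fin.castSucc hnr (Fin.castSucc_injective 3) β ?_ a b hne
    refine hsum (fun a b => ℓ3 (dv (D b) (dv (D a) x))) (h.frame_dd ℓ3 fun a => ?_)
    induction a using Fin.lastCases with
    | last => left; change δ (Y 3) = 0; rw [hY, map_zero]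
    | cast a => right; exact hl0 _ (e_mem D0 x a)
  have hβ0 : ∀ a, β a a = 0 := by
    intro a
    have := hβsym a a
    rw [← two_mul] at this
    exact (mul_eq_zero.mp this).resolve_left two_ne_zero
  have hfin : (∀ a b, β a b = 0) → False := by
    intro h0
    refine h.stable_false rfl (r := 3) (by norm_num) Fin.castSucc (Fin.castSucc_injective 3) ?_
    intro a b
    have := hdec _ (hA a b)
    have h2 : ℓ3 (dv (D b.castSucc) (dv (D a.castSucc) x)) = 0 := h0 a b
    rw [h2] at this
    simpa using this
  -- general computation
  have hcomp : ∀ (ℓ : (σ → F) →ₗ[F] F), (∀ u ∈ tang D x, ℓ u = 0) → ∀ (c : Fin 4),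
      (∀ a : Fin 3, ℓ (dv (D c) (dv (D a.castSucc) x)) = 0) → ∀ a b,
      ℓ (dv (D c) (dv (D b.castSucc) (dv (D a.castSucc) x))) =
        β a b * ℓ (dv (D c) (dv (D 3) x)) := by
    intro ℓ hℓ c hc a b
    have h1 := hdec _ (hA a b)
    have h2 : dv (D b.castSucc) (dv (D a.castSucc) x) =
      (dv (D b.castSucc) (dv (D a.castSucc) x) - β a b • dv (D 3) x) + β a b • dv (D 3) x := by
      abel
    have h3 : dv (D c) (dv (D b.castSucc) (dv (D a.castSucc) x) - β a b • dv (D 3) x) ∈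
        LinearMap.ker ℓ := by
      refine tang_dv (LinearMap.ker ℓ) (D c) (fun u hu => hℓ u (hT0 hu)) (hℓ _ (e_mem D x c)) ?_ _ h1
      intro a
      exact hc a
    rw [h2, dv_add, dv_smul, map_add, map_add, map_smul, map_smul, LinearMap.mem_ker.mp h3,
      hℓ _ (e_mem D x 3)]
    simp
  have hA0 : ∀ (ℓ : (σ → F) →ₗ[F] F), (∀ u ∈ tang D x, ℓ u = 0) → ∀ a b : Fin 3,
      ℓ (dv (D b.castSucc) (dv (D a.castSucc) x)) = 0 := fun ℓ hℓ a b => hℓ _ (hA a b)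
  by_cases hθ : ∀ c : Fin 3, dv (D c.castSucc) (dv (D 3) x) ∈ tang D x
  · by_cases h33 : dv (D 3) (dv (D 3) x) ∈ tang D x
    · have h3c : ∀ c : Fin 3, dv (D 3) (dv (D c.castSucc) x) ∈ tang D x := by
        intro c
        by_contra hne
        obtain ⟨ℓ, h1, h2⟩ := sep _ _ hne
        apply h2
        rw [h.dd_symm ℓ h1]
        exact h1 _ (hθ c)
      refine h.stable_false rfl (r := 4) (by norm_num) id Function.injective_id ?_
      intro a b
      simp only [id]
      induction a using Fin.lastCases with
      | last =>
        induction b using Fin.lastCases with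
        | last => exact h33
        | cast b => exact hθ b
      | cast a =>
        induction b using Fin.lastCases with
        | last => exact h3c a
        | cast b => exact hA a b
    · obtain ⟨ℓ, h1, h2⟩ := sep _ _ h33
      have h3c : ∀ c : Fin 3, dv (D 3) (dv (D c.castSucc) x) ∈ tang D x := by
        intro c
        by_contra hne
        obtain ⟨ℓ, h1, h2⟩ := sep _ _ hne
        apply h2
        rw [h.dd_symm ℓ h1]
        exact h1 _ (hθ c)
      apply hfin
      intro a b
      have e1 := hcomp ℓ h1 3 (fun a => h1 _ (h3c a)) a b
      obtain ⟨S, hS⟩ := h.bracket 3 b.castSucc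
      have e2 := congrArg ℓ (hS (dv (D a.castSucc) x))
      rw [map_sub, map_sum, e1] at e2
      have e3 : dv (D b.castSucc) (dv (D 3) (dv (D a.castSucc) x)) ∈ tang D x := by
        refine tang_dv _ _ le_rfl (e_mem D x _) ?_ _ (h3c a)
        intro c
        induction c using Fin.lastCases with
        | last => exact hθ b
        | cast c => exact hA c b
      rw [h1 _ e3, sub_zero, Finset.sum_eq_zero] at e2
      · exact (mul_eq_zero.mp e2).resolve_right h2
      · intro e _
        rw [map_smul]
        have : dv (D e) (dv (D a.castSucc) x) ∈ tang D x := by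
          induction e using Fin.lastCases with
          | last => exact h3c a
          | cast c => exact hA a c
        rw [h1 _ this, smul_zero]
  · push Not at hθ
    obtain ⟨c, hc⟩ := hθ
    obtain ⟨ℓ, h1, h2⟩ := sep _ _ hc
    let θ : Fin 3 → F := fun c => ℓ (dv (D c.castSucc) (dv (D 3) x))
    have hid : ∀ a b c, β a b * θ c - β a c * θ b = 2 * β b c * θ a := by
      intro a b c
      have e1 := hcomp ℓ h1 c.castSucc (fun a => hA0 ℓ h1 a c) a b
      have e2 := hcomp ℓ h1 b.castSucc (fun a => hA0 ℓ h1 a b) a c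
      obtain ⟨S, hS⟩ := h.bracket c.castSucc b.castSucc
      have e3 := congrArg ℓ (hS (dv (D a.castSucc) x))
      rw [map_sub, map_sum, e1, e2] at e3
      have e4 := congrArg ℓ3 (hS x)
      rw [map_sub, map_sum, Fin.sum_univ_castSucc] at e4
      have e5 : ∀ e : Fin 3, ℓ3 (S e.castSucc • dv (D e.castSucc) x) = 0 := by
        intro e
        rw [map_smul, hl0 _ (e_mem D0 x e), smul_zero]
      have e6 : ℓ3 (S (Fin.last 3) • dv (D (Fin.last 3)) x) = S (Fin.last 3) := by
        rw [map_smul]; change S _ • ℓ3 (dv (D 3) x) = _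
        rw [hl3]; simp
      rw [e6, Finset.sum_eq_zero (fun e _ => e5 e), zero_add] at e4
      rw [Fin.sum_univ_castSucc] at e3
      have e7 : ∀ e : Fin 3, ℓ (S e.castSucc • dv (D e.castSucc) (dv (D a.castSucc) x)) = 0 := by
        intro e
        rw [map_smul, hA0 ℓ h1, smul_zero]
      rw [Finset.sum_eq_zero (fun e _ => e7 e), zero_add, map_smul, ← e4] at e3
      have e8 : ℓ (dv (D (Fin.last 3)) (dv (D a.castSucc) x)) = θ a := h.dd_symm ℓ h1 _ _
      rw [e8] at e3
      have e9 : β b c - β c b = 2 * β b c := by linear_combination -(hβsym b c)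
      rw [← e9]
      exact e3
    have hc' : θ c ≠ 0 := h2
    have hcb : ∀ b, β c b = 0 := by
      intro b
      have e1 := hid c b c
      rw [hβ0 c] at e1
      have e2 := hβsym b c
      have e3 : 3 * β c b * θ c = 0 := by linear_combination e1 + 2 * θ c * e2
      have := (mul_eq_zero.mp e3).resolve_right hc'
      exact (mul_eq_zero.mp this).resolve_left (by norm_num)
    apply hfin
    intro a b
    have e1 := hid a b c
    have e2 : ∀ b, β b c = 0 := by
      intro b
      have := hβsym b c
      rw [hcb b] at this
      simpa using this
    rw [e2, e2] at e1
    simp only [zero_mul, sub_zero, mul_zero] at e1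
    exact (mul_eq_zero.mp e1).resolve_right hc'

theorem case5_lin (h : Core 5 f d D x δ Y) (l : Fin 4 → F) (hl : l ≠ 0)
    (hY : ∑ a, Y a * algebraMap F Ω (l a) = 0) : False := by
  obtain ⟨B', B, hB, hc⟩ := exists_col l hl
  refine (h.basis B B' hB).case5_lin0 ?_
  rw [← hY]
  refine Finset.sum_congr rfl fun b _ => ?_
  rw [← hc b]; rfl

end Core

end FL

namespace FL

open Matrix

/-- determinant under rank one perturbation of rows -/
theorem det_add_rank_one {A n : Type*} [CommRing A] [Fintype n] [DecidableEq n]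
    (u : n → n → A) (z : n → A) (E : n → A) :
    Matrix.det (Matrix.of fun i => u i + z i • E) = Matrix.det (Matrix.of u) +
      ∑ i, z i * Matrix.det ((Matrix.of u).updateRow i E) := by
  have key : ∀ S : Finset n, Matrix.det (Matrix.of fun i => if i ∈ S then u i + z i • E else u i) =
      Matrix.det (Matrix.of u) + ∑ i ∈ S, z i * Matrix.det ((Matrix.of u).updateRow i E) := by
    intro S
    induction S using Finset.induction_on with
    | empty => simp
    | insert a S ha ih =>
      rw [Finset.sum_insert ha, add_left_comm, ← ih]
      have e1 : (Matrix.of fun i => if i ∈ insert a S then u i + z i • E else u i) =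
          (Matrix.of fun i => if i ∈ S then u i + z i • E else u i).updateRow a (u a + z a • E) := by
        ext i j
        by_cases h : i = a
        · subst h; simp
        · simp [h, Matrix.updateRow_apply]
      have e2 : (Matrix.of fun i => if i ∈ S then u i + z i • E else u i).updateRow a (u a) =
          (Matrix.of fun i => if i ∈ S then u i + z i • E else u i) := by
        ext i j
        by_cases h : i = a
        · subst h; simp [ha]
        · simp [h, Matrix.updateRow_apply]
      rw [e1, Matrix.det_updateRow_add, e2, Matrix.det_updateRow_smul, add_comm]
      congr 2
      have h3 := Matrix.det_eq_of_forall_row_eq_smul_add_const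
        (A := (Matrix.of fun i => if i ∈ S then u i + z i • E else u i).updateRow a E)
        (B := (Matrix.of u).updateRow a E) (fun i => if i ∈ S then z i else 0) a (by simp [ha]) (by
          intro i j
          by_cases h : i = a
          · subst h; simp [ha]
          · by_cases h2 : i ∈ S <;> simp [h, h2, Matrix.updateRow_apply])
      exact h3
  have := key Finset.univ
  simpa using this

theorem detForm_rank_one {A σ : Type*} [CommRing A] [Fintype σ] [DecidableEq σ] {ι : Type*}
    [Fintype ι] {t N : ℕ} (hN : Fintype.card ι = N + 1) (e : σ ≃ ι ⊕ Fin t) (c : A)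
    (Z : ι → σ → A) (z : ι → A) (E : σ → A) :
    ∃ Θ : (σ → A) [⋀^Fin t]→ₗ[A] A, c ^ N • Θ = detForm e (fun i => c • Z i + z i • E) := by
  classical
  refine ⟨c • detForm e Z + ∑ i, z i • detForm e (Function.update Z i E), ?_⟩
  ext ν
  rw [AlternatingMap.smul_apply, AlternatingMap.add_apply, AlternatingMap.smul_apply,
    smul_eq_mul, smul_eq_mul]
  have hsumap : ∀ (S : Finset ι) (g : ι → (σ → A) [⋀^Fin t]→ₗ[A] A), (∑ i ∈ S, g i) ν =
      ∑ i ∈ S, g i ν := by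
    intro S g
    induction S using Finset.induction_on with
    | empty => simp
    | insert a S ha ih => rw [Finset.sum_insert ha, Finset.sum_insert ha, AlternatingMap.add_apply, ih]
  rw [hsumap]
  simp only [AlternatingMap.smul_apply, smul_eq_mul]
  have h1 := det_add_rank_one (fun i => Sum.elim (fun a => c • Z a) ν (e i))
    (fun i => Sum.elim z 0 (e i)) E
  have h2 : detForm e (fun i => c • Z i + z i • E) ν = Matrix.det (Matrix.of fun i =>
      Sum.elim (fun a => c • Z a) ν (e i) + Sum.elim z 0 (e i) • E) := by
    rw [detForm_apply]
    congr 2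
    funext i
    rcases e i with a | b <;> simp
  have hsc : ∀ (Z : ι → σ → A) (w : ι → A), Matrix.det (Matrix.of fun i => Sum.elim (fun a => w a • Z a) ν (e i)) =
      (∏ a, w a) * detForm e Z ν := by
    intro Z w
    have := Matrix.det_mul_column (fun i => Sum.elim w 1 (e i)) (Matrix.of fun i => Sum.elim Z ν (e i))
    rw [detForm_apply]
    have h4 : ∏ i, Sum.elim w 1 (e i) = ∏ a, w a := by
      rw [e.prod_comp (fun i => Sum.elim w 1 i), Fintype.prod_sum_type]
      simp
    rw [← h4, ← this]
    congr 1
    ext i j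
    simp only [Matrix.of_apply]
    rcases e i with a | b <;> simp
  rw [h2, h1, hsc, Finset.prod_const, Finset.card_univ, hN, mul_add, pow_succ, mul_assoc]
  congr 1
  rw [← e.symm.sum_comp, Fintype.sum_sum_type]
  simp only [Equiv.apply_symm_apply, Sum.elim_inl, Sum.elim_inr, Pi.zero_apply, zero_mul,
    Finset.sum_const_zero, add_zero]
  rw [Finset.mul_sum]
  refine Finset.sum_congr rfl fun a _ => ?_
  have h5 := hsc (Function.update Z a E) (fun b => if b = a then 1 else c)
  rw [Finset.prod_ite, Finset.prod_const_one, one_mul, Finset.prod_const, Finset.filter_ne' Finset.univ a,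
    Finset.card_erase_of_mem (Finset.mem_univ a), Finset.card_univ, hN, Nat.add_sub_cancel] at h5
  rw [mul_left_comm, ← h5]
  congr 2
  ext i j
  simp only [Matrix.of_apply, Matrix.updateRow_apply]
  by_cases h : i = e.symm (Sum.inl a)
  · subst h; simp
  · rw [if_neg h]
    rcases hi : e i with b | b
    · have : b ≠ a := by rintro rfl; apply h; rw [← hi]; simp
      simp [this]
    · simp


section QA

variable {R : Type*} [CommRing R] {P : R}

/-- ring homs out of a quadratic algebra -/
noncomputable def qlift {S : Type*} [CommRing S] (g : R →+* S) (t : S) (ht : t * t = g P) :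
    QuadraticAlgebra R P 0 →+* S where
  toFun z := g z.re + g z.im * t
  map_one' := by simp [QuadraticAlgebra.re_one, QuadraticAlgebra.im_one]
  map_zero' := by simp
  map_add' z w := by simp; ring
  map_mul' z w := by simp; linear_combination - (g z.im * g w.im) * ht

theorem qlift_apply {S : Type*} [CommRing S] (g : R →+* S) (t : S) (ht : t * t = g P)
    (z : QuadraticAlgebra R P 0) : qlift g t ht z = g z.re + g z.im * t := rfl

/-- `2 v D` on the quadratic algebra -/
noncomputable def qder {K : Type*} [CommRing K] [Algebra K R] (D : Derivation K R R) :
    Derivation K (QuadraticAlgebra R P 0) (QuadraticAlgebra R P 0) :=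
  Derivation.mk'
    { toFun := fun z => ⟨2 * P * D z.im + z.im * D P, 2 * D z.re⟩
      map_add' := by
        intro z w
        ext <;> simp <;> ring
      map_smul' := by
        intro c z
        ext <;> simp only [QuadraticAlgebra.im_smul, QuadraticAlgebra.re_smul, D.map_smul, RingHom.id_apply] <;>
          simp only [Algebra.smul_def] <;> ring }
    (by
      intro z w
      ext <;> simp <;> ring)

theorem qder_apply {K : Type*} [CommRing K] [Algebra K R] (D : Derivation K R R)
    (z : QuadraticAlgebra R P 0) : qder D z = ⟨2 * P * D z.im + z.im * D P, 2 * D z.re⟩ := rfl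

theorem q_mul_alg (r : R) (n : ℕ) (z : QuadraticAlgebra R P 0) :
    algebraMap R (QuadraticAlgebra R P 0) r ^ n * z = ⟨r ^ n * z.re, r ^ n * z.im⟩ := by
  rw [← map_pow, QuadraticAlgebra.algebraMap_eq]
  ext <;> simp

theorem q_reg2 (x y : R) (M N : ℕ) (h : ∀ z w : R, y ^ M * z = x ^ N * w → ∃ z', z = x ^ N * z')
    (z w : QuadraticAlgebra R P 0)
    (hz : algebraMap R _ y ^ M * z = algebraMap R _ x ^ N * w) :
    ∃ z', z = algebraMap R _ x ^ N * z' := by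
  rw [q_mul_alg, q_mul_alg, QuadraticAlgebra.mk.injEq] at hz
  obtain ⟨a, ha⟩ := h _ _ hz.1
  obtain ⟨b, hb⟩ := h _ _ hz.2
  refine ⟨⟨a, b⟩, ?_⟩
  rw [q_mul_alg]
  ext
  · exact ha
  · exact hb

theorem q_reg3 (x y u : R) (L M N : ℕ)
    (h : ∀ z a b : R, u ^ L * z = x ^ M * a + y ^ N * b → ∃ a' b', z = x ^ M * a' + y ^ N * b')
    (z a b : QuadraticAlgebra R P 0)
    (hz : algebraMap R _ u ^ L * z = algebraMap R _ x ^ M * a + algebraMap R _ y ^ N * b) :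
    ∃ a' b', z = algebraMap R _ x ^ M * a' + algebraMap R _ y ^ N * b' := by
  simp only [q_mul_alg] at hz ⊢
  have h1 := congrArg QuadraticAlgebra.re hz
  have h2 := congrArg QuadraticAlgebra.im hz
  simp only [QuadraticAlgebra.re_add, QuadraticAlgebra.im_add] at h1 h2
  obtain ⟨a1, b1, e1⟩ := h _ _ _ h1
  obtain ⟨a2, b2, e2⟩ := h _ _ _ h2
  refine ⟨⟨a1, a2⟩, ⟨b1, b2⟩, ?_⟩
  ext
  · simpa using e1
  · simpa using e2

theorem q_domain [IsDomain R] (h : ∀ U V : R, U * U = P * V * V → U = 0 ∧ V = 0) :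
    IsDomain (QuadraticAlgebra R P 0) := by
  have : NoZeroDivisors (QuadraticAlgebra R P 0) := by
    constructor
    intro z w hzw
    have h1 : (z.re * z.re - P * z.im * z.im) * (w.re * w.re - P * w.im * w.im) = 0 := by
      have e1 := congrArg QuadraticAlgebra.re hzw
      have e2 := congrArg QuadraticAlgebra.im hzw
      simp at e1 e2
      linear_combination (z.re * w.re + P * z.im * w.im) * e1 - P * (z.re * w.im + z.im * w.re) * e2
    rcases mul_eq_zero.mp h1 with h2 | h2
    · left
      have := h _ _ (sub_eq_zero.mp h2)
      ext <;> simp [this.1, this.2]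
    · right
      have := h _ _ (sub_eq_zero.mp h2)
      ext <;> simp [this.1, this.2]
  exact NoZeroDivisors.to_isDomain _

end QA

section rho

variable {F : Type*} [Field F] [Infinite F]

/-- the substitution `(w, l, l X)` -/
noncomputable def rho (w l : F) : MvPolynomial (Fin 3) F →ₐ[F] Polynomial F :=
  MvPolynomial.aeval ![Polynomial.C w, Polynomial.C l, Polynomial.C l * Polynomial.X]

theorem rho_zero (U : MvPolynomial (Fin 3) F) (h : ∀ w l, l ≠ 0 → rho w l U = 0) : U = 0 := by
  have h1 : MvPolynomial.X 1 * U = 0 := by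
    apply MvPolynomial.funext
    intro v
    by_cases hv : v 1 = 0
    · simp [hv]
    have h2 := congrArg (Polynomial.eval (v 2 / v 1)) (h (v 0) (v 1) hv)
    have h3 : Polynomial.eval (v 2 / v 1) (rho (v 0) (v 1) U) = MvPolynomial.eval v U := by
      have e := MvPolynomial.comp_aeval_apply (R := F) (f := ![Polynomial.C (v 0), Polynomial.C (v 1), Polynomial.C (v 1) * Polynomial.X])
        (Polynomial.aeval (v 2 / v 1)) U
      have e2 : (fun i => (Polynomial.aeval (v 2 / v 1)) (![Polynomial.C (v 0), Polynomial.C (v 1), Polynomial.C (v 1) * Polynomial.X] i)) = v := by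
        funext i
        fin_cases i <;> simp
        field_simp
      rw [e2, Polynomial.coe_aeval_eq_eval] at e
      exact e
    rw [h3] at h2
    rw [map_mul, h2]; simp
  exact (mul_eq_zero.mp h1).resolve_left (MvPolynomial.X_ne_zero _)

theorem rho_hom3 (w l : F) (P : Polynomial F) (n : ℕ) (hP : P.natDegree ≤ n) :
    rho w l (hom3 n P) = Polynomial.C (l ^ n) * P := by
  rw [hom3, map_sum]
  conv_rhs => rw [P.as_sum_range' (n + 1) (Nat.lt_succ_of_le hP), Finset.mul_sum]
  apply Finset.sum_congr rfl
  intro i hi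
  have hi' : i ≤ n := by simpa [Nat.lt_succ_iff] using hi
  have : l ^ n = l ^ (n - i) * l ^ i := by rw [← pow_add]; congr 1; omega
  simp only [rho, map_mul, map_pow, MvPolynomial.aeval_X, MvPolynomial.aeval_C, this]
  rw [← Polynomial.C_mul_X_pow_eq_monomial]
  simp [mul_pow]
  ring

theorem poly_sq {P U V : Polynomial F} (hP : ∀ S, P ≠ S * S) (h : U * U = P * V * V) :
    U = 0 ∧ V = 0 := by
  by_cases hV : V = 0
  · subst hV
    simpa using h
  exfalso
  have h1 : V ^ 2 ∣ U ^ 2 := ⟨P, by rw [sq U, h]; ring⟩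
  rw [IsIntegrallyClosed.pow_dvd_pow_iff (by norm_num)] at h1
  obtain ⟨S, rfl⟩ := h1
  apply hP S
  have : (V * V) * P = (V * V) * (S * S) := by linear_combination -h
  exact mul_left_cancel₀ (mul_ne_zero hV hV) this

theorem mv_sq {P : Polynomial F} (hP : ∀ S, P ≠ S * S) (hd : P.natDegree ≤ 4)
    (U V : MvPolynomial (Fin 3) F) (h : U * U = hom3 4 P * V * V) : U = 0 ∧ V = 0 := by
  have key : ∀ w l : F, l ≠ 0 → rho w l U = 0 ∧ rho w l V = 0 := by
    intro w l hl
    have h1 := congrArg (rho w l) h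
    simp only [map_mul, rho_hom3 _ _ _ _ hd] at h1
    have h2 := poly_sq (U := rho w l U) (V := Polynomial.C (l ^ 2) * rho w l V) hP (by
      rw [h1]
      simp only [map_pow]
      ring)
    refine ⟨h2.1, ?_⟩
    exact (mul_eq_zero.mp h2.2).resolve_left (by simpa using hl)
  exact ⟨rho_zero U fun w l hl => (key w l hl).1, rho_zero V fun w l hl => (key w l hl).2⟩

end rho

end FL

namespace FL

set_option linter.unusedSectionVars false

open Matrix MvPolynomial

theorem hom3_wh2 {F : Type*} [Field F] (p : Polynomial F) :
    IsWeightedHomogeneous (![2, 1, 1] : Fin 3 → ℕ) (hom3 4 p) 4 := by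
  apply IsWeightedHomogeneous.sum
  intro i hi
  have hi' : i ≤ 4 := by simpa [Nat.lt_succ_iff] using hi
  have h := (isWeightedHomogeneous_C (![2, 1, 1] : Fin 3 → ℕ) (p.coeff i)).mul
    (((isWeightedHomogeneous_X F (![2, 1, 1] : Fin 3 → ℕ) 1).pow (4 - i)).mul
    ((isWeightedHomogeneous_X F (![2, 1, 1] : Fin 3 → ℕ) 2).pow i))
  convert h using 1
  simp
  omega

/-- the quadratic algebra used for elliptic curves -/
abbrev QA3 {F : Type*} [Field F] (p : Polynomial F) : Type _ :=
  QuadraticAlgebra (MvPolynomial (Fin 3) F) (hom3 4 p) 0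

/-- grading on the quadratic algebra -/
noncomputable def qcoact (K : Type*) {F : Type*} [Field K] [Field F] [Algebra K F] (p : Polynomial F) :
    QuadraticAlgebra (MvPolynomial (Fin 3) F) (hom3 4 p) 0 →ₐ[K]
      Polynomial (QuadraticAlgebra (MvPolynomial (Fin 3) F) (hom3 4 p) 0) :=
  { qlift ((Polynomial.mapRingHom (algebraMap (MvPolynomial (Fin 3) F)
      (QuadraticAlgebra (MvPolynomial (Fin 3) F) (hom3 4 p) 0))).comp
        (coact K (![2, 1, 1] : Fin 3 → ℕ)).toRingHom)
      (Polynomial.X ^ 2 * Polynomial.C ⟨0, 1⟩) (by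
        change _ = Polynomial.mapRingHom _ (coact K _ (hom3 4 p))
        rw [coact_wh K _ _ _ (hom3_wh2 p)]
        have : (⟨0, 1⟩ : QuadraticAlgebra (MvPolynomial (Fin 3) F) (hom3 4 p) 0) * ⟨0, 1⟩ =
          algebraMap _ _ (hom3 4 p) := by
          rw [QuadraticAlgebra.algebraMap_eq]
          ext1 <;> simp
        simp only [map_mul, map_pow, Polynomial.coe_mapRingHom, Polynomial.map_X, Polynomial.map_C,
          ← this]
        ring) with
    commutes' := by
      intro r
      have h1 : (algebraMap K (QuadraticAlgebra (MvPolynomial (Fin 3) F) (hom3 4 p) 0) r) =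
        algebraMap (MvPolynomial (Fin 3) F) _ (C (algebraMap K F r)) := rfl
      change Polynomial.mapRingHom _ (coact K _ _) + Polynomial.mapRingHom _ (coact K _ _) * _ = _
      rw [h1, QuadraticAlgebra.algebraMap_eq]
      simp only [coact_C, map_zero, zero_mul, add_zero, Polynomial.coe_mapRingHom,
        Polynomial.map_C]
      rfl }

theorem qcoact_wh (K : Type*) {F : Type*} [Field K] [Field F] [Algebra K F] (p : Polynomial F)
    (z : QuadraticAlgebra (MvPolynomial (Fin 3) F) (hom3 4 p) 0) (n : ℕ)
    (h1 : IsWeightedHomogeneous (![2, 1, 1] : Fin 3 → ℕ) z.re (n + 2))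
    (h2 : IsWeightedHomogeneous (![2, 1, 1] : Fin 3 → ℕ) z.im n) :
    qcoact K p z = Polynomial.X ^ (n + 2) * Polynomial.C z := by
  change Polynomial.mapRingHom _ (coact K _ _) + Polynomial.mapRingHom _ (coact K _ _) * _ = _
  rw [coact_wh K _ _ _ h1, coact_wh K _ _ _ h2]
  have : z = algebraMap _ _ z.re + algebraMap _ _ z.im * ⟨0, 1⟩ := by
    simp only [QuadraticAlgebra.algebraMap_eq]
    ext1 <;> simp
  conv_rhs => rw [this]
  simp only [map_mul, map_pow, Polynomial.coe_mapRingHom, Polynomial.map_X, Polynomial.map_C, map_add]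
  ring

section

variable {K F σ : Type*} [Field K] [Field F] [IsAlgClosed F] [CharZero F] [Algebra K F]
    [Fintype σ] {s : ℕ}

/-- the first component of the parametrisation -/
noncomputable def eq1 (D : Fin 4 → Derivation K F F) (x : σ → F) (j : σ) : MvPolynomial (Fin 3) F :=
  X 0 * C (x j) +
    (X 1 ^ 2 * C (D 0 (x j)) +
     X 1 * X 2 * C (D 1 (x j)) +
     X 2 ^ 2 * C (D 2 (x j)))

theorem eq1_wh (D : Fin 4 → Derivation K F F) (x : σ → F) (j : σ) :
    IsWeightedHomogeneous (![2, 1, 1] : Fin 3 → ℕ) (eq1 D x j) 2 := by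
  have hX := fun r : Fin 3 => isWeightedHomogeneous_X F (![2, 1, 1] : Fin 3 → ℕ) r
  have hC := fun r : F => isWeightedHomogeneous_C (![2, 1, 1] : Fin 3 → ℕ) r
  refine .add (by simpa using (hX 0).mul (hC (x j))) (.add (.add ?_ ?_) ?_)
  · simpa using ((hX 1).pow 2).mul (hC (D 0 (x j)))
  · simpa using ((hX 1).mul (hX 2)).mul (hC (D 1 (x j)))
  · simpa using ((hX 2).pow 2).mul (hC (D 2 (x j)))

theorem E_core
    (f : Fin s → MvPolynomial σ K) (d : Fin s → ℕ) (hf : ∀ i, (f i).IsHomogeneous (d i))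
    (hsm : Smooth F f) (hcard : Fintype.card σ = 5 + s + 1) (hm : ∑ i, (d i - 1) = 5)
    (D : Fin 4 → Derivation K F F) (x : σ → F)
    (hli : LinearIndependent F (Fin.cons x (fun a j => D a (x j)) : Fin (4 + 1) → σ → F))
    (p : Polynomial F) (hp : p.natDegree ≤ 4) (hns : ∀ S, p ≠ S * S)
    (hP : ∀ i, aeval (fun j => (⟨eq1 D x j, C (D 3 (x j))⟩ :
      QuadraticAlgebra (MvPolynomial (Fin 3) F) (hom3 4 p) 0)) (f i) = 0) : False := by
  classical
  have hdom : IsDomain (QA3 p) := q_domain (mv_sq hns hp)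
  have hft : Algebra.FiniteType F (QA3 p) :=
    Algebra.FiniteType.trans (S := MvPolynomial (Fin 3) F) inferInstance inferInstance
  let P : σ → (QA3 p) := fun j => ⟨eq1 D x j, C (D 3 (x j))⟩
  let v : (QA3 p) := ⟨0, 1⟩
  let D0 : Fin 5 → Derivation K (MvPolynomial (Fin 3) F) (MvPolynomial (Fin 3) F) :=
    ![pd K 0, pd K 1, pd K 2, mapCoeff (Fin 3) (D 2), mapCoeff (Fin 3) (D 3)]
  let wts : Fin 5 → ℕ := ![0, 1, 1, 2, 2]
  let Δ : Fin 5 → Derivation K (QA3 p) (QA3 p) := fun i => qder (D0 i)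
  have hD1 : ∀ i j, IsWeightedHomogeneous (![2, 1, 1] : Fin 3 → ℕ)
      (D0 i (eq1 D x j)) (wts i) := by
    intro i j
    fin_cases i
    · exact (eq1_wh D x j).pderiv (by simp [wts])
    · exact (eq1_wh D x j).pderiv (by simp [wts])
    · exact (eq1_wh D x j).pderiv (by simp [wts])
    · exact mapCoeff_wh _ _ _ _ (eq1_wh D x j)
    · exact mapCoeff_wh _ _ _ _ (eq1_wh D x j)
  have hD2 : ∀ i, IsWeightedHomogeneous (![2, 1, 1] : Fin 3 → ℕ)
      (D0 i (hom3 4 p)) (wts i + 2) := by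
    intro i
    fin_cases i
    · exact (hom3_wh2 p).pderiv (by simp [wts])
    · exact (hom3_wh2 p).pderiv (by simp [wts])
    · exact (hom3_wh2 p).pderiv (by simp [wts])
    · exact mapCoeff_wh _ _ _ _ (hom3_wh2 p)
    · exact mapCoeff_wh _ _ _ _ (hom3_wh2 p)
  have hD3 : ∀ i (c : F), IsWeightedHomogeneous (![2, 1, 1] : Fin 3 → ℕ)
      (hom3 4 p * D0 i (C c)) (wts i + 2) := by
    intro i c
    have h0 : ∀ r : Fin 3, pd K r (C c : MvPolynomial (Fin 3) F) = 0 := by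
      intro r; change pderiv r (C c) = 0; simp
    fin_cases i
    · simp [D0, h0, isWeightedHomogeneous_zero]
    · simp [D0, h0, isWeightedHomogeneous_zero]
    · simp [D0, h0, isWeightedHomogeneous_zero]
    · change IsWeightedHomogeneous _ (_ * mapCoeff _ _ _) (2 + 2)
      simpa [mapCoeff_C] using (hom3_wh2 p).mul (isWeightedHomogeneous_C _ (D 2 c))
    · change IsWeightedHomogeneous _ (_ * mapCoeff _ _ _) (2 + 2)
      simpa [mapCoeff_C] using (hom3_wh2 p).mul (isWeightedHomogeneous_C _ (D 3 c))
  have hC2 : (2 : MvPolynomial (Fin 3) F) = C 2 := (map_ofNat C 2).symm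
  have h2v : (2 * v : (QA3 p)) ≠ 0 := by
    intro h
    have := congrArg QuadraticAlgebra.im h
    have h2 := congrArg (eval 0) this
    simp [v, QuadraticAlgebra.im_ofNat, QuadraticAlgebra.re_ofNat] at h2
    rw [hC2, constantCoeff_C] at h2
    norm_num at h2
  let E : σ → (QA3 p) := fun j => ⟨C (D 3 (x j)), 0⟩
  obtain ⟨Θ, hΘ⟩ := detForm_rank_one (N := 4) (by simp) (Fintype.equivOfCardEq (by simp; omega) :
      σ ≃ Fin 5 ⊕ Fin (s + 1)) (2 * v : (QA3 p))
      (fun i j => ⟨D0 i (eq1 D x j), D0 i (C (D 3 (x j)))⟩)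
      (fun i => algebraMap (MvPolynomial (Fin 3) F) (QA3 p) (D0 i (hom3 4 p))) E
  set eqv : σ ≃ Fin 5 ⊕ Fin (s + 1) := (Fintype.equivOfCardEq (by simp; omega)) with heqv
  have hΔ : (fun i => (2 * v : (QA3 p)) • (fun j => (⟨D0 i (eq1 D x j), D0 i (C (D 3 (x j)))⟩ : (QA3 p))) +
      algebraMap (MvPolynomial (Fin 3) F) (QA3 p) (D0 i (hom3 4 p)) • E) = fun i j => Δ i (P j) := by
    funext i j
    simp only [Δ, P, qder_apply, Pi.add_apply, Pi.smul_apply, smul_eq_mul, E, v,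
      QuadraticAlgebra.algebraMap_eq]
    ext1
    · simp [QuadraticAlgebra.re_ofNat, QuadraticAlgebra.im_ofNat]; ring
    · simp [QuadraticAlgebra.re_ofNat, QuadraticAlgebra.im_ofNat]
  rw [hΔ] at hΘ
  have hγΔ : ∀ i j, qcoact K p (Δ i (P j)) = Polynomial.X ^ (wts i + 2) * Polynomial.C (Δ i (P j)) := by
    intro i j
    apply qcoact_wh
    · simp only [Δ, P, qder_apply]
      refine .add ?_ ?_
      · rw [hC2, mul_assoc]
        simpa using (isWeightedHomogeneous_C _ (2:F)).mul (hD3 i (D 3 (x j)))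
      · simpa using (isWeightedHomogeneous_C _ (D 3 (x j))).mul (hD2 i)
    · simp only [Δ, P, qder_apply]
      rw [hC2]
      simpa using (isWeightedHomogeneous_C _ (2:F)).mul (hD1 i j)
  have hγv : qcoact K p (2 * v) = Polynomial.X ^ 2 * Polynomial.C (2 * v) := by
    refine qcoact_wh K p _ 0 ?_ ?_
    · simp [v, QuadraticAlgebra.re_ofNat, QuadraticAlgebra.im_ofNat, isWeightedHomogeneous_zero]
    · simp only [v, QuadraticAlgebra.im_mul, QuadraticAlgebra.re_ofNat, QuadraticAlgebra.im_ofNat]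
      simp only [mul_one, zero_mul, mul_zero, add_zero]
      rw [hC2]
      exact isWeightedHomogeneous_C _ _
  have hzero : Θ = 0 := by
    refine G_lemma (F := F) f d hf hsm P hP (fun r => algebraMap (MvPolynomial (Fin 3) F) (QA3 p) (X r)) ?_ ?_
      (fun M N z w h => q_reg2 _ _ M N (fun z w h => mv_reg2 0 1 (by decide) M N z w h) z w h)
      (fun L M N z a b h => q_reg3 _ _ _ L M N
        (fun z a b h => mv_reg3 0 1 2 (by decide) (by decide) L M N z a b h) z a b h)
      eqv Δ Θ ((2 * v) ^ 4) (pow_ne_zero _ h2v) hΘ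
      (qcoact K p) 2 (fun j => qcoact_wh K p _ 0 (eq1_wh D x j) (isWeightedHomogeneous_C _ _))
      8 ?_ ?_
    · intro φ i hφ h0
      apply hφ
      let a : Fin 3 → F := fun r => φ (algebraMap (MvPolynomial (Fin 3) F) (QA3 p) (X r))
      have h1 : ∀ q, φ (algebraMap (MvPolynomial (Fin 3) F) (QA3 p) q) = eval a q := by
        intro q
        have : φ.comp (IsScalarTower.toAlgHom F (MvPolynomial (Fin 3) F) (QA3 p)) = aeval a := by
          ext r; simp [a]
        have h2 := congrArg (fun ψ => ψ q) this
        simpa [aeval_eq_eval] using h2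
      have h2 : ∀ j, a 0 * x j + (a 1 ^ 2 * D 0 (x j) + a 1 * a 2 * D 1 (x j) + a 2 ^ 2 * D 2 (x j)) +
          D 3 (x j) * φ v = 0 := by
        intro j
        have h3 := congrFun h0 j
        have h4 : P j = algebraMap (MvPolynomial (Fin 3) F) (QA3 p) (eq1 D x j) + algebraMap (MvPolynomial (Fin 3) F) (QA3 p) (C (D 3 (x j))) * v := by
          simp only [QuadraticAlgebra.algebraMap_eq, P, v]
          ext1 <;> simp
        simp only [Pi.zero_apply] at h3
        rw [h4, map_add, map_mul, h1, h1] at h3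
        simpa [eq1] using h3
      obtain ⟨h3, h4⟩ := li_cons_apply hli (a 0) ![a 1 ^ 2, a 1 * a 2, a 2 ^ 2, φ v] (by
        funext j
        have := h2 j
        simp [Fin.sum_univ_four]
        linear_combination this)
      have h5 := h4 0
      have h6 := h4 2
      simp at h5 h6
      fin_cases i
      · exact h3
      · exact h5
      · exact h6
    · intro i h
      have := congrArg QuadraticAlgebra.re h
      rw [QuadraticAlgebra.algebraMap_eq] at this
      simp at this
    · intro idx
      have h1 := detForm_weight (qcoact K p).toRingHom eqv (fun i j => Δ i (P j)) (fun i => wts i + 2) hγΔ idx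
      rw [← hΘ] at h1
      change qcoact K p _ = _ at h1
      rw [AlternatingMap.smul_apply, smul_eq_mul, map_mul, map_pow, hγv] at h1
      have h2 : ∑ i, (wts i + 2) = 16 := by simp [wts, Fin.sum_univ_five]
      rw [h2] at h1
      have h3 : (Polynomial.X ^ 2 * Polynomial.C (2 * v)) ^ 4 ≠ (0 : Polynomial (QA3 p)) :=
        pow_ne_zero _ (mul_ne_zero (pow_ne_zero _ Polynomial.X_ne_zero) (by simpa using h2v))
      apply mul_left_cancel₀ h3
      rw [h1]
      simp only [map_mul, map_pow]
      ring
    · rw [← Finset.mul_sum, hm]; norm_num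
  rw [hzero, smul_zero] at hΘ
  obtain ⟨t0, ht0⟩ : ∃ t, p.eval t ≠ 0 := by
    by_contra hcon
    push Not at hcon
    exact hns 0 (by rw [mul_zero]; exact Polynomial.funext (fun r => by simpa using hcon r))
  obtain ⟨v0, hv0⟩ := IsAlgClosed.exists_pow_nat_eq (p.eval t0) (n := 2) (by norm_num)
  have hv0n : v0 ≠ 0 := by rintro rfl; apply ht0; rw [← hv0]; simp
  let e : Fin 4 → σ → F := fun a j => D a (x j)
  let A1 : F := 4 * p.eval t0 - t0 * (Polynomial.derivative p).eval t0
  let A2 : F := (Polynomial.derivative p).eval t0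
  let vv : Fin 5 → σ → F := ![(2 * v0) • x, (2 * v0) • ((2:F) • e 0 + t0 • e 1) + A1 • e 3,
    (2 * v0) • (e 1 + (2 * t0) • e 2) + A2 • e 3, (2 * v0) • e 2, (2 * v0) • e 3]
  let uc : Fin 4 → σ → F := fun c j => 2 * p.eval t0 * D c (D 3 (x j)) +
    D 3 (x j) * (∑ i ∈ Finset.range (4 + 1), D c (p.coeff i * 1) * t0 ^ i) +
    2 * v0 * (D c (D 0 (x j)) + t0 * D c (D 1 (x j)) + t0 ^ 2 * D c (D 2 (x j)))
  let uu : Fin 5 → σ → F := ![0, 0, 0, uc 2, uc 3]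
  have hvv : LinearIndependent F vv := by
    rw [Fintype.linearIndependent_iff]
    intro g hg
    obtain ⟨h0, h1⟩ := li_cons_apply hli (2 * v0 * g 0) ![2 * v0 * (2 * g 1), 2 * v0 * (t0 * g 1 + g 2),
      2 * v0 * (2 * t0 * g 2 + g 3), A1 * g 1 + A2 * g 2 + 2 * v0 * g 4] (by
        rw [← hg]
        funext j
        simp [Fin.sum_univ_five, Fin.sum_univ_four, vv, e]
        ring)
    have k0 := h1 0
    have k1 := h1 1
    have k2 := h1 2
    have k3 := h1 3
    simp [hv0n] at h0 k0 k1 k2 k3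
    simp [k0] at k1 k3
    simp [k1] at k2 k3
    simp [hv0n] at k3
    intro i
    fin_cases i
    · exact h0
    · exact k0
    · exact k1
    · exact k2
    · exact k3
  obtain ⟨w0, hw0, hLI⟩ := li_open vv uu hvv
  have hev : v0 * v0 = eval ![w0, 1, t0] (hom3 4 p) := by
    rw [hom3_eval _ _ hp _ (by simp)]
    simp [← hv0, sq]
  apply detForm_ne_zero (qlift (eval ![w0, 1, t0]) v0 hev : (QA3 p) →+* F)
    (fun c => (⟨C c, 0⟩ : (QA3 p))) (by intro c; simp [qlift_apply]) eqv
    (fun i j => Δ i (P j)) _ hΘ.symm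
  have hLI2 := hLI.units_smul (![(Units.mk0 w0 hw0)⁻¹, (Units.mk0 w0 hw0)⁻¹, (Units.mk0 w0 hw0)⁻¹, 1, 1])
  suffices heq : (fun i j => qlift (eval ![w0, 1, t0]) v0 hev (Δ i (P j))) =
      ((![(Units.mk0 w0 hw0)⁻¹, (Units.mk0 w0 hw0)⁻¹, (Units.mk0 w0 hw0)⁻¹, 1, 1] : Fin 5 → Fˣ) •
        fun i => w0 • vv i + uu i) by
    rw [heq]; exact hLI2
  have hvp : p.eval t0 = v0 * v0 := by rw [← hv0, sq]
  have hpdv : ∀ r : Fin 3, ∀ j, eval ![w0, 1, t0] (pd K r (eq1 D x j)) =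
      ![x j, 2 * D 0 (x j) + t0 * D 1 (x j), D 1 (x j) + 2 * t0 * D 2 (x j)] r := by
    intro r j
    change eval _ (pderiv r (eq1 D x j)) = _
    fin_cases r <;>
    simp [eq1, Derivation.leibniz, Derivation.leibniz_pow, pderiv_X] <;> ring
  have hpdC : ∀ r : Fin 3, ∀ c : F, pd K r (C c : MvPolynomial (Fin 3) F) = 0 := by
    intro r c; change pderiv r (C c) = 0; simp
  have hpdP : ∀ r : Fin 3, eval ![w0, 1, t0] (pd K r (hom3 4 p)) = ![0, A1, A2] r := by
    intro r
    change eval _ (pderiv r _) = _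
    fin_cases r
    · simp [hom3_pderiv_zero]
    · simpa [A1] using hom3_pderiv_one 4 p hp w0 t0
    · simpa [A2] using hom3_pderiv_two 4 p hp w0 t0
  have hmc : ∀ (c : Fin 4) j, eval ![w0, 1, t0] (mapCoeff (Fin 3) (D c) (eq1 D x j)) =
      w0 * D c (x j) + (D c (D 0 (x j)) + t0 * D c (D 1 (x j)) + t0 ^ 2 * D c (D 2 (x j))) := by
    intro c j
    simp only [eq1, map_add, Derivation.leibniz, Derivation.leibniz_pow, mapCoeff_C, mapCoeff_X]
    simp
  have hmP : ∀ (c : Fin 4), eval ![w0, 1, t0] (mapCoeff (Fin 3) (D c) (hom3 4 p)) =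
      ∑ i ∈ Finset.range (4 + 1), D c (p.coeff i * 1) * t0 ^ i := by
    intro c
    have := hom3_mapCoeff_eval (D c) 4 p 1 w0 t0
    rwa [map_one, mul_one] at this
  have hom := hev
  funext i j
  simp only [Δ, P, qder_apply, qlift_apply]
  simp only [map_add, map_mul, ← hev, map_ofNat]
  have hww : w0⁻¹ * w0 = 1 := inv_mul_cancel₀ hw0
  fin_cases i
  · simp [D0, hpdC, hpdv, hpdP, vv, uu, Units.smul_def]
    field_simp
  · simp [D0, hpdC, hpdv, hpdP, vv, uu, Units.smul_def, e]
    field_simp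
    ring
  · simp [D0, hpdC, hpdv, hpdP, vv, uu, Units.smul_def, e]
    field_simp
    ring
  · simp only [D0]
    simp [mapCoeff_C, hmc, hmP, vv, uu, uc, e, hvp]
    ring
  · simp only [D0]
    simp [mapCoeff_C, hmc, hmP, vv, uu, uc, e, hvp]
    ring

end

section

variable {K F Ω σ : Type*} [Field K] [Field F] [Field Ω] [Algebra K F] [Algebra F Ω]
    [Algebra K Ω] [IsScalarTower K F Ω] [IsAlgClosed F] [CharZero F] [Fintype σ] {s : ℕ}
    {f : Fin s → MvPolynomial σ K} {d : Fin s → ℕ}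
    {D : Fin 4 → Derivation K F F} {x : σ → F} {δ : Derivation K Ω Ω} {Y : Fin 4 → Ω}

theorem mem_of_algebraic (y : Ω) (hy : IsAlgebraic F y) : ∃ a : F, algebraMap F Ω a = y := by
  have h1 := IsAlgClosed.degree_eq_one_of_irreducible F (minpoly.irreducible hy.isIntegral)
  exact minpoly.mem_range_of_degree_eq_one F y h1

theorem E_lemma (h : Core 5 f d D x δ Y) (c τ ν : Ω) (p : Polynomial F) (hp : p.natDegree ≤ 4)
    (hns : ∀ S, p ≠ S * S) (hν : ν * ν = Polynomial.aeval τ p)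
    (hY : ∀ a, Y a = c * ![1, τ, τ ^ 2, ν] a) : False := by
  have hc : c ≠ 0 := by
    rintro rfl
    exact h.hnp ⟨0, 0, fun a => by simp [hY]⟩
  have hτ : Transcendental F τ := by
    intro hτ
    obtain ⟨t, ht⟩ := mem_of_algebraic (F := F) τ hτ
    obtain ⟨w, hw⟩ := IsAlgClosed.exists_pow_nat_eq (p.eval t) (n := 2) (by norm_num)
    have h1 : (ν - algebraMap F Ω w) * (ν + algebraMap F Ω w) = 0 := by
      have : algebraMap F Ω (p.eval t) = Polynomial.aeval τ p := by
        rw [← ht, Polynomial.aeval_algebraMap_apply]; simp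
      rw [← hw, ← hν, map_pow] at this
      linear_combination -this
    obtain ⟨w', hw'⟩ : ∃ w', ν = algebraMap F Ω w' := by
      rcases mul_eq_zero.mp h1 with h2 | h2
      · exact ⟨w, sub_eq_zero.mp h2⟩
      · exact ⟨-w, by rw [map_neg]; linear_combination h2⟩
    apply h.hnp
    refine ⟨c, ![1, t, t ^ 2, w'], fun a => ?_⟩
    rw [hY]
    fin_cases a <;> simp [hw', ht]
  refine E_core f d h.hf h.hsm h.hcard h.hm D x h.li p hp hns ?_
  intro i
  set z := aeval (fun j => (⟨eq1 D x j, C (D 3 (x j))⟩ : QA3 p)) (f i) with hz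
  have key : ∀ w l : F, l ≠ 0 → rho w l z.re = 0 ∧ rho w l z.im = 0 := by
    intro w l hl
    let g : MvPolynomial (Fin 3) F →+* Ω := (Polynomial.aeval τ : Polynomial F →ₐ[F] Ω).toRingHom.comp (rho w l).toRingHom
    have hg : ∀ q, g q = Polynomial.aeval τ (rho w l q) := fun q => rfl
    let Φ : QA3 p →+* Ω := qlift g (algebraMap F Ω l ^ 2 * ν) (by
      rw [hg, rho_hom3 w l p 4 hp, map_mul, ← hν]
      simp
      ring)
    let Φ' : QA3 p →ₐ[K] Ω := { Φ with
      commutes' := by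
        intro r
        have h1 : (algebraMap K (QA3 p) r) =
          algebraMap (MvPolynomial (Fin 3) F) _ (C (algebraMap K F r)) := rfl
        change g _ + g _ * _ = _
        rw [h1, QuadraticAlgebra.algebraMap_eq]
        simp only [map_zero, zero_mul, add_zero, hg]
        rw [← algebraMap_eq, AlgHom.commutes, AlgHom.commutes]
        exact (IsScalarTower.algebraMap_apply K F Ω r).symm }
    have h1 : Φ z = 0 := by
      have h2 := comp_aeval_apply (R := K) (f := fun j => (⟨eq1 D x j, C (D 3 (x j))⟩ : QA3 p)) Φ' (f i)
      change Φ z = _ at h2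
      rw [h2]
      have h3 := h.van (algebraMap F Ω w) (algebraMap F Ω l ^ 2 / c) i
      rw [← h3]
      congr 1
      refine congrArg aeval ?_
      funext j
      change g _ + g _ * _ = _
      rw [h.hδ]
      simp only [hg, eq1, rho]
      simp [Fin.sum_univ_four, hY]
      field_simp
      ring
    change g z.re + g z.im * (algebraMap F Ω l ^ 2 * ν) = 0 at h1
    have h2 : rho w l z.re * rho w l z.re = p * (Polynomial.C (l ^ 2) * rho w l z.im) *
        (Polynomial.C (l ^ 2) * rho w l z.im) := by
      apply (transcendental_iff_injective.mp hτ)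
      rw [hg, hg] at h1
      simp only [map_mul, ← hν, Polynomial.aeval_C, map_pow]
      linear_combination (Polynomial.aeval τ (rho w l z.re) - Polynomial.aeval τ (rho w l z.im) * (algebraMap F Ω l ^ 2 * ν)) * h1
    have h3 := poly_sq hns h2
    exact ⟨h3.1, (mul_eq_zero.mp h3.2).resolve_left (by simpa using hl)⟩
  ext1
  · exact rho_zero _ fun w l hl => (key w l hl).1
  · exact rho_zero _ fun w l hl => (key w l hl).2

end

end FL

namespace FL

open Matrix

section pencil

variable {F Ω : Type*} [Field F] [Field Ω] [Algebra F Ω] [IsAlgClosed F] [CharZero F]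

/-- singular member of a pencil -/
theorem pencil {n : ℕ} (Q1 Q2 : Matrix (Fin (n + 1)) (Fin (n + 1)) F)
    (hli : ∀ a b : F, a • Q1 + b • Q2 = 0 → a = 0 ∧ b = 0)
    (V : Submodule F (Matrix (Fin (n + 1)) (Fin (n + 1)) F)) (h1 : Q1 ∈ V) (h2 : Q2 ∈ V) :
    ∃ QA ∈ V, ∃ QB ∈ V, (∀ a b : F, a • QA + b • QB = 0 → a = 0 ∧ b = 0) ∧
      ∃ z : Fin (n + 1) → F, z ≠ 0 ∧ QA *ᵥ z = 0 := by
  by_cases hd : Q2.det = 0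
  · obtain ⟨z, hz, hz0⟩ := Matrix.exists_mulVec_eq_zero_iff.mpr hd
    refine ⟨Q2, h2, Q1, h1, fun a b h => ?_, z, hz, hz0⟩
    exact (hli b a ((add_comm _ _).trans h)).symm
  · obtain ⟨μ, hμ⟩ := Module.End.exists_eigenvalue (Matrix.toLin' (Q2⁻¹ * Q1))
    obtain ⟨v, hv⟩ := hμ.exists_hasEigenvector
    have hv1 := hv.apply_eq_smul
    rw [Matrix.toLin'_apply, ← Matrix.mulVec_mulVec] at hv1
    have hv2 := congrArg (fun w => Q2 *ᵥ w) hv1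
    simp only [Matrix.mulVec_mulVec, Matrix.mulVec_smul] at hv2
    rw [Matrix.mul_nonsing_inv_cancel_left _ _ (isUnit_iff_ne_zero.mpr hd)] at hv2
    refine ⟨Q1 - μ • Q2, V.sub_mem h1 (V.smul_mem _ h2), Q2, h2, fun a b h => ?_, v, hv.2, ?_⟩
    · have := hli a (b - a * μ) (by rw [← h]; module)
      obtain ⟨rfl, hb⟩ := this
      exact ⟨rfl, by simpa using hb⟩
    · rw [Matrix.sub_mulVec, hv2, Matrix.smul_mulVec, sub_self]

/-- value of a quadric -/
def qval (Q : Matrix (Fin 4) (Fin 4) F) (y : Fin 4 → Ω) : Ω :=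
  ∑ a, ∑ b, y a * y b * algebraMap F Ω (Q a b)


theorem qval_eq (Q : Matrix (Fin 4) (Fin 4) F) (y : Fin 4 → Ω) :
    qval Q y = y ⬝ᵥ ((Q.map (algebraMap F Ω)) *ᵥ y) := by
  simp only [qval, dotProduct, Matrix.mulVec, Matrix.map_apply, Finset.mul_sum]
  refine Finset.sum_congr rfl fun a _ => Finset.sum_congr rfl fun b _ => by ring

theorem qval_trans (Q M : Matrix (Fin 4) (Fin 4) F) (y z : Fin 4 → Ω)
    (hyz : y = z ᵥ* (M.map (algebraMap F Ω))) : qval Q y = qval (M * Q * Mᵀ) z := by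
  rw [qval_eq, qval_eq, hyz]
  rw [Matrix.map_mul, Matrix.map_mul, ← Matrix.mulVec_mulVec, ← Matrix.mulVec_mulVec,
    ← Matrix.dotProduct_mulVec, Matrix.transpose_map, Matrix.mulVec_transpose]

/-- final normal form -/
theorem pencil_final (c τ v : Ω) (QA Q : Matrix (Fin 4) (Fin 4) F) (hA : QAᵀ = QA) (hQ : Qᵀ = Q)
    (hA3 : ∀ a, QA a 3 = 0)
    (hli : ∀ a b : F, a • QA + b • Q = 0 → a = 0 ∧ b = 0)
    (hL : ∀ l : Fin 4 → F, ∑ a, ![c, c * τ, c * τ ^ 2, v] a * algebraMap F Ω (l a) = 0 → l = 0)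
    (hqA : qval QA ![c, c * τ, c * τ ^ 2, v] = 0) (hq : qval Q ![c, c * τ, c * τ ^ 2, v] = 0) :
    RatPt F 4 ![c, c * τ, c * τ ^ 2, v] ∨
    ∃ (M : Matrix (Fin 4) (Fin 4) F) (ν : Ω) (p : Polynomial F), p.natDegree ≤ 4 ∧
      (∀ S, p ≠ S * S) ∧ ν * ν = Polynomial.aeval τ p ∧
      ![c, c * τ, c * τ ^ 2, v] = (fun a => c * ![1, τ, τ ^ 2, ν] a) ᵥ* M.map (algebraMap F Ω) := by
  have hc : c ≠ 0 := by
    rintro rfl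
    have := congrFun (hL (Pi.single 0 1) (by simp [Fin.sum_univ_succ])) 0
    simp at this
  have hτ : Transcendental F τ := by
    intro halg
    obtain ⟨t, rfl⟩ := mem_of_algebraic (F := F) τ halg
    have := congrFun (hL ![-t, 1, 0, 0] (by simp [Fin.sum_univ_four]; try ring)) 1
    simp at this
  have sA : ∀ a b, QA a b = QA b a := fun a b => congrFun (congrFun hA b) a
  have sQ : ∀ a b, Q a b = Q b a := fun a b => congrFun (congrFun hQ b) a
  -- expansion
  let q : Polynomial F := Polynomial.C (Q 0 3) + Polynomial.C (Q 1 3) * Polynomial.X +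
    Polynomial.C (Q 2 3) * Polynomial.X ^ 2
  let R : Matrix (Fin 4) (Fin 4) F → Polynomial F := fun Q =>
    Polynomial.C (Q 0 0) + Polynomial.C (2 * Q 0 1) * Polynomial.X +
      Polynomial.C (2 * Q 0 2 + Q 1 1) * Polynomial.X ^ 2 +
      Polynomial.C (2 * Q 1 2) * Polynomial.X ^ 3 + Polynomial.C (Q 2 2) * Polynomial.X ^ 4
  have hRA : R QA = 0 := by
    by_contra hne
    apply hne
    by_contra hne
    refine hτ ⟨R QA, hne, ?_⟩
    simp only [qval, Fin.sum_univ_four, sA 1 0, sA 2 0, sA 2 1, sA 3 0, sA 3 1, sA 3 2, hA3,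
      Matrix.cons_val, map_zero] at hqA
    have : c ^ 2 * Polynomial.aeval τ (R QA) = 0 := by
      simp only [R, map_add, map_mul, Polynomial.aeval_C, map_pow, Polynomial.aeval_X, map_ofNat]
      linear_combination hqA
    simpa [hc] using this
  have hqe : algebraMap F Ω (Q 3 3) * v ^ 2 + 2 * v * c * Polynomial.aeval τ q +
      c ^ 2 * Polynomial.aeval τ (R Q) = 0 := by
    simp only [qval, Fin.sum_univ_four, sQ 1 0, sQ 2 0, sQ 2 1, sQ 3 0, sQ 3 1, sQ 3 2,
      Matrix.cons_val] at hq
    simp only [q, R, map_add, map_mul, Polynomial.aeval_C, map_pow, Polynomial.aeval_X, map_ofNat]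
    linear_combination hq
  have hqd : q.natDegree ≤ 2 := by
    simp only [q]; compute_degree
  have hRd : (R Q).natDegree ≤ 4 := by
    simp only [R]; compute_degree
  have hRc : ∀ Q, R Q = 0 → Q 0 0 = 0 ∧ Q 0 1 = 0 ∧ 2 * Q 0 2 + Q 1 1 = 0 ∧ Q 1 2 = 0 ∧
      Q 2 2 = 0 := by
    intro Q h
    have e0 := congrArg (fun p => Polynomial.coeff p 0) h
    have e1 := congrArg (fun p => Polynomial.coeff p 1) h
    have e2 := congrArg (fun p => Polynomial.coeff p 2) h
    have e3 := congrArg (fun p => Polynomial.coeff p 3) h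
    have e4 := congrArg (fun p => Polynomial.coeff p 4) h
    simp only [R, Polynomial.coeff_add, Polynomial.coeff_C_mul, Polynomial.coeff_X, Polynomial.coeff_C,
      Polynomial.coeff_X_pow, Polynomial.coeff_zero] at e0 e1 e2 e3 e4
    norm_num at e0 e1 e2 e3 e4
    exact ⟨e0, e1, e2, e3, e4⟩
  by_cases hα : Q 3 3 = 0
  · left
    by_cases hq0 : q = 0
    · exfalso
      have h03 := congrArg (fun p => Polynomial.coeff p 0) hq0
      have h13 := congrArg (fun p => Polynomial.coeff p 1) hq0
      have h23 := congrArg (fun p => Polynomial.coeff p 2) hq0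
      simp [q, Polynomial.coeff_X, Polynomial.coeff_C, Polynomial.coeff_X_pow] at h03 h13 h23
      have hRQ : R Q = 0 := by
        by_contra hne
        refine hτ ⟨R Q, hne, ?_⟩
        simpa [hα, hq0, hc] using hqe
      obtain ⟨a0, a1, a2, a3, a4⟩ := hRc QA hRA
      obtain ⟨b0, b1, b2, b3, b4⟩ := hRc Q hRQ
      have hz : (Q 1 1) • QA + (- QA 1 1) • Q = 0 := by
        ext a b
        have w : ∀ a b, a ≤ b → (Q 1 1) * QA a b + (- QA 1 1) * Q a b = 0 := by
          intro a b hab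
          fin_cases a <;> fin_cases b <;> simp at hab <;>
            simp [a0, a1, a3, a4, b0, b1, b3, b4, h03, h13, h23, hα, hA3]
          · linear_combination (1/2 : F) * Q 1 1 * a2 - (1/2 : F) * QA 1 1 * b2
          · ring
        simp only [Matrix.add_apply, Matrix.smul_apply, smul_eq_mul, Matrix.zero_apply]
        rcases le_total a b with h | h
        · exact w a b h
        · rw [sA a b, sQ a b]; exact w b a h
      obtain ⟨b11, a11⟩ := hli _ _ hz
      have a11' : QA 1 1 = 0 := by simpa using a11
      have a02 : QA 0 2 = 0 := by simpa [a11'] using a2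
      have hA0 : QA = 0 := by
        ext a b
        have w : ∀ a b, a ≤ b → QA a b = 0 := by
          intro a b hab
          fin_cases a <;> fin_cases b <;> simp at hab <;>
            simp [a0, a1, a3, a4, hA3, a11', a02]
        rcases le_total a b with h | h
        · exact w a b h
        · rw [sA a b]; exact w b a h
      have := hli 1 0 (by simp [hA0])
      exact one_ne_zero this.1
    · have hqτ : Polynomial.aeval τ q ≠ 0 := fun h => hτ ⟨q, hq0, h⟩
      have : CharZero Ω := charZero_of_injective_algebraMap (algebraMap F Ω).injective
      refine ⟨τ, c / (2 * Polynomial.aeval τ q), ![2 * q, 2 * q * Polynomial.X,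
        2 * q * Polynomial.X ^ 2, - R Q], ?_, ?_⟩
      · have h2 : (2 : Polynomial F) = Polynomial.C 2 := rfl
        intro i
        fin_cases i
        · simp only [Fin.zero_eta, Matrix.cons_val_zero, h2]
          exact (Polynomial.natDegree_C_mul_le _ _).trans (by omega)
        · simp only [Fin.mk_one, Matrix.cons_val_one, h2]
          refine (Polynomial.natDegree_mul_le).trans ?_
          have := Polynomial.natDegree_C_mul_le (2 : F) q
          have := Polynomial.natDegree_X_le (R := F)
          omega
        · simp only [Fin.reduceFinMk, Matrix.cons_val, h2]
          refine (Polynomial.natDegree_mul_le).trans ?_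
          have := Polynomial.natDegree_C_mul_le (2 : F) q
          have := Polynomial.natDegree_X_pow_le (R := F) 2
          omega
        · simp only [Fin.reduceFinMk, Matrix.cons_val, Polynomial.natDegree_neg]
          exact hRd
      · intro i
        fin_cases i
        · simp [map_ofNat]; field_simp
        · simp [map_ofNat]; field_simp
        · simp [map_ofNat]; field_simp
        · simp [map_ofNat]
          field_simp
          rw [hα] at hqe
          have : c * (2 * v * Polynomial.aeval τ q + c * Polynomial.aeval τ (R Q)) = 0 := by
            simp only [map_zero] at hqe
            linear_combination hqe
          have := (mul_eq_zero.mp this).resolve_left hc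
          linear_combination this
  · let α := Q 3 3
    let P : Polynomial F := Polynomial.C (α⁻¹ ^ 2) * q ^ 2 - Polynomial.C α⁻¹ * R Q
    let ν : Ω := v / c + algebraMap F Ω α⁻¹ * Polynomial.aeval τ q
    have hαΩ : algebraMap F Ω α ≠ 0 := by simpa using hα
    have hν : ν * ν = Polynomial.aeval τ P := by
      simp only [ν, P, map_sub, map_mul, map_pow, Polynomial.aeval_C, map_inv₀]
      field_simp
      linear_combination (algebraMap F Ω α) * hqe
    have hP : P.natDegree ≤ 4 := by
      refine (Polynomial.natDegree_sub_le _ _).trans (max_le ?_ ?_)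
      · refine (Polynomial.natDegree_C_mul_le _ _).trans (Polynomial.natDegree_pow_le.trans ?_)
        omega
      · exact (Polynomial.natDegree_C_mul_le _ _).trans hRd
    have hv : v = c * ν - c * algebraMap F Ω α⁻¹ * Polynomial.aeval τ q := by
      simp only [ν]; field_simp; ring
    by_cases hns : ∀ S, P ≠ S * S
    · right
      refine ⟨!![1, 0, 0, -α⁻¹ * Q 0 3; 0, 1, 0, -α⁻¹ * Q 1 3; 0, 0, 1, -α⁻¹ * Q 2 3; 0, 0, 0, 1],
        ν, P, hP, hns, hν, ?_⟩
      funext a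
      fin_cases a
      · simp [Matrix.vecMul, dotProduct, Fin.sum_univ_four]
      · simp [Matrix.vecMul, dotProduct, Fin.sum_univ_four]
      · simp [Matrix.vecMul, dotProduct, Fin.sum_univ_four]
      · simp [Matrix.vecMul, dotProduct, Fin.sum_univ_four]
        rw [hv]
        simp [q]
        ring
    · left
      push Not at hns
      obtain ⟨S, hS⟩ := hns
      have hSd : S.natDegree ≤ 2 := by
        have : (S * S).natDegree = S.natDegree + S.natDegree := by
          by_cases h0 : S = 0
          · simp [h0]
          · exact Polynomial.natDegree_mul h0 h0
        rw [hS, this] at hP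
        omega
      have : ∃ T : Polynomial F, T.natDegree ≤ 2 ∧ ν = Polynomial.aeval τ T := by
        rw [hS, map_mul] at hν
        rcases mul_self_eq_mul_self_iff.mp hν with h | h
        · exact ⟨S, hSd, h⟩
        · exact ⟨-S, by simpa using hSd, by simpa using h⟩
      obtain ⟨T, hT, hνT⟩ := this
      refine ⟨τ, c, ![1, Polynomial.X, Polynomial.X ^ 2, T - Polynomial.C α⁻¹ * q], ?_, ?_⟩
      · intro i
        fin_cases i
        · simp
        · simp
        · simp
        · simp only [Fin.reduceFinMk, Matrix.cons_val]
          refine (Polynomial.natDegree_sub_le _ _).trans (max_le (by omega) ?_)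
          exact (Polynomial.natDegree_C_mul_le _ _).trans (by omega)
      · intro i
        fin_cases i
        · simp
        · simp
        · simp
        · simp only [Fin.reduceFinMk, Matrix.cons_val]
          rw [hv, hνT]
          simp
          ring

theorem li_mat (y z : Fin 4 → Ω) (M : Matrix (Fin 4) (Fin 4) F)
    (hL : ∀ l : Fin 4 → F, ∑ a, y a * algebraMap F Ω (l a) = 0 → l = 0)
    (hyz : y = z ᵥ* (M.map (algebraMap F Ω))) : IsUnit M.det := by
  rw [isUnit_iff_ne_zero]
  intro h0
  obtain ⟨l, hl, hl0⟩ := Matrix.exists_mulVec_eq_zero_iff.mpr h0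
  apply hl
  apply hL
  have : ∑ a, y a * algebraMap F Ω (l a) = y ⬝ᵥ (fun a => algebraMap F Ω (l a)) := rfl
  rw [this, hyz, ← Matrix.dotProduct_mulVec]
  have : M.map (algebraMap F Ω) *ᵥ (fun a => algebraMap F Ω (l a)) = 0 := by
    funext a
    have := congrArg (algebraMap F Ω) (congrFun hl0 a)
    simpa [Matrix.mulVec, dotProduct, map_sum] using this
  rw [this, dotProduct_zero]

theorem li_vec (y z : Fin 4 → Ω) (M : Matrix (Fin 4) (Fin 4) F) (hM : IsUnit M.det)
    (hL : ∀ l : Fin 4 → F, ∑ a, y a * algebraMap F Ω (l a) = 0 → l = 0)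
    (hyz : y = z ᵥ* (M.map (algebraMap F Ω))) :
    ∀ l : Fin 4 → F, ∑ a, z a * algebraMap F Ω (l a) = 0 → l = 0 := by
  intro l hl
  have h1 : M *ᵥ (M⁻¹ *ᵥ l) = l := by
    rw [Matrix.mulVec_mulVec, Matrix.mul_nonsing_inv _ hM, Matrix.one_mulVec]
  have := hL (M⁻¹ *ᵥ l) ?_
  · rw [← h1, this, Matrix.mulVec_zero]
  · have e : ∑ a, y a * algebraMap F Ω ((M⁻¹ *ᵥ l) a)
      = y ⬝ᵥ (fun a => algebraMap F Ω ((M⁻¹ *ᵥ l) a)) := rfl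
    rw [e, hyz, ← Matrix.dotProduct_mulVec]
    have : M.map (algebraMap F Ω) *ᵥ (fun a => algebraMap F Ω ((M⁻¹ *ᵥ l) a))
        = fun a => algebraMap F Ω (l a) := by
      funext a
      have := congrArg (algebraMap F Ω) (congrFun h1 a)
      rw [← this]
      simp [Matrix.mulVec, dotProduct, map_sum, Matrix.map_apply]
    rw [this]
    exact hl

theorem pencil_main (y : Fin 4 → Ω) (Q1 Q2 : Matrix (Fin 4) (Fin 4) F)
    (hQ1 : Q1ᵀ = Q1) (hQ2 : Q2ᵀ = Q2)
    (hli : ∀ a b : F, a • Q1 + b • Q2 = 0 → a = 0 ∧ b = 0)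
    (hL : ∀ l : Fin 4 → F, ∑ a, y a * algebraMap F Ω (l a) = 0 → l = 0)
    (hq1 : qval Q1 y = 0) (hq2 : qval Q2 y = 0) :
    RatPt F 4 y ∨
    ∃ (M : Matrix (Fin 4) (Fin 4) F) (c τ ν : Ω) (p : Polynomial F), p.natDegree ≤ 4 ∧
      (∀ S, p ≠ S * S) ∧ ν * ν = Polynomial.aeval τ p ∧
      y = (fun a => c * ![1, τ, τ ^ 2, ν] a) ᵥ* M.map (algebraMap F Ω) := by
  let V : Submodule F (Matrix (Fin 4) (Fin 4) F) :=
    { carrier := {Q | Qᵀ = Q ∧ qval Q y = 0}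
      add_mem' := by
        rintro a b ⟨h1, h2⟩ ⟨h3, h4⟩
        refine ⟨by rw [Matrix.transpose_add, h1, h3], ?_⟩
        have : qval (a + b) y = qval a y + qval b y := by
          simp [qval, mul_add, Finset.sum_add_distrib]
        rw [this, h2, h4, add_zero]
      zero_mem' := by simp [qval]
      smul_mem' := by
        rintro c a ⟨h1, h2⟩
        refine ⟨by rw [Matrix.transpose_smul, h1], ?_⟩
        have : qval (c • a) y = algebraMap F Ω c * qval a y := by
          simp only [qval, Finset.mul_sum, Matrix.smul_apply, smul_eq_mul, map_mul]
          refine Finset.sum_congr rfl fun a _ => Finset.sum_congr rfl fun b _ => by ring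
        rw [this, h2, mul_zero] }
  obtain ⟨QA, ⟨hA, hqA⟩, QB, ⟨hB, hqB⟩, hli, z0, hz0, hAz⟩ := pencil Q1 Q2 hli V ⟨hQ1, hq1⟩ ⟨hQ2, hq2⟩
  obtain ⟨C', C, hC, hlast⟩ := exists_col z0 hz0
  have hC2 : C * C' = 1 := mul_eq_one_comm.mp hC
  -- y = y' C'ᵀ
  let y' : Fin 4 → Ω := y ᵥ* (Cᵀ.map (algebraMap F Ω))
  have hyy' : y = y' ᵥ* (C'ᵀ.map (algebraMap F Ω)) := by
    simp only [y']
    rw [Matrix.vecMul_vecMul, ← Matrix.map_mul, ← Matrix.transpose_mul, hC]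
    simp
  have cong : ∀ (M Q : Matrix (Fin 4) (Fin 4) F), Qᵀ = Q → (M * Q * Mᵀ)ᵀ = M * Q * Mᵀ := by
    intro M Q h
    rw [Matrix.transpose_mul, Matrix.transpose_mul, h, Matrix.transpose_transpose, Matrix.mul_assoc]
  have conli : ∀ (M QA QB : Matrix (Fin 4) (Fin 4) F), IsUnit M.det →
      (∀ a b : F, a • QA + b • QB = 0 → a = 0 ∧ b = 0) →
      ∀ a b : F, a • (M * QA * Mᵀ) + b • (M * QB * Mᵀ) = 0 → a = 0 ∧ b = 0 := by
    intro M QA QB hM h a b hab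
    apply h
    have e : a • (M * QA * Mᵀ) + b • (M * QB * Mᵀ) = M * (a • QA + b • QB) * Mᵀ := by
      simp [Matrix.mul_add, Matrix.add_mul]
    rw [e] at hab
    have h2 : M⁻¹ * (M * (a • QA + b • QB) * Mᵀ) * (Mᵀ)⁻¹ = 0 := by rw [hab]; simp
    rw [Matrix.mul_assoc M, Matrix.nonsing_inv_mul_cancel_left _ _ hM,
      Matrix.mul_nonsing_inv_cancel_right _ _ (by rwa [Matrix.det_transpose])] at h2
    exact h2
  have hU := li_mat _ _ _ hL hyy'
  have hL' := li_vec _ _ _ hU hL hyy'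
  set A1 := C'ᵀ * QA * C'ᵀᵀ with hA1
  set B1 := C'ᵀ * QB * C'ᵀᵀ with hB1
  have hqA1 : qval A1 y' = 0 := by rw [← qval_trans _ _ _ _ hyy']; exact hqA
  have hqB1 : qval B1 y' = 0 := by rw [← qval_trans _ _ _ _ hyy']; exact hqB
  have hsA1 := cong C'ᵀ QA hA
  have hsB1 := cong C'ᵀ QB hB
  have hli1 := conli _ _ _ hU hli
  rw [← hA1, ← hB1] at hli1
  rw [← hA1] at hsA1
  rw [← hB1] at hsB1
  have hA13 : ∀ a, A1 a 3 = 0 := by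
    intro a
    have : (fun b => C' b 3) = z0 := funext hlast
    rw [hA1, Matrix.mul_assoc, Matrix.transpose_transpose, Matrix.mul_apply]
    apply Finset.sum_eq_zero
    intro b _
    have : (QA * C') b 3 = (QA *ᵥ z0) b := by
      rw [← this]; rfl
    rw [this, hAz]; simp
  have sA1 : ∀ a b, A1 a b = A1 b a := fun a b => congrFun (congrFun hsA1 b) a
  have hr : RatPt F 2 ![y' 0, y' 1, y' 2] := by
    refine conic _ (A1 0 0) (2 * A1 0 1) (A1 1 1) (2 * A1 0 2) (2 * A1 1 2) (A1 2 2) ?_ ?_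
    · rintro ⟨h1, h2, h3, h4, h5, h6⟩
      have : A1 = 0 := by
        simp at h2 h4 h5
        have w : ∀ a b, a ≤ b → A1 a b = 0 := by
          intro a b hab
          fin_cases a <;> fin_cases b <;> simp at hab <;> simp [h1, h2, h3, h4, h5, h6, hA13]
        ext a b
        rcases le_total a b with h | h
        · exact w a b h
        · rw [sA1 a b]; exact w b a h
      exact one_ne_zero (hli1 1 0 (by simp [this])).1
    · simp only [qval, Fin.sum_univ_four, sA1 1 0, sA1 2 0, sA1 2 1, sA1 3 0, sA1 3 1, sA1 3 2, hA13,
        map_zero] at hqA1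
      simp only [Matrix.cons_val, map_mul, map_ofNat]
      linear_combination hqA1
  obtain ⟨τ, c, p, hp, hyp⟩ := hr
  let N : Matrix (Fin 4) (Fin 4) F :=
    !![(p 0).coeff 0, (p 1).coeff 0, (p 2).coeff 0, 0; (p 0).coeff 1, (p 1).coeff 1, (p 2).coeff 1, 0;
      (p 0).coeff 2, (p 1).coeff 2, (p 2).coeff 2, 0; 0, 0, 0, 1]
  have hev : ∀ i, Polynomial.aeval τ (p i) = algebraMap F Ω ((p i).coeff 0) +
      algebraMap F Ω ((p i).coeff 1) * τ + algebraMap F Ω ((p i).coeff 2) * τ ^ 2 := by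
    intro i
    rw [Polynomial.aeval_eq_sum_range' (n := 3) (by have := hp i; omega)]
    simp [Finset.sum_range_succ, Algebra.smul_def]
  have hyz : y' = ![c, c * τ, c * τ ^ 2, y' 3] ᵥ* N.map (algebraMap F Ω) := by
    have h0 := hyp 0
    have h1 := hyp 1
    have h2 := hyp 2
    rw [hev] at h0 h1 h2
    simp only [Matrix.cons_val] at h0 h1 h2
    funext a
    fin_cases a <;> simp [N, Matrix.vecMul, dotProduct, Fin.sum_univ_four]
    · rw [h0]; ring
    · rw [h1]; ring
    · rw [h2]; ring
  have hN := li_mat _ _ _ hL' hyz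
  have hLz := li_vec _ _ _ hN hL' hyz
  rcases pencil_final c τ (y' 3) (N * A1 * Nᵀ) (N * B1 * Nᵀ) (cong _ _ hsA1) (cong _ _ hsB1) (by
      intro a
      rw [Matrix.mul_assoc, Matrix.mul_apply]
      apply Finset.sum_eq_zero
      intro b _
      rw [Matrix.mul_apply]
      simp [Fin.sum_univ_four, N, hA13]) (conli _ _ _ hN hli1) hLz
      (by rw [← qval_trans _ _ _ _ hyz]; exact hqA1) (by rw [← qval_trans _ _ _ _ hyz]; exact hqB1)
      with h | ⟨M, ν, P, h1, h2, h3, h4⟩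
  · left
    have e : y = ![c, c * τ, c * τ ^ 2, y' 3] ᵥ* (N * C'ᵀ).map (algebraMap F Ω) := by
      rw [Matrix.map_mul, ← Matrix.vecMul_vecMul, ← hyz]; exact hyy'
    have := h.lin (fun a i => (N * C'ᵀ) i a)
    convert this using 1
    rw [e]
    funext a
    simp only [Matrix.vecMul, dotProduct, Matrix.map_apply]
    exact Finset.sum_congr rfl fun _ _ => mul_comm _ _
  · right
    refine ⟨M * (N * C'ᵀ), c, τ, ν, P, h1, h2, h3, ?_⟩
    rw [Matrix.map_mul, Matrix.map_mul, ← Matrix.vecMul_vecMul, ← Matrix.vecMul_vecMul, ← h4, ← hyz]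
    exact hyy'

end pencil

end FL

namespace FL

open Matrix

/-- height of the maximal ideal of a rational point -/
theorem height_point {K : Type*} [Field K] {n : ℕ} (a : Fin n → K) :
    (n : ℕ∞) ≤ (RingHom.ker (MvPolynomial.aeval a : MvPolynomial (Fin n) K →ₐ[K] K)).height := by
  classical
  let φ : ℕ → (MvPolynomial (Fin n) K →ₐ[K] MvPolynomial (Fin n) K) := fun j =>
    MvPolynomial.aeval fun i => if (i : ℕ) < j then MvPolynomial.C (a i) else MvPolynomial.X i
  have hP : ∀ j, (RingHom.ker (φ j)).IsPrime := fun j => RingHom.ker_isPrime _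
  have hle : ∀ j, j ≤ n → (j : ℕ∞) ≤ (RingHom.ker (φ j)).height := by
    intro j
    induction j with
    | zero => simp
    | succ j ih =>
      intro hj
      have h1 := ih (by omega)
      have hlt : RingHom.ker (φ j) < RingHom.ker (φ (j + 1)) := by
        refine lt_of_le_of_ne ?_ ?_
        · intro p hp
          rw [RingHom.mem_ker] at hp ⊢
          have : φ (j + 1) = (φ (j + 1)).comp (φ j) := by
            apply MvPolynomial.algHom_ext
            intro i
            simp only [φ, MvPolynomial.aeval_X, AlgHom.comp_apply]
            by_cases h1 : (i : ℕ) < j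
            · simp [h1, show (i : ℕ) < j + 1 by omega, MvPolynomial.algHom_C]
            · simp [h1]
          rw [this, AlgHom.comp_apply, hp, map_zero]
        · intro he
          have h2 : (MvPolynomial.X ⟨j, by omega⟩ - MvPolynomial.C (a ⟨j, by omega⟩) :
              MvPolynomial (Fin n) K) ∈ RingHom.ker (φ (j + 1)) := by
            rw [RingHom.mem_ker, map_sub]
            simp [φ, MvPolynomial.algHom_C]
          rw [← he, RingHom.mem_ker, map_sub] at h2
          simp only [φ, MvPolynomial.aeval_X, MvPolynomial.algHom_C] at h2
          simp only [lt_self_iff_false, if_false] at h2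
          have := congrArg (MvPolynomial.eval (fun _ => a ⟨j, by omega⟩ + 1)) h2
          simp at this
      have := Ideal.height_add_one_le_of_lt_of_isPrime hlt
      push_cast
      exact (add_le_add_left h1 1).trans this
  have := hle n le_rfl
  have e : RingHom.ker (φ n) = RingHom.ker (MvPolynomial.aeval a : MvPolynomial (Fin n) K →ₐ[K] K) := by
    have : φ n = (Algebra.ofId K (MvPolynomial (Fin n) K)).comp (MvPolynomial.aeval a) := by
      apply MvPolynomial.algHom_ext
      intro i
      simp [φ, Algebra.ofId_apply, MvPolynomial.algebraMap_eq]
    ext p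
    rw [RingHom.mem_ker, RingHom.mem_ker, this, AlgHom.comp_apply, Algebra.ofId_apply,
      MvPolynomial.algebraMap_eq, MvPolynomial.C_eq_zero]
  rwa [e] at this

/-- few forms in many variables have a nontrivial common zero. -/
theorem common_zero {K : Type*} [Field K] [IsAlgClosed K] {n N : ℕ} (hN : N < n)
    (g : Fin N → MvPolynomial (Fin n) K) (e : Fin N → ℕ) (he : ∀ i, 0 < e i)
    (hg : ∀ i, (g i).IsHomogeneous (e i)) :
    ∃ u : Fin n → K, u ≠ 0 ∧ ∀ i, MvPolynomial.eval u (g i) = 0 := by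
  classical
  by_contra hcon
  push Not at hcon
  let 𝔪 := RingHom.ker (MvPolynomial.aeval (0 : Fin n → K) : MvPolynomial (Fin n) K →ₐ[K] K)
  have : 𝔪.IsPrime := RingHom.ker_isPrime _
  have h0 : ∀ i, g i ∈ 𝔪 := by
    intro i
    rw [RingHom.mem_ker, MvPolynomial.aeval_eq_eval]
    have h2 := MvPolynomial.IsHomogeneous.coeff_eq_zero (hg i) (d := 0) (by simpa using (he i).ne)
    simpa [MvPolynomial.constantCoeff_eq] using h2
  have hI : Ideal.span (Set.range g) ≤ 𝔪 := by
    rw [Ideal.span_le]; rintro _ ⟨i, rfl⟩; exact h0 i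
  have hmin : 𝔪 ∈ (Ideal.span (Set.range g)).minimalPrimes := by
    refine ⟨⟨inferInstance, hI⟩, ?_⟩
    rintro Q ⟨hQ, hQI⟩ -
    refine le_trans ?_ (hQ.radical_le_iff.mpr hQI)
    rw [← MvPolynomial.vanishingIdeal_zeroLocus_eq_radical (K := K)]
    intro p hp u hu
    by_cases hu0 : u = 0
    · rw [hu0]; exact hp
    · obtain ⟨i, hi⟩ := hcon u hu0
      exact absurd (hu (g i) (Ideal.subset_span ⟨i, rfl⟩)) hi
  have h2 := Ideal.height_le_card_of_mem_minimalPrimes_span (Set.finite_range g) hmin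
  have h3 := (height_point (0 : Fin n → K)).trans h2
  have h4 : (Set.range g).ncard ≤ N := by
    rw [← Set.image_univ]
    refine (Set.ncard_image_le Set.finite_univ).trans ?_
    simp [Set.ncard_univ]
  norm_cast at h3
  omega

end FL

namespace FL

open Matrix MvPolynomial

theorem dvd_of_algInd {C L : Type*} [Field C] [Field L] [Algebra C L] {r : ℕ} (α : Fin (r + 1) → L)
    (hα : AlgebraicIndependent C (fun i : Fin r => α i.succ))
    (h g : MvPolynomial (Fin (r + 1)) C) (hirr : Irreducible h)
    (h0 : aeval α h = 0) (g0 : aeval α g = 0) : h ∣ g := by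
  classical
  let : NormalizedGCDMonoid (MvPolynomial (Fin r) C) := Classical.choice (inferInstance)
  let R := MvPolynomial (Fin r) C
  let φ : R →+* L := (aeval fun i : Fin r => α i.succ : R →ₐ[C] L).toRingHom
  have hφ : Function.Injective φ := hα
  let Q := FractionRing R
  let Φ : Q →+* L := IsFractionRing.lift hφ
  have hΦ : ∀ a : R, Φ (algebraMap R Q a) = φ a := fun a => IsFractionRing.lift_algebraMap hφ a
  let e := finSuccEquiv C r
  have hev : ∀ p, ((e p).map (algebraMap R Q)).eval₂ Φ (α 0) = aeval α p := by
    intro p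
    rw [Polynomial.eval₂_map]
    have h1 : Φ.comp (algebraMap R Q) = φ := RingHom.ext hΦ
    rw [h1]
    let ψ : MvPolynomial (Fin (r + 1)) C →ₐ[C] L :=
      { toRingHom := (Polynomial.eval₂RingHom φ (α 0)).comp (e : _ →+* _)
        commutes' := by
          intro c
          simp [e, φ, finSuccEquiv_apply]
          exact aeval_C _ _ }
    have : ψ = aeval α := by
      apply algHom_ext
      intro i
      refine Fin.cases ?_ (fun i => ?_) i
      · change Polynomial.eval₂ φ (α 0) (e (MvPolynomial.X 0)) = _
        simp [e, finSuccEquiv_X_zero]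
      · change Polynomial.eval₂ φ (α 0) (e (MvPolynomial.X i.succ)) = _
        simp [e, finSuccEquiv_X_succ, φ]
        exact aeval_X _ _
    exact congrArg (fun t => t p) this
  have hirr' : Irreducible (e h) := (MulEquiv.irreducible_iff e).mpr hirr
  have hd : (e h).natDegree ≠ 0 := by
    intro hd
    rw [Polynomial.natDegree_eq_zero] at hd
    obtain ⟨a, ha⟩ := hd
    have := hev h
    rw [← ha, h0] at this
    simp only [Polynomial.map_C, Polynomial.eval₂_C, hΦ] at this
    have ha0 : a = 0 := (map_eq_zero_iff φ hφ).mp this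
    rw [ha0, map_zero] at ha
    exact hirr'.ne_zero ha.symm
  have hprim : (e h).IsPrimitive := hirr'.isPrimitive hd
  have hirrQ := (hprim.irreducible_iff_irreducible_map_fraction_map (K := Q)).mp hirr'
  have hdvd : (e h).map (algebraMap R Q) ∣ (e g).map (algebraMap R Q) := by
    by_contra hnd
    obtain ⟨a, b, hab⟩ := (hirrQ.coprime_iff_not_dvd).mpr hnd
    have := congrArg (Polynomial.eval₂ Φ (α 0)) hab
    rw [Polynomial.eval₂_add, Polynomial.eval₂_mul, Polynomial.eval₂_mul, hev, hev, h0, g0] at this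
    simp at this
  have h4 : e h ∣ e g := Polynomial.IsPrimitive.dvd_of_fraction_map_dvd_fraction_map hprim hdvd
  exact (map_dvd_iff e).mp h4

/-- Scaling of homogeneous components. -/
theorem aeval_scale {C F σ : Type*} [Field C] [Field F] [Algebra C F] (z : σ → F)
    (p : MvPolynomial σ C) :
    aeval (fun i => Polynomial.X * Polynomial.C (z i)) p =
      ∑ n ∈ Finset.range (p.totalDegree + 1),
        Polynomial.C (aeval z (homogeneousComponent n p)) *
          Polynomial.X ^ n := by
  have hh : ∀ n (q : MvPolynomial σ C), q.IsHomogeneous n →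
      aeval (fun i => Polynomial.X * Polynomial.C (z i)) q =
        Polynomial.C (aeval z q) * Polynomial.X ^ n := by
    intro n q hq
    rw [aeval_def, eval₂_eq, aeval_def, eval₂_eq,
      map_sum, Finset.sum_mul]
    refine Finset.sum_congr rfl fun m hm => ?_
    have hdeg : ∑ i ∈ m.support, m i = n := by
      have := hq (mem_support_iff.mp hm)
      rw [← this]
      simp [Finsupp.weight_apply, Finsupp.sum]
    simp only [mul_pow, Finset.prod_mul_distrib, map_mul, map_prod, map_pow]
    rw [Finset.prod_pow_eq_pow_sum, hdeg, Polynomial.C_eq_algebraMap,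
      ← IsScalarTower.algebraMap_apply C F (Polynomial F)]
    ring
  conv_lhs => rw [← sum_homogeneousComponent p]
  rw [map_sum]
  exact Finset.sum_congr rfl fun n _ => hh n _ (homogeneousComponent_isHomogeneous n p)

theorem scale_zero {C F σ : Type*} [Field C] [Field F] [Algebra C F] (z : σ → F)
    (p : MvPolynomial σ C)
    (hp : aeval (fun i => Polynomial.X * Polynomial.C (z i)) p = 0) (n : ℕ) :
    aeval z (homogeneousComponent n p) = 0 := by
  by_cases hn : p.totalDegree < n
  · rw [homogeneousComponent_eq_zero _ _ hn, map_zero]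
  rw [aeval_scale] at hp
  have := congrArg (fun q => Polynomial.coeff q n) hp
  simp only [Polynomial.finsetSum_coeff, Polynomial.coeff_C_mul, Polynomial.coeff_X_pow,
    Polynomial.coeff_zero] at this
  rw [Finset.sum_eq_single n] at this
  · simpa using this
  · intro b _ hb; simp [hb.symm]
  · intro h; simp at h; omega

theorem hom_quot {C σ : Type*} [Field C] (h q g : MvPolynomial σ C) (y n : ℕ)
    (hh : h.IsHomogeneous y) (hg : g.IsHomogeneous n) (e : g = h * q) :
    (n < y → g = 0) ∧ (y ≤ n → ∃ q', q'.IsHomogeneous (n - y) ∧ g = h * q') := by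
  classical
  have h1 : g = ∑ j ∈ Finset.range (q.totalDegree + 1),
      h * homogeneousComponent j q := by
    rw [← Finset.mul_sum, sum_homogeneousComponent, e]
  have h2 := congrArg (homogeneousComponent n) h1
  rw [map_sum, homogeneousComponent_eq_self hg] at h2
  have h3 : ∀ j, homogeneousComponent n (h * homogeneousComponent j q) =
      if n = y + j then h * homogeneousComponent j q else 0 := by
    intro j
    have := homogeneousComponent_of_mem (m := n) (n := y + j)
      (hh.mul (homogeneousComponent_isHomogeneous j q))
    rw [this]
  simp only [h3] at h2
  constructor
  · intro hn
    rw [h2]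
    exact Finset.sum_eq_zero fun j _ => by rw [if_neg (by omega)]
  · intro hn
    refine ⟨homogeneousComponent (n - y) q,
      homogeneousComponent_isHomogeneous _ _, ?_⟩
    by_cases hq : q.totalDegree < n - y
    · rw [homogeneousComponent_eq_zero _ _ hq, mul_zero, h2]
      refine Finset.sum_eq_zero fun j hj => ?_
      simp at hj
      rw [if_neg (by omega)]
    · rw [h2, Finset.sum_eq_single (n - y)]
      · rw [if_pos (by omega)]
      · intro j _ hj; rw [if_neg (by omega)]
      · intro h; simp at h; omega

section hyp

variable {C F : Type*} [Field C] [Field F] [CharZero F] [Algebra C F] {r : ℕ}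

/-- Covectors killing `z` and all its derivatives. -/
def Ann (𝔇 : Set (Derivation C F F)) (z : Fin (r + 1) → F) (φ : Fin (r + 1) → F) : Prop :=
  ∑ j, φ j * z j = 0 ∧ ∀ D ∈ 𝔇, ∑ j, φ j * D (z j) = 0

theorem dvd_hom (𝔇 : Set (Derivation C F F)) (z : Fin (r + 1) → F)
    (hann : ∀ φ ψ, φ ≠ 0 → Ann 𝔇 z φ → Ann 𝔇 z ψ → ∃ c : F, ψ = c • φ)
    (h : MvPolynomial (Fin (r + 1)) C) (y : ℕ) (hy : 1 ≤ y) (hh : h.IsHomogeneous y) (hne : h ≠ 0)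
    (h0 : aeval z h = 0)
    (hmin : ∀ n < y, ∀ g : MvPolynomial (Fin (r + 1)) C, g.IsHomogeneous n →
      aeval z g = 0 → g = 0)
    (n : ℕ) (g : MvPolynomial (Fin (r + 1)) C) (hg : g.IsHomogeneous n)
    (g0 : aeval z g = 0) : h ∣ g := by
  classical
  have hC : CharZero C := by
    refine ⟨fun a b h => ?_⟩
    have := congrArg (algebraMap C F) h
    simpa using this
  -- a variable with nonzero derivative
  have hex : ∃ i, pderiv i h ≠ 0 := by
    by_contra hcon
    push Not at hcon
    have := hh.sum_X_mul_pderiv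
    simp only [hcon, mul_zero, Finset.sum_const_zero] at this
    have h2 := this.symm
    rw [nsmul_eq_mul, mul_eq_zero] at h2
    rcases h2 with h2 | h2
    · have : (y : MvPolynomial (Fin (r + 1)) C) ≠ 0 := by
        exact_mod_cast (by omega : y ≠ 0)
      exact this h2
    · exact hne h2
  obtain ⟨i0, hi0⟩ := hex
  let φ : Fin (r + 1) → F := fun j => aeval z (pderiv j h)
  have hφ0 : φ i0 ≠ 0 := by
    intro hc
    exact hi0 (hmin (y - 1) (by omega) _ (hh.pderiv) hc)
  have hφ : Ann 𝔇 z φ := by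
    constructor
    · have := congrArg (aeval z) hh.sum_X_mul_pderiv
      rw [map_sum] at this
      simp only [map_mul, aeval_X, map_nsmul, h0, smul_zero] at this
      rw [← this]
      exact Finset.sum_congr rfl fun j _ => mul_comm _ _
    · intro D _
      have := deriv_aeval D z h
      rw [h0, map_zero] at this
      exact this.symm
  let e := Equiv.swap i0 (0 : Fin (r + 1))
  let z' : Fin (r + 1) → F := fun i => z (e i)
  have hren : ∀ p : MvPolynomial (Fin (r + 1)) C, rename e (rename e p) = p := by
    intro p
    rw [rename_rename]
    have : (e ∘ e : Fin (r + 1) → Fin (r + 1)) = id := by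
      funext i; simp [e]
    rw [this, rename_id_apply]
  have hz' : ∀ p : MvPolynomial (Fin (r + 1)) C,
      aeval z' (rename e p) = aeval z p := by
    intro p
    rw [aeval_rename]
    congr 2
    funext i
    simp [z', e]
  let L := FractionRing (Polynomial F)
  let β : Fin (r + 1) → Polynomial F := fun i => Polynomial.X * Polynomial.C (z' i)
  let α : Fin (r + 1) → L := fun i => algebraMap (Polynomial F) L (β i)
  have hαβ : ∀ p : MvPolynomial (Fin (r + 1)) C, aeval α p = 0 ↔ aeval β p = 0 := by
    intro p
    have : aeval α p = algebraMap (Polynomial F) L (aeval β p) :=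
      aeval_algebraMap_apply L β p
    rw [this, map_eq_zero_iff _ (IsFractionRing.injective _ _)]
  have hβ : ∀ (p : MvPolynomial (Fin (r + 1)) C) (n : ℕ), p.IsHomogeneous n →
      aeval z' p = 0 → aeval β p = 0 := by
    intro p n hp hp0
    rw [aeval_scale]
    refine Finset.sum_eq_zero fun k _ => ?_
    rw [homogeneousComponent_of_mem hp]
    split_ifs <;> simp [hp0]
  have hmin' : ∀ p : MvPolynomial (Fin (r + 1)) C, p ≠ 0 → aeval α p = 0 →
      y ≤ p.totalDegree := by
    intro p hp hp0
    by_contra hlt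
    push Not at hlt
    apply hp
    rw [← sum_homogeneousComponent p]
    refine Finset.sum_eq_zero fun k hk => ?_
    have h1 := scale_zero z' p ((hαβ p).mp hp0) k
    have h2 := hmin k (by simp at hk; omega)
      (rename e (homogeneousComponent k p))
      ((homogeneousComponent_isHomogeneous k p).rename_isHomogeneous) (by
        rw [← hz', hren]; exact h1)
    rw [← hren (homogeneousComponent k p), h2, map_zero]
  have hh' : (rename e h).IsHomogeneous y := hh.rename_isHomogeneous
  have hne' : rename e h ≠ 0 := by
    intro hc; apply hne; rw [← hren h, hc, map_zero]
  have hα0 : aeval α (rename e h) = 0 :=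
    (hαβ _).mpr (hβ _ y hh' (by rw [hz']; exact h0))
  have hirr : Irreducible (rename e h) := by
    have key : ∀ a b : MvPolynomial (Fin (r + 1)) C, rename e h = a * b →
        aeval α a = 0 → IsUnit b := by
      intro a b hab ha
      have ha0 : a ≠ 0 := by rintro rfl; simp only [zero_mul, mul_zero] at hab; exact hne' hab
      have hb0 : b ≠ 0 := by rintro rfl; simp only [zero_mul, mul_zero] at hab; exact hne' hab
      have h1 := hmin' a ha0 ha
      have h2 := totalDegree_mul_of_isDomain ha0 hb0
      rw [← hab, hh'.totalDegree hne'] at h2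
      have h3 : b.totalDegree = 0 := by omega
      rw [totalDegree_eq_zero_iff_eq_C] at h3
      rw [h3]
      have : b.coeff 0 ≠ 0 := by intro hc; rw [hc, map_zero] at h3; exact hb0 h3
      exact (isUnit_iff_ne_zero.mpr this).map MvPolynomial.C
    refine ⟨?_, ?_⟩
    · intro hu
      have := (hu.map (aeval α)).ne_zero
      exact this hα0
    · intro a b hab
      have := hα0
      rw [hab, map_mul, mul_eq_zero] at this
      rcases this with ha | hb
      · exact Or.inr (key a b hab ha)
      · exact Or.inl (key b a (by rw [hab, mul_comm]) hb)
  have hind : AlgebraicIndependent C (fun i : Fin r => α i.succ) := by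
    rw [algebraicIndependent_iff]
    intro p hp
    have hp' : aeval (fun i : Fin r => β i.succ) p = 0 := by
      have : aeval (fun i : Fin r => α i.succ) p =
          algebraMap (Polynomial F) L (aeval (fun i : Fin r => β i.succ) p) :=
        aeval_algebraMap_apply L (fun i : Fin r => β i.succ) p
      rwa [this, map_eq_zero_iff _ (IsFractionRing.injective _ _)] at hp
    rw [← sum_homogeneousComponent p]
    refine Finset.sum_eq_zero fun k _ => ?_
    have h1 := scale_zero (fun i : Fin r => z' i.succ) p hp' k
    refine hom_span 𝔇 (fun i : Fin r => z' i.succ) ?_ k _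
      (homogeneousComponent_isHomogeneous k p) h1
    intro ψ hψ1 hψ2
    let ψ' : Fin (r + 1) → F := fun j => (Fin.cons 0 ψ : Fin (r + 1) → F) (e j)
    have hsum : ∀ w : Fin (r + 1) → F, ∑ j, ψ' j * w j = ∑ j, ψ j * w (e j.succ) := by
      intro w
      rw [← Equiv.sum_comp e, Fin.sum_univ_succ]
      simp [ψ', e]
    obtain ⟨c, hc⟩ := hann φ ψ' (fun h => hφ0 (by rw [h]; rfl)) hφ ⟨by rw [hsum]; exact hψ1, by
      intro D hD; rw [hsum (fun j => D (z j))]; exact hψ2 D hD⟩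
    have h00 := congrFun hc i0
    simp [ψ', e, hφ0] at h00
    funext j
    have := congrFun hc (e j.succ)
    simpa [ψ', e, h00] using this
  have hg' : (rename e g).IsHomogeneous n := hg.rename_isHomogeneous
  have := dvd_of_algInd α hind _ (rename e g) hirr hα0
    ((hαβ _).mpr (hβ _ n hg' (by rw [hz']; exact g0)))
  have := map_dvd (rename e) this
  rwa [hren, hren] at this

end hyp

end FL

namespace FL

open Matrix

namespace Core

variable {K F Ω σ : Type*} [Field K] [Field F] [Field Ω] [Algebra K F] [Algebra F Ω]
    [Algebra K Ω] [IsScalarTower K F Ω] [IsAlgClosed F] [CharZero F] [Fintype σ] {s : ℕ}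
    {f : Fin s → MvPolynomial σ K} {d : Fin s → ℕ}
    {D : Fin 4 → Derivation K F F} {x : σ → F} {δ : Derivation K Ω Ω} {Y : Fin 4 → Ω}

theorem no_lin (h : Core 5 f d D x δ Y) (l : Fin 4 → F)
    (hY : ∑ a, Y a * algebraMap F Ω (l a) = 0) : l = 0 := by
  by_contra hl
  exact h.case5_lin l hl hY

/-- second fundamental form along a functional -/
def QM (D : Fin 4 → Derivation K F F) (x : σ → F) (ℓ : (σ → F) →ₗ[F] F) : Matrix (Fin 4) (Fin 4) F :=
  Matrix.of fun a b => ℓ (dv (D b) (dv (D a) x))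

theorem two_quad (h : Core 5 f d D x δ Y) (ℓ1 ℓ2 : (σ → F) →ₗ[F] F)
    (h1 : ∀ u ∈ tang D x, ℓ1 u = 0) (h2 : ∀ u ∈ tang D x, ℓ2 u = 0)
    (hli : ∀ a b : F, a • QM D x ℓ1 + b • QM D x ℓ2 = 0 → a = 0 ∧ b = 0) : False := by
  have hs : ∀ ℓ : (σ → F) →ₗ[F] F, (∀ u ∈ tang D x, ℓ u = 0) → (QM D x ℓ)ᵀ = QM D x ℓ := by
    intro ℓ hℓ
    ext a b
    exact h.dd_symm ℓ hℓ a b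
  have hq : ∀ ℓ : (σ → F) →ₗ[F] F, (∀ u ∈ tang D x, ℓ u = 0) → qval (QM D x ℓ) Y = 0 := by
    intro ℓ hℓ
    exact h.frame_dd ℓ fun a => Or.inr (hℓ _ (e_mem D x a))
  rcases pencil_main Y _ _ (hs ℓ1 h1) (hs ℓ2 h2) hli h.no_lin (hq _ h1) (hq _ h2) with
    hr | ⟨M, c, τ, ν, p, hp, hns, hν, hY⟩
  · exact h.R_gen rfl hr
  · have hM := li_mat Y _ M h.no_lin hY
    have hb := h.basis M M⁻¹ (Matrix.nonsing_inv_mul M hM)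
    refine E_lemma hb c τ ν p hp hns hν ?_
    intro a
    have e : (fun a => ∑ b, Y b * algebraMap F Ω (M⁻¹ b a)) = Y ᵥ* (M⁻¹.map (algebraMap F Ω)) := rfl
    have := congrFun e a
    rw [hY, Matrix.vecMul_vecMul, ← Matrix.map_mul, Matrix.mul_nonsing_inv M hM] at this
    simpa [← hY] using this

theorem one_quad (h : Core 5 f d D x δ Y) : ∃ W : Submodule F (σ → F), Module.finrank F W = 6 ∧
    tang D x ≤ W ∧ ∀ a, ∀ u ∈ W, dv (D a) u ∈ W := by
  classical
  by_cases hall : ∀ a b, dv (D b) (dv (D a) x) ∈ tang D x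
  · exfalso
    exact h.stable_false rfl (r := 4) (by norm_num) id Function.injective_id hall
  push Not at hall
  obtain ⟨a0, b0, hab⟩ := hall
  obtain ⟨ℓ0, hℓ0, hne⟩ := sep _ _ hab
  set g := QM D x ℓ0 with hg
  have hg0 : g a0 b0 ≠ 0 := hne
  set E : σ → F := (g a0 b0)⁻¹ • dv (D b0) (dv (D a0) x) with hE
  have hℓE : ℓ0 E = 1 := by
    rw [hE, map_smul, smul_eq_mul]; exact inv_mul_cancel₀ hg0
  have key : ∀ a b, dv (D b) (dv (D a) x) - g a b • E ∈ tang D x := by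
    intro a b
    by_contra hc
    obtain ⟨ℓ, hℓ, hn⟩ := sep _ _ hc
    -- Q_ℓ proportional to g
    by_cases hli : ∀ α β : F, α • QM D x ℓ0 + β • QM D x ℓ = 0 → α = 0 ∧ β = 0
    · exact h.two_quad ℓ0 ℓ hℓ0 hℓ hli
    push Not at hli
    obtain ⟨α, β, h1, h2⟩ := hli
    have hβ : β ≠ 0 := by
      rintro rfl
      have hα : α ≠ 0 := fun h0 => h2 h0 rfl
      have := congrFun (congrFun h1 a0) b0
      simp only [zero_smul, add_zero] at this
      exact mul_ne_zero hα hg0 this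
    have h3 : ∀ a b, ℓ (dv (D b) (dv (D a) x)) = -(β⁻¹ * α) * g a b := by
      intro a b
      have := congrFun (congrFun h1 a) b
      have : α * g a b + β * ℓ (dv (D b) (dv (D a) x)) = 0 := this
      field_simp
      linear_combination this
    apply hn
    rw [map_sub, map_smul, hE, map_smul, h3, h3 a0 b0]
    simp only [smul_eq_mul]
    field_simp
    ring
  let W : Submodule F (σ → F) := tang D x ⊔ Submodule.span F {E}
  have hTW : tang D x ≤ W := le_sup_left
  have hEW : E ∈ W := Submodule.mem_sup_right (Submodule.mem_span_singleton_self E)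
  have hdd : ∀ a b, dv (D b) (dv (D a) x) ∈ W := by
    intro a b
    have := W.add_mem (hTW (key a b)) (W.smul_mem (g a b) hEW)
    simpa using this
  have hdT : ∀ c, ∀ u ∈ tang D x, dv (D c) u ∈ W := fun c =>
    tang_dv W (D c) hTW (hTW (e_mem D x c)) (fun a => hdd a c)
  have hdE : ∀ c, dv (D c) E ∈ W := by
    by_contra hc
    push Not at hc
    obtain ⟨c, hc⟩ := hc
    obtain ⟨ℓ, hℓ, hn⟩ := sep _ _ hc
    have h1 : ∀ a b c, ℓ (dv (D c) (dv (D b) (dv (D a) x))) = g a b * ℓ (dv (D c) E) := by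
      intro a b c
      have e1 := hℓ _ (hdT c _ (key a b))
      have e2 : dv (D b) (dv (D a) x) = (dv (D b) (dv (D a) x) - g a b • E) + g a b • E := by
        simp
      rw [e2, dv_add, map_add, e1, dv_smul, map_add, map_smul, map_smul, hℓ E hEW]
      simp
    have h2 : ∀ a b c, g a b * ℓ (dv (D c) E) = g a c * ℓ (dv (D b) E) := by
      intro a b c
      rw [← h1, ← h1]
      obtain ⟨S, hS⟩ := h.bracket c b
      have := congrArg ℓ (hS (dv (D a) x))
      rw [map_sub, map_sum, Finset.sum_eq_zero, sub_eq_zero] at this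
      · exact this
      · intro e _
        rw [map_smul, hℓ _ (hdd a e), smul_zero]
    -- g a b = u a * θ b
    have hq : ∑ a, ∑ b, Y a * Y b * algebraMap F Ω (g a b) = 0 :=
      h.frame_dd ℓ0 fun a => Or.inr (hℓ0 _ (e_mem D x a))
    have h3 : (∑ a, Y a * algebraMap F Ω (g a c)) *
        (∑ b, Y b * algebraMap F Ω (ℓ (dv (D b) E))) = 0 := by
      have : algebraMap F Ω (ℓ (dv (D c) E)) *
          ∑ a, ∑ b, Y a * Y b * algebraMap F Ω (g a b) = 0 := by rw [hq, mul_zero]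
      rw [← this, Finset.sum_mul_sum, Finset.mul_sum]
      refine Finset.sum_congr rfl fun a _ => ?_
      rw [Finset.mul_sum]
      refine Finset.sum_congr rfl fun b _ => ?_
      have := congrArg (algebraMap F Ω) (h2 a b c)
      rw [map_mul, map_mul] at this
      linear_combination (- Y a * Y b) * this
    rcases mul_eq_zero.mp h3 with h4 | h4
    · have h5 := congrFun (h.no_lin _ h4) a0
      have h6 := h2 a0 b0 c
      simp only [Pi.zero_apply] at h5
      rw [h5, zero_mul] at h6
      exact mul_ne_zero hg0 hn h6
    · have h5 := congrFun (h.no_lin _ h4) c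
      exact hn h5
  refine ⟨W, ?_, hTW, ?_⟩
  · have hT : Module.finrank F (tang D x) = 5 := by
      have h1 := finrank_span_eq_card h.li
      rw [Fintype.card_fin] at h1
      rw [Fin.range_cons, Set.insert_eq] at h1
      exact h1
    have hET : E ∉ tang D x := fun hc => by
      have := hℓ0 _ hc
      rw [hℓE] at this
      exact one_ne_zero this
    have h2 := Submodule.finrank_sup_add_finrank_inf_eq (tang D x) (Submodule.span F {E})
    have hE0 : E ≠ 0 := fun hc => hET (hc ▸ Submodule.zero_mem _)
    have h3 : tang D x ⊓ Submodule.span F {E} = ⊥ := by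
      rw [← disjoint_iff, Submodule.disjoint_span_singleton' hE0]
      exact hET
    rw [h3, finrank_bot, finrank_span_singleton hE0, hT] at h2
    exact h2
  · intro a u hu
    obtain ⟨t, ht, v, hv, rfl⟩ := Submodule.mem_sup.mp hu
    obtain ⟨c, rfl⟩ := Submodule.mem_span_singleton.mp hv
    rw [dv_add, dv_smul]
    exact W.add_mem (hdT a t ht) (W.add_mem (W.smul_mem _ (hdE a)) (W.smul_mem _ hEW))

end Core

end FL

namespace FL

open Matrix MvPolynomial

theorem hom_zero_C {C σ : Type*} [Field C] (p : MvPolynomial σ C) (hp : p.IsHomogeneous 0) :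
    p = MvPolynomial.C (p.coeff 0) := by
  rwa [← totalDegree_zero_iff_isHomogeneous,
    totalDegree_eq_zero_iff_eq_C] at hp

theorem quad_form {C : Type*} [Field C] [CharZero C] {r : ℕ} (h : MvPolynomial (Fin r) C)
    (hh : h.IsHomogeneous 2) : ∃ c : Fin r → Fin r → C, (∀ a b, c a b = c b a) ∧
      ∀ {A : Type*} [Field A] [Algebra C A] (z : Fin r → A), aeval z h =
        ∑ a, ∑ b, algebraMap C A (c a b) * z a * z b := by
  let c0 : Fin r → Fin r → C := fun a b => (pderiv b (pderiv a h)).coeff 0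
  have h0 : ∀ a b, pderiv b (pderiv a h) = MvPolynomial.C (c0 a b) := by
    intro a b
    exact hom_zero_C _ ((hh.pderiv (i := a)).pderiv (i := b))
  refine ⟨fun a b => 2⁻¹ * c0 a b, ?_, ?_⟩
  · intro a b
    have : c0 a b = c0 b a := by
      have h2 : pderiv b (pderiv a h) =
          pderiv a (pderiv b h) := by
        have : ⁅(pderiv b : Derivation C (MvPolynomial (Fin r) C) (MvPolynomial (Fin r) C)),
          (pderiv a : Derivation C (MvPolynomial (Fin r) C) (MvPolynomial (Fin r) C))⁆ = 0 := by
          apply derivation_ext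
          intro i
          simp [Derivation.commutator_apply, pderiv_X, Pi.single_apply, apply_ite]
        have := DFunLike.congr_fun this h
        rw [Derivation.commutator_apply, Derivation.zero_apply, sub_eq_zero] at this
        exact this
      simp only [c0, h2]
    simp only [this]
  · intro A _ _ z
    have e1 := congrArg (aeval z) hh.sum_X_mul_pderiv
    have e2 : ∀ a, aeval z (pderiv a h) =
        ∑ b, z b * algebraMap C A (c0 a b) := by
      intro a
      have := congrArg (aeval z) (hh.pderiv (i := a)).sum_X_mul_pderiv
      simp only [h0, map_sum, map_mul, aeval_X, aeval_C] at this
      rw [this]; simp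
    rw [map_sum, map_nsmul] at e1
    simp only [map_mul, aeval_X, e2] at e1
    have h2 : (algebraMap C A 2) * algebraMap C A 2⁻¹ = 1 := by
      rw [← map_mul, mul_inv_cancel₀ two_ne_zero, map_one]
    have h3 : (algebraMap C A 2) = 2 := map_ofNat _ 2
    rw [h3] at h2
    have h4 : aeval z h = algebraMap C A 2⁻¹ * (2 • aeval z h) := by
      rw [nsmul_eq_mul, Nat.cast_ofNat]
      linear_combination (-aeval z h) * h2
    rw [h4, ← e1, Finset.mul_sum]
    refine Finset.sum_congr rfl fun a _ => ?_
    rw [Finset.mul_sum, Finset.mul_sum]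
    refine Finset.sum_congr rfl fun b _ => ?_
    rw [map_mul]
    ring

theorem isotropic {F : Type*} [Field F] [IsAlgClosed F] (G : Fin 4 → Fin 4 → F) :
    ∃ p q : Fin 4 → F, LinearIndependent F ![p, q] ∧ (∑ a, ∑ b, G a b * p a * p b = 0) ∧
      (∑ a, ∑ b, G a b * p a * q b = 0) ∧ (∑ a, ∑ b, G a b * q a * q b = 0) := by
  classical
  let Q : MvPolynomial (Fin 4) F :=
    ∑ a, ∑ b, MvPolynomial.C (G a b) * MvPolynomial.X a * MvPolynomial.X b
  have hQ : Q.IsHomogeneous 2 := by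
    refine IsHomogeneous.sum _ _ _ fun a _ => ?_
    refine IsHomogeneous.sum _ _ _ fun b _ => ?_
    exact ((isHomogeneous_C _ _).mul (isHomogeneous_X _ a)).mul
      (isHomogeneous_X _ b)
  have hQe : ∀ u, eval u Q = ∑ a, ∑ b, G a b * u a * u b := by
    intro u; simp [Q]
  obtain ⟨p, hp0, hp⟩ := common_zero (n := 4) (N := 1) (by norm_num) (fun _ => Q) (fun _ => 2)
    (fun _ => by norm_num) (fun _ => hQ)
  obtain ⟨a0, ha0⟩ : ∃ a, p a ≠ 0 := by
    by_contra hc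
    push Not at hc
    exact hp0 (funext hc)
  let L : MvPolynomial (Fin 4) F :=
    ∑ a, ∑ b, MvPolynomial.C (G a b * p a) * MvPolynomial.X b
  have hL : L.IsHomogeneous 1 := by
    refine IsHomogeneous.sum _ _ _ fun a _ => ?_
    refine IsHomogeneous.sum _ _ _ fun b _ => ?_
    exact (isHomogeneous_C _ _).mul (isHomogeneous_X _ b)
  obtain ⟨q, hq0, hq⟩ := common_zero (n := 4) (N := 3) (by norm_num)
    ![Q, L, MvPolynomial.X a0] ![2, 1, 1] (by intro i; fin_cases i <;> simp) (by
      intro i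
      fin_cases i
      · exact hQ
      · exact hL
      · exact isHomogeneous_X _ a0)
  refine ⟨p, q, ?_, ?_, ?_, ?_⟩
  · rw [LinearIndependent.pair_iff]
    intro α β hab
    have h2 : q a0 = 0 := by simpa using hq 2
    have h1 := congrFun hab a0
    simp [h2, ha0] at h1
    rw [h1, zero_smul, zero_add, smul_eq_zero] at hab
    exact ⟨h1, hab.resolve_right hq0⟩
  · rw [← hQe]; exact hp 0
  · have : eval q L = 0 := hq 1
    simpa [L] using this
  · rw [← hQe]; exact hq 0


theorem pderiv_restr {K C σ : Type*} [Field K] [Field C] [Algebra K C] [Fintype σ] {r : ℕ}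
    (w : Fin r → σ → C) (g : MvPolynomial σ K) (b : Fin r) :
    pderiv b (restr w g) = ∑ j, restr w (pderiv j g) * MvPolynomial.C (w b j) := by
  classical
  unfold restr
  have := deriv_aeval ((pderiv b :
    Derivation C (MvPolynomial (Fin r) C) (MvPolynomial (Fin r) C)).restrictScalars K)
    (fun j => ∑ b, MvPolynomial.C (w b j) * MvPolynomial.X b) g
  refine Eq.trans this ?_
  refine Finset.sum_congr rfl fun j _ => ?_
  congr 1
  simp [pderiv_X, Pi.single_apply]

namespace Core

variable {K F Ω σ : Type*} [Field K] [Field F] [Field Ω] [Algebra K F] [Algebra F Ω]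
    [Algebra K Ω] [IsScalarTower K F Ω] [IsAlgClosed F] [CharZero F] [Fintype σ] {s : ℕ}
    {f : Fin s → MvPolynomial σ K} {d : Fin s → ℕ}
    {D : Fin 4 → Derivation K F F} {x : σ → F} {δ : Derivation K Ω Ω} {Y : Fin 4 → Ω}

theorem row_false {C : Type*} [Field C] [Algebra K C] [Algebra C F] [IsScalarTower K C F]
    (h : Core 5 f d D x δ Y) (hd : ∀ i, 2 ≤ d i) (ι : Fin 6 → σ) (w : Fin 6 → σ → C)
    (hw : ∀ b c, w b (ι c) = if b = c then 1 else 0)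
    (i : Fin s) {N : ℕ} (hN : s + N ≤ 5) (ex : Fin N → MvPolynomial (Fin 6) C) (e : Fin N → ℕ)
    (he : ∀ l, 0 < e l) (hex : ∀ l, (ex l).IsHomogeneous (e l))
    (hz : ∀ u : Fin 6 → F, (∀ l, aeval u (ex l) = 0) →
      (∀ l, aeval u (restr w (f l)) = 0) ∧
      ∀ b, aeval u (pderiv b (restr w (f i))) = 0) : False := by
  classical
  have hι : Function.Injective ι := by
    intro b c hbc
    by_contra hne
    have h1 := hw b c
    rw [← hbc, hw b b, if_pos rfl, if_neg hne] at h1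
    exact one_ne_zero h1
  let J := {j : σ // j ∉ Set.range ι}
  have hJ : Fintype.card J = s := by
    have h1 := Fintype.card_subtype_compl (fun j => j ∈ Set.range ι)
    have h2 : Fintype.card {j // j ∈ Set.range ι} = 6 := by
      have := Set.card_range_of_injective hι
      rw [Fintype.card_fin] at this
      exact this
    rw [h2, h.hcard] at h1
    have h3 : Fintype.card J = 5 + s + 1 - 6 := h1
    omega
  let P : Fin N ⊕ J → MvPolynomial (Fin 6) C :=
    Sum.elim ex (fun j => restr w (pderiv j.1 (f i)))
  let eP : Fin N ⊕ J → ℕ := Sum.elim e (fun _ => d i - 1)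
  let eq : Fin (Fintype.card (Fin N ⊕ J)) ≃ Fin N ⊕ J := (Fintype.equivFin _).symm
  obtain ⟨u, hu0, hu⟩ := common_zero (n := 6) (N := Fintype.card (Fin N ⊕ J))
    (by rw [Fintype.card_sum, Fintype.card_fin, hJ]; omega)
    (fun l => MvPolynomial.map (algebraMap C F) (P (eq l))) (fun l => eP (eq l)) (by
      intro l
      rcases eq l with l | l
      · exact he l
      · have := hd i
        simp only [eP, Sum.elim_inr]; omega) (by
      intro l
      apply IsHomogeneous.map
      rcases eq l with l | l
      · exact hex l
      · exact restr_homog w _ _ ((h.hf i).pderiv))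
  have hu' : ∀ l, aeval u (P l) = 0 := by
    intro l
    have := hu (eq.symm l)
    simp only [Equiv.apply_symm_apply] at this
    rw [eval_map] at this
    exact this
  obtain ⟨hz1, hz2⟩ := hz u (fun l => hu' (Sum.inl l))
  let v : σ → F := fun j => ∑ b, u b * algebraMap C F (w b j)
  have hv0 : v ≠ 0 := by
    intro hv
    apply hu0
    funext c
    have := congrFun hv (ι c)
    simpa [v, hw, apply_ite] using this
  have hvf : ∀ l, aeval v (f l) = 0 := by
    intro l
    have := aeval_restr w (f l) u
    rw [hz1] at this
    exact this.symm
  have hli := (h.hsm v hv0 hvf).ne_zero i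
  apply hli
  have hoff : ∀ j, j ∉ Set.range ι → aeval v (pderiv j (f i)) = 0 := by
    intro j hj
    have h1 := hu' (Sum.inr ⟨j, hj⟩)
    have h2 := aeval_restr w (pderiv j (f i)) u
    exact h2.symm.trans h1
  funext j
  change aeval v (pderiv j (f i)) = 0
  by_cases hj : j ∈ Set.range ι
  · obtain ⟨b, rfl⟩ := hj
    have h1 := hz2 b
    rw [pderiv_restr, map_sum, Finset.sum_eq_single (ι b)] at h1
    · rw [map_mul, hw, if_pos rfl, aeval_restr] at h1
      simpa using h1
    · intro j _ hjb
      rw [map_mul, aeval_restr]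
      by_cases hj : j ∈ Set.range ι
      · obtain ⟨c, rfl⟩ := hj
        rw [hw, if_neg (fun hbc => hjb (by rw [hbc]))]
        simp
      · have := hoff j hj
        rw [show (fun j => ∑ b, u b * algebraMap C F (w b j)) = v from rfl, this, zero_mul]
    · simp
  · exact hoff j hj

end Core

end FL

namespace FL

open Matrix

namespace Core

variable {K F Ω σ : Type*} [Field K] [Field F] [Field Ω] [Algebra K F] [Algebra F Ω]
    [Algebra K Ω] [IsScalarTower K F Ω] [IsAlgClosed F] [CharZero F] [Fintype σ] {s : ℕ}
    {f : Fin s → MvPolynomial σ K} {d : Fin s → ℕ}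
    {D : Fin 4 → Derivation K F F} {x : σ → F} {δ : Derivation K Ω Ω} {Y : Fin 4 → Ω}

theorem deg_combo (s y : ℕ) (hs : 2 ≤ s) (d : Fin s → ℕ) (hd : ∀ i, 2 ≤ d i)
    (hm : ∑ i, (d i - 1) = 5) (hy : 3 ≤ y) :
    (∀ i, d i < y) ∨ (∃ i, d i < y ∧ s ≤ 4) ∨ (∃ i, y < d i ∧ s ≤ 3) := by
  by_contra hc
  push Not at hc
  obtain ⟨⟨i0, h0⟩, h1, h2⟩ := hc
  have h3 : s ≤ 5 := by
    have : ∑ i : Fin s, 1 ≤ ∑ i, (d i - 1) :=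
      Finset.sum_le_sum fun i _ => by have := hd i; omega
    simp at this
    omega
  have hge : ∀ i, s ≤ 4 → y ≤ d i := fun i hs4 => by
    by_contra hlt
    have := h1 i (by omega)
    omega
  have hle : ∀ i, s ≤ 3 → d i ≤ y := fun i hs4 => by
    by_contra hlt
    have := h2 i (by omega)
    omega
  have hdi := fun i => hd i
  interval_cases s
  · simp only [Fin.sum_univ_two] at hm
    have := hge 0 (by norm_num); have := hge 1 (by norm_num)
    have := hle 0 (by norm_num); have := hle 1 (by norm_num)
    omega
  · simp only [Fin.sum_univ_three] at hm
    have := hge 0 (by norm_num); have := hge 1 (by norm_num); have := hge 2 (by norm_num)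
    omega
  · simp only [Fin.sum_univ_four] at hm
    have := hge 0 (by norm_num); have := hge 1 (by norm_num); have := hge 2 (by norm_num)
    omega
  · have : ∑ i : Fin 5, (if i = i0 then 2 else 1) ≤ ∑ i, (d i - 1) :=
      Finset.sum_le_sum fun i _ => by
        have := hd i
        split_ifs with hi
        · subst hi; omega
        · omega
    rw [hm] at this
    fin_cases i0 <;> simp [Fin.sum_univ_five] at this

theorem six_false (h : Core 5 f d D x δ Y) (hd : ∀ i, 2 ≤ d i) (hs : 2 ≤ s) : False := by
  classical
  obtain ⟨W, hW6, hTW, hst⟩ := h.one_quad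
  let 𝔇 : Set (Derivation K F F) := Set.range D
  obtain ⟨ι, w, hw, hwW, hWc⟩ := descent 𝔇 W 6 hW6 (by
    rintro _ ⟨a, rfl⟩ u hu
    exact hst a u hu)
  let 𝔇' : Set (Derivation (constF 𝔇) F F) := {D' | ∃ D, ∃ hD : D ∈ 𝔇, D' = constDer 𝔇 D hD}
  let z : Fin 6 → F := fun b => x (ι b)
  let ε : Fin 4 → Fin 6 → F := fun a b => D a (x (ι b))
  have hxW : x ∈ W := hTW (x_mem D x)
  have heW : ∀ a, dv (D a) x ∈ W := fun a => hTW (e_mem D x a)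
  have hxj : ∀ j, x j = ∑ b, z b * (w b j : F) := fun j => hWc x hxW j
  have hej : ∀ a j, D a (x j) = ∑ b, ε a b * (w b j : F) := fun a j => hWc _ (heW a) j
  have hDc : ∀ a (c : constF 𝔇), D a (c : F) = 0 := fun a c => c.2 _ ⟨a, rfl⟩
  -- linear independence of z, ε
  have hli : LinearIndependent F (Fin.cons z ε : Fin 5 → Fin 6 → F) := by
    rw [Fintype.linearIndependent_iff]
    intro c hc
    have := Fintype.linearIndependent_iff.mp h.li c ?_
    · exact this
    · funext j
      simp only [Fin.sum_univ_succ (n := 4), Fin.cons_zero, Fin.cons_succ] at hc ⊢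
      have hc' : ∀ b, c 0 * z b + ∑ a : Fin 4, c a.succ * ε a b = 0 := by
        intro b
        have := congrFun hc b
        simpa [Finset.sum_apply] using this
      simp only [Pi.add_apply, Pi.smul_apply, smul_eq_mul, Finset.sum_apply, Pi.zero_apply]
      simp only [hej]
      rw [hxj j]
      have : ∑ b, (c 0 * z b + ∑ a : Fin 4, c a.succ * ε a b) * (w b j : F) = 0 :=
        Finset.sum_eq_zero fun b _ => by rw [hc' b, zero_mul]
      rw [← this]
      simp only [add_mul, Finset.sum_add_distrib, Finset.mul_sum, Finset.sum_mul]
      rw [Finset.sum_comm]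
      simp only [mul_assoc]
  have hann : ∀ φ ψ, φ ≠ 0 → Ann 𝔇' z φ → Ann 𝔇' z ψ → ∃ c : F, ψ = c • φ := by
    intro φ ψ hφ h1 h2
    let M : Matrix (Fin 5) (Fin 6) F := Matrix.of (Fin.cons z ε : Fin 5 → Fin 6 → F)
    have hker : ∀ φ, Ann 𝔇' z φ → φ ∈ LinearMap.ker M.mulVecLin := by
      intro φ hφ
      rw [LinearMap.mem_ker, Matrix.mulVecLin_apply]
      funext a
      refine Fin.cases ?_ (fun a => ?_) a
      · have := hφ.1
        simp only [Matrix.mulVec, dotProduct, M, Matrix.of_apply, Fin.cons_zero, Pi.zero_apply]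
        rw [← this]
        exact Finset.sum_congr rfl fun _ _ => mul_comm _ _
      · have := hφ.2 (constDer 𝔇 (D a) ⟨a, rfl⟩) ⟨D a, ⟨a, rfl⟩, rfl⟩
        simp only [Matrix.mulVec, dotProduct, M, Matrix.of_apply, Fin.cons_succ, Pi.zero_apply]
        rw [← this]
        exact Finset.sum_congr rfl fun _ _ => mul_comm _ _
    have hrank : M.rank = 5 := by
      have := LinearIndependent.rank_matrix (M := M) hli
      rw [this, Fintype.card_fin]
    have hk := LinearMap.finrank_range_add_finrank_ker M.mulVecLin
    rw [show Module.finrank F (LinearMap.range M.mulVecLin) = 5 from hrank] at hk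
    simp at hk
    have hk1 : Module.finrank F (LinearMap.ker M.mulVecLin) = 1 := by omega
    obtain ⟨c, hc⟩ := (finrank_eq_one_iff_of_nonzero'
      (⟨φ, hker φ h1⟩ : LinearMap.ker M.mulVecLin) (by
        intro h0; exact hφ (congrArg Subtype.val h0))).mp hk1 ⟨ψ, hker ψ h2⟩
    exact ⟨c, (congrArg Subtype.val hc).symm⟩
  have hfz : ∀ i, MvPolynomial.aeval z (restr w (f i)) = 0 := by
    intro i
    rw [aeval_restr, ← h.fx i]
    congr 2
    funext j
    exact (hxj j).symm
  have hev : ∀ i (w0 : F) (p : Fin 4 → F), MvPolynomial.aeval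
      (fun j => w0 * x j + ∑ a, p a * D a (x j)) (f i) =
      MvPolynomial.aeval (fun b => w0 * z b + ∑ a, p a * ε a b) (restr w (f i)) := by
    intro i w0 p
    rw [aeval_restr]
    congr 2
    funext j
    simp only [hej]
    rw [hxj j]
    simp only [add_mul, Finset.sum_add_distrib, Finset.mul_sum, Finset.sum_mul]
    rw [Finset.sum_comm]
    simp only [mul_assoc]
    rfl
  have hall0 : (∀ i, restr w (f i) = 0) → False := by
    intro h0
    refine h.no_plane rfl (Pi.single 0 1) (Pi.single 1 1) ?_ ?_
    · rw [LinearIndependent.pair_iff]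
      intro α β hab
      have e1 := congrFun hab 0
      have e2 := congrFun hab 1
      simp [Pi.single_apply] at e1 e2
      exact ⟨e1, e2⟩
    · intro w0 t i
      rw [hev, h0, map_zero]
  by_cases hex : ∃ y, ∃ g : MvPolynomial (Fin 6) (constF 𝔇), g.IsHomogeneous y ∧ g ≠ 0 ∧
      MvPolynomial.aeval z g = 0
  swap
  · push Not at hex
    refine hall0 fun i => ?_
    by_contra h0
    exact hex (d i) _ (restr_homog w _ _ (h.hf i)) h0 (hfz i)
  obtain ⟨g, hg, hgne, hg0⟩ := Nat.find_spec hex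
  have hmin : ∀ n < Nat.find hex, ∀ g : MvPolynomial (Fin 6) (constF 𝔇), g.IsHomogeneous n →
      MvPolynomial.aeval z g = 0 → g = 0 := by
    intro n hn g' h1 h2
    by_contra h3
    exact Nat.find_min hex hn ⟨g', h1, h3, h2⟩
  generalize Nat.find hex = y at *
  have hy1 : 1 ≤ y := by
    by_contra hlt
    have : y = 0 := by omega
    subst this
    rw [hom_zero_C g hg] at hg0 hgne
    rw [MvPolynomial.aeval_C] at hg0
    apply hgne
    rw [(map_eq_zero_iff _ (algebraMap (constF 𝔇) F).injective).mp hg0, map_zero]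
  have hdvd : ∀ i, g ∣ restr w (f i) := fun i =>
    dvd_hom 𝔇' z hann g y hy1 hg hgne hg0 hmin (d i) _ (restr_homog w _ _ (h.hf i)) (hfz i)
  have hvan : ∀ u : Fin 6 → F, MvPolynomial.aeval u g = 0 → ∀ i,
      MvPolynomial.aeval u (restr w (f i)) = 0 := by
    intro u hu i
    obtain ⟨q, hq⟩ := hdvd i
    rw [hq, map_mul, hu, zero_mul]
  have hder : ∀ a, ∑ b, MvPolynomial.aeval z (MvPolynomial.pderiv b g) * ε a b = 0 := by
    intro a
    have := deriv_aeval (constDer 𝔇 (D a) ⟨a, rfl⟩) z g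
    rw [hg0, map_zero] at this
    exact this.symm
  have hquot : ∀ i, (d i < y → restr w (f i) = 0) ∧ (y ≤ d i → ∃ q', q'.IsHomogeneous (d i - y) ∧
      restr w (f i) = g * q') := by
    intro i
    obtain ⟨q, hq⟩ := hdvd i
    exact hom_quot g q _ y (d i) hg (restr_homog w _ _ (h.hf i)) hq
  rcases Nat.lt_or_ge y 3 with hy3 | hy3
  · -- planes
    obtain rfl | rfl : y = 1 ∨ y = 2 := by omega
    · -- linear
      have hlin : ∀ u : Fin 6 → F, MvPolynomial.aeval u g =
          ∑ b, u b * MvPolynomial.aeval z (MvPolynomial.pderiv b g) := by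
        intro u
        have e1 := congrArg (MvPolynomial.aeval u) hg.sum_X_mul_pderiv
        rw [one_nsmul] at e1
        rw [← e1, map_sum]
        refine Finset.sum_congr rfl fun b _ => ?_
        rw [map_mul, MvPolynomial.aeval_X]
        have h0 := hom_zero_C _ (hg.pderiv (i := b))
        rw [h0, MvPolynomial.aeval_C, MvPolynomial.aeval_C]
      refine h.no_plane rfl (Pi.single 0 1) (Pi.single 1 1) ?_ ?_
      · rw [LinearIndependent.pair_iff]
        intro α β hab
        have e1 := congrFun hab 0
        have e2 := congrFun hab 1
        simp [Pi.single_apply] at e1 e2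
        exact ⟨e1, e2⟩
      · intro w0 t i
        rw [hev]
        apply hvan
        rw [hlin]
        have e1 := hlin z
        rw [hg0] at e1
        generalize (Pi.single 0 1 : Fin 4 → F) = p0
        generalize (Pi.single 1 1 : Fin 4 → F) = p1
        have e2 : ∀ p : Fin 4 → F, ∑ b, (∑ a, p a * ε a b) *
            MvPolynomial.aeval z (MvPolynomial.pderiv b g) = 0 := by
          intro p
          simp only [Finset.sum_mul]
          rw [Finset.sum_comm]
          refine Finset.sum_eq_zero fun a _ => ?_
          rw [← mul_zero (p a), ← hder a, Finset.mul_sum]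
          refine Finset.sum_congr rfl fun b _ => ?_
          ring
        simp only [add_mul, Finset.sum_add_distrib]
        have e3 := e2 (fun a => p0 a + t * p1 a)
        simp only [add_mul, Finset.sum_add_distrib] at e3
        rw [e3, add_zero]
        simp only [mul_assoc]
        rw [← Finset.mul_sum, ← e1, mul_zero]
    · obtain ⟨c, hcs, hc⟩ := quad_form g hg
      let β : (Fin 6 → F) → (Fin 6 → F) → F := fun u v =>
        ∑ a, ∑ b, algebraMap (constF 𝔇) F (c a b) * u a * v b
      have hβ : ∀ u, MvPolynomial.aeval u g = β u u := fun u => hc u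
      have hβs : ∀ u v, β u v = β v u := by
        intro u v
        simp only [β]
        rw [Finset.sum_comm]
        refine Finset.sum_congr rfl fun a _ => Finset.sum_congr rfl fun b _ => ?_
        rw [hcs]; ring
      let B : (Fin 6 → F) →ₗ[F] (Fin 6 → F) →ₗ[F] F := LinearMap.mk₂ F β
        (by intro u u' v; simp only [β, Pi.add_apply, mul_add, add_mul, Finset.sum_add_distrib])
        (by intro a u v; simp only [β, Pi.smul_apply, smul_eq_mul, Finset.mul_sum]
            refine Finset.sum_congr rfl fun a _ => Finset.sum_congr rfl fun b _ => ?_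
            ring)
        (by intro u u' v; simp only [β, Pi.add_apply, mul_add, Finset.sum_add_distrib])
        (by intro a u v; simp only [β, Pi.smul_apply, smul_eq_mul, Finset.mul_sum]
            refine Finset.sum_congr rfl fun a _ => Finset.sum_congr rfl fun b _ => ?_
            ring)
      have hB : ∀ u v, B u v = β u v := fun u v => rfl
      have hBs : ∀ u v, B u v = B v u := hβs
      have hBzz : B z z = 0 := by rw [hB, ← hβ, hg0]
      have hBze : ∀ a, B z (ε a) = 0 := by
        intro a
        have h1 : D a (B z z) = 0 := by rw [hBzz, map_zero]
        have h2 : D a (B z z) = B z (ε a) + B (ε a) z := by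
          simp only [hB, β, map_sum, ← Finset.sum_add_distrib]
          refine Finset.sum_congr rfl fun b _ => Finset.sum_congr rfl fun b' _ => ?_
          have : D a (algebraMap (constF 𝔇) F (c b b')) = 0 := hDc a _
          rw [Derivation.leibniz, Derivation.leibniz, this]
          simp only [smul_eq_mul, z, ε]
          ring
        rw [h1, hBs (ε a), ← two_mul] at h2
        exact (mul_eq_zero.mp h2.symm).resolve_left two_ne_zero
      obtain ⟨p, q, hpq, e1, e2, e3⟩ := isotropic (fun a b => B (ε a) (ε b))
      let P : Fin 6 → F := ∑ a, p a • ε a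
      let Q : Fin 6 → F := ∑ a, q a • ε a
      have hsum : ∀ p q : Fin 4 → F, B (∑ a, p a • ε a) (∑ a, q a • ε a) =
          ∑ a, ∑ b, B (ε a) (ε b) * p a * q b := by
        intro p q
        simp only [map_sum, LinearMap.sum_apply, map_smul, LinearMap.smul_apply, smul_eq_mul]
        rw [Finset.sum_comm]
        refine Finset.sum_congr rfl fun a _ => ?_
        rw [Finset.mul_sum]
        refine Finset.sum_congr rfl fun b _ => ?_
        ring
      have hPP : B P P = 0 := by rw [hsum]; exact e1
      have hPQ : B P Q = 0 := by rw [hsum]; exact e2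
      have hQQ : B Q Q = 0 := by rw [hsum]; exact e3
      have hzs : ∀ p : Fin 4 → F, B z (∑ a, p a • ε a) = 0 := by
        intro p
        simp [map_sum, hBze]
      refine h.no_plane rfl p q hpq ?_
      intro w0 t i
      rw [hev]
      apply hvan
      have : (fun b => w0 * z b + ∑ a, (p a + t * q a) * ε a b) = w0 • z + (P + t • Q) := by
        funext b
        simp [P, Q, Finset.sum_apply, add_mul, Finset.sum_add_distrib, Finset.mul_sum, mul_assoc]
      rw [this, hβ, ← hB]
      simp only [map_add, LinearMap.add_apply, map_smul, LinearMap.smul_apply, hBzz, hPP, hPQ, hQQ,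
        hBs Q P, hBs P z, hBs Q z, hzs p, hzs q, P, Q, smul_zero, add_zero]
  · rcases deg_combo s y hs d hd h.hm hy3 with hA | ⟨i, hi, hs4⟩ | ⟨i, hi, hs3⟩
    · exact hall0 fun i => (hquot i).1 (hA i)
    · refine h.row_false hd ι w hw i (N := 1) (by omega) (fun _ => g) (fun _ => y)
        (fun _ => by omega) (fun _ => hg) ?_
      intro u hu
      refine ⟨hvan u (hu 0), fun b => ?_⟩
      rw [(hquot i).1 hi, map_zero, map_zero]
    · obtain ⟨q, hq, hfq⟩ := (hquot i).2 (by omega)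
      refine h.row_false hd ι w hw i (N := 2) (by omega) ![g, q] ![y, d i - y] ?_ ?_ ?_
      · intro l; fin_cases l
        · exact hy1
        · simp; omega
      · intro l; fin_cases l
        · exact hg
        · exact hq
      · intro u hu
        have h0 : MvPolynomial.aeval u g = 0 := hu 0
        have h1 : MvPolynomial.aeval u q = 0 := hu 1
        refine ⟨hvan u h0, fun b => ?_⟩
        rw [hfq, Derivation.leibniz, map_add, smul_eq_mul, smul_eq_mul, map_mul, map_mul, h0, h1]
        simp

end Core

end FL

namespace FL

open Matrix MvPolynomial

theorem EN_int {F L σ : Type*} [Field F] [Field L] [Algebra F L] [Fintype σ] {s r : ℕ}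
    (e : Fin s → ℕ) (he : ∀ i, 1 ≤ e i) (R : Fin s → σ → MvPolynomial (Fin (r + 1)) F)
    (hR : ∀ i j, (R i j).IsHomogeneous (e i))
    (hρ : ∀ k : Fin (r + 1), ∃ M : ℕ, ∃ ρ : Fin s → σ → MvPolynomial (Fin (r + 1)) F,
      ∀ l i, ∑ j, R i j * ρ l j = if i = l then X k ^ M else 0)
    (p : Fin (r + 1) → L) (hp : p 0 = 1) (t : Fin s → L)
    (V : ValuationSubring L) (hF : ∀ c : F, algebraMap F L c ∈ V)
    (hG : ∀ j, ∑ i, t i * aeval p (R i j) ∈ V) (l : Fin s) (b : Fin (r + 1)) :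
    p b * t l ∈ V := by
  obtain ⟨k, hk⟩ := Finite.exists_max (fun b => V.valuation (p b))
  have hk0 : p k ≠ 0 := by
    intro h0
    have := hk 0
    rw [h0, hp] at this
    simp at this
  obtain ⟨M, ρ, hρ⟩ := hρ k
  have hp' : ∀ b, p b / p k ∈ V := by
    intro b
    rw [← ValuationSubring.valuation_le_one_iff, map_div₀]
    exact div_le_one_of_le₀ (hk b) zero_le'
  have hpoly : ∀ g : MvPolynomial (Fin (r + 1)) F,
      aeval (fun b => p b / p k) g ∈ V := by
    intro g
    induction g using MvPolynomial.induction_on with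
    | C a => simpa using hF a
    | add a b ha hb => rw [map_add]; exact V.add_mem _ _ ha hb
    | mul_X a i ha => rw [map_mul, aeval_X]; exact V.mul_mem _ _ ha (hp' i)
  have ht : ∀ l, t l * p k ^ e l ∈ V := by
    intro l
    have h1 : t l * p k ^ e l = ∑ j, aeval (fun b => p b / p k) (ρ l j) *
        ∑ i, t i * aeval p (R i j) := by
      have h2 : ∀ i j, aeval p (R i j) =
          p k ^ e i * aeval (fun b => p b / p k) (R i j) := by
        intro i j
        rw [← aeval_smul_homog (hR i j)]
        congr 2
        funext b
        field_simp
      simp_rw [h2, Finset.mul_sum]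
      rw [Finset.sum_comm]
      have h3 : ∀ i, ∑ j, aeval (fun b => p b / p k) (ρ l j) *
          (t i * (p k ^ e i * aeval (fun b => p b / p k) (R i j))) =
          if i = l then t i * p k ^ e i else 0 := by
        intro i
        have := congrArg (aeval (fun b => p b / p k)) (hρ l i)
        rw [map_sum] at this
        simp_rw [map_mul] at this
        calc _ = t i * p k ^ e i * ∑ j, aeval (fun b => p b / p k) (R i j) *
            aeval (fun b => p b / p k) (ρ l j) := by
              rw [Finset.mul_sum]; refine Finset.sum_congr rfl fun j _ => by ring
          _ = _ := by
              rw [this]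
              split_ifs with h
              · simp [hk0]
              · simp
      simp_rw [h3]
      simp
    rw [h1]
    exact sum_mem fun j _ => V.mul_mem _ _ (hpoly _) (hG j)
  have h5 : p b * t l = (p b / p k) * (p 0 / p k) ^ (e l - 1) * (t l * p k ^ e l) := by
    obtain ⟨q, hq⟩ := Nat.exists_eq_add_of_le (he l)
    rw [hq, hp, show 1 + q - 1 = q by omega]
    rw [one_div, inv_pow]
    have : p k ^ q ≠ 0 := pow_ne_zero _ hk0
    field_simp
    ring
  rw [h5]
  exact V.mul_mem _ _ (V.mul_mem _ _ (hp' b) (pow_mem (hp' 0) _)) (ht l)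

theorem EN {K F σ : Type*} [Field K] [Field F] [Algebra K F] [IsAlgClosed F] [Fintype σ]
    {s : ℕ} (f : Fin s → MvPolynomial σ K) (d : Fin s → ℕ) (hf : ∀ i, (f i).IsHomogeneous (d i))
    (hd : ∀ i, 2 ≤ d i) (hsm : Smooth F f) (hcard : Fintype.card σ ≤ s + 6) (i0 : Fin s)
    (W : Submodule F (σ → F)) (hW4 : Module.finrank F W = 4)
    (hW : ∀ u ∈ W, ∀ i, aeval u (f i) = 0) : False := by
  classical
  obtain ⟨ι, w, hι, hspan⟩ := exists_coords W 4 hW4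
  have hinf : Infinite F := IsAlgClosed.instInfinite
  let w' : Fin 4 → σ → F := fun b => (w b : σ → F)
  let R : Fin s → σ → MvPolynomial (Fin (3 + 1)) F := fun i j =>
    restr w' (pderiv j (f i))
  have hz : ∀ z : Fin 4 → F, (fun j => ∑ b, z b * w' b j) ∈ W := by
    intro z
    have : (fun j => ∑ b, z b * w' b j) = ((∑ b, z b • w b : W) : σ → F) := by
      funext j; simp [w']
    rw [this]; exact Subtype.mem _
  have hr0 : ∀ i, restr w' (f i) = 0 := by
    intro i
    apply MvPolynomial.funext
    intro z
    rw [map_zero, ← coe_aeval_eq_eval]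
    have := aeval_restr (A := F) w' (f i) z
    refine this.trans ?_
    simp only [Algebra.algebraMap_self, RingHom.id_apply]
    exact hW _ (hz z) i
  have hR : ∀ i j, (R i j).IsHomogeneous (d i - 1) := by
    intro i j
    exact restr_homog _ _ _ ((hf i).pderiv)
  have hrel : ∀ i b, ∑ j, R i j * C (w' b j) = 0 := by
    intro i b
    have := pderiv_restr w' (f i) b
    rw [hr0, map_zero] at this
    exact this.symm
  have hρ : ∀ k : Fin (3 + 1), ∃ M : ℕ, ∃ ρ : Fin s → σ → MvPolynomial (Fin (3 + 1)) F,
      ∀ l i, ∑ j, R i j * ρ l j = if i = l then X k ^ M else 0 := by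
    intro k
    obtain ⟨M, ρ, h⟩ := rho_exists (F := F) (Matrix.of R) (X k) (by
      intro φ hφ
      have h1 := hsm (fun j => ∑ b, φ (X b) * w' b j) (by
        intro h0
        apply hφ
        have := congrFun h0 (ι k)
        simpa [w', hι] using this) (fun i => hW _ (hz _) i)
      convert h1 using 1
      funext i j
      simp only [Matrix.map_apply, Matrix.of_apply, Jac, R]
      have h2 : φ = aeval (fun b => φ (X b)) := by
        ext b; simp
      rw [h2]
      have := aeval_restr (A := F) w' (pderiv j (f i)) (fun b => φ (X b))
      simpa using this)
    refine ⟨M, ρ, fun l i => ?_⟩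
    have := congrFun (h l) i
    simp only [mulVec, dotProduct, Matrix.of_apply, Pi.smul_apply, Pi.single_apply, smul_eq_mul, mul_ite, mul_one, mul_zero] at this
    exact this
  let A := MvPolynomial (Fin s ⊕ Fin 3) F
  let L := FractionRing A
  let t : Fin s → L := fun i => algebraMap A L (X (Sum.inl i))
  let p : Fin (3 + 1) → L := Fin.cons 1 (fun b => algebraMap A L (X (Sum.inr b)))
  let G : σ → L := fun j => ∑ i, t i * aeval p (R i j)
  let S := (Finset.univ.filter fun j => j ∉ Set.range ι).image G
  have hScard : S.card ≤ s + 2 := by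
    have hinj : Function.Injective ι := by
      intro a b hab
      have h1 := hι a a
      have h2 := hι a b
      rw [← hab, h1] at h2
      by_contra h
      simp [h] at h2
    refine Finset.card_image_le.trans ?_
    have h1 : (Finset.univ.filter fun j => j ∉ Set.range ι) = (Finset.univ.image ι)ᶜ := by
      ext j; simp
    rw [h1, Finset.card_compl, Finset.card_image_of_injective _ hinj]
    simp; omega
  let B := Algebra.adjoin F (S : Set L)
  have hGB : ∀ j, G j ∈ B := by
    have h1 : ∀ j, j ∉ Set.range ι → G j ∈ B := by
      intro j hj
      apply Algebra.subset_adjoin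
      simp only [S, Finset.coe_image, Set.mem_image]
      exact ⟨j, by simpa using hj, rfl⟩
    intro j
    by_cases hj : j ∈ Set.range ι
    · obtain ⟨b, rfl⟩ := hj
      have h2 : ∑ j, G j * algebraMap F L (w' b j) = 0 := by
        have h9 : ∀ j, G j * algebraMap F L (w' b j) =
            ∑ i, t i * aeval p (R i j) * algebraMap F L (w' b j) := fun j =>
          Finset.sum_mul _ _ _
        rw [Finset.sum_congr rfl fun j _ => h9 j, Finset.sum_comm]
        refine Finset.sum_eq_zero fun i _ => ?_
        have := congrArg (aeval p) (hrel i b)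
        rw [map_sum, map_zero] at this
        have h3 := congrArg (fun z => t i * z) this
        simp only [mul_zero, Finset.mul_sum, map_mul, algHom_C] at h3
        rw [← h3]
        exact Finset.sum_congr rfl fun j _ => by ring
      rw [← Finset.sum_filter_add_sum_filter_not Finset.univ (fun j => j ∈ Set.range ι)] at h2
      have h4 : ∑ j with j ∈ Set.range ι, G j * algebraMap F L (w' b j) = G (ι b) := by
        rw [Finset.sum_eq_single (ι b)]
        · simp [w', hι]
        · intro j hj hjb
          obtain ⟨c, rfl⟩ := (Finset.mem_filter.mp hj).2
          have : b ≠ c := fun h => hjb (by rw [h])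
          simp [w', hι, this]
        · intro h; simp at h
      rw [h4] at h2
      rw [eq_neg_of_add_eq_zero_left h2]
      exact neg_mem (sum_mem fun j hj => B.mul_mem (h1 j (Finset.mem_filter.mp hj).2)
        (B.algebraMap_mem _))
    · exact h1 j hj
  have hintg : ∀ l b, IsAlgebraic B (p b * t l) := by
    intro l b
    have h1 : p b * t l ∈ (integralClosure (Subring.closure
        (Set.range (algebraMap F L) ∪ Set.range G)) L).toSubring := by
      rw [← iInf_valuationSubring_superset, Subring.mem_iInf]
      rintro ⟨V, hV⟩
      exact EN_int (fun i => d i - 1) (fun i => by have := hd i; omega) R hR hρ p rfl t V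
        (fun c => hV (Or.inl ⟨c, rfl⟩)) (fun j => hV (Or.inr ⟨j, rfl⟩)) l b
    have h2 : IsIntegral (Subring.closure (Set.range (algebraMap F L) ∪ Set.range G)) (p b * t l) :=
      h1
    have hle : Subring.closure (Set.range (algebraMap F L) ∪ Set.range G) ≤ B.toSubring := by
      rw [Subring.closure_le]
      rintro _ (⟨c, rfl⟩ | ⟨j, rfl⟩)
      · exact B.algebraMap_mem c
      · exact hGB j
    obtain ⟨q, hq, hq2⟩ := h2
    refine IsIntegral.isAlgebraic (R := B) ⟨q.map (Subring.inclusion hle), hq.map _, ?_⟩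
    rw [Polynomial.eval₂_map]
    exact hq2
  have ht0 : t i0 ≠ 0 := by
    intro h
    have := (IsFractionRing.injective A L) (h.trans (map_zero _).symm)
    exact X_ne_zero _ this
  have hp : ∀ b, IsAlgebraic B (p b) := by
    intro b
    have h1 := (hintg i0 b).mul (hintg i0 0).inv
    have : p b * t i0 * (p 0 * t i0)⁻¹ = p b := by
      have : p 0 = 1 := rfl
      rw [this, one_mul, mul_assoc, mul_inv_cancel₀ ht0, mul_one]
    rwa [this] at h1
  have hA : ∀ a : A, IsAlgebraic B (algebraMap A L a) := by
    intro a
    induction a using MvPolynomial.induction_on with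
    | C c =>
      have : algebraMap A L (C c) = algebraMap B L (algebraMap F B c) := by
        rw [← IsScalarTower.algebraMap_apply F B L, ← algebraMap_eq,
          ← IsScalarTower.algebraMap_apply F A L]
      rw [this]; exact isAlgebraic_algebraMap _
    | add a b ha hb => rw [map_add]; exact ha.add hb
    | mul_X a i ha =>
      rw [map_mul]
      refine ha.mul ?_
      rcases i with i | i
      · have := hintg i 0
        rwa [show p 0 * t i = t i from one_mul _] at this
      · exact hp i.succ
  have hL : Algebra.IsAlgebraic B L := by
    constructor
    intro z
    obtain ⟨a, b, hb, rfl⟩ := IsFractionRing.div_surjective (A := A) z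
    rw [div_eq_mul_inv]
    exact (hA a).mul (hA b).inv
  have h1 := Algebra.IsAlgebraic.trdeg_le_cardinalMk F (S : Set L)
  have h2 : AlgebraicIndependent F (fun i => algebraMap A L (X i)) := by
    have := (algebraicIndependent_X (Fin s ⊕ Fin 3) F).map'
      (f := IsScalarTower.toAlgHom F A L) (IsFractionRing.injective A L)
    exact this
  have h3 := h2.lift_cardinalMk_le_trdeg
  have h4 : (Cardinal.mk (S : Set L)) = (S.card : Cardinal) := by simp
  rw [h4] at h1
  have h5 := h3.trans (Cardinal.lift_le.mpr h1)
  simp at h5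
  have h6 : s + 3 ≤ S.card := by exact_mod_cast h5
  omega

end FL

namespace FL

open Matrix

theorem aeval_cons {F Ω : Type*} [Field F] [Field Ω] [Algebra F Ω] {n : ℕ} (w : Ω) (Y : Fin n → Ω)
    (g : MvPolynomial (Fin (n + 1)) F) :
    MvPolynomial.aeval (Fin.cons w Y : Fin (n + 1) → Ω) g =
      Polynomial.eval w ((MvPolynomial.finSuccEquiv F n g).map (MvPolynomial.aeval Y).toRingHom) := by
  induction g using MvPolynomial.induction_on with
  | C a => simp [MvPolynomial.finSuccEquiv_apply]
  | add a b ha hb => rw [map_add, ha, hb, map_add, Polynomial.map_add, Polynomial.eval_add]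
  | mul_X a i ha =>
    rw [map_mul, ha, map_mul, Polynomial.map_mul, Polynomial.eval_mul]
    congr 1
    refine Fin.cases ?_ (fun j => ?_) i
    · simp [MvPolynomial.finSuccEquiv_X_zero]
    · simp [MvPolynomial.finSuccEquiv_X_succ]

namespace Core

variable {K F Ω σ : Type*} [Field K] [Field F] [Field Ω] [Algebra K F] [Algebra F Ω]
    [Algebra K Ω] [IsScalarTower K F Ω] [IsAlgClosed F] [CharZero F] [Fintype σ] {s : ℕ}
    {f : Fin s → MvPolynomial σ K} {d : Fin s → ℕ}
    {D : Fin 3 → Derivation K F F} {x : σ → F} {δ : Derivation K Ω Ω} {Y : Fin 3 → Ω}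

theorem case53 [CharZero Ω] (h : Core 5 f d D x δ Y) (hd : ∀ i, 2 ≤ d i) (hs : 2 ≤ s)
    (hspan : ∀ φ : Fin 3 → Ω, ∑ a, φ a * Y a = 0 →
      (∀ E : Derivation F Ω Ω, ∑ a, φ a * E (Y a) = 0) → φ = 0) : False := by
  have hg : ∀ i, restr (Fin.cons x (fun a j => D a (x j)) : Fin 4 → σ → F) (f i) = 0 := by
    intro i
    set g := restr (Fin.cons x (fun a j => D a (x j)) : Fin 4 → σ → F) (f i) with hgdef
    have hh : g.IsHomogeneous (d i) := restr_homog _ _ _ (h.hf i)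
    have h1 : ∀ w : Ω, MvPolynomial.aeval (Fin.cons w Y : Fin 4 → Ω) g = 0 := by
      intro w
      rw [hgdef, aeval_restr]
      rw [← h.van w 1 i]
      congr 2
      funext j
      rw [Fin.sum_univ_succ, h.hδ, one_mul]
      simp
    have h2 : (MvPolynomial.finSuccEquiv F 3 g).map (MvPolynomial.aeval Y).toRingHom = 0 := by
      apply Polynomial.funext
      intro w
      rw [← aeval_cons, h1, Polynomial.eval_zero]
    have h3 : MvPolynomial.finSuccEquiv F 3 g = 0 := by
      ext1 j
      rw [Polynomial.coeff_zero]
      by_cases hj : j ≤ d i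
      · refine hom_span (Set.univ : Set (Derivation F Ω Ω)) Y
          (fun φ h1 h2 => hspan φ h1 fun E => h2 E trivial) (d i - j) _
          (hh.finSuccEquiv_coeff_isHomogeneous j _ (by omega)) ?_
        have := congrArg (fun p => Polynomial.coeff p j) h2
        simpa using this
      · apply Polynomial.coeff_eq_zero_of_natDegree_lt
        rw [MvPolynomial.natDegree_finSuccEquiv]
        have := (MvPolynomial.degreeOf_le_totalDegree g 0).trans hh.totalDegree_le
        omega
    simpa using h3
  refine EN f d h.hf hd h.hsm (by rw [h.hcard]; omega) ⟨0, by omega⟩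
    (Submodule.span F (Set.range (Fin.cons x (fun a j => D a (x j)) : Fin 4 → σ → F))) ?_ ?_
  · rw [finrank_span_eq_card h.li]; simp
  · intro u hu i
    obtain ⟨c, rfl⟩ := (Submodule.mem_span_range_iff_exists_fun F).mp hu
    have := aeval_restr (A := F) (Fin.cons x (fun a j => D a (x j)) : Fin 4 → σ → F) (f i) c
    rw [hg, map_zero] at this
    rw [this]
    congr 2
end Core

end FL

namespace FL

open Matrix

theorem step1 {K Ω σ : Type*} [Field K] [Field Ω] [IsAlgClosed Ω] [Algebra K Ω]
    [Fintype σ] {s m r : ℕ}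
    (f : Fin s → MvPolynomial σ K) (d : Fin s → ℕ) (hf : ∀ i, (f i).IsHomogeneous (d i))
    (hsm : Smooth Ω f) (hcard : Fintype.card σ = m + s + 1) (hm : ∑ i, (d i - 1) = m)
    (hr : r + 1 = m) (u v : σ → Ω)
    (hline : ∀ (α β : Ω) i, MvPolynomial.aeval (fun j => α * u j + β * v j) (f i) = 0)
    (E : Fin r → Derivation K Ω Ω) (c : Ω)
    (hli : LinearIndependent Ω (Sum.elim ![u, v] (fun a j => E a (u j) + c * E a (v j)) :
      Fin 2 ⊕ Fin r → σ → Ω)) : False := by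
  classical
  have hinf : Infinite Ω := IsAlgClosed.instInfinite
  let P : σ → (MvPolynomial (Fin 2) Ω) := fun j => MvPolynomial.X 0 * MvPolynomial.C (u j) +
    MvPolynomial.X 1 * MvPolynomial.C (v j)
  have hφP : ∀ (φ : (MvPolynomial (Fin 2) Ω) →ₐ[Ω] Ω) j, φ (P j) = φ (MvPolynomial.X 0) * u j + φ (MvPolynomial.X 1) * v j := by
    intro φ j
    simp [P]
  have hφf : ∀ (φ : (MvPolynomial (Fin 2) Ω) →ₐ[Ω] Ω) i, φ (MvPolynomial.aeval P (f i)) = 0 := by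
    intro φ i
    have h3 := MvPolynomial.comp_aeval_apply (f := P) (φ.restrictScalars K) (f i)
    refine Eq.trans h3 ?_
    rw [← hline (φ (MvPolynomial.X 0)) (φ (MvPolynomial.X 1)) i]
    congr 2
    funext j
    exact hφP φ j
  have hP : ∀ i, MvPolynomial.aeval P (f i) = 0 := by
    intro i
    apply MvPolynomial.funext
    intro z
    rw [map_zero]
    exact hφf (MvPolynomial.aeval z) i
  have huv : LinearIndependent Ω ![u, v] := by
    have := hli.comp Sum.inl Sum.inl_injective
    exact this
  have h1 : ∀ i : Fin 2, ∃ M : ℕ, ∃ ρ : Fin s → σ → (MvPolynomial (Fin 2) Ω),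
      ∀ l, Jac f P *ᵥ (ρ l) = (MvPolynomial.X i : (MvPolynomial (Fin 2) Ω)) ^ M • Pi.single l 1 := by
    intro i
    apply rho_exists (F := Ω)
    intro φ hφ
    have h2 := hsm (fun j => φ (P j)) (by
      intro h0
      have h5 := Fintype.linearIndependent_iff.mp huv ![φ (MvPolynomial.X 0), φ (MvPolynomial.X 1)] (by
        rw [Fin.sum_univ_two]
        funext j
        have := congrFun h0 j
        simp only [hφP] at this
        simpa using this)
      apply hφ
      have := h5 i
      fin_cases i <;> simpa using this) (by
      intro l
      have h3 := MvPolynomial.comp_aeval_apply (f := P) (φ.restrictScalars K) (f l)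
      refine Eq.trans h3.symm ?_
      exact hφf φ l)
    have h4 : (Jac f P).map φ = Jac f (fun j => φ (P j)) := jac_map f (φ.restrictScalars K) P
    rw [h4]; exact h2
  choose M ρ hρ using h1
  let Δ : Fin 2 ⊕ Fin r → Derivation K (MvPolynomial (Fin 2) Ω) (MvPolynomial (Fin 2) Ω) := Sum.elim
    (fun b => (MvPolynomial.pderiv b : Derivation Ω (MvPolynomial (Fin 2) Ω) (MvPolynomial (Fin 2) Ω)).restrictScalars K)
    (fun a => mapCoeff (Fin 2) (E a))
  have hΔ1 : ∀ a j, Δ (Sum.inr a) (P j) = MvPolynomial.X 0 * MvPolynomial.C (E a (u j)) +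
      MvPolynomial.X 1 * MvPolynomial.C (E a (v j)) := by
    intro a j
    simp [Δ, P, mapCoeff_C, mapCoeff_X]
  have hΔ0 : ∀ b j, Δ (Sum.inl b) (P j) = MvPolynomial.C ((![u, v] b) j) := by
    intro b j
    fin_cases b
    · simp [Δ, P, MvPolynomial.pderiv_X]
    · simp [Δ, P, MvPolynomial.pderiv_X]
  have e : σ ≃ (Fin 2 ⊕ Fin r) ⊕ Fin s := Fintype.equivOfCardEq (by simp; omega)
  let Φ := detForm e (fun i j => Δ i (P j))
  have hΦ0 : Φ ≠ 0 := by
    refine detForm_ne_zero (MvPolynomial.aeval ![1, c] : (MvPolynomial (Fin 2) Ω) →ₐ[Ω] Ω).toRingHom MvPolynomial.C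
      (by intro x; simp) e _ ?_
    convert hli using 1
    funext i j
    rcases i with b | a
    · rw [hΔ0]; simp
    · rw [hΔ1]; simp
  obtain ⟨μ, hμ⟩ := factor_lemma (Jac f P).mulVecLin Φ (by
      intro ν i hi
      apply detForm_eq_zero_of_dep
      intro hli
      let inc : (Fin 2 ⊕ Fin r) ⊕ Fin 1 → (Fin 2 ⊕ Fin r) ⊕ Fin s := Sum.map id (fun _ => i)
      have hinc : Function.Injective inc := by
        apply Function.Injective.sumMap Function.injective_id
        intro a b _
        exact Subsingleton.elim _ _
      refine ker_dep (Jac f P) (MvPolynomial.X 0 ^ M 0) (pow_ne_zero _ (MvPolynomial.X_ne_zero _))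
        (ρ 0) (hρ 0) _ ?_ ?_ (hli.comp inc hinc)
      · rintro (a | b)
        · change Jac f P *ᵥ (fun j => Δ a (P j)) = 0
          rw [jac_mulVec_deriv]
          funext l
          simp [hP]
        · simpa [inc] using hi
      · simp; omega)
    (MvPolynomial.X 0 ^ M 0) (MvPolynomial.X 1 ^ M 1) (ρ 0) (ρ 1)
    (fun l => hρ 0 l) (fun l => hρ 1 l) (pow_ne_zero _ (MvPolynomial.X_ne_zero _)) (by
      intro z w h
      simp only [← pow_mul] at h ⊢
      exact mv_reg2 0 1 (by simp) _ _ z w h)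
  have hidx : ∃ idx : Fin s → σ, Φ (fun l => Pi.single (idx l) 1) ≠ 0 := by
    by_contra hc
    push Not at hc
    apply hΦ0
    refine Module.Basis.ext_alternating (Pi.basisFun (MvPolynomial (Fin 2) Ω) σ) fun idx _ => ?_
    simpa using hc idx
  obtain ⟨idx, hne⟩ := hidx
  let γ := (coact K (F := Ω) (fun _ : Fin 2 => 1)).toRingHom
  have hwt : ∀ (q : (MvPolynomial (Fin 2) Ω)) n, q.IsHomogeneous n → γ q = Polynomial.X ^ n * Polynomial.C q := by
    intro q n hq
    exact coact_wh K _ q n hq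
  have hPh : ∀ j, (P j).IsHomogeneous 1 := by
    intro j
    refine MvPolynomial.IsHomogeneous.add ?_ ?_
    · rw [mul_comm]; exact MvPolynomial.isHomogeneous_C_mul_X _ _
    · rw [mul_comm]; exact MvPolynomial.isHomogeneous_C_mul_X _ _
  have hw1 := detForm_weight γ e (fun i j => Δ i (P j)) (Sum.elim (fun _ => 0) (fun _ => 1)) (by
    rintro (b | a) j
    · rw [hΔ0]; exact hwt _ _ (MvPolynomial.isHomogeneous_C _ _)
    · rw [hΔ1]
      refine hwt _ _ (MvPolynomial.IsHomogeneous.add ?_ ?_)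
      · rw [mul_comm]; exact MvPolynomial.isHomogeneous_C_mul_X _ _
      · rw [mul_comm]; exact MvPolynomial.isHomogeneous_C_mul_X _ _) idx
  set dt := Matrix.det (Matrix.of fun i => (Jac f P).mulVecLin (Pi.single (idx i) 1)) with hdt
  have hw2 : γ dt = Polynomial.X ^ m * Polynomial.C dt := by
    rw [hdt, ← Matrix.det_transpose, ← hm]
    apply det_weight
    intro i l
    simp only [Matrix.transpose_apply, Matrix.of_apply, Matrix.mulVecLin_apply,
      Matrix.mulVec_single_one, Matrix.col_apply]
    refine hwt _ _ ?_
    have := ((hf i).pderiv (i := idx l)).aeval P (n := 1) hPh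
    simpa [Jac] using this
  have hΦμ : Φ (fun l => Pi.single (idx l) 1) = μ * dt := hμ _
  change γ (Φ _) = _ * Polynomial.C (Φ _) at hw1
  rw [hΦμ, map_mul, hw2] at hw1
  simp only [Fintype.sum_sum_type, Sum.elim_inl, Sum.elim_inr, Finset.sum_const_zero, zero_add,
    Finset.sum_const, Finset.card_univ, Fintype.card_fin, smul_eq_mul, mul_one] at hw1
  rw [← hr, pow_succ] at hw1
  have h9 : (Polynomial.X : Polynomial (MvPolynomial (Fin 2) Ω)) ^ r * (γ μ * Polynomial.X * Polynomial.C dt) =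
      Polynomial.X ^ r * Polynomial.C (μ * dt) := by
    rw [← hw1]; ring
  have h10 := mul_left_cancel₀ (pow_ne_zero _ Polynomial.X_ne_zero) h9
  have h11 := congrArg (Polynomial.eval 0) h10
  simp only [Polynomial.eval_mul, Polynomial.eval_X, mul_zero, zero_mul, Polynomial.eval_C] at h11
  exact hne (hΦμ.trans h11.symm)

end FL

namespace FL

open Matrix

theorem der_sum_apply {K Ω ι : Type*} [Field K] [Field Ω] [Algebra K Ω] (S : Finset ι)
    (E : ι → Derivation K Ω Ω) (c : Ω) : (∑ a ∈ S, E a) c = ∑ a ∈ S, E a c := by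
  classical
  induction S using Finset.induction_on with
  | empty => simp
  | insert a S ha ih => rw [Finset.sum_insert ha, Finset.sum_insert ha, Derivation.add_apply, ih]

section Frame

variable {K Ω : Type*} [Field K] [Field Ω] [Algebra K Ω]

theorem constF_closed [IsAlgClosed Ω] [CharZero Ω] (𝔇 : Set (Derivation K Ω Ω)) :
    IsAlgClosed (constF 𝔇) := by
  have hC : CharZero (constF 𝔇) := by
    refine ⟨fun a b h => ?_⟩
    have := congrArg (algebraMap (constF 𝔇) Ω) h
    simpa using this
  apply IsAlgClosed.of_exists_root
  intro p hp hirr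
  obtain ⟨z, hz⟩ := IsAlgClosed.exists_aeval_eq_zero Ω p hirr.degree_pos.ne'
  have hzF : z ∈ constF 𝔇 := by
    intro D hD
    have h1 : constDer 𝔇 D hD (Polynomial.aeval z p) = 0 := by rw [hz, map_zero]
    rw [Derivation.map_aeval, constDer_apply, smul_eq_mul] at h1
    refine (mul_eq_zero.mp h1).resolve_left fun h2 => ?_
    have hsep := hirr.separable
    obtain ⟨a, b, hab⟩ := hsep
    have := congrArg (Polynomial.aeval z) hab
    rw [map_add, map_mul, map_mul, hz, h2] at this
    simp at this
  refine ⟨⟨z, hzF⟩, ?_⟩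
  have h3 : algebraMap (constF 𝔇) Ω (p.eval ⟨z, hzF⟩) = 0 := by
    rw [← hz, Polynomial.aeval_def, Polynomial.eval₂_eq_eval_map]
    exact (Polynomial.eval_map_algebraMap p z ▸ (Polynomial.aeval_algebraMap_apply Ω (⟨z, hzF⟩ : constF 𝔇) p).symm)
  exact (map_eq_zero _).mp h3

/-- Restriction of a derivation to a subfield. -/
noncomputable def restrDer (F : IntermediateField K Ω) (E : Derivation K Ω Ω)
    (h : ∀ c : F, E c ∈ F) : Derivation K F F :=
  Derivation.mk'
    { toFun := fun c => ⟨E c, h c⟩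
      map_add' := by intro a b; ext; simp
      map_smul' := by intro c a; ext; simp }
    (by intro a b; ext; simp)

/-- Derivations killing `x`. -/
def killD (K : Type*) {Ω σ : Type*} [Field K] [Field Ω] [Algebra K Ω] (x : σ → Ω) :
    Set (Derivation K Ω Ω) := {D | ∀ j, D (x j) = 0}

theorem frame {σ : Type*} [Fintype σ] (x : σ → Ω) (k : ℕ)
    (hk : Module.finrank Ω (LinearMap.range (evD (K := K) x)) = k) :
    ∃ (ι : Fin k → σ) (E : Fin k → Derivation K Ω Ω)
      (D : Fin k → Derivation K (constF (killD K x)) (constF (killD K x))),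
      (∀ a b, E a (x (ι b)) = if a = b then 1 else 0) ∧
      (∀ a c, ((D a c : constF (killD K x)) : Ω) = E a c) ∧ (∀ a b, ⁅D a, D b⁆ = 0) ∧
      ∀ (δ : Derivation K Ω Ω) (c : constF (killD K x)), δ c = ∑ a, δ (x (ι a)) * E a c := by
  classical
  obtain ⟨ι, w, hw, hspan⟩ := exists_coords _ k hk
  choose E hE using fun a => (w a).2
  have hEx : ∀ a j, E a (x j) = (w a : σ → Ω) j := fun a j => congrFun (hE a) j
  have hEι : ∀ a b, E a (x (ι b)) = if a = b then 1 else 0 := by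
    intro a b; rw [hEx, hw]
  have hzero : ∀ δ : Derivation K Ω Ω, (∀ b, δ (x (ι b)) = 0) → δ ∈ killD K x := by
    intro δ hδ j
    have h1 := hspan ⟨evD x δ, δ, rfl⟩
    have h2 : ∀ b, evD x δ (ι b) = 0 := hδ
    simp only [h2, zero_smul, Finset.sum_const_zero] at h1
    exact congrFun (congrArg Subtype.val h1) j
  have hδ : ∀ (δ : Derivation K Ω Ω) (c : constF (killD K x)),
      δ c = ∑ a, δ (x (ι a)) * E a c := by
    intro δ c
    have h1 : δ - ∑ a, δ (x (ι a)) • E a ∈ killD K x := by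
      apply hzero
      intro b
      rw [Derivation.sub_apply, der_sum_apply]
      simp [hEι]
    have h2 := c.2 _ h1
    rw [Derivation.sub_apply, der_sum_apply] at h2
    simpa [sub_eq_zero] using h2
  have hEF : ∀ a (c : constF (killD K x)), E a c ∈ constF (killD K x) := by
    intro a c D hD
    have h1 : ⁅D, E a⁆ ∈ killD K x := by
      apply hzero
      intro b
      rw [Derivation.commutator_apply, hEι, hD]
      split_ifs <;> simp
    have h2 := c.2 _ h1
    rw [Derivation.commutator_apply, c.2 _ hD, map_zero, sub_zero] at h2
    exact h2
  refine ⟨ι, E, fun a => restrDer _ (E a) (hEF a), hEι, fun _ _ => rfl, ?_, hδ⟩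
  intro a b
  ext c
  have h1 : ⁅E a, E b⁆ ∈ killD K x := by
    apply hzero
    intro e
    rw [Derivation.commutator_apply, hEι, hEι]
    split_ifs <;> simp
  exact c.2 _ h1

end Frame

theorem smooth_of_ext {K F Ω σ : Type*} [Field K] [Field F] [Field Ω] [Algebra K F] [Algebra F Ω]
    [Algebra K Ω] [IsScalarTower K F Ω] {s : ℕ} (f : Fin s → MvPolynomial σ K)
    (h : Smooth Ω f) : Smooth F f := by
  intro v hv hf
  have h1 := h (fun j => algebraMap F Ω (v j)) (by
    intro h0; apply hv; funext j
    exact (map_eq_zero _).mp (congrFun h0 j)) (by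
    intro i
    have := MvPolynomial.aeval_algebraMap_apply Ω v (f i)
    rw [hf, map_zero] at this
    exact this)
  have h2 := jac_map f (IsScalarTower.toAlgHom K F Ω) v
  have h3 : (fun i => Jac f (fun j => algebraMap F Ω (v j)) i) =
      fun i j => algebraMap F Ω (Jac f v i j) := by
    funext i j
    exact (congrFun (congrFun h2 i) j).symm
  rw [h3] at h1
  rw [Fintype.linearIndependent_iff] at h1 ⊢
  intro g hg i
  have := h1 (fun i => algebraMap F Ω (g i)) (by
    funext j
    have h4 := congrArg (algebraMap F Ω) (congrFun hg j)
    simpa [Algebra.smul_def] using h4) i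
  exact (map_eq_zero _).mp this

end FL

namespace FL

open Matrix

/-- There are always new independent elements with derivations. -/
def Big (K Ω : Type*) [Field K] [Field Ω] [Algebra K Ω] : Prop :=
  ∀ (Z : Finset Ω) (r : ℕ), ∃ (c : Fin r → Ω) (E : Fin r → Derivation K Ω Ω),
    (∀ a, ∀ z ∈ Z, E a z = 0) ∧ ∀ a b, E a (c b) = if a = b then 1 else 0

theorem base_case {K Ω σ : Type*} [Field K] [Field Ω] [IsAlgClosed Ω] [CharZero Ω] [Algebra K Ω]
    [Fintype σ] {s m : ℕ} (f : Fin s → MvPolynomial σ K) (d : Fin s → ℕ)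
    (hf : ∀ i, (f i).IsHomogeneous (d i)) (hd : ∀ i, 2 ≤ d i) (hs : 2 ≤ s)
    (hsm : Smooth Ω f) (hcard : Fintype.card σ = m + s + 1) (hm : ∑ i, (d i - 1) = m)
    (hm5 : m ≤ 5) (hbig : Big K Ω) (i0 j0 : σ) (u v : σ → Ω)
    (hui : u i0 = 1) (huj : u j0 = 0) (hvi : v i0 = 0) (hvj : v j0 = 1)
    (hline : ∀ (α β : Ω) i, MvPolynomial.aeval (fun j => α * u j + β * v j) (f i) = 0)
    (hrk : m ≤ Module.finrank Ω (LinearMap.range (evD (K := K) (Sum.elim u v))) + 1) : False := by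
  classical
  obtain ⟨c', dd, hdd0, hdd1⟩ := hbig (Finset.univ.image u ∪ Finset.univ.image v) 1
  obtain ⟨c, hc⟩ : ∃ c, c = c' 0 := ⟨_, rfl⟩
  obtain ⟨δ, hδ⟩ : ∃ δ, δ = dd 0 := ⟨_, rfl⟩
  have hδu : ∀ j, δ (u j) = 0 := fun j => hδ ▸ hdd0 0 _ (by simp)
  have hδv : ∀ j, δ (v j) = 0 := fun j => hδ ▸ hdd0 0 _ (by simp)
  have hδc : δ c = 1 := by rw [hδ, hc, hdd1]; simp
  obtain ⟨x, hx⟩ : ∃ x : σ → Ω, x = fun j => u j + c * v j := ⟨_, rfl⟩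
  have hxj : ∀ j, x j = u j + c * v j := fun j => congrFun hx j
  have hδx : ∀ j, δ (x j) = v j := by intro j; simp [hxj, hδu, hδv, hδc]
  have hxj0 : x j0 = c := by rw [hxj, huj, hvj]; ring
  have hxi0 : x i0 = 1 := by rw [hxj, hui, hvi]; ring
  obtain ⟨k, hk⟩ : ∃ k, Module.finrank Ω (LinearMap.range (evD (K := K) x)) = k := ⟨_, rfl⟩
  obtain ⟨ι, E, D, hEι, hDE, hbr, hexp⟩ := frame x k hk
  have hFc : IsAlgClosed (constF (killD K x)) := constF_closed _
  have hF0 : CharZero (constF (killD K x)) := by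
    refine ⟨fun a b h => ?_⟩
    have := congrArg (algebraMap (constF (killD K x)) Ω) h
    simpa using this
  let xF : σ → (constF (killD K x)) := fun j => ⟨x j, fun D hD => hD j⟩
  let Y : Fin k → Ω := fun a => v (ι a)
  have hDx : ∀ (δ : Derivation K Ω Ω) j, δ (x j) = ∑ a, δ (x (ι a)) * E a (x j) := fun δ j =>
    hexp δ (xF j)
  have hvE : ∀ j, v j = ∑ a, Y a * E a (x j) := by
    intro j
    rw [← hδx j, hDx δ j]
    refine Finset.sum_congr rfl fun a _ => by rw [hδx]
  have hY1 : ∑ a, Y a * E a c = 1 := by rw [← hxj0, ← hvE, hvj]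
  have hEF : ∀ a j, E a (x j) = algebraMap (constF (killD K x)) Ω (D a (xF j)) := fun a j => (hDE a (xF j)).symm
  -- the space T
  let T := LinearMap.range (evD (K := (constF (killD K x))) Y)
  have hTk : ∀ t ∈ T, ∑ a, t a * E a c = 0 := by
    rintro _ ⟨e, rfl⟩
    have h1 := congrArg e hY1
    rw [Derivation.map_one_eq_zero, map_sum] at h1
    rw [← h1]
    refine Finset.sum_congr rfl fun a _ => ?_
    rw [← hxj0, hEF, Derivation.leibniz, Derivation.map_algebraMap]
    simp [evD_apply, mul_comm]
  have hT1 : m ≤ Module.finrank Ω T + k := by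
    let N := LinearMap.range (evD (K := K) (Sum.elim x v))
    let q : (σ ⊕ σ → Ω) →ₗ[Ω] (σ ⊕ σ → Ω) :=
      { toFun := fun z => Sum.elim (fun j => z (Sum.inl j) - z (Sum.inl j0) * v j - c * z (Sum.inr j))
          (fun j => z (Sum.inr j))
        map_add' := by intro a b; funext j; rcases j with j | j <;> simp; ring
        map_smul' := by intro a b; funext j; rcases j with j | j <;> simp; ring }
    have hq : ∀ e : Derivation K Ω Ω, q (evD (Sum.elim x v) e) = evD (Sum.elim u v) e := by
      intro e
      funext j
      rcases j with j | j
      · simp only [q, LinearMap.coe_mk, AddHom.coe_mk, Sum.elim_inl, evD_apply, Sum.elim_inr]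
        rw [hxj0, hxj]; simp; ring
      · rfl
    let q' := q.comp N.subtype
    have h1 := LinearMap.finrank_range_add_finrank_ker q'
    have h2 : LinearMap.range q' = LinearMap.range (evD (K := K) (Sum.elim u v)) := by
      ext z
      constructor
      · rintro ⟨⟨_, e, rfl⟩, rfl⟩
        exact ⟨e, (hq e).symm⟩
      · rintro ⟨e, rfl⟩
        exact ⟨⟨_, e, rfl⟩, hq e⟩
    have h3 : 0 < Module.finrank Ω (LinearMap.ker q') := by
      refine Nat.pos_of_ne_zero fun hz => ?_
      have hbot := Submodule.finrank_eq_zero.mp hz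
      have hmem : (⟨evD (Sum.elim x v) δ, δ, rfl⟩ : N) ∈ LinearMap.ker q' := ?_
      · rw [hbot, Submodule.mem_bot] at hmem
        have := congrFun (congrArg (fun z : N => (z : σ ⊕ σ → Ω)) hmem) (Sum.inl j0)
        simp [evD_apply, hδx, hvj] at this
      · rw [LinearMap.mem_ker]
        change q (evD (Sum.elim x v) δ) = 0
        rw [hq]
        funext j
        rcases j with j | j
        · exact hδu j
        · exact hδv j
    rw [h2] at h1
    let π : N →ₗ[Ω] (σ → Ω) := (LinearMap.funLeft Ω Ω Sum.inl).comp N.subtype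
    have h4 := LinearMap.finrank_range_add_finrank_ker π
    have h5 : LinearMap.range π = LinearMap.range (evD (K := K) x) := by
      ext z
      constructor
      · rintro ⟨⟨_, e, rfl⟩, rfl⟩
        exact ⟨e, rfl⟩
      · rintro ⟨e, rfl⟩
        exact ⟨⟨_, e, rfl⟩, rfl⟩
    rw [h5, hk] at h4
    let g : LinearMap.ker π →ₗ[Ω] (Fin k → Ω) :=
      (LinearMap.funLeft Ω Ω (fun a => Sum.inr (ι a))).comp
        (N.subtype.comp (LinearMap.ker π).subtype)
    have hker : ∀ e : Derivation K Ω Ω, (∀ j, e (x j) = 0) → ∀ j, e (v j) = ∑ a, e (Y a) * E a (x j) := by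
      intro e he j
      have he' : e ∈ killD K x := he
      rw [hvE j, map_sum]
      refine Finset.sum_congr rfl fun a _ => ?_
      have h9 : e (E a (x j)) = 0 := by
        rw [hEF]; exact (D a (xF j)).2 e he'
      rw [Derivation.leibniz, h9]; simp [mul_comm]
    have h6 : Function.Injective g := by
      rintro ⟨⟨_, e, rfl⟩, he⟩ ⟨⟨_, e', rfl⟩, he'⟩ h0
      have he1 : ∀ j, e (x j) = 0 := fun j => congrFun he j
      have he1' : ∀ j, e' (x j) = 0 := fun j => congrFun he' j
      have he2 : ∀ a, e (Y a) = e' (Y a) := fun a => congrFun h0 a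
      refine Subtype.ext (Subtype.ext (funext fun j => ?_))
      rcases j with j | j
      · exact (he1 j).trans (he1' j).symm
      · change e (v j) = e' (v j)
        rw [hker e he1 j, hker e' he1' j]
        simp only [he2]
    have h7 : LinearMap.range g ≤ T := by
      rintro _ ⟨⟨⟨_, e, rfl⟩, he⟩, rfl⟩
      have he1 : e ∈ killD K x := fun j => congrFun he j
      exact ⟨constDer _ e he1, rfl⟩
    have h8 := Submodule.finrank_mono h7
    rw [LinearMap.finrank_range_of_inj h6] at h8
    change _ = Module.finrank Ω N at h4
    omega
  have hspan : ∀ r : ℕ, r ≤ Module.finrank Ω T → r + 1 = k → ∀ φ : Fin k → Ω, ∑ a, φ a * Y a = 0 →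
      (∀ e : Derivation (constF (killD K x)) Ω Ω, ∑ a, φ a * e (Y a) = 0) → φ = 0 := by
    intro r hr hrk φ h1 h2
    let T' := T ⊔ Submodule.span Ω {Y}
    have hlt : T < T' := by
      refine lt_of_le_of_ne le_sup_left fun h => ?_
      have : Y ∈ T := by rw [h]; exact Submodule.mem_sup_right (Submodule.mem_span_singleton_self Y)
      have := hTk _ this
      rw [hY1] at this
      exact one_ne_zero this
    have h3 := Submodule.finrank_lt_finrank_of_lt hlt
    have h4 : T' = ⊤ := by
      apply Submodule.eq_top_of_finrank_eq
      have := Submodule.finrank_le T'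
      simp at this ⊢
      omega
    have h5 : T' ≤ LinearMap.ker (Fintype.linearCombination Ω φ) := by
      refine sup_le ?_ ?_
      · rintro _ ⟨e, rfl⟩
        rw [LinearMap.mem_ker, Fintype.linearCombination_apply, ← h2 e]
        exact Finset.sum_congr rfl fun a _ => mul_comm _ _
      · rw [Submodule.span_singleton_le_iff_mem, LinearMap.mem_ker,
          Fintype.linearCombination_apply, ← h1]
        exact Finset.sum_congr rfl fun a _ => mul_comm _ _
    rw [h4] at h5
    funext a
    have := h5 (Submodule.mem_top (x := Pi.single a 1))
    rw [LinearMap.mem_ker, Fintype.linearCombination_apply_single] at this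
    simpa using this
  have hT2 : Module.finrank Ω T + 1 ≤ k := by
    have hlt : T < ⊤ := by
      refine lt_of_le_of_ne le_top fun h => ?_
      have : Y ∈ T := by rw [h]; exact Submodule.mem_top
      have := hTk _ this
      rw [hY1] at this
      exact one_ne_zero this
    have h3 := Submodule.finrank_lt_finrank_of_lt hlt
    simp at h3
    omega
  -- step 1
  have hkm : k < m := by
    by_contra hkm
    have hm2 : 2 ≤ m := by
      rw [← hm]
      calc 2 ≤ s := hs
        _ = ∑ i : Fin s, 1 := by simp
        _ ≤ _ := Finset.sum_le_sum fun i _ => by have := hd i; omega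
    obtain ⟨a0, ha0⟩ : ∃ a0, Y a0 ≠ 0 := by
      by_contra hc
      push Not at hc
      simp [hc] at hY1
    obtain ⟨k', rfl⟩ : ∃ k', k = k' + 1 := ⟨k - 1, by omega⟩
    let emb : Fin (m - 1) → Fin (k' + 1) := fun a => a0.succAbove (Fin.castLE (by omega) a)
    have hemb : Function.Injective emb :=
      (Fin.succAbove_right_injective).comp (Fin.castLE_injective _)
    refine step1 f d hf hsm hcard hm (r := m - 1) (by omega) u v hline (fun a => E (emb a)) c ?_
    have hcal : ∀ a j, E a (u j) + c * E a (v j) = E a (x j) - E a c * v j := by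
      intro a j
      simp [hxj]; ring
    rw [Fintype.linearIndependent_iff]
    intro g hg
    have hj : ∀ j, g (Sum.inl 0) * u j + g (Sum.inl 1) * v j +
        ∑ a, g (Sum.inr a) * (E (emb a) (x j) - E (emb a) c * v j) = 0 := by
      intro j
      have := congrFun hg j
      simp only [Fintype.sum_sum_type, Fin.sum_univ_two, Sum.elim_inl, Sum.elim_inr, hcal,
        Finset.sum_apply, Pi.smul_apply, smul_eq_mul, Matrix.cons_val_zero,
        Matrix.cons_val_one, Pi.zero_apply] at this
      exact this
    have g0 : g (Sum.inl 0) = 0 := by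
      have := hj i0
      simpa [hui, hvi, hxi0] using this
    set κ := g (Sum.inl 1) - ∑ a, g (Sum.inr a) * E (emb a) c with hκ
    have hb : ∀ b, κ * Y b + ∑ a, g (Sum.inr a) * (if emb a = b then 1 else 0) = 0 := by
      intro b
      have := hj (ι b)
      rw [g0] at this
      simp only [hEι, mul_sub, Finset.sum_sub_distrib] at this
      rw [hκ, sub_mul, Finset.sum_mul]
      refine Eq.trans ?_ this
      have h9 : ∀ a, g (Sum.inr a) * E (emb a) c * Y b = g (Sum.inr a) * (E (emb a) c * v (ι b)) :=
        fun a => mul_assoc _ _ _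
      simp only [h9]
      change (g (Sum.inl 1)) * v (ι b) - _ + _ = _
      ring
    have hκ0 : κ = 0 := by
      have := hb a0
      have h9 : ∀ a, emb a ≠ a0 := fun a => Fin.succAbove_ne _ _
      simpa [h9, ha0] using this
    have g2 : ∀ a, g (Sum.inr a) = 0 := by
      intro a
      have := hb (emb a)
      rw [hκ0] at this
      simpa [hemb.eq_iff] using this
    have g1 : g (Sum.inl 1) = 0 := by
      rw [hκ0] at hκ
      simpa [g2] using hκ.symm
    rintro (b | a)
    · fin_cases b
      · exact g0
      · exact g1
    · exact g2 a
  have core : Core m f d D xF δ Y :=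
    { hf := hf
      hsm := smooth_of_ext f hsm
      hcard := hcard
      hm := hm
      li := by
        rw [Fintype.linearIndependent_iff]
        intro g hg
        have hj : ∀ j, g 0 * xF j + ∑ a : Fin k, g a.succ * D a (xF j) = 0 := by
          intro j
          have := congrFun hg j
          rw [Fin.sum_univ_succ] at this
          simpa using this
        have hj' : ∀ j, algebraMap (constF (killD K x)) Ω (g 0) * x j +
            ∑ a : Fin k, algebraMap (constF (killD K x)) Ω (g a.succ) * E a (x j) = 0 := by
          intro j
          have := congrArg (algebraMap (constF (killD K x)) Ω) (hj j)
          rw [map_add, map_mul, map_sum, map_zero] at this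
          rw [← this]
          simp only [map_mul, hEF]
          rfl
        have g0 : algebraMap (constF (killD K x)) Ω (g 0) = 0 := by
          have := hj' i0
          simpa [hxi0] using this
        have g1 : ∀ a : Fin k, algebraMap (constF (killD K x)) Ω (g a.succ) = 0 := by
          intro a
          have := hj' (ι a)
          rw [g0] at this
          simpa [hEι] using this
        intro i
        refine Fin.cases ?_ (fun a => ?_) i
        · exact (map_eq_zero _).mp g0
        · exact (map_eq_zero _).mp (g1 a)
      hbr := fun a b => by rw [hbr]; exact Submodule.zero_mem _
      hδ := by
        intro z
        have := hexp δ z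
        refine Eq.trans this ?_
        refine Finset.sum_congr rfl fun a _ => ?_
        rw [hδx]
        congr 1
        exact (hDE a z).symm
      hδδ := by
        intro j
        change δ (δ (x j)) = 0
        rw [hδx, hδv]
      hnp := by
        rintro ⟨z, w, hw⟩
        have h1 : z * algebraMap (constF (killD K x)) Ω (∑ a, w a * D a (xF j0)) = 1 := by
          rw [← hY1, map_sum, Finset.mul_sum]
          refine Finset.sum_congr rfl fun a _ => ?_
          rw [hw, ← hxj0, hEF, map_mul, mul_assoc]
        have h2 : ∀ a, Y a = algebraMap (constF (killD K x)) Ω ((∑ a, w a * D a (xF j0))⁻¹ * w a) := by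
          intro a
          rw [hw, map_mul, map_inv₀]
          rw [eq_inv_of_mul_eq_one_left h1]
        have h3 : T = ⊥ := by
          rw [eq_bot_iff]
          rintro _ ⟨e, rfl⟩
          rw [Submodule.mem_bot]
          funext a
          rw [evD_apply, h2, Derivation.map_algebraMap]
          rfl
        rw [h3, finrank_bot] at hT1
        omega
      van := by
        intro w t i
        rw [← hline w (w * c + t) i]
        congr 2
        funext j
        change w * x j + t * δ (x j) = _
        rw [hδx, hxj]; ring }
  have hm' : m = 3 ∧ k = 2 ∨ m = 4 ∧ k = 3 ∨ m = 5 ∧ k = 4 ∨ m = 5 ∧ k = 3 := by omega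
  rcases hm' with ⟨rfl, rfl⟩ | ⟨rfl, rfl⟩ | ⟨rfl, rfl⟩ | ⟨rfl, rfl⟩
  · exact core.case3
  · exact core.case4
  · exact core.six_false hd hs
  · exact core.case53 hd hs (hspan 2 (by omega) rfl)

end FL

namespace FL

open Matrix

theorem bertini_smooth {K Ω : Type*} [Field K] [Field Ω] [Algebra K Ω] {s n : ℕ}
    (f : Fin s → MvPolynomial (Fin (n + 1)) K) (d : Fin s → ℕ)
    (hf : ∀ i, (f i).IsHomogeneous (d i)) (hsm : Smooth Ω f) (hn : s + 3 ≤ n)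
    (a0 : Fin (n + 1)) (i1 j1 : Fin n) (u v : Fin (n + 1) → Ω)
    (W : Fin n → Ω) (E : Fin n → Derivation K Ω Ω)
    (hEu : ∀ b j, E b (u j) = 0) (hEv : ∀ b j, E b (v j) = 0)
    (hu : u a0 = ∑ b, W b * u (a0.succAbove b)) (hv : v a0 = ∑ b, W b * v (a0.succAbove b))
    (hEW : ∀ b b', E b (W b') = (if b' = b then 1 else 0) -
      (if b' = i1 then u (a0.succAbove b) else 0) - (if b' = j1 then v (a0.succAbove b) else 0))
    (p : Fin (n + 1) → Ω) (hp : p ≠ 0) (hfp : ∀ i, MvPolynomial.aeval p (f i) = 0)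
    (hpW : p a0 = ∑ b, W b * p (a0.succAbove b)) (c : Fin s → Ω)
    (hc : ∀ b, ∑ i, c i * (Jac f p i (a0.succAbove b) + W b * Jac f p i a0) = 0) : c = 0 := by
  classical
  obtain ⟨H, hH⟩ : ∃ H : Fin (n + 1) → Ω, H = fun j => ∑ i, c i * Jac f p i j := ⟨_, rfl⟩
  have hHj : ∀ j, H j = ∑ i, c i * Jac f p i j := fun j => congrFun hH j
  have hHb : ∀ b, H (a0.succAbove b) = - W b * H a0 := by
    intro b
    have := hc b
    simp only [mul_add, Finset.sum_add_distrib] at this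
    rw [hHj, eq_neg_of_add_eq_zero_left this, hHj, neg_mul, Finset.mul_sum]
    congr 1
    exact Finset.sum_congr rfl fun i _ => by ring
  by_cases hμ : H a0 = 0
  · have h0 : ∀ j, H j = 0 := by
      intro j
      rcases Fin.eq_self_or_eq_succAbove a0 j with rfl | ⟨b, rfl⟩
      · exact hμ
      · rw [hHb, hμ, mul_zero]
    funext i
    refine Fintype.linearIndependent_iff.mp (hsm p hp hfp) c ?_ i
    funext j
    rw [Finset.sum_apply]
    exact (hHj j).symm.trans (h0 j)
  exfalso
  have hHp : ∀ b, ∑ j, H j * E b (p j) = 0 := by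
    intro b
    have h1 := jac_mulVec_deriv f (E b) p
    have h2 : ∑ i, c i * (Jac f p *ᵥ fun j => E b (p j)) i = 0 := by
      rw [h1]; simp [hfp]
    rw [← h2]
    simp only [hHj, Matrix.mulVec, dotProduct, Finset.sum_mul, Finset.mul_sum]
    rw [Finset.sum_comm]
    exact Finset.sum_congr rfl fun i _ => Finset.sum_congr rfl fun j _ => by ring
  have hpb : ∀ b, p (a0.succAbove b) = u (a0.succAbove b) * p (a0.succAbove i1) +
      v (a0.succAbove b) * p (a0.succAbove j1) := by
    intro b
    have h1 := hHp b
    rw [Fin.sum_univ_succAbove _ a0] at h1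
    have h2 := congrArg (E b) hpW
    rw [map_sum] at h2
    simp only [Derivation.leibniz, smul_eq_mul, hEW] at h2
    rw [h2] at h1
    simp only [hHb, Finset.sum_add_distrib, mul_add, Finset.mul_sum] at h1
    have h3 : H a0 * ∑ b', p (a0.succAbove b') * ((if b' = b then 1 else 0) -
      (if b' = i1 then u (a0.succAbove b) else 0) -
        (if b' = j1 then v (a0.succAbove b) else 0)) = 0 := by
      refine Eq.trans ?_ h1
      rw [Finset.mul_sum, ← Finset.sum_add_distrib, ← Finset.sum_add_distrib]
      exact Finset.sum_congr rfl fun i _ => by ring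
    have h4 := (mul_eq_zero.mp h3).resolve_left hμ
    simp only [mul_sub, Finset.sum_sub_distrib, mul_ite, mul_one, mul_zero,
      Finset.sum_ite_eq', Finset.mem_univ, if_true] at h4
    linear_combination h4
  obtain ⟨α, hα⟩ : ∃ α, α = p (a0.succAbove i1) := ⟨_, rfl⟩
  obtain ⟨β, hβ⟩ : ∃ β, β = p (a0.succAbove j1) := ⟨_, rfl⟩
  have hpj : ∀ j, p j = α * u j + β * v j := by
    intro j
    rcases Fin.eq_self_or_eq_succAbove a0 j with rfl | ⟨b, rfl⟩
    · rw [hpW, hu, hv, Finset.mul_sum, Finset.mul_sum, ← Finset.sum_add_distrib]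
      exact Finset.sum_congr rfl fun b _ => by rw [hpb b, ← hα, ← hβ]; ring
    · rw [hpb b, hα, hβ]; ring
  obtain ⟨γ, q, hγ, hq, hEq⟩ : ∃ (γ : Ω) (q : Fin (n + 1) → Ω), γ ≠ 0 ∧ p = (fun j => γ * q j) ∧
      ∀ b, ∃ ε, ∀ j, E b (q j) = ε * v j := by
    by_cases h0 : α = 0
    · have h1 : β ≠ 0 := by
        rintro rfl
        apply hp
        funext j
        rw [hpj, h0]; simp
      refine ⟨β, v, h1, funext fun j => by rw [hpj, h0]; ring, fun b => ⟨0, fun j => ?_⟩⟩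
      rw [hEv, zero_mul]
    · refine ⟨α, fun j => u j + β / α * v j, h0, funext fun j => ?_,
        fun b => ⟨E b (β / α), fun j => ?_⟩⟩
      · rw [hpj]; field_simp
      · simp [hEu, hEv, mul_comm]
  obtain ⟨c', hc'⟩ : ∃ c' : Fin s → Ω, ∀ j, H j = ∑ i, c' i * Jac f q i j := by
    refine ⟨fun i => c i * γ ^ (d i - 1), fun j => ?_⟩
    rw [hHj]
    refine Finset.sum_congr rfl fun i _ => ?_
    simp only [Jac, Matrix.of_apply]
    rw [hq, aeval_smul_homog (hf i).pderiv]; ring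
  obtain ⟨g, hg⟩ : ∃ g : Fin (n + 1) → Ω, g = fun j => ∑ i, c' i * ∑ l,
    MvPolynomial.aeval q (MvPolynomial.pderiv l (MvPolynomial.pderiv j (f i))) * v l := ⟨_, rfl⟩
  let V : Fin s ⊕ Fin 3 → Fin (n + 1) → Ω := Sum.elim (fun i => Jac f q i)
    ![g, Pi.single (a0.succAbove i1) 1, Pi.single (a0.succAbove j1) 1]
  let S := Submodule.span Ω (Set.range V)
  have hVS : ∀ i, V i ∈ S := fun i => Submodule.subset_span ⟨i, rfl⟩
  have hHS : H ∈ S := by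
    have : H = ∑ i, c' i • V (Sum.inl i) := by
      funext j
      rw [hc', Finset.sum_apply]; rfl
    rw [this]
    exact Submodule.sum_mem _ fun i _ => S.smul_mem _ (hVS _)
  have hES : ∀ b, (fun j => E b (H j)) ∈ S := by
    intro b
    obtain ⟨ε, hε⟩ := hEq b
    have : (fun j => E b (H j)) = ∑ i, E b (c' i) • V (Sum.inl i) + ε • V (Sum.inr 0) := by
      funext j
      rw [hc', map_sum]
      simp only [Derivation.leibniz, Jac, Matrix.of_apply, deriv_aeval, hε, smul_eq_mul,
        Finset.sum_add_distrib]
      rw [add_comm, Pi.add_apply, Finset.sum_apply]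
      congr 1
      · exact Finset.sum_congr rfl fun i _ => mul_comm _ _
      · change _ = ε * g j
        rw [hg]
        simp only [Finset.mul_sum]
        exact Finset.sum_congr rfl fun i _ => Finset.sum_congr rfl fun l _ => by ring
    rw [this]
    exact S.add_mem (Submodule.sum_mem _ fun i _ => S.smul_mem _ (hVS _)) (S.smul_mem _ (hVS _))
  have h1 : ∀ b, (Pi.single (a0.succAbove b) 1 : Fin (n + 1) → Ω) ∈ S := by
    intro b
    have : (Pi.single (a0.succAbove b) 1 : Fin (n + 1) → Ω) =
        (H a0)⁻¹ • ((E b (H a0) / H a0) • H - (fun j => E b (H j))) +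
        u (a0.succAbove b) • V (Sum.inr 1) + v (a0.succAbove b) • V (Sum.inr 2) := by
      funext j
      change _ = (H a0)⁻¹ * ((E b (H a0) / H a0) * H j - E b (H j)) + u (a0.succAbove b) *
        (Pi.single (a0.succAbove i1) 1 : Fin (n + 1) → Ω) j + v (a0.succAbove b) *
        (Pi.single (a0.succAbove j1) 1 : Fin (n + 1) → Ω) j
      rcases Fin.eq_self_or_eq_succAbove a0 j with rfl | ⟨b', rfl⟩
      · simp [Fin.ne_succAbove, hμ]
      · rw [hHb]
        simp only [Derivation.leibniz, Derivation.map_neg, smul_eq_mul, hEW, Pi.single_apply,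
          Fin.succAbove_right_inj]
        field_simp
        split_ifs <;> ring
    rw [this]
    exact S.add_mem (S.add_mem (S.smul_mem _ (S.sub_mem (S.smul_mem _ hHS) (hES b)))
      (S.smul_mem _ (hVS _))) (S.smul_mem _ (hVS _))
  have h2 : (Pi.single a0 1 : Fin (n + 1) → Ω) ∈ S := by
    have : (Pi.single a0 1 : Fin (n + 1) → Ω) = (H a0)⁻¹ • H +
        ∑ b, W b • (Pi.single (a0.succAbove b) 1 : Fin (n + 1) → Ω) := by
      funext j
      simp only [Pi.add_apply, Finset.sum_apply, Pi.smul_apply, smul_eq_mul]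
      rcases Fin.eq_self_or_eq_succAbove a0 j with rfl | ⟨b', rfl⟩
      · simp [Fin.ne_succAbove, hμ]
      · rw [hHb]
        simp only [Pi.single_apply, Fin.succAbove_right_inj, mul_ite, mul_one, mul_zero,
          Finset.sum_ite_eq, Finset.mem_univ, if_true, Fin.succAbove_ne, if_false]
        field_simp
        ring
    rw [this]
    exact S.add_mem (S.smul_mem _ hHS) (Submodule.sum_mem _ fun b _ => S.smul_mem _ (h1 b))
  have h3 : S = ⊤ := by
    rw [eq_top_iff]
    intro z _
    rw [pi_eq_sum_univ' z]
    refine Submodule.sum_mem _ fun j _ => S.smul_mem _ ?_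
    rcases Fin.eq_self_or_eq_succAbove a0 j with rfl | ⟨b', rfl⟩
    · convert h2 using 1
    · convert h1 b' using 1
  have h4 : Module.finrank Ω S ≤ Fintype.card (Fin s ⊕ Fin 3) := finrank_range_le_card V
  rw [h3, finrank_top] at h4
  simp at h4
  omega

end FL

namespace FL

open Matrix

theorem bertini_rank {K Ω : Type*} [Field K] [Field Ω] [Algebra K Ω] {n : ℕ}
    (a0 : Fin (n + 1)) (i1 j1 : Fin n) (u v : Fin (n + 1) → Ω)
    (W : Fin n → Ω) (E : Fin n → Derivation K Ω Ω)
    (hEu : ∀ b j, E b (u j) = 0) (hEv : ∀ b j, E b (v j) = 0)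
    (hu : u a0 = ∑ b, W b * u (a0.succAbove b)) (hv : v a0 = ∑ b, W b * v (a0.succAbove b))
    (hEW : ∀ b b', E b (W b') = (if b' = b then 1 else 0) -
      (if b' = i1 then u (a0.succAbove b) else 0) - (if b' = j1 then v (a0.succAbove b) else 0)) :
    Module.finrank Ω (LinearMap.range (evD (K := K) (Sum.elim u v))) ≤
      Module.finrank Ω (LinearMap.range (evD (K := constF (killD K W))
        (Sum.elim (fun b => u (a0.succAbove b)) (fun b => v (a0.succAbove b))))) + 2 := by
  classical
  let R := LinearMap.range (evD (K := K) (Sum.elim u v))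
  let φ : (Fin (n + 1) ⊕ Fin (n + 1) → Ω) →ₗ[Ω] (Fin 2 → Ω) :=
    { toFun := fun r => ![r (Sum.inl a0) - ∑ b, W b * r (Sum.inl (a0.succAbove b)),
        r (Sum.inr a0) - ∑ b, W b * r (Sum.inr (a0.succAbove b))]
      map_add' := by
        intro r r'
        ext j
        fin_cases j <;> simp [mul_add, Finset.sum_add_distrib] <;> ring
      map_smul' := by
        intro c r
        ext j
        fin_cases j <;> simp [mul_sub, Finset.mul_sum, mul_left_comm] }
  have hφ : ∀ r, φ r = 0 → r (Sum.inl a0) = ∑ b, W b * r (Sum.inl (a0.succAbove b)) ∧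
      r (Sum.inr a0) = ∑ b, W b * r (Sum.inr (a0.succAbove b)) := fun r hr =>
    ⟨sub_eq_zero.mp (congrFun hr 0), sub_eq_zero.mp (congrFun hr 1)⟩
  let φ' := φ.comp R.subtype
  have h1 := LinearMap.finrank_range_add_finrank_ker φ'
  have h2 : Module.finrank Ω (LinearMap.range φ') ≤ 2 := by
    have := Submodule.finrank_le (LinearMap.range φ')
    simpa using this
  let g : LinearMap.ker φ' →ₗ[Ω] (Fin n ⊕ Fin n → Ω) :=
    (LinearMap.funLeft Ω Ω (Sum.map a0.succAbove a0.succAbove)).comp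
      (R.subtype.comp (LinearMap.ker φ').subtype)
  have h3 : Function.Injective g := by
    rintro ⟨⟨r, hr⟩, h⟩ ⟨⟨r', hr'⟩, h'⟩ h0
    obtain ⟨a1, a2⟩ := hφ r h
    obtain ⟨b1, b2⟩ := hφ r' h'
    have e1 : ∀ b, r (Sum.inl (a0.succAbove b)) = r' (Sum.inl (a0.succAbove b)) := fun b =>
      congrFun h0 (Sum.inl b)
    have e2 : ∀ b, r (Sum.inr (a0.succAbove b)) = r' (Sum.inr (a0.succAbove b)) := fun b =>
      congrFun h0 (Sum.inr b)
    refine Subtype.ext (Subtype.ext (funext fun j => ?_))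
    change r j = r' j
    rcases j with j | j <;> rcases Fin.eq_self_or_eq_succAbove a0 j with rfl | ⟨b, rfl⟩
    · rw [a1, b1]; simp only [e1]
    · exact e1 b
    · rw [a2, b2]; simp only [e2]
    · exact e2 b
  have h4 : LinearMap.range g ≤ LinearMap.range (evD (K := constF (killD K W))
        (Sum.elim (fun b => u (a0.succAbove b)) (fun b => v (a0.succAbove b)))) := by
    rintro _ ⟨⟨⟨_, D, rfl⟩, h⟩, rfl⟩
    obtain ⟨a1, a2⟩ : D (u a0) = ∑ b, W b * D (u (a0.succAbove b)) ∧
      D (v a0) = ∑ b, W b * D (v (a0.succAbove b)) := hφ _ h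
    have s1 : ∑ b, D (W b) * u (a0.succAbove b) = 0 := by
      have := congrArg D hu
      rw [a1, map_sum] at this
      simp only [Derivation.leibniz, smul_eq_mul, Finset.sum_add_distrib] at this
      rw [← left_eq_add.mp this]
      exact Finset.sum_congr rfl fun b _ => mul_comm _ _
    have s2 : ∑ b, D (W b) * v (a0.succAbove b) = 0 := by
      have := congrArg D hv
      rw [a2, map_sum] at this
      simp only [Derivation.leibniz, smul_eq_mul, Finset.sum_add_distrib] at this
      rw [← left_eq_add.mp this]
      exact Finset.sum_congr rfl fun b _ => mul_comm _ _
    have hD' : D - ∑ b, D (W b) • E b ∈ killD K W := by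
      intro b'
      rw [Derivation.sub_apply, der_sum_apply]
      simp only [Derivation.smul_apply, smul_eq_mul, hEW, mul_sub, Finset.sum_sub_distrib, mul_ite,
        mul_one, mul_zero, Finset.sum_ite_eq, Finset.mem_univ, if_true]
      split_ifs <;> simp [s1, s2]
    refine ⟨constDer _ _ hD', funext fun j => ?_⟩
    rcases j with b | b
    · rw [evD_apply, constDer_apply, Derivation.sub_apply, der_sum_apply]
      simp only [Sum.elim_inl, Derivation.smul_apply, hEu, smul_zero, Finset.sum_const_zero, sub_zero]
      rfl
    · rw [evD_apply, constDer_apply, Derivation.sub_apply, der_sum_apply]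
      simp only [Sum.elim_inr, Derivation.smul_apply, hEv, smul_zero, Finset.sum_const_zero, sub_zero]
      rfl
  have h5 := Submodule.finrank_mono h4
  rw [LinearMap.finrank_range_of_inj h3] at h5
  change _ = Module.finrank Ω R at h1
  change Module.finrank Ω R ≤ _
  omega

universe w

/-- Upper bound on the dimension of the space of lines. -/
theorem rank_le {Ω : Type w} [Field Ω] [IsAlgClosed Ω] [CharZero Ω] {s : ℕ} (d : Fin s → ℕ)
    (hd : ∀ i, 2 ≤ d i) (hs : 2 ≤ s) (h5 : ∑ i, (d i - 1) ≤ 5) (t : ℕ) :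
    ∀ (n : ℕ) (K : Type w) [Field K] [Algebra K Ω] (f : Fin s → MvPolynomial (Fin (n + 1)) K),
    n = ∑ i, d i + t → (∀ i, (f i).IsHomogeneous (d i)) → Smooth Ω f → Big K Ω →
    ∀ (i0 j0 : Fin (n + 1)) (u v : Fin (n + 1) → Ω),
    u i0 = 1 → u j0 = 0 → v i0 = 0 → v j0 = 1 →
    (∀ (α β : Ω) i, MvPolynomial.aeval (fun j => α * u j + β * v j) (f i) = 0) →
    Module.finrank Ω (LinearMap.range (evD (K := K) (Sum.elim u v))) + ∑ i, d i + s + 2 ≤ 2 * n := by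
  classical
  have hds : ∑ i, d i = ∑ i, (d i - 1) + s := by
    have : ∑ i, d i = ∑ i, ((d i - 1) + 1) := Finset.sum_congr rfl fun i _ => by
      have := hd i; omega
    rw [this, Finset.sum_add_distrib]; simp
  have hs2 : s ≤ ∑ i, (d i - 1) := by
    calc s = ∑ i : Fin s, 1 := by simp
      _ ≤ _ := Finset.sum_le_sum fun i _ => by have := hd i; omega
  induction t with
  | zero =>
    intro n K _ _ f hn hf hsm hbig i0 j0 u v hui huj hvi hvj hline
    by_contra hlt
    exact base_case f d hf hd hs hsm (m := ∑ i, (d i - 1)) (by simp; omega) rfl h5 hbig i0 j0 u v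
      hui huj hvi hvj hline (by omega)
  | succ t ih =>
    intro n K _ _ f hn hf hsm hbig i0 j0 u v hui huj hvi hvj hline
    obtain ⟨n, rfl⟩ : ∃ N, n = N + 1 := ⟨n - 1, by omega⟩
    obtain ⟨a0, ha0⟩ : ∃ a0 : Fin (n + 1 + 1), a0 ∉ ({i0, j0} : Finset (Fin (n + 1 + 1))) := by
      by_contra hc
      push Not at hc
      have h1 : (Finset.univ : Finset (Fin (n + 1 + 1))) ⊆ {i0, j0} := fun a _ => hc a
      have h2 := Finset.card_le_card h1
      have h3 : ({i0, j0} : Finset (Fin (n + 1 + 1))).card ≤ 2 := Finset.card_le_two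
      simp at h2
      omega
    simp only [Finset.mem_insert, Finset.mem_singleton, not_or] at ha0
    obtain ⟨i1, rfl⟩ := Fin.exists_succAbove_eq (Ne.symm ha0.1)
    obtain ⟨j1, rfl⟩ := Fin.exists_succAbove_eq (Ne.symm ha0.2)
    obtain ⟨c, E, hE0, hEc⟩ := hbig (Finset.univ.image u ∪ Finset.univ.image v) (n + 1)
    have hEu : ∀ b j, E b (u j) = 0 := fun b j => hE0 b _ (by simp)
    have hEv : ∀ b j, E b (v j) = 0 := fun b j => hE0 b _ (by simp)
    obtain ⟨X, hX⟩ : ∃ X, X = ∑ b, c b * u (a0.succAbove b) - u a0 := ⟨_, rfl⟩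
    obtain ⟨Y, hY⟩ : ∃ Y, Y = ∑ b, c b * v (a0.succAbove b) - v a0 := ⟨_, rfl⟩
    obtain ⟨W, hW⟩ : ∃ W : Fin (n + 1) → Ω, ∀ b, W b = c b - (if b = i1 then X else 0) -
      (if b = j1 then Y else 0) := ⟨_, fun _ => rfl⟩
    have hu : u a0 = ∑ b, W b * u (a0.succAbove b) := by
      simp only [hW, sub_mul, Finset.sum_sub_distrib, ite_mul, zero_mul, Finset.sum_ite_eq',
        Finset.mem_univ, if_true, hui, huj]
      rw [hX]; ring
    have hv : v a0 = ∑ b, W b * v (a0.succAbove b) := by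
      simp only [hW, sub_mul, Finset.sum_sub_distrib, ite_mul, zero_mul, Finset.sum_ite_eq',
        Finset.mem_univ, if_true, hvi, hvj]
      rw [hY]; ring
    have hEX : ∀ b, E b X = u (a0.succAbove b) := by
      intro b
      rw [hX, map_sub, map_sum, hEu]
      simp [hEu, hEc]
    have hEY : ∀ b, E b Y = v (a0.succAbove b) := by
      intro b
      rw [hY, map_sub, map_sum, hEv]
      simp [hEv, hEc]
    have hEW : ∀ b b', E b (W b') = (if b' = b then 1 else 0) -
        (if b' = i1 then u (a0.succAbove b) else 0) -
        (if b' = j1 then v (a0.succAbove b) else 0) := by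
      intro b b'
      rw [hW, map_sub, map_sub, hEc, apply_ite (E b), apply_ite (E b), hEX, hEY, map_zero]
      simp only [eq_comm]
    have hrank := bertini_rank a0 i1 j1 u v W E hEu hEv hu hv hEW
    let W1 : Fin (n + 1) → constF (killD K W) := fun b => ⟨W b, fun D hD => hD b⟩
    let w : Fin (n + 1) → Fin (n + 1 + 1) → constF (killD K W) := fun b =>
      a0.insertNth (W1 b) (Pi.single b 1)
    have hw0 : ∀ b, algebraMap (constF (killD K W)) Ω (w b a0) = W b := by
      intro b; simp [w]; rfl
    have hw1 : ∀ b b', algebraMap (constF (killD K W)) Ω (w b (a0.succAbove b')) =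
        if b' = b then 1 else 0 := by
      intro b b'
      simp only [w, Fin.insertNth_apply_succAbove, Pi.single_apply]
      split_ifs <;> simp
    have hP0 : ∀ z : Fin (n + 1) → Ω,
        ∑ b, z b * algebraMap (constF (killD K W)) Ω (w b a0) = ∑ b, W b * z b := by
      intro z
      exact Finset.sum_congr rfl fun b _ => by rw [hw0, mul_comm]
    have hP1 : ∀ (z : Fin (n + 1) → Ω) b',
        ∑ b, z b * algebraMap (constF (killD K W)) Ω (w b (a0.succAbove b')) = z b' := by
      intro z b'
      simp [hw1]
    have hfull : ∀ (α β : Ω), (fun j => ∑ b, (α * u (a0.succAbove b) + β * v (a0.succAbove b)) *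
        algebraMap (constF (killD K W)) Ω (w b j)) = fun j => α * u j + β * v j := by
      intro α β
      funext j
      rcases Fin.eq_self_or_eq_succAbove a0 j with rfl | ⟨b, rfl⟩
      · rw [hP0, hu, hv, Finset.mul_sum, Finset.mul_sum, ← Finset.sum_add_distrib]
        exact Finset.sum_congr rfl fun b _ => by ring
      · rw [hP1]
    have hind := ih n (constF (killD K W)) (fun i => restr w (f i)) (by omega)
      (fun i => restr_homog w _ _ (hf i)) ?_ ?_ i1 j1 (fun b => u (a0.succAbove b))
      (fun b => v (a0.succAbove b)) hui huj hvi hvj ?_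
    · omega
    · intro z hz hfz
      have hfz' : ∀ i, MvPolynomial.aeval (fun j => ∑ b, z b *
          algebraMap (constF (killD K W)) Ω (w b j)) (f i) = 0 := fun i => by
        rw [← aeval_restr]; exact hfz i
      rw [Fintype.linearIndependent_iff]
      intro g hg i
      refine congrFun (bertini_smooth f d hf hsm (by omega) a0 i1 j1 u v W E hEu hEv hu hv hEW
        (fun j => ∑ b, z b * algebraMap (constF (killD K W)) Ω (w b j)) ?_ hfz' ?_ g ?_) i
      · intro h0
        apply hz
        funext b
        rw [← hP1 z b]
        exact congrFun h0 _
      · rw [hP0]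
        exact Finset.sum_congr rfl fun b _ => by rw [hP1]
      · intro b
        have h0 := congrFun hg b
        rw [Finset.sum_apply] at h0
        refine Eq.trans (Finset.sum_congr rfl fun i _ => ?_) h0
        rw [Pi.smul_apply, smul_eq_mul]
        congr 1
        change _ = MvPolynomial.aeval z (MvPolynomial.pderiv b (restr w (f i)))
        rw [pderiv_restr, map_sum, Fin.sum_univ_succAbove _ a0]
        simp only [map_mul, MvPolynomial.aeval_C, aeval_restr, hw1, hw0, mul_ite, mul_one, mul_zero,
          Finset.sum_ite_eq', Finset.mem_univ, if_true]
        simp only [Jac, Matrix.of_apply]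
        ring
    · intro Z r
      obtain ⟨c, E, h1, h2⟩ := hbig (Z ∪ Finset.univ.image W) r
      exact ⟨c, fun a => constDer _ (E a) (fun j => h1 a _ (by simp)), fun a z hz =>
        h1 a z (by simp [hz]), fun a b => h2 a b⟩
    · intro α β i
      rw [← hline α β i, ← hfull α β]
      exact aeval_restr w (f i) _

end FL

namespace FL

open Matrix

theorem lower_abs {τ T : Type*} [Finite τ] [TopologicalSpace T] (J : Ideal (MvPolynomial τ ℂ))
    (ψ : MvPolynomial.zeroLocus ℂ J → T)
    (h1 : ∀ g : MvPolynomial τ ℂ, ∃ O : Set T, IsOpen O ∧ ∀ z, ψ z ∈ O ↔ MvPolynomial.aeval z.1 g ≠ 0)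
    (h2 : ∀ O : Set T, IsOpen O → ∀ z, ψ z ∈ O → ∃ g : MvPolynomial τ ℂ,
      MvPolynomial.aeval z.1 g ≠ 0 ∧ ∀ z' : MvPolynomial.zeroLocus ℂ J,
        MvPolynomial.aeval z'.1 g ≠ 0 → ψ z' ∈ O) :
    ringKrullDim (MvPolynomial τ ℂ ⧸ J) ≤ topologicalKrullDim T := by
  let Q : PrimeSpectrum (MvPolynomial τ ℂ ⧸ J) → Ideal (MvPolynomial τ ℂ) := fun q =>
    q.asIdeal.comap (Ideal.Quotient.mk J)
  have hQp : ∀ q, (Q q).IsPrime := fun q => Ideal.comap_isPrime _ _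
  have hQJ : ∀ q, J ≤ Q q := fun q g hg => by
    simp only [Q, Ideal.mem_comap, Ideal.Quotient.eq_zero_iff_mem.mpr hg, Submodule.zero_mem]
  have hex : ∀ q, ∀ g ∉ Q q, ∃ z : MvPolynomial.zeroLocus ℂ J, (∀ p ∈ Q q, MvPolynomial.aeval z.1 p = 0) ∧
      MvPolynomial.aeval z.1 g ≠ 0 := by
    intro q g hg
    rw [← (hQp q).radical, ← MvPolynomial.vanishingIdeal_zeroLocus_eq_radical (K := ℂ) (Q q),
      MvPolynomial.mem_vanishingIdeal_iff] at hg
    push Not at hg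
    obtain ⟨z, hz, hz'⟩ := hg
    exact ⟨⟨z, fun p hp => hz p (hQJ q hp)⟩, hz, hz'⟩
  let S : PrimeSpectrum (MvPolynomial τ ℂ ⧸ J) → Set T := fun q =>
    {t | ∃ z, (∀ p ∈ Q q, MvPolynomial.aeval z.1 p = 0) ∧ ψ z = t}
  have hirr : ∀ q, IsIrreducible (S q) := by
    intro q
    constructor
    · obtain ⟨z, hz, -⟩ := hex q 1 ((Ideal.ne_top_iff_one _).mp (hQp q).ne_top)
      exact ⟨_, z, hz, rfl⟩
    · rintro O1 O2 ho1 ho2 ⟨_, ⟨z1, hz1, rfl⟩, hO1⟩ ⟨_, ⟨z2, hz2, rfl⟩, hO2⟩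
      obtain ⟨g1, hg1, hg1'⟩ := h2 O1 ho1 z1 hO1
      obtain ⟨g2, hg2, hg2'⟩ := h2 O2 ho2 z2 hO2
      obtain ⟨z, hz, hz'⟩ := hex q (g1 * g2) fun h => ((hQp q).mem_or_mem h).elim
        (fun h => hg1 (hz1 _ h)) (fun h => hg2 (hz2 _ h))
      rw [map_mul] at hz'
      exact ⟨ψ z, ⟨z, hz, rfl⟩, hg1' z (left_ne_zero_of_mul hz'), hg2' z (right_ne_zero_of_mul hz')⟩
  let Φ : PrimeSpectrum (MvPolynomial τ ℂ ⧸ J) → (TopologicalSpace.IrreducibleCloseds T)ᵒᵈ := fun q =>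
    OrderDual.toDual ⟨closure (S q), (hirr q).closure, isClosed_closure⟩
  have hanti : StrictMono Φ := by
    intro q q' hlt
    have hle : Q q ≤ Q q' := Ideal.comap_mono hlt.le
    change closure (S q') < closure (S q)
    refine lt_of_le_of_ne (closure_mono ?_) fun he => ?_
    · rintro _ ⟨z, hz, rfl⟩
      exact ⟨z, fun p hp => hz p (hle hp), rfl⟩
    · have hnot : ¬ Q q' ≤ Q q := by
        intro h
        refine hlt.not_ge ?_
        intro g hg
        obtain ⟨g, rfl⟩ := Ideal.Quotient.mk_surjective g
        exact h hg
      obtain ⟨g, hg, hg'⟩ := SetLike.not_le_iff_exists.mp hnot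
      obtain ⟨O, hO, hOg⟩ := h1 g
      obtain ⟨z, hz, hz'⟩ := hex q g hg'
      have hmem : ψ z ∈ closure (S q') := by rw [he]; exact subset_closure ⟨z, hz, rfl⟩
      obtain ⟨_, hy, ⟨z', hz1, rfl⟩⟩ := mem_closure_iff.mp hmem O hO ((hOg z).mpr hz')
      exact (hOg z').mp hy (hz1 g hg)
  have := Order.krullDim_le_of_strictMono Φ hanti
  rw [Order.krullDim_orderDual] at this
  exact this

theorem upper_abs {τ T : Type*} [TopologicalSpace T] (E : Set (τ → ℂ)) (ψ : E → T)
    (h1 : ∀ g : MvPolynomial τ ℂ, ∃ O : Set T, IsOpen O ∧ ∀ z, ψ z ∈ O ↔ MvPolynomial.aeval z.1 g ≠ 0)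
    (h2 : ∀ O : Set T, IsOpen O → ∀ z, ψ z ∈ O → ∃ g : MvPolynomial τ ℂ,
      MvPolynomial.aeval z.1 g ≠ 0 ∧ ∀ z' : E, MvPolynomial.aeval z'.1 g ≠ 0 → ψ z' ∈ O)
    (h3 : IsOpen (Set.range ψ)) (c : LTSeries (TopologicalSpace.IrreducibleCloseds T))
    (hc : ((c.head : Set T) ∩ Set.range ψ).Nonempty) :
    ∃ P : Ideal (MvPolynomial τ ℂ), P.IsPrime ∧
      (∀ g : MvPolynomial τ ℂ, (∀ z ∈ E, MvPolynomial.aeval z g = 0) → g ∈ P) ∧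
      (c.length : WithBot ℕ∞) ≤ ringKrullDim (MvPolynomial τ ℂ ⧸ P) := by
  have hne : ∀ l, ((c l : Set T) ∩ Set.range ψ).Nonempty := fun l => by
    refine hc.mono (Set.inter_subset_inter_left _ ?_)
    exact LTSeries.head_le c l
  let I : Fin (c.length + 1) → Ideal (MvPolynomial τ ℂ) := fun l =>
    { carrier := {g | ∀ z : E, ψ z ∈ (c l : Set T) → MvPolynomial.aeval z.1 g = 0}
      add_mem' := by intro a b ha hb z hz; rw [map_add, ha z hz, hb z hz, add_zero]
      zero_mem' := by intro z hz; simp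
      smul_mem' := by intro a b hb z hz; rw [smul_eq_mul, map_mul, hb z hz, mul_zero] }
  have hmem : ∀ l g, g ∈ I l ↔ ∀ z : E, ψ z ∈ (c l : Set T) → MvPolynomial.aeval z.1 g = 0 :=
    fun l g => Iff.rfl
  have hpt : ∀ l (O1 O2 : Set T), IsOpen O1 → IsOpen O2 → ((c l : Set T) ∩ O1).Nonempty →
      ((c l : Set T) ∩ O2).Nonempty → ∃ z : E, ψ z ∈ (c l : Set T) ∧ ψ z ∈ O1 ∧ ψ z ∈ O2 := by
    intro l O1 O2 ho1 ho2 hn1 hn2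
    have hp := (c l).isIrreducible.isPreirreducible
    obtain ⟨t, ht, hto⟩ := hp O1 O2 ho1 ho2 hn1 hn2
    obtain ⟨_, ht', ⟨h4, h5⟩, ⟨z, rfl⟩⟩ := hp (O1 ∩ O2) (Set.range ψ) (ho1.inter ho2) h3 ⟨t, ht, hto⟩ (hne l)
    exact ⟨z, ht', h4, h5⟩
  have hprime : ∀ l, (I l).IsPrime := by
    intro l
    refine ⟨fun h => ?_, fun {g h} hgh => ?_⟩
    · obtain ⟨_, ht, ⟨z, rfl⟩⟩ := hne l
      have : (1 : MvPolynomial τ ℂ) ∈ I l := by rw [h]; exact Submodule.mem_top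
      simpa using this z ht
    · by_contra hcon
      rw [not_or, hmem, hmem] at hcon
      push Not at hcon
      obtain ⟨⟨z1, hz1, hg1⟩, ⟨z2, hz2, hg2⟩⟩ := hcon
      obtain ⟨O1, ho1, hO1⟩ := h1 g
      obtain ⟨O2, ho2, hO2⟩ := h1 h
      obtain ⟨z, hz, ha, hb⟩ := hpt l O1 O2 ho1 ho2 ⟨_, hz1, (hO1 z1).mpr hg1⟩
        ⟨_, hz2, (hO2 z2).mpr hg2⟩
      have := hgh z hz
      rw [map_mul] at this
      exact mul_ne_zero ((hO1 z).mp ha) ((hO2 z).mp hb) this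
  have hanti : ∀ l l', l < l' → I l' < I l := by
    intro l l' hll
    have hlt := c.strictMono hll
    refine lt_of_le_of_ne (fun g hg z hz => hg z (hlt.le hz)) fun he => ?_
    have hnot : ¬ (c l' : Set T) ⊆ c l := fun h => hlt.not_ge h
    obtain ⟨t, ht, ht'⟩ := Set.not_subset.mp hnot
    obtain ⟨z, hz, hz1, -⟩ := hpt l' (c l : Set T)ᶜ (c l : Set T)ᶜ (c l).isClosed.isOpen_compl
      (c l).isClosed.isOpen_compl ⟨t, ht, ht'⟩ ⟨t, ht, ht'⟩
    obtain ⟨g, hg, hg'⟩ := h2 _ (c l).isClosed.isOpen_compl z hz1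
    have hgI : g ∈ I l := by
      intro z' hz'
      by_contra h0
      exact hg' z' h0 hz'
    rw [← he] at hgI
    exact hg (hgI z hz)
  let P := I (Fin.last _)
  have hPle : ∀ l, P ≤ I l := fun l => by
    rcases (Fin.le_last l).lt_or_eq with h | h
    · exact (hanti _ _ h).le
    · rw [h]
  refine ⟨P, hprime _, fun g hg z _ => hg z.1 z.2, ?_⟩
  have hmap : ∀ l, ((I l).map (Ideal.Quotient.mk P)).comap (Ideal.Quotient.mk P) = I l := by
    intro l
    rw [Ideal.comap_map_of_surjective _ Ideal.Quotient.mk_surjective, ← RingHom.ker_eq_comap_bot,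
      Ideal.mk_ker]
    exact sup_eq_left.mpr (hPle l)
  let Φ : Fin (c.length + 1) → (PrimeSpectrum (MvPolynomial τ ℂ ⧸ P))ᵒᵈ := fun l =>
    OrderDual.toDual ⟨(I l).map (Ideal.Quotient.mk P), by
      have := hprime l
      refine Ideal.map_isPrime_of_surjective Ideal.Quotient.mk_surjective ?_
      rw [Ideal.mk_ker]
      exact hPle l⟩
  have hΦ : StrictMono Φ := by
    intro l l' hll
    change (I l').map (Ideal.Quotient.mk P) < (I l).map (Ideal.Quotient.mk P)
    refine lt_of_le_of_ne (Ideal.map_mono (hanti _ _ hll).le) fun he => ?_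
    have := congrArg (Ideal.comap (Ideal.Quotient.mk P)) he
    rw [hmap, hmap] at this
    exact (hanti _ _ hll).ne this
  have h9 : (c.length : WithBot ℕ∞) ≤ Order.krullDim (PrimeSpectrum (MvPolynomial τ ℂ ⧸ P))ᵒᵈ :=
    Order.LTSeries.length_le_krullDim (LTSeries.mk c.length Φ hΦ)
  rw [Order.krullDim_orderDual] at h9
  exact h9

end FL

namespace FL

open Matrix

/-- Polynomials in countably many variables. -/
abbrev AN := MvPolynomial ℕ ℂ

/-- A large algebraically closed field. -/
abbrev Om := AlgebraicClosure (FractionRing AN)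

theorem om_inj : Function.Injective (algebraMap AN Om) := by
  rw [IsScalarTower.algebraMap_eq AN (FractionRing AN) Om]
  exact (algebraMap (FractionRing AN) Om).injective.comp (IsFractionRing.injective AN _)

theorem om_der (N : ℕ) : ∃ D : Derivation ℂ Om Om, ∀ g : AN,
    D (algebraMap AN Om g) = algebraMap AN Om (MvPolynomial.pderiv N g) := by
  have h1 : Algebra.FormallyEtale AN (FractionRing AN) :=
    Algebra.FormallyEtale.of_isLocalization (nonZeroDivisors AN)
  have h2 : Algebra.FormallyEtale (FractionRing AN) Om :=
    Algebra.FormallyEtale.of_isSeparable _ _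
  have h3 : Algebra.FormallyEtale AN Om := Algebra.FormallyEtale.comp AN (FractionRing AN) Om
  let D0 : Derivation ℂ AN Om := (Algebra.linearMap AN Om).compDer (MvPolynomial.pderiv N)
  let e := KaehlerDifferential.tensorKaehlerEquivOfFormallyEtale ℂ AN Om
  let L : KaehlerDifferential ℂ Om →ₗ[Om] Om :=
    (LinearMap.liftBaseChange Om D0.liftKaehlerDifferential) ∘ₗ e.symm.toLinearMap
  refine ⟨L.compDer (KaehlerDifferential.D ℂ Om), fun g => ?_⟩
  have h4 : e.symm (KaehlerDifferential.D ℂ Om (algebraMap AN Om g)) =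
      1 ⊗ₜ KaehlerDifferential.D ℂ AN g :=
    KaehlerDifferential.tensorKaehlerEquivOfFormallyEtale_symm_D_algebraMap ℂ AN Om g
  have h5 : L (KaehlerDifferential.D ℂ Om (algebraMap AN Om g)) = D0 g := by
    simp only [L, LinearMap.comp_apply, LinearEquiv.coe_coe, h4]
    simp
  exact h5

theorem om_big : Big ℂ Om := by
  classical
  choose δ hδ using om_der
  have hinj := om_inj
  let 𝔇 : ℕ → Set (Derivation ℂ Om Om) := fun N => {D | ∃ m, N ≤ m ∧ D = δ m}
  have halg : ∀ z : Om, ∃ N, ∀ m, N ≤ m → δ m z = 0 := by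
    intro z
    have h1 : IsAlgebraic AN z :=
      (IsFractionRing.isAlgebraic_iff AN (FractionRing AN) Om).mpr
        (Algebra.IsAlgebraic.isAlgebraic z)
    obtain ⟨p, hp0, hp⟩ := h1
    let S : Finset ℕ := p.support.biUnion fun k => (p.coeff k).vars
    let N := S.sup id + 1
    have hS : ∀ m, N ≤ m → ∀ k, MvPolynomial.pderiv m (p.coeff k) = 0 := by
      intro m hm k
      by_cases hk : k ∈ p.support
      · apply MvPolynomial.pderiv_eq_zero_of_notMem_vars
        intro hmem
        have := Finset.le_sup (f := id) (show m ∈ S from Finset.mem_biUnion.mpr ⟨k, hk, hmem⟩)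
        simp only [id] at this
        omega
      · rw [Polynomial.notMem_support_iff.mp hk, map_zero]
    have hcl := constF_closed (𝔇 N)
    have hco : ∀ k, algebraMap AN Om (p.coeff k) ∈ constF (𝔇 N) := by
      intro k
      rw [mem_constF]
      rintro _ ⟨m, hm, rfl⟩
      rw [hδ, hS m hm, map_zero]
    obtain ⟨q, hq⟩ : ∃ q : Polynomial (constF (𝔇 N)),
        q.map (algebraMap (constF (𝔇 N)) Om) = p.map (algebraMap AN Om) := by
      have : p.map (algebraMap AN Om) ∈ Polynomial.lifts (algebraMap (constF (𝔇 N)) Om) := by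
        rw [Polynomial.lifts_iff_coeff_lifts]
        intro k
        rw [Polynomial.coeff_map]
        exact ⟨⟨_, hco k⟩, rfl⟩
      exact (Polynomial.mem_lifts _).mp this
    have hq0 : q ≠ 0 := fun h => by
      rw [h, Polynomial.map_zero] at hq
      exact hp0 ((Polynomial.map_eq_zero_iff hinj).mp hq.symm)
    have hr : (q.map (algebraMap (constF (𝔇 N)) Om)).IsRoot z := by
      rw [hq, Polynomial.IsRoot.def, ← Polynomial.eval₂_eq_eval_map]
      exact hp
    obtain ⟨w, hw⟩ := (IsAlgClosed.splits q).mem_range_of_isRoot hq0 hr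
    refine ⟨N, fun m hm => ?_⟩
    rw [← hw]
    exact w.2 _ ⟨m, hm, rfl⟩
  intro Z r
  choose N hN using halg
  refine ⟨fun a => algebraMap AN Om (MvPolynomial.X (Z.sup N + a)), fun a => δ (Z.sup N + a),
    fun a z hz => hN z _ ((Finset.le_sup (f := N) hz).trans (Nat.le_add_right _ _)), fun a b => ?_⟩
  rw [hδ, MvPolynomial.pderiv_X, Pi.single_apply]
  by_cases h : a = b
  · subst h; simp
  · have : ¬ (Z.sup N + (b : ℕ) = Z.sup N + a) := fun h' => h (Fin.ext (by omega))
    rw [if_neg this, if_neg h, map_zero]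

theorem dim_le_of_integral {R S : Type*} [CommRing R] [CommRing S] [Algebra R S]
    [Algebra.IsIntegral R S] : ringKrullDim S ≤ ringKrullDim R := by
  refine Order.krullDim_le_of_strictMono (PrimeSpectrum.comap (algebraMap R S)) ?_
  intro I J h
  have := I.2
  exact Ideal.IsIntegral.comap_lt_comap (R := R) (show I.asIdeal < J.asIdeal from h)

theorem lift_gen {B S M : Type*} [CommRing B] [CommRing S] [IsDomain S] [Field M]
    [IsAlgClosed M] [Algebra B S] [Algebra.IsIntegral B S]
    (hinj : Function.Injective (algebraMap B S)) (ι : B →+* M) (hι : Function.Injective ι) :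
    ∃ φ : S →+* M, ∀ b, φ (algebraMap B S b) = ι b := by
  let _ : Algebra B M := ι.toAlgebra
  have : IsDomain B := hι.isDomain ι
  have ht1 : FaithfulSMul B M := (faithfulSMul_iff_algebraMap_injective _ _).mpr hι
  have ht2 : FaithfulSMul B S := (faithfulSMul_iff_algebraMap_injective _ _).mpr hinj
  let φ : S →ₐ[B] M := IsAlgClosed.lift
  exact ⟨φ.toRingHom, φ.commutes⟩

theorem gen_point {τ : Type} [Fintype τ] (P : Ideal (MvPolynomial τ ℂ)) [P.IsPrime] (r : ℕ)
    (hr : (r : WithBot ℕ∞) ≤ ringKrullDim (MvPolynomial τ ℂ ⧸ P)) :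
    ∃ z : τ → Om, (∀ g ∈ P, MvPolynomial.aeval z g = 0) ∧
      r ≤ Module.finrank Om (LinearMap.range (evD (K := ℂ) z)) := by
  classical
  obtain ⟨s, g, hg, hintg⟩ := exists_integral_inj_algHom_of_fg ℂ (MvPolynomial τ ℂ ⧸ P)
  let B := MvPolynomial (Fin s) ℂ
  let _ : Algebra B (MvPolynomial τ ℂ ⧸ P) := g.toRingHom.toAlgebra
  have hI : Algebra.IsIntegral B (MvPolynomial τ ℂ ⧸ P) := ⟨hintg⟩
  have hrs : r ≤ s := by
    have h1 := hr.trans (dim_le_of_integral (R := B))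
    rw [MvPolynomial.ringKrullDim_of_isNoetherianRing, ringKrullDim_eq_zero_of_field] at h1
    simpa using h1
  let ι : B →+* Om := (algebraMap AN Om).comp (MvPolynomial.rename (R := ℂ) (Fin.val (n := s))).toRingHom
  have hι : Function.Injective ι := om_inj.comp (MvPolynomial.rename_injective _ Fin.val_injective)
  obtain ⟨φ, hφ⟩ := lift_gen (S := MvPolynomial τ ℂ ⧸ P) hg ι hι
  have hφC : ∀ c : ℂ, φ (algebraMap ℂ _ c) = algebraMap ℂ Om c := by
    intro c
    have h1 : algebraMap ℂ (MvPolynomial τ ℂ ⧸ P) c =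
      algebraMap B _ (MvPolynomial.C c) := (g.commutes c).symm
    rw [h1, hφ]
    change algebraMap AN Om (MvPolynomial.rename _ _) = _
    rw [MvPolynomial.rename_C, IsScalarTower.algebraMap_apply ℂ AN Om]
    rfl
  let Φ : (MvPolynomial τ ℂ ⧸ P) →ₐ[ℂ] Om := { φ with commutes' := hφC }
  let z : τ → Om := fun j => Φ (Ideal.Quotient.mk P (MvPolynomial.X j))
  have hz : ∀ h, MvPolynomial.aeval z h = Φ (Ideal.Quotient.mk P h) := by
    intro h
    have : MvPolynomial.aeval z = Φ.comp (Ideal.Quotient.mkₐ ℂ P) :=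
      MvPolynomial.algHom_ext fun j => by simp [z]
    rw [this]; rfl
  choose H hH using fun t => Ideal.Quotient.mk_surjective (g (MvPolynomial.X t))
  have hX : ∀ t, MvPolynomial.aeval z (H t) = algebraMap AN Om (MvPolynomial.X (t : ℕ)) := by
    intro t
    rw [hz, hH]
    refine (hφ (MvPolynomial.X t)).trans ?_
    change algebraMap AN Om (MvPolynomial.rename _ _) = _
    rw [MvPolynomial.rename_X]
  refine ⟨z, fun g hg => by rw [hz, Ideal.Quotient.eq_zero_iff_mem.mpr hg, map_zero], hrs.trans ?_⟩
  choose δ hδ using om_der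
  have hli : LinearIndependent Om (fun t : Fin s =>
      (⟨evD z (δ t), LinearMap.mem_range_self _ _⟩ : LinearMap.range (evD (K := ℂ) z))) := by
    rw [Fintype.linearIndependent_iff]
    intro c hc t
    have h1 : evD z (∑ t : Fin s, c t • δ t) = 0 := by
      have := congrArg Subtype.val hc
      simpa using this
    have h2 : (∑ t : Fin s, c t • δ t) (MvPolynomial.aeval z (H t)) = 0 := by
      rw [deriv_aeval]
      refine Finset.sum_eq_zero fun j _ => ?_
      rw [← evD_apply z, h1]; simp
    rw [hX, der_sum_apply, Finset.sum_eq_single t] at h2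
    · simpa [hδ] using h2
    · intro t' _ hne
      have : (t : ℕ) ≠ t' := fun h => hne (Fin.ext h.symm)
      simp [hδ, MvPolynomial.pderiv_X, this]
    · simp
  simpa using hli.fintype_card_le_finrank

theorem smooth_om {n s : ℕ} (f : Fin s → MvPolynomial (Fin (n + 1)) ℂ) (h : Smooth ℂ f) :
    Smooth Om f := by
  classical
  intro v hv hfv
  rw [Fintype.linearIndependent_iff]
  intro c hc
  by_contra! hcon
  obtain ⟨i0, hi0⟩ := hcon
  obtain ⟨j0, hj0⟩ := Function.ne_iff.mp hv
  let A := Algebra.adjoin ℂ ((Set.range v ∪ Set.range c) ∪ {(v j0)⁻¹, (c i0)⁻¹})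
  have hA : Algebra.FiniteType ℂ A := by
    rw [← Subalgebra.fg_iff_finiteType]
    exact Subalgebra.fg_def.mpr ⟨_, ((Set.finite_range v).union (Set.finite_range c)).union
      (by simp), rfl⟩
  have hsub := Algebra.subset_adjoin (R := ℂ)
    (s := (Set.range v ∪ Set.range c) ∪ {(v j0)⁻¹, (c i0)⁻¹})
  let v' : Fin (n + 1) → A := fun j => ⟨v j, hsub (by simp)⟩
  let c' : Fin s → A := fun j => ⟨c j, hsub (by simp)⟩
  let v1 : A := ⟨(v j0)⁻¹, hsub (by simp)⟩
  let c1 : A := ⟨(c i0)⁻¹, hsub (by simp)⟩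
  have e1 : v' j0 * v1 = 1 := Subtype.ext (mul_inv_cancel₀ hj0)
  have e2 : c' i0 * c1 = 1 := Subtype.ext (mul_inv_cancel₀ hi0)
  have hev : ∀ p : MvPolynomial (Fin (n + 1)) ℂ,
      ((MvPolynomial.aeval v' p : A) : Om) = MvPolynomial.aeval v p := by
    intro p
    exact MvPolynomial.comp_aeval_apply (f := v') A.val p
  have e3 : ∀ i, MvPolynomial.aeval v' (f i) = 0 := fun i => Subtype.ext ((hev _).trans (hfv i))
  have e4 : ∀ j, ∑ i, c' i * MvPolynomial.aeval v' (MvPolynomial.pderiv j (f i)) = 0 := by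
    intro j
    apply Subtype.ext
    have := congrFun hc j
    simp only [Finset.sum_apply, Pi.smul_apply, smul_eq_mul, Jac, Matrix.of_apply,
      Pi.zero_apply] at this
    refine Eq.trans ?_ this
    rw [AddSubmonoidClass.coe_finsetSum]
    exact Finset.sum_congr rfl fun i _ => by
      rw [← hev]; rfl
  have hk := nss (F := ℂ) (⊥ : Ideal A) 1 fun φ _ => by
    exfalso
    have hφ : ∀ p : MvPolynomial (Fin (n + 1)) ℂ,
      MvPolynomial.aeval (fun j => φ (v' j)) p = φ (MvPolynomial.aeval v' p) := fun p =>
        (MvPolynomial.comp_aeval_apply (f := v') φ p).symm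
    have h1 := h (fun j => φ (v' j)) (fun h0 => by
      have := congrArg φ e1
      rw [map_mul, show φ (v' j0) = 0 from congrFun h0 j0] at this
      simp at this) (fun i => by rw [hφ, e3, map_zero])
    rw [Fintype.linearIndependent_iff] at h1
    have h2 := h1 (fun i => φ (c' i)) (by
      ext j
      simp only [Finset.sum_apply, Pi.smul_apply, smul_eq_mul, Jac, Matrix.of_apply,
        Pi.zero_apply, hφ]
      rw [← map_zero φ, ← e4 j, map_sum]
      simp) i0
    have := congrArg φ e2
    rw [map_mul, h2] at this
    simp at this
  have : (⊥ : Ideal A).radical ≠ ⊤ := by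
    rw [Ne, Ideal.radical_eq_top]
    exact bot_ne_top
  exact this ((Ideal.eq_top_iff_one _).mpr hk)

end FL

namespace FL

open Matrix MvPolynomial

variable {n s : ℕ}

/-- Basic open sets of the Grassmannian. -/
def grD (F : MvPolynomial (Fin (n + 1) ⊕ Fin (n + 1)) ℂ) : Set (ProjLine n) :=
  {W : ProjLine n | ¬ ∀ u ∈ W.1, ∀ v ∈ W.1, eval (Sum.elim u v) F = 0}

theorem grD_open (F : MvPolynomial (Fin (n + 1) ⊕ Fin (n + 1)) ℂ) : IsOpen (grD F) :=
  TopologicalSpace.isOpen_generateFrom_of_mem ⟨F, rfl⟩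

/-- Restriction of a polynomial to a parametrized line. -/
noncomputable def onLine {Ω τ : Type*} [Field Ω] [Algebra ℂ Ω] (a b : τ → Ω)
    (f : MvPolynomial τ ℂ) : Polynomial Ω :=
  aeval (fun j => Polynomial.C (a j) + Polynomial.X * Polynomial.C (b j)) f

theorem onLine_eval {Ω τ : Type*} [Field Ω] [Algebra ℂ Ω] (a b : τ → Ω)
    (f : MvPolynomial τ ℂ) (t : Ω) :
    (onLine a b f).eval t = aeval (fun j => a j + t * b j) f := by
  have h := comp_aeval_apply (f := fun j => Polynomial.C (a j) + Polynomial.X * Polynomial.C (b j))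
    ((Polynomial.aeval (R := Ω) t).restrictScalars ℂ) f
  rw [AlgHom.restrictScalars_apply, Polynomial.coe_aeval_eq_eval] at h
  refine h.trans ?_
  congr 2
  ext j
  simp
  ring

theorem line_ext {Ω τ : Type*} [Field Ω] [Algebra ℂ Ω] (a b : τ → Ω)
    (f : MvPolynomial τ ℂ) (S : Set ℂ) (hS : S.Infinite)
    (h : ∀ t ∈ S, aeval (fun j => a j + algebraMap ℂ Ω t * b j) f = 0) (t : Ω) :
    aeval (fun j => a j + t * b j) f = 0 := by
  rw [← onLine_eval, Polynomial.eq_zero_of_infinite_isRoot (onLine a b f) ?_, Polynomial.eval_zero]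
  refine (hS.image (algebraMap ℂ Ω).injective.injOn).mono ?_
  rintro _ ⟨t, ht, rfl⟩
  exact (onLine_eval a b f _).trans (h t ht)

theorem grD_mul (F G : MvPolynomial (Fin (n + 1) ⊕ Fin (n + 1)) ℂ) :
    grD (F * G) = grD F ∩ grD G := by
  ext W
  simp only [grD, Set.mem_inter_iff, Set.mem_ofPred_eq, map_mul]
  constructor
  · intro h
    exact ⟨fun h' => h fun u hu v hv => by rw [h' u hu v hv, zero_mul],
      fun h' => h fun u hu v hv => by rw [h' u hu v hv, mul_zero]⟩
  · rintro ⟨h1, h2⟩ h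
    push Not at h1 h2
    obtain ⟨u, hu, v, hv, h1⟩ := h1
    obtain ⟨u', hu', v', hv', h2⟩ := h2
    have key : ∀ t : ℂ, eval (fun j => Sum.elim u v j + t * Sum.elim (u' - u) (v' - v) j) F *
        eval (fun j => Sum.elim u v j + t * Sum.elim (u' - u) (v' - v) j) G = 0 := by
      intro t
      have := h (u + t • (u' - u)) (W.1.add_mem hu (W.1.smul_mem _ (W.1.sub_mem hu' hu)))
        (v + t • (v' - v)) (W.1.add_mem hv (W.1.smul_mem _ (W.1.sub_mem hv' hv)))
      have e : (fun j => Sum.elim u v j + t * Sum.elim (u' - u) (v' - v) j) =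
          Sum.elim (u + t • (u' - u)) (v + t • (v' - v)) := by
        ext j; cases j <;> simp
      rw [e]; exact this
    have h0 : onLine (Sum.elim u v) (Sum.elim (u' - u) (v' - v)) F *
        onLine (Sum.elim u v) (Sum.elim (u' - u) (v' - v)) G = 0 := by
      apply Polynomial.funext
      intro t
      rw [Polynomial.eval_mul, onLine_eval, onLine_eval, Polynomial.eval_zero]
      exact key t
    rcases mul_eq_zero.mp h0 with h0 | h0
    · have := congrArg (Polynomial.eval 0) h0
      rw [onLine_eval] at this
      simp only [zero_mul, add_zero, Polynomial.eval_zero] at this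
      exact h1 this
    · have := congrArg (Polynomial.eval 1) h0
      rw [onLine_eval] at this
      have e : (fun j => Sum.elim u v j + 1 * Sum.elim (u' - u) (v' - v) j) = Sum.elim u' v' := by
        ext j; cases j <;> simp
      rw [e, Polynomial.eval_zero] at this
      exact h2 this

theorem grD_basis (O : Set (ProjLine n)) (hO : IsOpen O) (W : ProjLine n) (hW : W ∈ O) :
    ∃ F, W ∈ grD F ∧ grD F ⊆ O := by
  induction hO with
  | basic U hU =>
    obtain ⟨F, rfl⟩ := hU
    exact ⟨F, hW, le_rfl⟩
  | univ => exact ⟨1, fun h => one_ne_zero ((map_one _).symm.trans (h 0 W.1.zero_mem 0 W.1.zero_mem)),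
      Set.subset_univ _⟩
  | inter A B _ _ h1 h2 =>
    obtain ⟨F, hF, hF'⟩ := h1 hW.1
    obtain ⟨G, hG, hG'⟩ := h2 hW.2
    exact ⟨F * G, by rw [grD_mul]; exact ⟨hF, hG⟩, by
      rw [grD_mul]; exact Set.inter_subset_inter hF' hG'⟩
  | sUnion S _ ih =>
    obtain ⟨A, hA, hWA⟩ := hW
    obtain ⟨F, hF, hF'⟩ := ih A hA hWA
    exact ⟨F, hF, hF'.trans (Set.subset_sUnion_of_mem hA)⟩

/-- Lines on `f = 0` in echelon form. -/
def Ech (f : Fin s → MvPolynomial (Fin (n + 1)) ℂ) (i j : Fin (n + 1)) :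
    Set (Fin (n + 1) ⊕ Fin (n + 1) → ℂ) :=
  {z | (z (.inl i) = 1 ∧ z (.inl j) = 0 ∧ z (.inr i) = 0 ∧ z (.inr j) = 1) ∧
    ∀ (α β : ℂ) k, aeval (fun a => α * z (.inl a) + β * z (.inr a)) (f k) = 0}

/-- Plücker minor. -/
noncomputable def plk (i j : Fin (n + 1)) : MvPolynomial (Fin (n + 1) ⊕ Fin (n + 1)) ℂ :=
  X (.inl i) * X (.inr j) - X (.inl j) * X (.inr i)

theorem plk_eval (i j : Fin (n + 1)) (u v : Fin (n + 1) → ℂ) :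
    eval (Sum.elim u v) (plk i j) = u i * v j - u j * v i := by simp [plk]

theorem chart_homog (i j : Fin (n + 1)) (g : MvPolynomial (Fin (n + 1) ⊕ Fin (n + 1)) ℂ) :
    ∃ N : ℕ, ∀ M, N ≤ M → ∃ G : MvPolynomial (Fin (n + 1) ⊕ Fin (n + 1)) ℂ,
      ∀ (z : Fin (n + 1) ⊕ Fin (n + 1) → ℂ) (u v : Fin (n + 1) → ℂ) (p : ℂ),
      eval (Sum.elim u v) (plk i j) = p →
      (∀ a, eval (Sum.elim u v) (plk a j) = p * z (.inl a)) →
      (∀ a, eval (Sum.elim u v) (plk i a) = p * z (.inr a)) →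
      eval (Sum.elim u v) G = p ^ M * eval z g := by
  induction g using MvPolynomial.induction_on with
  | C c =>
    refine ⟨0, fun M _ => ⟨plk i j ^ M * C c, fun z u v p hp _ _ => ?_⟩⟩
    rw [map_mul, map_pow, hp]; simp
  | add g h ihg ihh =>
    obtain ⟨N1, h1⟩ := ihg
    obtain ⟨N2, h2⟩ := ihh
    refine ⟨max N1 N2, fun M hM => ?_⟩
    obtain ⟨G1, h1⟩ := h1 M ((le_max_left _ _).trans hM)
    obtain ⟨G2, h2⟩ := h2 M ((le_max_right _ _).trans hM)
    exact ⟨G1 + G2, fun z u v p a b c => by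
      rw [map_add, h1 z u v p a b c, h2 z u v p a b c, map_add, mul_add]⟩
  | mul_X g a ih =>
    obtain ⟨N, h⟩ := ih
    refine ⟨N + 1, fun M hM => ?_⟩
    obtain ⟨M, rfl⟩ : ∃ M', M = M' + 1 := ⟨M - 1, by omega⟩
    obtain ⟨G, hG⟩ := h M (by omega)
    refine ⟨G * (Sum.elim (fun a => plk a j) (fun a => plk i a) a), fun z u v p e1 e2 e3 => ?_⟩
    rw [map_mul, hG z u v p e1 e2 e3, map_mul, eval_X]
    cases a with
    | inl a => rw [Sum.elim_inl, e2]; ring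
    | inr a => rw [Sum.elim_inr, e3]; ring

theorem mem_span2 {u v w : Fin (n + 1) → ℂ} (h : w ∈ Submodule.span ℂ {u, v}) :
    ∃ α β : ℂ, ∀ a, w a = α * u a + β * v a := by
  obtain ⟨α, β, rfl⟩ := Submodule.mem_span_pair.mp h
  exact ⟨α, β, fun a => by simp⟩

theorem chart (f : Fin s → MvPolynomial (Fin (n + 1)) ℂ) (T : Set (ProjLine n))
    (hT : ∀ W, W ∈ T ↔ ∀ w ∈ W.1, ∀ k, aeval w (f k) = 0) (i j : Fin (n + 1)) :
    ∃ ψ : Ech f i j → T,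
      (∀ g : MvPolynomial (Fin (n + 1) ⊕ Fin (n + 1)) ℂ,
        ∃ O : Set T, IsOpen O ∧ ∀ z, ψ z ∈ O ↔ aeval z.1 g ≠ 0) ∧
      (∀ O : Set T, IsOpen O → ∀ z, ψ z ∈ O →
        ∃ g : MvPolynomial (Fin (n + 1) ⊕ Fin (n + 1)) ℂ, aeval z.1 g ≠ 0 ∧
          ∀ z' : Ech f i j, aeval z'.1 g ≠ 0 → ψ z' ∈ O) ∧
      IsOpen (Set.range ψ) ∧
      ∀ W : T, ∀ u ∈ W.1.1, ∀ v ∈ W.1.1, u i * v j - u j * v i ≠ 0 → W ∈ Set.range ψ := by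
  classical
  let x : (Fin (n + 1) ⊕ Fin (n + 1) → ℂ) → Fin (n + 1) → ℂ := fun z a => z (.inl a)
  let y : (Fin (n + 1) ⊕ Fin (n + 1) → ℂ) → Fin (n + 1) → ℂ := fun z a => z (.inr a)
  let S : (Fin (n + 1) ⊕ Fin (n + 1) → ℂ) → Submodule ℂ (Fin (n + 1) → ℂ) := fun z =>
    Submodule.span ℂ {x z, y z}
  have hfin : ∀ z ∈ Ech f i j, Module.finrank ℂ (S z) = 2 := by
    rintro z ⟨⟨h1, h2, h3, h4⟩, -⟩
    have hli : LinearIndependent ℂ ![x z, y z] := by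
      rw [LinearIndependent.pair_iff]
      intro a b hab
      have e1 := congrFun hab i
      have e2 := congrFun hab j
      simp only [x, y, Pi.add_apply, Pi.smul_apply, h1, h2, h3, h4, smul_eq_mul, Pi.zero_apply]
        at e1 e2
      constructor
      · linear_combination e1
      · linear_combination e2
    have := finrank_span_eq_card hli
    rw [Matrix.range_cons, Matrix.range_cons, Matrix.range_empty, Set.union_empty] at this
    exact this.trans (Fintype.card_fin 2)
  have hx : ∀ z, x z ∈ S z := fun z => Submodule.subset_span (by simp)
  have hy : ∀ z, y z ∈ S z := fun z => Submodule.subset_span (by simp)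
  let ψ : Ech f i j → T := fun z => ⟨⟨S z.1, hfin z.1 z.2⟩, (hT _).mpr (by
    intro w hw k
    obtain ⟨α, β, h⟩ := mem_span2 hw
    rw [show w = _ from funext h]
    exact z.2.2 α β k)⟩
  have hW : ∀ W : T, ∀ u ∈ W.1.1, ∀ v ∈ W.1.1, u i * v j - u j * v i ≠ 0 →
      W ∈ Set.range ψ := by
    intro W u hu v hv hp
    have hinv := inv_mul_cancel₀ hp
    let p := u i * v j - u j * v i
    let u' := p⁻¹ • (v j • u - u j • v)
    let v' := p⁻¹ • (u i • v - v i • u)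
    have hu' : u' ∈ W.1.1 := W.1.1.smul_mem _ (W.1.1.sub_mem (W.1.1.smul_mem _ hu) (W.1.1.smul_mem _ hv))
    have hv' : v' ∈ W.1.1 := W.1.1.smul_mem _ (W.1.1.sub_mem (W.1.1.smul_mem _ hv) (W.1.1.smul_mem _ hu))
    have hz : Sum.elim u' v' ∈ Ech f i j := by
      refine ⟨⟨?_, ?_, ?_, ?_⟩, fun α β k => ?_⟩
      · simp only [Sum.elim_inl, u', p, Pi.smul_apply, Pi.sub_apply, smul_eq_mul]
        linear_combination hinv
      · simp only [Sum.elim_inl, u', p, Pi.smul_apply, Pi.sub_apply, smul_eq_mul]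
        ring
      · simp only [Sum.elim_inr, v', p, Pi.smul_apply, Pi.sub_apply, smul_eq_mul]
        ring
      · simp only [Sum.elim_inr, v', p, Pi.smul_apply, Pi.sub_apply, smul_eq_mul]
        linear_combination hinv
      · exact (hT W.1).mp W.2 (α • u' + β • v')
          (W.1.1.add_mem (W.1.1.smul_mem _ hu') (W.1.1.smul_mem _ hv')) k
    refine ⟨⟨_, hz⟩, Subtype.ext (Subtype.ext ?_)⟩
    refine Submodule.eq_of_le_of_finrank_eq ?_ ((hfin _ hz).trans W.1.2.symm)
    refine Submodule.span_le.mpr ?_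
    rintro w (rfl | rfl)
    · exact hu'
    · exact hv'
  refine ⟨ψ, fun g => ?_, fun O hO z hz => ?_, ?_, hW⟩
  · obtain ⟨N, hN⟩ := chart_homog i j g
    obtain ⟨G, hG⟩ := hN N le_rfl
    have hG' : ∀ z ∈ Ech f i j, ∀ (α β γ δ : ℂ) (u v : Fin (n + 1) → ℂ),
        (∀ a, u a = α * x z a + β * y z a) → (∀ a, v a = γ * x z a + δ * y z a) →
        eval (Sum.elim u v) G = (α * δ - β * γ) ^ N * eval z g := by
      rintro z ⟨⟨h1, h2, h3, h4⟩, -⟩ α β γ δ u v hu hv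
      refine hG z u v _ ?_ ?_ ?_
      · simp only [plk_eval, hu, hv, x, y, h1, h2, h3, h4]; ring
      · intro a; simp only [plk_eval, hu, hv, x, y, h1, h2, h3, h4]; ring
      · intro a; simp only [plk_eval, hu, hv, x, y, h1, h2, h3, h4]; ring
    refine ⟨Subtype.val ⁻¹' grD G, (grD_open G).preimage continuous_subtype_val, fun z => ?_⟩
    constructor
    · intro h h0
      refine h fun u hu v hv => ?_
      obtain ⟨α, β, hu⟩ := mem_span2 hu
      obtain ⟨γ, δ, hv⟩ := mem_span2 hv
      rw [hG' z.1 z.2 α β γ δ u v hu hv, show eval z.1 g = 0 from h0, mul_zero]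
    · intro h h0
      have h1 := h0 (x z.1) (hx _) (y z.1) (hy _)
      rw [hG' z.1 z.2 1 0 0 1 _ _ (by simp) (by simp)] at h1
      exact h (by simpa using h1)
  · obtain ⟨O', hO', rfl⟩ := isOpen_induced_iff.mp hO
    obtain ⟨F, hF, hFO⟩ := grD_basis O' hO' _ hz
    have hF' := hF
    simp only [grD, Set.mem_ofPred_eq] at hF'
    push Not at hF'
    obtain ⟨u, hu, v, hv, hne⟩ := hF'
    obtain ⟨α, β, hu⟩ := mem_span2 hu
    obtain ⟨γ, δ, hv⟩ := mem_span2 hv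
    let q : Fin (n + 1) ⊕ Fin (n + 1) → MvPolynomial (Fin (n + 1) ⊕ Fin (n + 1)) ℂ :=
      Sum.elim (fun a => C α * X (.inl a) + C β * X (.inr a))
        (fun a => C γ * X (.inl a) + C δ * X (.inr a))
    have hq : ∀ z', aeval z' (aeval q F) =
        eval (Sum.elim (α • x z' + β • y z') (γ • x z' + δ • y z')) F := by
      intro z'
      rw [comp_aeval_apply]
      change aeval _ F = aeval _ F
      congr 2
      ext a
      cases a <;> simp [q, x, y]
    refine ⟨aeval q F, ?_, fun z' hz' => hFO ?_⟩
    · rw [hq]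
      convert! hne using 4
      · ext a; rw [hu]; rfl
      · ext a; rw [hv]; rfl
    · intro h
      rw [hq] at hz'
      exact hz' (h _ ((S z'.1).add_mem ((S z'.1).smul_mem _ (hx _)) ((S z'.1).smul_mem _ (hy _)))
        _ ((S z'.1).add_mem ((S z'.1).smul_mem _ (hx _)) ((S z'.1).smul_mem _ (hy _))))
  · have : Set.range ψ = Subtype.val ⁻¹' grD (plk i j) := by
      ext W
      constructor
      · rintro ⟨⟨z, hz⟩, rfl⟩ h
        have := h (x z) (hx _) (y z) (hy _)
        obtain ⟨⟨h1, h2, h3, h4⟩, -⟩ := hz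
        simp [plk_eval, x, y, h1, h2, h3, h4] at this
      · intro h
        simp only [grD, Set.mem_preimage, Set.mem_ofPred_eq] at h
        push Not at h
        obtain ⟨u, hu, v, hv, hne⟩ := h
        exact hW W u hu v hv (by rwa [plk_eval] at hne)
    rw [this]
    exact (grD_open _).preimage continuous_subtype_val

theorem exists_minor (W : ProjLine n) : ∃ u ∈ W.1, ∃ v ∈ W.1, ∃ i j : Fin (n + 1),
    u i * v j - u j * v i ≠ 0 := by
  by_contra! hcon
  obtain ⟨b⟩ : Nonempty (Module.Basis (Fin 2) ℂ W.1) := ⟨Module.finBasisOfFinrankEq ℂ W.1 W.2⟩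
  have hli := b.linearIndependent
  rw [Fintype.linearIndependent_iff] at hli
  have hb0 := b.ne_zero 0
  obtain ⟨i, hi⟩ := Function.ne_iff.mp (fun h => hb0 (Subtype.ext h) : (b 0 : Fin (n + 1) → ℂ) ≠ 0)
  have h := hli ![-(b 1 : Fin (n + 1) → ℂ) i, (b 0 : Fin (n + 1) → ℂ) i] (by
    rw [Fin.sum_univ_two]
    apply Subtype.ext
    ext j
    have := hcon _ (b 0).2 _ (b 1).2 i j
    simp
    linear_combination this) 1
  exact hi h

end FL

namespace FL

open Matrix MvPolynomial

variable {n s : ℕ}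

theorem height_point' {τ : Type} [Fintype τ] (a : τ → ℂ) :
    (Fintype.card τ : ℕ∞) ≤ (RingHom.ker (aeval a : MvPolynomial τ ℂ →ₐ[ℂ] ℂ)).height := by
  let e := Fintype.equivFin τ
  have h := height_point (a ∘ e.symm)
  let φ : MvPolynomial τ ℂ ≃+* MvPolynomial (Fin (Fintype.card τ)) ℂ := (renameEquiv ℂ e).toRingEquiv
  have h2 := φ.height_comap (RingHom.ker (aeval (a ∘ e.symm) :
    MvPolynomial (Fin (Fintype.card τ)) ℂ →ₐ[ℂ] ℂ))
  rw [← h2] at h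
  convert! h using 2
  ext g
  simp only [RingHom.mem_ker, Ideal.mem_comap]
  have : aeval (a ∘ e.symm) (φ g) = aeval a g := by
    change aeval (a ∘ e.symm) (rename e g) = _
    rw [aeval_rename]
    congr 2
    ext; simp
  rw [this]

theorem fano_mem {d : Fin s → ℕ} {f : Fin s → MvPolynomial (Fin (n + 1)) ℂ}
    {X : Set (Projectivization ℂ (Fin (n + 1) → ℂ))} (hX : IsSmoothCI n s d f X) (W : ProjLine n) :
    W ∈ fanoLines X ↔ ∀ w ∈ W.1, ∀ k, aeval w (f k) = 0 := by
  have hX' := hX.locus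
  subst hX'
  constructor
  · intro h w hw k
    by_cases hw0 : w = 0
    · have := aeval_smul_homog (hX.homog k) (0 : ℂ) w
      rw [zero_pow (by have := hX.two_le_deg k; omega), zero_mul] at this
      rw [hw0]
      convert! this using 2
      simp
      rfl
    · obtain ⟨a, ha⟩ := Projectivization.exists_smul_eq_mk_rep ℂ w hw0
      have h1 : Projectivization.mk ℂ w hw0 ∈ lineSet W.1 := by
        change Projectivization.rep _ ∈ W.1
        rw [← ha]
        exact W.1.smul_mem _ hw
      have h2 : aeval (Projectivization.mk ℂ w hw0).rep (f k) = 0 := h h1 k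
      rw [← ha] at h2
      have := aeval_smul_homog (hX.homog k) (a : ℂ) w
      rw [show (fun j => (a : ℂ) * w j) = a • w from rfl, h2] at this
      exact (mul_eq_zero.mp this.symm).resolve_left (pow_ne_zero _ a.ne_zero)
  · intro h x hx k
    exact h _ hx k

theorem smoothCI {d : Fin s → ℕ} {f : Fin s → MvPolynomial (Fin (n + 1)) ℂ}
    {X : Set (Projectivization ℂ (Fin (n + 1) → ℂ))} (hX : IsSmoothCI n s d f X) : Smooth ℂ f := by
  intro v hv h0
  have := hX.smooth v hv h0
  rw [Matrix.rank_eq_finrank_span_row] at this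
  rw [linearIndependent_iff_card_eq_finrank_span, Fintype.card_fin]
  exact this.symm

theorem upper_bound (d : Fin s → ℕ) (hd : ∀ i, 2 ≤ d i) (hs : 2 ≤ s) (h5 : ∑ i, (d i - 1) ≤ 5)
    (f : Fin s → MvPolynomial (Fin (n + 1)) ℂ) (hf : ∀ i, (f i).IsHomogeneous (d i))
    (hn : ∑ i, d i ≤ n) (hsm : Smooth ℂ f) (T : Set (ProjLine n))
    (hT : ∀ W, W ∈ T ↔ ∀ w ∈ W.1, ∀ k, aeval w (f k) = 0) :
    topologicalKrullDim T ≤ ((2 * n - ∑ i, d i - s - 2 : ℕ) : WithBot ℕ∞) := by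
  unfold topologicalKrullDim Order.krullDim
  refine iSup_le fun c => ?_
  obtain ⟨W, hW⟩ := c.head.isIrreducible.1
  obtain ⟨u, hu, v, hv, i, j, hp⟩ := exists_minor W.1
  obtain ⟨ψ, h1, h2, h3, h4⟩ := chart f T hT i j
  obtain ⟨P, hP, hE, hl⟩ := upper_abs _ ψ h1 h2 h3 c ⟨W, hW, h4 W u hu v hv hp⟩
  obtain ⟨z, hz, hr⟩ := gen_point P _ hl
  have hzE : ∀ g : MvPolynomial (Fin (n + 1) ⊕ Fin (n + 1)) ℂ,
    (∀ z ∈ Ech f i j, aeval z g = 0) → aeval z g = 0 := fun g hg => hz g (hE g hg)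
  have hline : ∀ (α β : ℂ) k, aeval (fun a => algebraMap ℂ Om α * z (.inl a) +
      algebraMap ℂ Om β * z (.inr a)) (f k) = 0 := by
    intro α β k
    have h := hzE (aeval (fun a => C α * X (.inl a) + C β * X (.inr a)) (f k)) (by
      intro z' hz'
      rw [comp_aeval_apply]
      simpa using hz'.2 α β k)
    rw [comp_aeval_apply] at h
    simpa using h
  have hline2 : ∀ (α : Om) (β : ℂ) k, aeval (fun a => α * z (.inl a) +
      algebraMap ℂ Om β * z (.inr a)) (f k) = 0 := by
    intro α β k
    have := line_ext (fun a => algebraMap ℂ Om β * z (.inr a)) (fun a => z (.inl a)) (f k)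
      Set.univ Set.infinite_univ (fun t _ => by simpa [add_comm] using hline t β k) α
    simpa [add_comm] using this
  have hline3 : ∀ (α β : Om) k, aeval (fun a => α * z (.inl a) + β * z (.inr a)) (f k) = 0 :=
    fun α β k => line_ext (fun a => α * z (.inl a)) (fun a => z (.inr a)) (f k)
      Set.univ Set.infinite_univ (fun t _ => hline2 α t k) β
  have e1 : z (.inl i) = 1 := by
    have := hzE (X (.inl i) - 1) (fun z' hz' => by simp [hz'.1.1])
    simpa [sub_eq_zero] using this
  have e2 : z (.inl j) = 0 := by
    simpa using hzE (X (.inl j)) (fun z' hz' => by simp [hz'.1.2.1])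
  have e3 : z (.inr i) = 0 := by
    simpa using hzE (X (.inr i)) (fun z' hz' => by simp [hz'.1.2.2.1])
  have e4 : z (.inr j) = 1 := by
    have := hzE (X (.inr j) - 1) (fun z' hz' => by simp [hz'.1.2.2.2])
    simpa [sub_eq_zero] using this
  have key := rank_le (Ω := Om) d hd hs h5 (n - ∑ i, d i) n ℂ f (by omega) hf (smooth_om f hsm) om_big i j
    (fun a => z (.inl a)) (fun a => z (.inr a)) e1 e2 e3 e4 hline3
  have e : Sum.elim (fun a => z (.inl a)) (fun a => z (.inr a)) = z := by
    ext a; cases a <;> rfl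
  rw [e] at key
  norm_cast
  omega

theorem lower_bound (d : Fin s → ℕ)
    (f : Fin s → MvPolynomial (Fin (n + 1)) ℂ) (hf : ∀ i, (f i).IsHomogeneous (d i))
    (T : Set (ProjLine n))
    (hT : ∀ W, W ∈ T ↔ ∀ w ∈ W.1, ∀ k, aeval w (f k) = 0) (hne : T.Nonempty) :
    ((2 * n - ∑ i, d i - s - 2 : ℕ) : WithBot ℕ∞) ≤ topologicalKrullDim T := by
  classical
  obtain ⟨W, hW⟩ := hne
  obtain ⟨u, hu, v, hv, i, j, hp⟩ := exists_minor W
  obtain ⟨ψ, h1, h2, h3, h4⟩ := chart f T hT i j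
  obtain ⟨⟨z0, hz0⟩, -⟩ := h4 ⟨W, hW⟩ u hu v hv hp
  let G : Fin 4 ⊕ (Σ k : Fin s, Fin (d k + 1)) → MvPolynomial (Fin (n + 1) ⊕ Fin (n + 1)) ℂ :=
    Sum.elim ![X (.inl i) - 1, X (.inl j), X (.inr i), X (.inr j) - 1]
      (fun kb => aeval (fun a => X (.inl a) + C ((kb.2 : ℕ) : ℂ) * X (.inr a)) (f kb.1))
  have hG : ∀ z, z ∈ Ech f i j ↔ ∀ c, aeval z (G c) = 0 := by
    intro z
    have hGf : ∀ k b, aeval z (G (.inr ⟨k, b⟩)) =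
        aeval (fun a => z (.inl a) + ((b : ℕ) : ℂ) * z (.inr a)) (f k) := by
      intro k b
      simp only [G, Sum.elim_inr]
      rw [comp_aeval_apply]
      simp
    constructor
    · rintro ⟨⟨a1, a2, a3, a4⟩, h⟩ (c | ⟨k, b⟩)
      · fin_cases c <;> simp [G, a1, a2, a3, a4]
      · rw [hGf]
        simpa using h 1 b k
    · intro h
      refine ⟨⟨?_, ?_, ?_, ?_⟩, fun α β k => ?_⟩
      · simpa [G, sub_eq_zero] using h (.inl 0)
      · simpa [G] using h (.inl 1)
      · simpa [G] using h (.inl 2)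
      · simpa [G, sub_eq_zero] using h (.inl 3)
      · have hq : onLine (fun a => z (.inl a)) (fun a => z (.inr a)) (f k) = 0 := by
          refine Polynomial.eq_zero_of_natDegree_lt_card_of_eval_eq_zero _
            (ι := Fin (d k + 1)) (f := fun b => ((b : ℕ) : ℂ)) ?_ (fun b => ?_) ?_
          · intro b b' hb
            exact Fin.ext (Nat.cast_injective (R := ℂ) hb)
          · rw [onLine_eval, ← hGf, h]
          · rw [Fintype.card_fin]
            have := aeval_natDegree_le (f k) (hf k).totalDegree_le
              (fun a => Polynomial.C (z (.inl a)) + Polynomial.X * Polynomial.C (z (.inr a)))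
              (n := 1) (fun a => by compute_degree)
            exact Nat.lt_succ_of_le (by simpa [onLine] using this)
        have h1 : ∀ t : ℂ, aeval (fun a => z (.inl a) + t * z (.inr a)) (f k) = 0 := fun t => by
          rw [← onLine_eval, hq, Polynomial.eval_zero]
        have := line_ext (fun a => β * z (.inr a)) (fun a => z (.inl a)) (f k) {0}ᶜ
          (Set.finite_singleton 0).infinite_compl (fun t ht => by
            have h2 := aeval_smul_homog (hf k) t (fun a => z (.inl a) + (t⁻¹ * β) * z (.inr a))
            rw [h1, mul_zero] at h2
            refine Eq.trans ?_ h2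
            congr 2
            ext a
            have : t * t⁻¹ = 1 := mul_inv_cancel₀ ht
            simp only [Algebra.algebraMap_self, RingHom.id_apply]
            linear_combination (- β * z (.inr a)) * this) α
        simpa [add_comm] using this
  let J := Ideal.span (Set.range G)
  have hJ : ∀ z : zeroLocus ℂ J, z.1 ∈ Ech f i j := fun z => (hG _).mpr fun c =>
    z.2 _ (Ideal.subset_span ⟨c, rfl⟩)
  have hJ' : ∀ z ∈ Ech f i j, z ∈ zeroLocus ℂ J := by
    intro z hz g hg
    have : J ≤ RingHom.ker (aeval z : _ →ₐ[ℂ] ℂ) := by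
      refine Ideal.span_le.mpr ?_
      rintro _ ⟨c, rfl⟩
      exact (hG z).mp hz c
    exact this hg
  have hlow := lower_abs J (fun z => ψ ⟨z.1, hJ z⟩)
    (fun g => by
      obtain ⟨O, hO, h⟩ := h1 g
      exact ⟨O, hO, fun z => h _⟩)
    (fun O hO z hz => by
      obtain ⟨g, hg, h⟩ := h2 O hO _ hz
      exact ⟨g, hg, fun z' hz' => h ⟨z'.1, hJ z'⟩ hz'⟩)
  refine le_trans ?_ hlow
  have hpr : (RingHom.ker (aeval z0 : MvPolynomial (Fin (n + 1) ⊕ Fin (n + 1)) ℂ →ₐ[ℂ] ℂ)).IsPrime :=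
    RingHom.ker_isPrime _
  have hh := Ideal.height_le_ringKrullDim_quotient_add_encard
    (p := RingHom.ker (aeval z0 : MvPolynomial (Fin (n + 1) ⊕ Fin (n + 1)) ℂ →ₐ[ℂ] ℂ))
    (Set.range G) (by rintro _ ⟨c, rfl⟩; exact (hG z0).mp hz0 c)
  have hc : (Set.range G).encard ≤ ((4 + (∑ k, d k + s) : ℕ) : ℕ∞) := by
    have e1 : (Set.range G).encard ≤ ENat.card (Fin 4 ⊕ (Σ k : Fin s, Fin (d k + 1))) := by
      rw [← Set.image_univ, ← Set.encard_univ]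
      exact Set.encard_image_le _ _
    refine e1.trans (le_of_eq ?_)
    rw [ENat.card_eq_coe_fintype_card]
    simp [Finset.sum_add_distrib]
  have hpt := height_point' z0
  have hfin : ((2 * (n + 1) : ℕ) : WithBot ℕ∞) ≤
      ringKrullDim (MvPolynomial (Fin (n + 1) ⊕ Fin (n + 1)) ℂ ⧸ J) +
        ((4 + (∑ k, d k + s) : ℕ) : WithBot ℕ∞) := by
    refine le_trans ?_ (hh.trans ?_)
    · have : Fintype.card (Fin (n + 1) ⊕ Fin (n + 1)) = 2 * (n + 1) := by simp; ring
      rw [← this]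
      exact_mod_cast hpt
    · gcongr
      exact WithBot.coe_le_coe.mpr hc
  generalize ringKrullDim (MvPolynomial (Fin (n + 1) ⊕ Fin (n + 1)) ℂ ⧸ J) = D at hfin
  induction D with
  | bot =>
    rw [WithBot.bot_add, le_bot_iff] at hfin
    exact absurd hfin (WithBot.coe_ne_bot (a := ((2 * (n + 1) : ℕ) : ℕ∞)))
  | coe D =>
    induction D with
    | top => exact le_top
    | coe D =>
      have h1 : ((2 * (n + 1) : ℕ) : ℕ∞) ≤ (D : ℕ∞) + ((4 + (∑ k, d k + s) : ℕ) : ℕ∞) :=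
        WithBot.coe_le_coe.mp hfin
      have h2 : 2 * (n + 1) ≤ D + (4 + (∑ k, d k + s)) := by exact_mod_cast h1
      refine (WithBot.coe_le_coe (a := ((2 * n - ∑ i, d i - s - 2 : ℕ) : ℕ∞))).mpr ?_
      exact Nat.cast_le.mpr (by omega)

end FL

namespace FL

open Matrix MvPolynomial

theorem coefs {σ R : Type} [CommRing R] [Algebra ℂ R] (g : MvPolynomial σ ℂ) (d : ℕ)
    (hg : g.IsHomogeneous d) (u v : σ → R) :
    ∃ h : ℕ → R, ∀ (S : Type) [CommRing S] [Algebra ℂ S] [Algebra R S] [IsScalarTower ℂ R S]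
      (α β : S), aeval (fun a => α * algebraMap R S (u a) + β * algebraMap R S (v a)) g =
        ∑ b ∈ Finset.range (d + 1), algebraMap R S (h b) * α ^ (d - b) * β ^ b := by
  classical
  let q : σ → MvPolynomial (Fin 2) R := fun a => C (u a) * X 0 + C (v a) * X 1
  let p : MvPolynomial (Fin 2) R := aeval q g
  have hp : p.IsHomogeneous d := by
    have := hg.aeval q (n := 1) fun a =>
      (isHomogeneous_C_mul_X _ _).add (isHomogeneous_C_mul_X _ _)
    simpa using this
  refine ⟨fun b => ∑ m ∈ p.support with m 1 = b, coeff m p, fun S _ _ _ _ α β => ?_⟩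
  have h := comp_aeval_apply (R := ℂ) (f := q)
    ((aeval (R := R) (![α, β] : Fin 2 → S)).restrictScalars ℂ) g
  have h1 : aeval (fun a => α * algebraMap R S (u a) + β * algebraMap R S (v a)) g =
      aeval (![α, β] : Fin 2 → S) p := by
    refine Eq.trans ?_ h.symm
    congr 2
    funext j
    simp [q, mul_comm]
  have hm2 : ∀ m ∈ p.support, m 0 + m 1 = d := by
    intro m hm
    have := hp (mem_support_iff.mp hm)
    rw [Finsupp.weight_apply, Finsupp.sum_fintype _ _ (by simp)] at this
    simpa [Fin.sum_univ_two] using this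
  rw [h1, aeval_def, eval₂_eq', ← Finset.sum_fiberwise_of_maps_to (g := fun m => m 1)
    (t := Finset.range (d + 1)) (fun m hm => by
      have := hm2 m hm
      rw [Finset.mem_range]; omega)]
  refine Finset.sum_congr rfl fun b _ => ?_
  rw [map_sum, Finset.sum_mul, Finset.sum_mul]
  refine Finset.sum_congr rfl fun m hm => ?_
  rw [Finset.mem_filter] at hm
  have := hm2 m hm.1
  rw [Fin.prod_univ_two, ← hm.2, show d - m 1 = m 0 by omega]
  simp [mul_assoc]

theorem kap {s m : ℕ} (d : Fin s → ℕ) (hd : ∀ i, 2 ≤ d i) (hm : ∑ i, d i ≤ m + 1)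
    (i0 i1 : Fin s) (h01 : i0 ≠ i1) :
    ∃ κ : Fin s → ℕ → Fin m, ∀ (R : Type) [Zero R] (g : Fin s → ℕ → R),
      g i0 (d i0 - 1) = g i1 0 → ∃ Z : Fin m → R, ∀ i t, t < d i → Z (κ i t) = g i t := by
  classical
  let T := Σ i, Fin (d i)
  let x1 : T := ⟨i1, ⟨0, by have := hd i1; omega⟩⟩
  let x0 : T := ⟨i0, ⟨d i0 - 1, by have := hd i0; omega⟩⟩
  have hx : x0 ≠ x1 := fun h => h01 (congrArg Sigma.fst h)
  have hc : Fintype.card {x : T // x ≠ x1} ≤ Fintype.card (Fin m) := by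
    rw [Fintype.card_subtype_compl, Fintype.card_sigma, Fintype.card_subtype_eq]
    simp only [Fintype.card_fin]; omega
  obtain ⟨e⟩ := Function.Embedding.nonempty_of_card_le hc
  let r : T → {x : T // x ≠ x1} := fun x => if h : x = x1 then ⟨x0, hx⟩ else ⟨x, h⟩
  refine ⟨fun i t => if h : t < d i then e (r ⟨i, ⟨t, h⟩⟩) else e ⟨x0, hx⟩,
    fun R _ g hg => ⟨Function.extend e (fun y => g y.1.1 y.1.2) 0, fun i t h => ?_⟩⟩
  beta_reduce
  rw [dif_pos h, e.injective.extend_apply]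
  by_cases h1 : (⟨i, ⟨t, h⟩⟩ : T) = x1
  · have hr : r ⟨i, ⟨t, h⟩⟩ = ⟨x0, hx⟩ := dif_pos h1
    rw [hr]
    exact hg.trans (congrArg (fun x : T => g x.1 x.2) h1).symm
  · have hr : r ⟨i, ⟨t, h⟩⟩ = ⟨⟨i, ⟨t, h⟩⟩, h1⟩ := dif_neg h1
    rw [hr]

theorem dvd_none {ι : Type} (P : MvPolynomial (Option ι) ℂ) :
    X none ∣ P - aeval (fun o : Option ι => o.elim 0 fun a => X (some a)) P := by
  induction P using MvPolynomial.induction_on with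
  | C a => simp
  | add p q hp hq => rw [map_add, add_sub_add_comm]; exact dvd_add hp hq
  | mul_X p o hp =>
    rw [map_mul, aeval_X]
    cases o with
    | none => simp
    | some a => simpa [← sub_mul] using hp.mul_right _

/-- Algebraic independence by specialization at `μ = 0`. -/
theorem alg_ind {ι A : Type} [CommRing A] [IsDomain A] [Algebra ℂ A]
    (z : Option ι → A) (hz : z none ≠ 0) (φ : A →ₐ[ℂ] MvPolynomial ι ℂ)
    (h0 : φ (z none) = 0) (h1 : ∀ a, φ (z (some a)) = X a)
    (P : MvPolynomial (Option ι) ℂ) (hP : aeval z P = 0) : P = 0 := by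
  have key : ∀ N (P : MvPolynomial (Option ι) ℂ), P.totalDegree < N → aeval z P = 0 → P = 0 := by
    intro N
    induction N with
    | zero => intro P h; omega
    | succ N ih =>
      intro P hN hP
      have h2 := dvd_none P
      have h3 : aeval (fun o : Option ι => o.elim 0 fun a => X (some a)) P =
          rename some (φ (aeval z P)) := by
        rw [← AlgHom.comp_apply, ← AlgHom.comp_apply]
        congr 1
        ext o
        cases o <;> simp [h0, h1]
      rw [h3, hP, map_zero, map_zero, sub_zero] at h2
      obtain ⟨Q, rfl⟩ := h2
      rw [map_mul, aeval_X] at hP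
      have hQ : Q = 0 := by
        by_contra hQ
        refine hQ (ih Q ?_ ((mul_eq_zero.mp hP).resolve_left hz))
        rw [mul_comm, totalDegree_mul_of_isDomain hQ (X_ne_zero _),
          totalDegree_X] at hN
        omega
      rw [hQ, mul_zero]
  exact key _ P (Nat.lt_succ_self _) hP

/-- Specialization of a line over a valuation ring. -/
theorem spec_line {n s : ℕ} {L : Type} [Field L] [Algebra ℂ L] (V : ValuationSubring L)
    (hF : ∀ c : ℂ, algebraMap ℂ L c ∈ V) (f : Fin s → MvPolynomial (Fin (n + 1)) ℂ)
    (i j : Fin (n + 1)) (w : Fin (n + 1) ⊕ Fin (n + 1) → L) (hw : ∀ a, w a ∈ V)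
    (he : w (.inl i) = 1 ∧ w (.inl j) = 0 ∧ w (.inr i) = 0 ∧ w (.inr j) = 1)
    (hv : ∀ (α β : ℂ) k, V.valuation (aeval (fun a => algebraMap ℂ L α * w (.inl a) +
      algebraMap ℂ L β * w (.inr a)) (f k)) < 1) : ∃ z, z ∈ Ech f i j := by
  by_contra hcon
  let S : Set (MvPolynomial (Fin (n + 1) ⊕ Fin (n + 1)) ℂ) :=
    {X (.inl i) - 1, X (.inl j), X (.inr i), X (.inr j) - 1} ∪
    {g | ∃ (α β : ℂ) (k : Fin s), g = aeval (fun a => C α * X (.inl a) + C β * X (.inr a)) (f k)}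
  have hr := nss (F := ℂ) (Ideal.span S) 1 fun φ hφ => by
    exfalso
    have hφ' : ∀ g ∈ S, φ g = 0 := fun g hg => hφ g (Ideal.subset_span hg)
    refine hcon ⟨fun a => φ (X a), ⟨?_, ?_, ?_, ?_⟩, fun α β k => ?_⟩
    · have := hφ' (X (.inl i) - 1) (by simp [S])
      rwa [map_sub, map_one, sub_eq_zero] at this
    · exact hφ' (X (.inl j)) (by simp [S])
    · exact hφ' (X (.inr i)) (by simp [S])
    · have := hφ' (X (.inr j) - 1) (by simp [S])
      rwa [map_sub, map_one, sub_eq_zero] at this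
    · have := hφ' _ (Or.inr ⟨α, β, k, rfl⟩)
      rw [comp_aeval_apply] at this
      rw [← this]
      congr 2
      funext a
      rw [map_add, map_mul, map_mul, ← algebraMap_eq, AlgHom.commutes, AlgHom.commutes]
      rfl
  obtain ⟨N, h1⟩ := hr
  rw [one_pow] at h1
  have hpoly : ∀ g : MvPolynomial (Fin (n + 1) ⊕ Fin (n + 1)) ℂ, aeval w g ∈ V := by
    intro g
    induction g using MvPolynomial.induction_on with
    | C a => simpa using hF a
    | add a b ha hb => rw [map_add]; exact V.add_mem _ _ ha hb
    | mul_X a i ha => rw [map_mul, aeval_X]; exact V.mul_mem _ _ ha (hw i)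
  have h2 : ∀ g ∈ Ideal.span S, V.valuation (aeval w g) < 1 := by
    intro g hg
    induction hg using Submodule.span_induction with
    | zero => simp
    | add a b _ _ ha hb => rw [map_add]; exact V.valuation.map_add_lt ha hb
    | smul a b _ hb =>
      rw [smul_eq_mul, map_mul, map_mul]
      exact mul_lt_one_of_nonneg_of_lt_one_right ((V.valuation_le_one_iff _).mpr (hpoly a))
        zero_le hb
    | mem g hg =>
      rcases hg with hg | ⟨α, β, k, rfl⟩
      · simp only [Set.mem_insert_iff, Set.mem_singleton_iff] at hg
        rcases hg with rfl | rfl | rfl | rfl <;> simp [he]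
      · rw [comp_aeval_apply]
        convert hv α β k using 4
        funext a
        simp
  have := h2 1 h1
  simp at this

end FL

namespace FL

open Matrix MvPolynomial

/-- Solution of the linear system of the special equations. -/
theorem lin_solve {s : ℕ} {R : Type} [CommRing R] (d : Fin s → ℕ) (hd : ∀ i, 2 ≤ d i)
    (i0 i1 : Fin s) (h01 : i0 ≠ i1) (Y : Fin s → ℕ → R) :
    ∃ x y : Fin s → ℕ → R, x i0 (d i0 - 1) = x i1 0 ∧ y i0 (d i0 - 1) = y i1 0 ∧
      ∀ i b, b ≤ d i → (if b < d i then x i b else 0) + (if b = 0 then 0 else y i (b - 1)) =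
        Y i b := by
  refine ⟨fun i t => if i = i0 then (if t = d i0 - 1 then Y i1 0 else Y i0 t) else
      if i = i1 then (if t = 1 then Y i1 1 - Y i0 (d i0) else Y i1 t) else Y i t,
    fun i t => if i = i0 then (if t = d i0 - 1 then Y i0 (d i0) else
        if t = d i0 - 2 then Y i0 (d i0 - 1) - Y i1 0 else 0) else
      if i = i1 then (if t = 0 then Y i0 (d i0) else if t = d i1 - 1 then Y i1 (d i1) else 0) else
      if t = d i - 1 then Y i (d i) else 0, by simp [h01.symm], by simp [h01.symm], ?_⟩
  intro i b hb
  have h2 := hd i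
  by_cases h0 : i = i0
  · subst h0
    simp only [if_true]
    split_ifs <;> first | omega | (subst_vars; simp)
    all_goals grind
  · by_cases h1 : i = i1
    · subst h1
      simp only [if_true, if_neg h0]
      split_ifs <;> grind
    · simp only [if_neg h0, if_neg h1]
      split_ifs <;> grind

theorem exists_line {m s : ℕ} (d : Fin s → ℕ) (hd : ∀ i, 2 ≤ d i) (hs : 2 ≤ s)
    (f : Fin s → MvPolynomial (Fin (m + 1 + 1)) ℂ) (hf : ∀ i, (f i).IsHomogeneous (d i))
    (hm : ∑ i, d i ≤ m + 1) : ∃ i j z, z ∈ Ech f i j := by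
  classical
  let i0 : Fin s := ⟨0, by omega⟩
  let i1 : Fin s := ⟨1, by omega⟩
  have h01 : i0 ≠ i1 := by simp [i0, i1]
  obtain ⟨κ, hκ⟩ := kap d hd hm i0 i1 h01
  let A := MvPolynomial (Option (Fin m ⊕ Fin m)) ℂ
  let L := FractionRing A
  let M0 : Fin m → A := fun a => X (some (.inl a))
  let M1 : Fin m → A := fun a => X (some (.inr a))
  let u : Fin (m + 1 + 1) → A := Fin.cons 1 (Fin.cons 0 M0)
  let v : Fin (m + 1 + 1) → A := Fin.cons 0 (Fin.cons 1 M1)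
  choose h hh using fun k => coefs (f k) (d k) (hf k) u v
  let l : Fin s → ℕ → A := fun k b =>
    (if b < d k then M0 (κ k b) else 0) + (if b = 0 then 0 else M1 (κ k (b - 1)))
  let g : Fin s → MvPolynomial (Fin (m + 1 + 1)) ℂ := fun k =>
    ∑ t ∈ Finset.range (d k), X (κ k t).succ.succ * X 0 ^ (d k - 1 - t) * X 1 ^ t
  have hg : ∀ k (α β : L), aeval (fun a => α * algebraMap A L (u a) + β * algebraMap A L (v a))
      (g k) = ∑ b ∈ Finset.range (d k + 1), algebraMap A L (l k b) * α ^ (d k - b) * β ^ b := by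
    intro k α β
    have e0 : u 0 = 1 := rfl
    have e1 : u 1 = 0 := rfl
    have e2 : v 0 = 0 := rfl
    have e3 : v 1 = 1 := rfl
    have e4 : ∀ a : Fin m, u a.succ.succ = M0 a := fun a => rfl
    have e5 : ∀ a : Fin m, v a.succ.succ = M1 a := fun a => rfl
    simp only [g, l, map_sum, map_mul, map_pow, aeval_X, map_add, add_mul,
      Finset.sum_add_distrib, e0, e1, e2, e3, e4, e5, map_one, map_zero, mul_one, mul_zero,
      add_zero, zero_add]
    congr 1
    · rw [Finset.sum_range_succ]
      simp only [lt_irrefl, if_false, map_zero, zero_mul, add_zero]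
      refine Finset.sum_congr rfl fun t ht => ?_
      rw [Finset.mem_range] at ht
      rw [if_pos ht, show d k - t = d k - 1 - t + 1 by omega]
      ring
    · rw [Finset.sum_range_succ']
      simp only [if_true, map_zero, zero_mul, add_zero, Nat.add_eq_zero_iff, one_ne_zero,
        and_false, if_false, Nat.add_sub_cancel]
      refine Finset.sum_congr rfl fun t ht => ?_
      rw [show d k - (t + 1) = d k - 1 - t by omega]
      ring
  let c : Fin s → ℕ → A := fun k b => (1 - X none) * l k b + X none * h k b
  let ι := Σ k : Fin s, Fin (d k + 1)
  let z : Option ι → A := fun o => o.elim (X none) fun x => c x.1 x.2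
  let Y : Fin s → ℕ → MvPolynomial ι ℂ := fun i b =>
    if hb : b < d i + 1 then X ⟨i, ⟨b, hb⟩⟩ else 0
  obtain ⟨x, y, hx, hy, hxy⟩ := lin_solve d hd i0 i1 h01 Y
  obtain ⟨Z0, hZ0⟩ := hκ _ x hx
  obtain ⟨Z1, hZ1⟩ := hκ _ y hy
  let φ : A →ₐ[ℂ] MvPolynomial ι ℂ := aeval fun o => o.elim 0 (Sum.elim Z0 Z1)
  have hφ0 : φ (X none) = 0 := aeval_X _ _
  have hφ1 : ∀ a, φ (z (some a)) = X a := by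
    rintro ⟨k, b⟩
    have hb : (b : ℕ) ≤ d k := Nat.lt_succ_iff.mp b.2
    have e0 : ∀ a, φ (M0 a) = Z0 a := fun a => aeval_X _ _
    have e1 : ∀ a, φ (M1 a) = Z1 a := fun a => aeval_X _ _
    have e2 : φ (l k b) = X ⟨k, b⟩ := by
      have : Y k b = X ⟨k, b⟩ := dif_pos b.2
      rw [← this, ← hxy k b hb]
      simp only [l, map_add, apply_ite φ, map_zero, e0, e1]
      congr 1
      · split_ifs with h
        · exact hZ0 k b h
        · rfl
      · split_ifs with h
        · rfl
        · exact hZ1 k _ (by omega)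
    change φ ((1 - X none) * l k b + X none * h k b) = _
    rw [map_add, map_mul, map_mul, map_sub, map_one, hφ0, e2]
    ring
  have hind := alg_ind z (X_ne_zero _) φ hφ0 hφ1
  let zL : Option ι → L := fun o => algebraMap A L (z o)
  let Ψ : MvPolynomial (Option ι) ℂ →ₐ[ℂ] L := aeval zL
  have hΨ : ∀ P, Ψ P = 0 → P = 0 := by
    intro P hP
    have : Ψ P = algebraMap A L (aeval z P) := by
      have := comp_aeval_apply (R := ℂ) (f := z) (IsScalarTower.toAlgHom ℂ A L) P
      exact this.symm
    rw [this, FaithfulSMul.algebraMap_eq_zero_iff] at hP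
    exact hind P hP
  let pt : Option ι → ℂ := fun o => o.elim 1 fun _ => 0
  let K : Ideal (MvPolynomial (Option ι) ℂ) := RingHom.ker (aeval pt : _ →ₐ[ℂ] ℂ)
  obtain ⟨V, hV1, hV2⟩ := Ideal.image_subset_nonunits_valuationSubring
    (K.map Ψ.toRingHom.rangeRestrict) (by
      rw [Ne, Ideal.eq_top_iff_one,
        Ideal.mem_map_iff_of_surjective _ Ψ.toRingHom.rangeRestrict_surjective]
      rintro ⟨P, hP, h1⟩
      have h2 : Ψ P = 1 := congrArg Subtype.val h1
      have h3 := hΨ (P - 1) (by rw [map_sub, h2, map_one, sub_self])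
      rw [sub_eq_zero.mp h3] at hP
      have h4 : aeval pt (1 : MvPolynomial (Option ι) ℂ) = 0 := hP
      simp at h4)
  have hVm : ∀ P, aeval pt P = 0 → V.valuation (Ψ P) < 1 := by
    intro P hP
    have := hV2 ⟨_, Ideal.mem_map_of_mem _ (show P ∈ K from hP), rfl⟩
    exact this
  have hF : ∀ c : ℂ, algebraMap ℂ L c ∈ V := fun c => by
    have := hV1 (Ψ.toRingHom.mem_range_self (C c))
    rw [← algebraMap_eq] at this
    exact (Ψ.commutes c) ▸ this
  have hμ : V.valuation (1 - algebraMap A L (X none)) < 1 := by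
    have := hVm (1 - X none) (by simp [pt])
    rwa [map_sub, map_one, show Ψ (X none) = algebraMap A L (X none) from aeval_X _ _] at this
  have hc : ∀ k b, b < d k + 1 → V.valuation (algebraMap A L (c k b)) < 1 := by
    intro k b hb
    have := hVm (X (some ⟨k, ⟨b, hb⟩⟩)) (by simp [pt])
    rwa [show Ψ (X _) = algebraMap A L (c k b) from aeval_X _ _] at this
  have hmul : ∀ a b : L, V.valuation a < 1 → b ∈ V → V.valuation (a * b) < 1 := by
    intro a b ha hb
    rw [map_mul, mul_comm]
    exact mul_lt_one_of_nonneg_of_lt_one_right ((V.valuation_le_one_iff _).mpr hb) zero_le ha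
  let p : Fin (m + 1 + 1) × Fin (m + 1 + 1) → L := fun ab =>
    algebraMap A L (u ab.1 * v ab.2 - u ab.2 * v ab.1)
  obtain ⟨⟨i, j⟩, hij⟩ := Finite.exists_max fun ab => V.valuation (p ab)
  have hp : p (i, j) ≠ 0 := by
    intro h0
    have h1 := hij (0, 1)
    have h2 : p (0, 1) = 1 := by
      change algebraMap A L (1 * 1 - 0 * 0) = 1
      simp
    rw [h0, h2] at h1
    simp at h1
  have hpV : ∀ ab, p ab / p (i, j) ∈ V := by
    intro ab
    rw [← ValuationSubring.valuation_le_one_iff, map_div₀]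
    exact div_le_one_of_le₀ (hij ab) zero_le
  let w : Fin (m + 1 + 1) ⊕ Fin (m + 1 + 1) → L :=
    Sum.elim (fun a => p (a, j) / p (i, j)) (fun a => p (i, a) / p (i, j))
  have hw : ∀ a, w a ∈ V := by rintro (a | a) <;> exact hpV _
  refine ⟨i, j, spec_line V hF f i j w hw ⟨div_self hp, ?_, ?_, div_self hp⟩ fun α β k => ?_⟩
  · simp [w, p]
  · simp [w, p]
  have hxV : ∀ a, algebraMap ℂ L α * w (.inl a) + algebraMap ℂ L β * w (.inr a) ∈ V := fun a =>
    V.add_mem _ _ (V.mul_mem _ _ (hF _) (hw _)) (V.mul_mem _ _ (hF _) (hw _))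
  have hpoly : ∀ q : MvPolynomial (Fin (m + 1 + 1)) ℂ, aeval (fun a => algebraMap ℂ L α *
      w (.inl a) + algebraMap ℂ L β * w (.inr a)) q ∈ V := by
    intro q
    induction q using MvPolynomial.induction_on with
    | C a => simpa using hF a
    | add a b ha hb => rw [map_add]; exact V.add_mem _ _ ha hb
    | mul_X a i ha => rw [map_mul, aeval_X]; exact V.mul_mem _ _ ha (hxV i)
  obtain ⟨α', hα⟩ : ∃ a, a = (algebraMap ℂ L α * algebraMap A L (v j) -
    algebraMap ℂ L β * algebraMap A L (v i)) / p (i, j) := ⟨_, rfl⟩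
  obtain ⟨β', hβ⟩ : ∃ a, a = (algebraMap ℂ L β * algebraMap A L (u i) -
    algebraMap ℂ L α * algebraMap A L (u j)) / p (i, j) := ⟨_, rfl⟩
  have hxe : (fun a => algebraMap ℂ L α * w (.inl a) + algebraMap ℂ L β * w (.inr a)) =
      fun a => α' * algebraMap A L (u a) + β' * algebraMap A L (v a) := by
    funext a
    rw [hα, hβ]
    simp only [w, Sum.elim_inl, Sum.elim_inr]
    rw [mul_div_assoc', mul_div_assoc', ← add_div, div_mul_eq_mul_div, div_mul_eq_mul_div, ← add_div]
    congr 1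
    simp only [p, map_sub, map_mul]
    ring
  have hα' : α' ∈ V := by
    have := hxV 0
    rw [congrFun hxe 0] at this
    simpa [u, v] using this
  have hβ' : β' ∈ V := by
    have := hxV 1
    rw [congrFun hxe 1] at this
    have e1 : u 1 = 0 := rfl
    have e3 : v 1 = 1 := rfl
    simpa [e1, e3] using this
  have hgV := hpoly (g k)
  have hfV := hpoly (f k)
  rw [hxe] at hgV hfV ⊢
  have hrel : aeval (fun a => α' * algebraMap A L (u a) + β' * algebraMap A L (v a)) (f k) =
      (1 - algebraMap A L (X none)) * (aeval (fun a => α' * algebraMap A L (u a) +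
        β' * algebraMap A L (v a)) (f k) - aeval (fun a => α' * algebraMap A L (u a) +
        β' * algebraMap A L (v a)) (g k)) +
      ∑ b ∈ Finset.range (d k + 1), algebraMap A L (c k b) * (α' ^ (d k - b) * β' ^ b) := by
    have : ∑ b ∈ Finset.range (d k + 1), algebraMap A L (c k b) * (α' ^ (d k - b) * β' ^ b) =
        (1 - algebraMap A L (X none)) * aeval (fun a => α' * algebraMap A L (u a) +
        β' * algebraMap A L (v a)) (g k) + algebraMap A L (X none) *
        aeval (fun a => α' * algebraMap A L (u a) + β' * algebraMap A L (v a)) (f k) := by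
      rw [hg, hh k L, Finset.mul_sum, Finset.mul_sum, ← Finset.sum_add_distrib]
      refine Finset.sum_congr rfl fun b _ => ?_
      simp only [c, map_add, map_mul, map_sub, map_one]
      ring
    rw [this]
    ring
  rw [hrel]
  refine V.valuation.map_add_lt (hmul _ _ hμ (sub_mem hfV hgV))
    (V.valuation.map_sum_lt one_ne_zero fun b hb => hmul _ _ (hc k b (Finset.mem_range.mp hb))
      (V.mul_mem _ _ (pow_mem hα' _) (pow_mem hβ' _)))

end FL

/-- **Theorem (main theorem).**  If `X ⊆ ℙ^n` is a smooth Fano complete intersection of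
`s ≥ 2` hypersurfaces of degrees `d_1, …, d_s` with `d := Σ d_i ≤ n` (Fano) and
`d − s ≤ 5`, then the Fano variety of lines `F(X)` has dimension exactly `2n − d − s − 2`. -/
theorem dim_fanoLines_of_sum_sub_card_le_five
    (n s : ℕ) (hs : 2 ≤ s) (d : Fin s → ℕ)
    (f : Fin s → MvPolynomial (Fin (n + 1)) ℂ)
    (X : Set (Projectivization ℂ (Fin (n + 1) → ℂ)))
    (hX : IsSmoothCI n s d f X)
    (hFano : ∑ i, d i ≤ n)
    (h5 : ∑ i, d i - s ≤ 5) :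
    topologicalKrullDim ↥(fanoLines X) =
      ((2 * n - ∑ i, d i - s - 2 : ℕ) : WithBot ℕ∞) := by
  have hd := hX.two_le_deg
  have h6 : ∑ i, (d i - 1) ≤ 5 := by
    have h7 : ∑ i, d i = ∑ i, (d i - 1) + s := by
      rw [Finset.sum_congr rfl fun i _ => show d i = (d i - 1) + 1 by have := hd i; omega,
        Finset.sum_add_distrib]
      simp
    omega
  refine le_antisymm (FL.upper_bound d hd hs h6 f hX.homog hFano (FL.smoothCI hX) _
    (FL.fano_mem hX)) (FL.lower_bound d f hX.homog _ (FL.fano_mem hX) ?_)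
  have hn : n ≠ 0 := by
    have h8 : d ⟨0, by omega⟩ ≤ ∑ i, d i :=
      Finset.single_le_sum (fun _ _ => Nat.zero_le _) (Finset.mem_univ _)
    have := hd ⟨0, by omega⟩
    omega
  obtain ⟨m, rfl⟩ := Nat.exists_eq_succ_of_ne_zero hn
  obtain ⟨i, j, z, hz⟩ := FL.exists_line (m := m) d hd hs f hX.homog hFano
  obtain ⟨ψ, -⟩ := FL.chart f _ (FL.fano_mem hX) i j
  exact ⟨_, (ψ ⟨z, hz⟩).2⟩

end
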